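/- Let n,m ≥ 1, let 1 < p < ∞, and let α ∈ ℕ^{n+nm} be a multi-index with |α| = k ≥ 1. There exists a constant C = C(n,m,α,p) such that for every nonzero a ∈ ℝ^n and every f ∈ C_c^∞(ℝ^{n+m}), the Riesz transform R_{α,a}f satisfies ‖R_{α,a}f‖_{L^p(ℝ^{n+m}, dμ_a)} ≤ C ‖f‖_{L^p(ℝ^{n+m}, dμ_a)}; that is, R_{α,a} is bounded on L^p(ℝ^{n+m}, dμ_a) uniformly in a. -/

import Mathlib

noncomputable section
open MeasureTheory Real Set Filter

/-- `ℝ^{n+m}` written as pairs `x = (x', x'')`. -/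
abbrev Ep (n m : ℕ) := EuclideanSpace ℝ (Fin n) × EuclideanSpace ℝ (Fin m)

/-- Euclidean dot product. -/
def dotp {n : ℕ} (a b : EuclideanSpace ℝ (Fin n)) : ℝ := ∑ i, a i * b i

/-- The measure `dμ_a = e^{2a·x'} dx` on `ℝ^{n+m}`. -/
def muG {n m : ℕ} (a : EuclideanSpace ℝ (Fin n)) : Measure (Ep n m) :=
  volume.withDensity fun x => ENNReal.ofReal (Real.exp (2 * dotp a x.1))

/-- Scaled Hermite heat kernel `k_{t,λ}(x',y')`. -/
def hermiteK (n : ℕ) {m : ℕ} (t : ℝ) (lam : EuclideanSpace ℝ (Fin m))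
    (x' y' : EuclideanSpace ℝ (Fin n)) : ℝ :=
  (‖lam‖ / (2 * π * Real.sinh (2 * ‖lam‖ * t))) ^ ((n : ℝ) / 2) *
    Real.exp (-(‖lam‖ / 2) * (Real.cosh (2 * ‖lam‖ * t) / Real.sinh (2 * ‖lam‖ * t)) *
        ‖x' - y'‖ ^ 2 - ‖lam‖ * Real.tanh (‖lam‖ * t) * dotp x' y')

/-- Grushin heat kernel `H_t(x,y) = (2π)^{-m} ∫ k_{t,λ}(x',y') e^{-iλ·(x''-y'')} dλ`. -/
def grushinH {n m : ℕ} (t : ℝ) (x y : Ep n m) : ℂ :=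
  ((((2 * π) ^ m)⁻¹ : ℝ) : ℂ) * ∫ lam : EuclideanSpace ℝ (Fin m),
    ((hermiteK n t lam x.1 y.1 : ℝ) : ℂ) *
      Complex.exp (-Complex.I * ((dotp lam (x.2 - y.2) : ℝ) : ℂ))

/-- Drifted Grushin heat kernel `H_{t,a}(x,y) = e^{-|a|²t} e^{-a·(x'+y')} H_t(x,y)`. -/
def driftH {n m : ℕ} (a : EuclideanSpace ℝ (Fin n)) (t : ℝ) (x y : Ep n m) : ℂ :=
  ((Real.exp (-‖a‖ ^ 2 * t) * Real.exp (-dotp a (x.1 + y.1)) : ℝ) : ℂ) * grushinH t x y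

/-- The drifted heat semigroup `e^{-tG_a} f(x) = ∫ H_{t,a}(x,y) f(y) e^{2a·y'} dy`. -/
def heatOp {n m : ℕ} (a : EuclideanSpace ℝ (Fin n)) (t : ℝ) (f : Ep n m → ℂ)
    (x : Ep n m) : ℂ :=
  ∫ y : Ep n m, driftH a t x y * f y * ((Real.exp (2 * dotp a y.1) : ℝ) : ℂ)

/-- The Grushin vector fields: `X_j = ∂_{x'_j}` and `X_{j,k} = x'_j ∂_{x''_k}`. -/
def vf {n m : ℕ} : (Fin n ⊕ Fin n × Fin m) → (Ep n m → ℂ) → (Ep n m → ℂ)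
  | Sum.inl j => fun f x =>
      deriv (fun s : ℝ => f (x.1 + s • EuclideanSpace.single j 1, x.2)) 0
  | Sum.inr jk => fun f x =>
      ((x.1 jk.1 : ℝ) : ℂ) *
        deriv (fun s : ℝ => f (x.1, x.2 + s • EuclideanSpace.single jk.2 1)) 0

/-- `X^α` for a multi-index `α ∈ ℕ^{n+nm}` (a fixed ordering of the compositions). -/
def Xalpha {n m : ℕ} (α : Fin n ⊕ Fin n × Fin m → ℕ) : (Ep n m → ℂ) → (Ep n m → ℂ) :=
  ((Finset.univ : Finset (Fin n ⊕ Fin n × Fin m)).toList).foldr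
    (fun i F => (vf i)^[α i] ∘ F) id

/-- The Riesz transform
`R_{α,a} f(x) = Γ(k/2)⁻¹ ∫₀^∞ t^{k/2-1} X^α (e^{-tG_a} f)(x) dt`, where `k = |α|`. -/
def grushinRiesz {n m : ℕ} (a : EuclideanSpace ℝ (Fin n)) (α : Fin n ⊕ Fin n × Fin m → ℕ)
    (f : Ep n m → ℂ) (x : Ep n m) : ℂ :=
  ((Real.Gamma (((∑ i, α i : ℕ) : ℝ) / 2))⁻¹ : ℝ) *
    ∫ t in Set.Ioi (0 : ℝ),
      ((t ^ ((((∑ i, α i : ℕ) : ℝ) / 2) - 1) : ℝ) : ℂ) * Xalpha α (heatOp a t f) x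

section
open scoped ENNReal NNReal Topology ComplexConjugate
namespace GR
set_option linter.unusedSectionVars false

/-! ### Schur test -/

theorem schur_lintegral {X Y : Type*} [MeasurableSpace X] [MeasurableSpace Y]
    {μ : Measure X} {ν : Measure Y} [SFinite μ] [SFinite ν]
    {K : X → Y → ℝ≥0∞} (hK : Measurable (Function.uncurry K)) {A B : ℝ≥0∞}
    (h1 : ∀ x, ∫⁻ y, K x y ∂ν ≤ A) (h2 : ∀ y, ∫⁻ x, K x y ∂μ ≤ B)
    {p : ℝ} (hp : 1 ≤ p) {f : Y → ℝ≥0∞} (hf : Measurable f) :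
    ∫⁻ x, (∫⁻ y, K x y * f y ∂ν) ^ p ∂μ ≤ A ^ (p - 1) * (B * ∫⁻ y, f y ^ p ∂ν) := by
  have hp0 : 0 < p := by linarith
  have key : ∀ x, (∫⁻ y, K x y * f y ∂ν) ^ p ≤ A ^ (p - 1) * ∫⁻ y, K x y * f y ^ p ∂ν := by
    intro x
    have hKx : Measurable (K x) := hK.of_uncurry_left
    rcases eq_or_lt_of_le hp with rfl | hp1
    · simp
    · have hpq : p.HolderConjugate (p / (p - 1)) := Real.HolderConjugate.conjExponent hp1
      have := ENNReal.lintegral_mul_le_Lp_mul_Lq (ν.withDensity (K x)) hpq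
        hf.aemeasurable (aemeasurable_const (b := (1 : ℝ≥0∞)))
      simp only [Pi.mul_apply, mul_one, ENNReal.one_rpow] at this
      rw [lintegral_withDensity_eq_lintegral_mul _ hKx hf,
        lintegral_withDensity_eq_lintegral_mul _ hKx (hf.pow_const p),
        lintegral_withDensity_eq_lintegral_mul _ hKx measurable_const] at this
      simp only [Pi.mul_apply, mul_one] at this
      have h3 := ENNReal.rpow_le_rpow this hp0.le
      refine h3.trans ?_
      rw [ENNReal.mul_rpow_of_nonneg _ _ hp0.le, ← ENNReal.rpow_mul, ← ENNReal.rpow_mul,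
        one_div, inv_mul_cancel₀ hp0.ne', ENNReal.rpow_one, mul_comm]
      have : 1 / (p / (p - 1)) * p = p - 1 := by field_simp
      rw [this]
      gcongr
      exact h1 x
  calc ∫⁻ x, (∫⁻ y, K x y * f y ∂ν) ^ p ∂μ
      ≤ ∫⁻ x, A ^ (p - 1) * ∫⁻ y, K x y * f y ^ p ∂ν ∂μ := lintegral_mono key
    _ = A ^ (p - 1) * ∫⁻ x, ∫⁻ y, K x y * f y ^ p ∂ν ∂μ := by
        rw [lintegral_const_mul]
        exact Measurable.lintegral_prod_right (f := fun x y => K x y * f y ^ p)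
          (hK.mul ((hf.comp measurable_snd).pow_const p))
    _ = A ^ (p - 1) * ∫⁻ y, ∫⁻ x, K x y * f y ^ p ∂μ ∂ν := by
        rw [lintegral_lintegral_swap]
        exact (hK.mul ((hf.comp measurable_snd).pow_const p)).aemeasurable
    _ = A ^ (p - 1) * ∫⁻ y, (∫⁻ x, K x y ∂μ) * f y ^ p ∂ν := by
        congr 1
        refine lintegral_congr fun y => ?_
        rw [lintegral_mul_const]
        exact hK.of_uncurry_right
    _ ≤ A ^ (p - 1) * ∫⁻ y, B * f y ^ p ∂ν := by
        gcongr with y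
        exact h2 y
    _ = _ := by
        rw [lintegral_const_mul _ (hf.pow_const p)]

/-! ### Cotlar–Stein -/

section CotlarStein
variable {E : Type*} [NormedAddCommGroup E] [InnerProductSpace ℂ E] [CompleteSpace E]
variable {ι : Type*} [Fintype ι]

/-- Words of length `N+1`. -/
def W (ι : Type*) : ℕ → Type _
  | 0 => ι × ι
  | N + 1 => (ι × ι) × W ι N

instance instFintypeW (ι : Type*) [Fintype ι] : ∀ N, Fintype (W ι N)
  | 0 => inferInstanceAs (Fintype (ι × ι))
  | N + 1 => by
      have := instFintypeW ι N
      exact inferInstanceAs (Fintype ((ι × ι) × W ι N))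

/-- first index of a word -/
def W.hd {ι : Type*} : ∀ {N}, W ι N → ι
  | 0, w => w.1
  | _ + 1, w => w.1.1

/-- the operator attached to a word -/
def W.op (T : ι → E →L[ℂ] E) : ∀ {N}, W ι N → (E →L[ℂ] E)
  | 0, w => star (T w.1) * T w.2
  | _ + 1, w => (star (T w.1.1) * T w.1.2) * W.op T w.2

/-- the tail operator: word operator without the first adjoint -/
def W.tl (T : ι → E →L[ℂ] E) : ∀ {N}, W ι N → (E →L[ℂ] E)
  | 0, w => T w.2
  | _ + 1, w => T w.1.2 * W.op T w.2

/-- first weight -/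
def W.b1 (a : ι → ι → ℝ) : ∀ {N}, W ι N → ℝ
  | 0, w => a w.1 w.2
  | _ + 1, w => a w.1.1 w.1.2 * W.b1 a w.2

/-- second weight -/
def W.b2 (a : ι → ι → ℝ) (B : ℝ) : ∀ {N}, W ι N → ℝ
  | 0, _ => B
  | _ + 1, w => a w.1.2 w.2.hd * W.b2 a B w.2

theorem W.op_eq (T : ι → E →L[ℂ] E) : ∀ {N} (w : W ι N), w.op T = star (T w.hd) * w.tl T
  | 0, w => rfl
  | _ + 1, w => by simp [W.op, W.tl, W.hd, mul_assoc]

theorem sum_op (T : ι → E →L[ℂ] E) : ∀ N, ∑ w : W ι N, w.op T =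
    (star (∑ i, T i) * ∑ i, T i) ^ (N + 1)
  | 0 => by
      change ∑ w : ι × ι, star (T w.1) * T w.2 = _
      rw [Fintype.sum_prod_type, zero_add, pow_one, star_sum, Finset.sum_mul_sum]
  | N + 1 => by
      change ∑ w : (ι × ι) × W ι N, (star (T w.1.1) * T w.1.2) * W.op T w.2 = _
      rw [Fintype.sum_prod_type, pow_succ', ← sum_op T N, star_sum, Finset.sum_mul_sum,
        ← Fintype.sum_prod_type (fun w : ι × ι => star (T w.1) * T w.2), Finset.sum_mul_sum]

theorem W.b1_nonneg {a : ι → ι → ℝ} (ha : ∀ i j, 0 ≤ a i j) : ∀ {N} (w : W ι N), 0 ≤ w.b1 a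
  | 0, _ => ha _ _
  | _ + 1, w => mul_nonneg (ha _ _) (W.b1_nonneg ha w.2)

theorem W.b2_nonneg {a : ι → ι → ℝ} (ha : ∀ i j, 0 ≤ a i j) {B : ℝ} (hB : 0 ≤ B) :
    ∀ {N} (w : W ι N), 0 ≤ w.b2 a B
  | 0, _ => hB
  | _ + 1, w => mul_nonneg (ha _ _) (W.b2_nonneg ha hB w.2)

theorem W.norm_op_le1 (T : ι → E →L[ℂ] E) {a : ι → ι → ℝ} (ha : ∀ i j, 0 ≤ a i j)
    (h1 : ∀ i j, ‖star (T i) * T j‖ ≤ a i j ^ 2) :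
    ∀ {N} (w : W ι N), ‖w.op T‖ ≤ (w.b1 a) ^ 2
  | 0, w => h1 _ _
  | _ + 1, w => by
      simp only [W.op, W.b1, mul_pow]
      exact (norm_mul_le _ _).trans (mul_le_mul (h1 _ _) (W.norm_op_le1 T ha h1 w.2)
        (norm_nonneg _) (by positivity))

theorem W.norm_tl_le (T : ι → E →L[ℂ] E) {a : ι → ι → ℝ} (ha : ∀ i j, 0 ≤ a i j)
    {B : ℝ} (hB : 0 ≤ B)
    (h2 : ∀ i j, ‖T i * star (T j)‖ ≤ a i j ^ 2) (hT : ∀ i, ‖T i‖ ≤ B) :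
    ∀ {N} (w : W ι N), ‖w.tl T‖ * B ≤ (w.b2 a B) ^ 2
  | 0, w => by
      simp only [W.tl, W.b2, pow_two]
      exact mul_le_mul_of_nonneg_right (hT _) hB
  | _ + 1, w => by
      simp only [W.tl, W.b2, mul_pow]
      rw [W.op_eq, ← mul_assoc]
      calc _ ≤ ‖T w.1.2 * star (T w.2.hd)‖ * ‖w.2.tl T‖ * B := by
            gcongr; exact norm_mul_le _ _
        _ ≤ a w.1.2 w.2.hd ^ 2 * (‖w.2.tl T‖ * B) := by
            rw [mul_assoc]; gcongr; exact h2 _ _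
        _ ≤ _ := by gcongr; exact W.norm_tl_le T ha hB h2 hT w.2

theorem W.norm_op_le2 (T : ι → E →L[ℂ] E) {a : ι → ι → ℝ} (ha : ∀ i j, 0 ≤ a i j)
    {B : ℝ} (hB : 0 ≤ B)
    (h2 : ∀ i j, ‖T i * star (T j)‖ ≤ a i j ^ 2) (hT : ∀ i, ‖T i‖ ≤ B)
    {N} (w : W ι N) : ‖w.op T‖ ≤ (w.b2 a B) ^ 2 := by
  rw [W.op_eq]
  refine le_trans ?_ (W.norm_tl_le T ha hB h2 hT w)
  refine (norm_mul_le _ _).trans ?_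
  rw [norm_star, mul_comm]
  gcongr
  exact hT _

theorem W.sum_b (a : ι → ι → ℝ) (ha : ∀ i j, 0 ≤ a i j) {B G : ℝ} (hB : 0 ≤ B) (hG : 0 ≤ G)
    (hs : ∀ i, ∑ j, a i j ≤ G) : ∀ N (f : ι → ℝ) (F : ℝ), (∀ i, 0 ≤ f i) → 0 ≤ F →
    (∑ i, f i ≤ F) →
    ∑ w : W ι N, f w.hd * (w.b1 a * w.b2 a B) ≤ F * B * G ^ (2 * N + 1)
  | 0, f, F, hf, hF, hfF => by
      change ∑ w : ι × ι, f w.1 * (a w.1 w.2 * B) ≤ _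
      rw [Fintype.sum_prod_type]
      calc ∑ i, ∑ j, f i * (a i j * B) = ∑ i, f i * ((∑ j, a i j) * B) := by
            simp_rw [Finset.sum_mul, Finset.mul_sum]
        _ ≤ ∑ i, f i * (G * B) := by
            refine Finset.sum_le_sum fun i _ => ?_
            have := hf i
            gcongr
            exact hs i
        _ = (∑ i, f i) * (G * B) := by rw [Finset.sum_mul]
        _ ≤ F * (G * B) := by gcongr
        _ = _ := by ring
  | N + 1, f, F, hf, hF, hfF => by
      change ∑ w : (ι × ι) × W ι N, f w.1.1 * ((a w.1.1 w.1.2 * W.b1 a w.2) *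
        (a w.1.2 w.2.hd * W.b2 a B w.2)) ≤ _
      rw [Fintype.sum_prod_type, Finset.sum_comm]
      have : ∀ w : W ι N, ∑ x : ι × ι, f x.1 * ((a x.1 x.2 * W.b1 a w) *
        (a x.2 w.hd * W.b2 a B w)) =
          (∑ x : ι × ι, f x.1 * a x.1 x.2 * a x.2 w.hd) * (W.b1 a w * W.b2 a B w) := by
        intro w
        rw [Finset.sum_mul]
        exact Finset.sum_congr rfl fun x _ => by ring
      simp_rw [this]
      refine (W.sum_b a ha hB hG hs N (fun i => ∑ x : ι × ι, f x.1 * a x.1 x.2 * a x.2 i)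
        (F * G ^ 2) ?_ (by positivity) ?_).trans (le_of_eq (by ring))
      · intro i
        exact Finset.sum_nonneg fun x _ => mul_nonneg (mul_nonneg (hf _) (ha _ _)) (ha _ _)
      · rw [Finset.sum_comm]
        calc ∑ x : ι × ι, ∑ i, f x.1 * a x.1 x.2 * a x.2 i
            = ∑ x : ι × ι, f x.1 * a x.1 x.2 * ∑ i, a x.2 i := by simp_rw [Finset.mul_sum]
          _ ≤ ∑ x : ι × ι, f x.1 * a x.1 x.2 * G := by
              refine Finset.sum_le_sum fun x _ => ?_
              exact mul_le_mul_of_nonneg_left (hs _) (mul_nonneg (hf _) (ha _ _))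
          _ = ∑ i, f i * (∑ j, a i j) * G := by
              rw [Fintype.sum_prod_type]
              simp_rw [Finset.mul_sum, Finset.sum_mul]
          _ ≤ ∑ i, f i * G * G := by
              refine Finset.sum_le_sum fun i _ => ?_
              have := hf i
              gcongr
              exact hs i
          _ = (∑ i, f i) * G ^ 2 := by
              rw [Finset.sum_mul]; exact Finset.sum_congr rfl fun x _ => by ring
          _ ≤ _ := by gcongr

theorem cotlar_stein (T : ι → E →L[ℂ] E) (a : ι → ι → ℝ) (ha : ∀ i j, 0 ≤ a i j) {G : ℝ}
    (hG : 0 < G) (hs : ∀ i, ∑ j, a i j ≤ G)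
    (h1 : ∀ i j, ‖star (T i) * T j‖ ≤ a i j ^ 2)
    (h2 : ∀ i j, ‖T i * star (T j)‖ ≤ a i j ^ 2) : ‖∑ i, T i‖ ≤ G := by
  set B : ℝ := ∑ i, ‖T i‖ with hBdef
  have hB : 0 ≤ B := Finset.sum_nonneg fun _ _ => norm_nonneg _
  have hT : ∀ i, ‖T i‖ ≤ B := fun i =>
    Finset.single_le_sum (f := fun i => ‖T i‖) (fun _ _ => norm_nonneg _) (Finset.mem_univ i)
  set S := ∑ i, T i with hS
  have hsa : IsSelfAdjoint (star S * S) := IsSelfAdjoint.star_mul_self S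
  have main : ∀ N, ‖(star S * S) ^ (N + 1)‖ ≤ (Fintype.card ι) * B * G ^ (2 * N + 1) := by
    intro N
    rw [hS, ← sum_op]
    refine (norm_sum_le _ _).trans ?_
    have := W.sum_b a ha hB hG.le hs N (fun _ => 1) (Fintype.card ι) (fun _ => zero_le_one)
      (by positivity) (by simp)
    refine le_trans (Finset.sum_le_sum fun w _ => ?_) this
    rw [one_mul]
    have e1 := W.norm_op_le1 T ha h1 w
    have e2 := W.norm_op_le2 T ha hB h2 hT w
    have n1 := W.b1_nonneg ha w
    have n2 := W.b2_nonneg ha hB w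
    by_contra! hc
    have := mul_self_lt_mul_self (mul_nonneg n1 n2) hc
    have h4 : ‖W.op T w‖ * ‖W.op T w‖ ≤ (w.b1 a) ^ 2 * (w.b2 a B) ^ 2 :=
      mul_le_mul e1 e2 (norm_nonneg _) (by positivity)
    nlinarith
  by_contra! hc
  have hlim : Tendsto (fun k : ℕ => (‖S‖ / G) ^ (2 * 2 ^ k)) atTop atTop := by
    have hr : 1 < ‖S‖ / G := (one_lt_div hG).2 hc
    refine (tendsto_pow_atTop_atTop_of_one_lt hr).comp ?_
    refine tendsto_atTop_mono (fun k => ?_) tendsto_id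
    have := Nat.lt_two_pow_self (n := k)
    simp only [id]; omega
  obtain ⟨k, hk⟩ := (hlim.eventually_gt_atTop ((Fintype.card ι) * B / G)).exists
  have h3 : ‖(star S * S) ^ (2 ^ k)‖ = ‖S‖ ^ (2 * 2 ^ k) := by
    have := hsa.nnnorm_pow_two_pow k
    have h' : ‖(star S * S) ^ (2 ^ k)‖ = ‖star S * S‖ ^ (2 ^ k) := by
      simpa using congrArg NNReal.toReal this
    rw [h', CStarRing.norm_star_mul_self, ← pow_two, ← pow_mul]
  have h4 := main (2 ^ k - 1)
  have h5 : 2 ^ k - 1 + 1 = 2 ^ k := Nat.sub_add_cancel Nat.one_le_two_pow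
  rw [h5, h3] at h4
  have h6 : 2 * (2 ^ k - 1) + 1 + 1 = 2 * 2 ^ k := by omega
  rw [div_pow, lt_div_iff₀ (by positivity)] at hk
  have h7 : G ^ (2 * 2 ^ k) = G ^ (2 * (2 ^ k - 1) + 1) * G := by rw [← pow_succ, h6]
  rw [h7] at hk
  have : (Fintype.card ι) * B / G * (G ^ (2 * (2 ^ k - 1) + 1) * G) =
    (Fintype.card ι) * B * G ^ (2 * (2 ^ k - 1) + 1) := by field_simp
  rw [this] at hk
  linarith

end CotlarStein
end GR
end

section
open scoped ENNReal NNReal Topology ComplexConjugate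
namespace GR
set_option linter.unusedSectionVars false

section L2
variable {X : Type*} [MeasurableSpace X] {μ : Measure X} [SFinite μ]

/-- The integral operator with kernel `K`. -/
def IntOp (μ : Measure X) (K : X → X → ℂ) (f : X → ℂ) (x : X) : ℂ := ∫ y, K x y * f y ∂μ

/-- Schur kernels. -/
structure SchurKer (μ : Measure X) (K : X → X → ℂ) (A B : ℝ≥0) : Prop where
  meas : Measurable (Function.uncurry K)
  row : ∀ x, ∫⁻ y, ‖K x y‖ₑ ∂μ ≤ A
  col : ∀ y, ∫⁻ x, ‖K x y‖ₑ ∂μ ≤ B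

variable {K L : X → X → ℂ} {A B A' B' : ℝ≥0}

theorem IntOp_congr {f g : X → ℂ} (h : f =ᵐ[μ] g) : IntOp μ K f = IntOp μ K g := by
  funext x
  exact integral_congr_ae (h.mono fun y hy => by simp [hy])

theorem IntOp_enorm_le (f : X → ℂ) (x : X) :
    ‖IntOp μ K f x‖ₑ ≤ ∫⁻ y, ‖K x y‖ₑ * ‖f y‖ₑ ∂μ := by
  refine (enorm_integral_le_lintegral_enorm _).trans (le_of_eq ?_)
  simp_rw [enorm_mul]

theorem SchurKer.menorm (h : SchurKer μ K A B) :
    Measurable (Function.uncurry fun x y => ‖K x y‖ₑ) := h.meas.enorm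

theorem SchurKer.stronglyMeasurable_IntOp (h : SchurKer μ K A B) {f : X → ℂ} (hf : Measurable f) :
    StronglyMeasurable (IntOp μ K f) := by
  have : Measurable (Function.uncurry fun x y => K x y * f y) :=
    h.meas.mul (hf.comp measurable_snd)
  exact this.stronglyMeasurable.integral_prod_right

theorem SchurKer.aesm_IntOp (h : SchurKer μ K A B) {f : X → ℂ} (hf : AEStronglyMeasurable f μ) :
    StronglyMeasurable (IntOp μ K f) := by
  rw [IntOp_congr hf.ae_eq_mk]
  exact h.stronglyMeasurable_IntOp hf.stronglyMeasurable_mk.measurable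

theorem SchurKer.lint_le (h : SchurKer μ K A B) {p : ℝ} (hp : 1 ≤ p) {f : X → ℂ}
    (hf : AEStronglyMeasurable f μ) :
    ∫⁻ x, (∫⁻ y, ‖K x y‖ₑ * ‖f y‖ₑ ∂μ) ^ p ∂μ ≤
      (A : ℝ≥0∞) ^ (p - 1) * (B * ∫⁻ y, ‖f y‖ₑ ^ p ∂μ) := by
  have e1 : ∀ x, ∫⁻ y, ‖K x y‖ₑ * ‖f y‖ₑ ∂μ = ∫⁻ y, ‖K x y‖ₑ * ‖hf.mk f y‖ₑ ∂μ := fun x =>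
    lintegral_congr_ae (hf.ae_eq_mk.mono fun y hy => by simp only; rw [← hy])
  have e2 : ∫⁻ y, ‖f y‖ₑ ^ p ∂μ = ∫⁻ y, ‖hf.mk f y‖ₑ ^ p ∂μ :=
    lintegral_congr_ae (hf.ae_eq_mk.mono fun y hy => by simp only; rw [← hy])
  simp_rw [e1, e2]
  exact schur_lintegral (ν := μ) h.menorm h.row h.col hp hf.stronglyMeasurable_mk.measurable.enorm

theorem eLpNorm_rpow {p : ℝ} (hp : 0 < p) (f : X → ℂ) :
    eLpNorm f (ENNReal.ofReal p) μ ^ p = ∫⁻ y, ‖f y‖ₑ ^ p ∂μ := by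
  rw [eLpNorm_eq_lintegral_rpow_enorm_toReal (by simpa using hp) ENNReal.ofReal_ne_top,
    ENNReal.toReal_ofReal hp.le, ← ENNReal.rpow_mul, one_div, inv_mul_cancel₀ hp.ne',
    ENNReal.rpow_one]

theorem SchurKer.eLpNorm_le (h : SchurKer μ K A B) {p : ℝ} (hp : 1 ≤ p) {f : X → ℂ}
    (hf : AEStronglyMeasurable f μ) :
    eLpNorm (IntOp μ K f) (ENNReal.ofReal p) μ ^ p ≤
      (A : ℝ≥0∞) ^ (p - 1) * B * eLpNorm f (ENNReal.ofReal p) μ ^ p := by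
  have hp0 : 0 < p := by linarith
  rw [eLpNorm_rpow hp0, eLpNorm_rpow hp0, mul_assoc]
  refine le_trans (lintegral_mono fun x => ?_) (h.lint_le hp hf)
  exact ENNReal.rpow_le_rpow (IntOp_enorm_le f x) hp0.le

theorem SchurKer.memLp (h : SchurKer μ K A B) {p : ℝ} (hp : 1 ≤ p) {f : X → ℂ}
    (hf : MemLp f (ENNReal.ofReal p) μ) : MemLp (IntOp μ K f) (ENNReal.ofReal p) μ := by
  have hp0 : 0 < p := by linarith
  refine ⟨(h.aesm_IntOp hf.1).aestronglyMeasurable, ?_⟩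
  have h1 := h.eLpNorm_le hp hf.1
  have h2 : eLpNorm (IntOp μ K f) (ENNReal.ofReal p) μ ^ p < ⊤ := by
    refine h1.trans_lt (ENNReal.mul_lt_top (ENNReal.mul_lt_top ?_ ENNReal.coe_lt_top) ?_)
    · exact ENNReal.rpow_lt_top_of_nonneg (by linarith) ENNReal.coe_ne_top
    · exact ENNReal.rpow_lt_top_of_nonneg hp0.le hf.2.ne
  exact (ENNReal.rpow_lt_top_iff_of_pos hp0).1 h2

theorem SchurKer.ae_integrable (h : SchurKer μ K A B) {p : ℝ} (hp : 1 ≤ p) {f : X → ℂ}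
    (hf : MemLp f (ENNReal.ofReal p) μ) : ∀ᵐ x ∂μ, Integrable (fun y => K x y * f y) μ := by
  have hp0 : 0 < p := by linarith
  have h1 := h.lint_le hp hf.1
  have h2 : ∫⁻ x, (∫⁻ y, ‖K x y‖ₑ * ‖f y‖ₑ ∂μ) ^ p ∂μ ≠ ⊤ := by
    refine (h1.trans_lt (ENNReal.mul_lt_top ?_ (ENNReal.mul_lt_top ENNReal.coe_lt_top ?_))).ne
    · exact ENNReal.rpow_lt_top_of_nonneg (by linarith) ENNReal.coe_ne_top
    · rw [← eLpNorm_rpow hp0]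
      exact ENNReal.rpow_lt_top_of_nonneg hp0.le hf.2.ne
  have h3 : AEMeasurable (fun x => (∫⁻ y, ‖K x y‖ₑ * ‖f y‖ₑ ∂μ) ^ p) μ := by
    have e1 : ∀ x, ∫⁻ y, ‖K x y‖ₑ * ‖f y‖ₑ ∂μ = ∫⁻ y, ‖K x y‖ₑ * ‖hf.1.mk f y‖ₑ ∂μ := fun x =>
      lintegral_congr_ae (hf.1.ae_eq_mk.mono fun y hy => by simp only; rw [← hy])
    simp_rw [e1]
    refine (Measurable.pow_const ?_ p).aemeasurable
    exact Measurable.lintegral_prod_right (f := fun x y => ‖K x y‖ₑ * ‖hf.1.mk f y‖ₑ)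
      (h.menorm.mul (hf.1.stronglyMeasurable_mk.measurable.enorm.comp measurable_snd))
  filter_upwards [ae_lt_top' h3 h2] with x hx
  have hx' := (ENNReal.rpow_lt_top_iff_of_pos hp0).1 hx
  refine ⟨(h.meas.of_uncurry_left.aestronglyMeasurable).mul hf.1, ?_⟩
  simpa [HasFiniteIntegral, enorm_mul] using hx'

theorem two_eq : ENNReal.ofReal 2 = 2 := by simp

theorem SchurKer.memLp2 (h : SchurKer μ K A B) (f : Lp ℂ 2 μ) : MemLp (IntOp μ K f) 2 μ := by
  have := h.memLp (p := 2) one_le_two (f := f) (by simpa using Lp.memLp f)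
  simpa using this

/-- Schur operators on `L²`. -/
def SchurKer.clm (h : SchurKer μ K A B) : Lp ℂ 2 μ →L[ℂ] Lp ℂ 2 μ :=
  LinearMap.mkContinuous
    { toFun := fun f => (h.memLp2 f).toLp _
      map_add' := by
        intro f g
        rw [← MemLp.toLp_add]
        refine MemLp.toLp_congr _ _ ?_
        have h1 := h.ae_integrable (p := 2) one_le_two (f := f) (by simpa using Lp.memLp f)
        have h2 := h.ae_integrable (p := 2) one_le_two (f := g) (by simpa using Lp.memLp g)
        filter_upwards [h1, h2] with x hx1 hx2
        rw [IntOp_congr (Lp.coeFn_add f g)]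
        simp only [IntOp, Pi.add_apply, mul_add]
        exact integral_add hx1 hx2
      map_smul' := by
        intro c f
        simp only [RingHom.id_apply]
        rw [← MemLp.toLp_const_smul]
        refine MemLp.toLp_congr _ _ ?_
        filter_upwards with x
        rw [IntOp_congr (Lp.coeFn_smul c f)]
        simp only [IntOp, Pi.smul_apply, smul_eq_mul]
        rw [← integral_const_mul]
        exact integral_congr_ae (Eventually.of_forall fun y => by ring) }
    (Real.sqrt (A * B)) (by
      intro f
      simp only [LinearMap.coe_mk, AddHom.coe_mk]
      rw [Lp.norm_toLp, Lp.norm_def, Real.sqrt_eq_rpow]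
      have h1 := h.eLpNorm_le (p := 2) one_le_two (f := f) (Lp.aestronglyMeasurable f)
      rw [two_eq] at h1
      have h2 := ENNReal.rpow_le_rpow h1 (z := 1 / 2) (by norm_num)
      rw [ENNReal.mul_rpow_of_nonneg _ _ (by norm_num), ← ENNReal.rpow_mul, ← ENNReal.rpow_mul] at h2
      norm_num at h2
      have h3 := ENNReal.toReal_mono (by
        refine ENNReal.mul_ne_top ?_ (Lp.eLpNorm_ne_top f)
        exact ENNReal.rpow_ne_top_of_nonneg (by norm_num)
          (ENNReal.mul_ne_top ENNReal.coe_ne_top ENNReal.coe_ne_top)) h2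
      rw [ENNReal.toReal_mul, ← ENNReal.toReal_rpow] at h3
      simpa using h3)

theorem SchurKer.clm_apply (h : SchurKer μ K A B) (f : Lp ℂ 2 μ) :
    h.clm f =ᵐ[μ] IntOp μ K f := MemLp.coeFn_toLp (h.memLp2 f)

theorem SchurKer.norm_clm_le (h : SchurKer μ K A B) : ‖h.clm‖ ≤ Real.sqrt (A * B) :=
  LinearMap.mkContinuous_norm_le _ (Real.sqrt_nonneg _) _

/-- composition of kernels -/
def kcomp (μ : Measure X) (L K : X → X → ℂ) (z y : X) : ℂ := ∫ x, L z x * K x y ∂μ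

theorem kcomp_meas (hL : Measurable (Function.uncurry L)) (hK : Measurable (Function.uncurry K)) :
    Measurable (Function.uncurry (kcomp μ L K)) := by
  have : Measurable (Function.uncurry fun (q : X × X) (x : X) => L q.1 x * K x q.2) := by
    refine Measurable.mul ?_ ?_
    · exact hL.comp ((measurable_fst.comp measurable_fst).prodMk measurable_snd)
    · exact hK.comp (measurable_snd.prodMk (measurable_snd.comp measurable_fst))
  exact (this.stronglyMeasurable.integral_prod_right).measurable

theorem SchurKer.comp_clm (hL : SchurKer μ L A' B') (hK : SchurKer μ K A B) {C D : ℝ≥0}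
    (hM : SchurKer μ (kcomp μ L K) C D) : hL.clm * hK.clm = hM.clm := by
  ext1 f
  apply Lp.ext
  rw [ContinuousLinearMap.mul_apply]
  refine (hL.clm_apply _).trans (EventuallyEq.trans ?_ (hM.clm_apply _).symm)
  rw [IntOp_congr (hK.clm_apply f)]
  -- absolute convergence
  have hf : MemLp f (ENNReal.ofReal 2) μ := by simpa using Lp.memLp f
  set f' := hf.1.mk f with hf'
  have hfm : Measurable f' := hf.1.stronglyMeasurable_mk.measurable
  have hff : f =ᵐ[μ] f' := hf.1.ae_eq_mk
  rw [IntOp_congr hff, IntOp_congr hff]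
  have hf2 : MemLp f' (ENNReal.ofReal 2) μ := hf.ae_eq hff
  set F : X → ℝ≥0∞ := fun x => ∫⁻ y, ‖K x y‖ₑ * ‖f' y‖ₑ ∂μ with hF
  have hFm : Measurable F := Measurable.lintegral_prod_right (f := fun x y => ‖K x y‖ₑ * ‖f' y‖ₑ)
      (hK.menorm.mul (hfm.enorm.comp measurable_snd))
  have h2 : ∫⁻ z, (∫⁻ x, ‖L z x‖ₑ * F x ∂μ) ^ (2 : ℝ) ∂μ ≠ ⊤ := by
    refine ((schur_lintegral (ν := μ) hL.menorm hL.row hL.col one_le_two hFm).trans_lt ?_).ne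
    refine ENNReal.mul_lt_top ?_ (ENNReal.mul_lt_top ENNReal.coe_lt_top ?_)
    · exact ENNReal.rpow_lt_top_of_nonneg (by linarith) ENNReal.coe_ne_top
    refine (hK.lint_le one_le_two hf2.1).trans_lt
      (ENNReal.mul_lt_top ?_ (ENNReal.mul_lt_top ENNReal.coe_lt_top ?_))
    · exact ENNReal.rpow_lt_top_of_nonneg (by linarith) ENNReal.coe_ne_top
    · rw [← eLpNorm_rpow two_pos]
      exact ENNReal.rpow_lt_top_of_nonneg two_pos.le hf2.2.ne
  have h3 : Measurable (fun z => (∫⁻ x, ‖L z x‖ₑ * F x ∂μ) ^ (2 : ℝ)) := by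
    refine (Measurable.pow_const ?_ _)
    exact Measurable.lintegral_prod_right (f := fun z x => ‖L z x‖ₑ * F x)
      (hL.menorm.mul (hFm.comp measurable_snd))
  filter_upwards [ae_lt_top h3 h2] with z hz
  have hz' := (ENNReal.rpow_lt_top_iff_of_pos two_pos).1 hz
  simp only [IntOp, kcomp]
  have m1 : Measurable (Function.uncurry fun x y => L z x * (K x y * f' y)) := by
    refine Measurable.mul ?_ (hK.meas.mul (hfm.comp measurable_snd))
    exact hL.meas.of_uncurry_left.comp measurable_fst
  have hinteg : Integrable (Function.uncurry fun x y => L z x * (K x y * f' y)) (μ.prod μ) := by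
    refine ⟨m1.aestronglyMeasurable, ?_⟩
    rw [HasFiniteIntegral, lintegral_prod _ m1.enorm.aemeasurable]
    refine lt_of_eq_of_lt ?_ hz'
    refine lintegral_congr fun x => ?_
    simp only [Function.uncurry, enorm_mul]
    rw [lintegral_const_mul]
    exact (hK.meas.of_uncurry_left.enorm).mul hfm.enorm
  calc ∫ x, L z x * ∫ y, K x y * f' y ∂μ ∂μ = ∫ x, ∫ y, L z x * (K x y * f' y) ∂μ ∂μ := by
        simp_rw [integral_const_mul]
    _ = ∫ y, ∫ x, L z x * (K x y * f' y) ∂μ ∂μ := integral_integral_swap hinteg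
    _ = _ := by
        refine integral_congr_ae (Eventually.of_forall fun y => ?_)
        simp only [← mul_assoc]
        rw [integral_mul_const]

/-- adjoint kernel -/
def kadj (K : X → X → ℂ) (x y : X) : ℂ := conj (K y x)

theorem SchurKer.adj (h : SchurKer μ K A B) : SchurKer μ (kadj K) B A where
  meas := by
    have : Measurable (Function.uncurry fun x y => K y x) := h.meas.comp measurable_swap
    exact Complex.continuous_conj.measurable.comp this
  row x := by simpa [kadj] using h.col x
  col y := by simpa [kadj] using h.row y

/-- pairing identity -/
theorem SchurKer.pairing (h : SchurKer μ K A B) {p q : ℝ} (hp : 1 ≤ p)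
    (hpq : p.HolderConjugate q) {f g : X → ℂ}
    (hf : MemLp f (ENNReal.ofReal p) μ) (hg : MemLp g (ENNReal.ofReal q) μ) :
    ∫ x, conj (g x) * IntOp μ K f x ∂μ = ∫ y, conj (IntOp μ (kadj K) g y) * f y ∂μ := by
  set f' := hf.1.mk f with hf'
  have hfm : Measurable f' := hf.1.stronglyMeasurable_mk.measurable
  have hff : f =ᵐ[μ] f' := hf.1.ae_eq_mk
  set g' := hg.1.mk g with hg'
  have hgm : Measurable g' := hg.1.stronglyMeasurable_mk.measurable
  have hgg : g =ᵐ[μ] g' := hg.1.ae_eq_mk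
  rw [IntOp_congr hff, IntOp_congr hgg]
  have e1 : ∫ x, conj (g x) * IntOp μ K f' x ∂μ = ∫ x, conj (g' x) * IntOp μ K f' x ∂μ :=
    integral_congr_ae (hgg.mono fun x hx => by simp only [hx])
  have e2 : ∫ x, conj (IntOp μ (kadj K) g' x) * f x ∂μ = ∫ x, conj (IntOp μ (kadj K) g' x) * f' x ∂μ :=
    integral_congr_ae (hff.mono fun x hx => by simp only [hx])
  rw [e1, e2]
  have hf2 : MemLp f' (ENNReal.ofReal p) μ := hf.ae_eq hff
  have hg2 : MemLp g' (ENNReal.ofReal q) μ := hg.ae_eq hgg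
  have hp0 : 0 < p := by linarith
  have hq0 : 0 < q := hpq.symm.pos
  have m1 : Measurable (Function.uncurry fun x y => conj (g' x) * (K x y * f' y)) := by
    refine Measurable.mul ?_ (h.meas.mul (hfm.comp measurable_snd))
    exact (Complex.continuous_conj.measurable.comp hgm).comp measurable_fst
  set F : X → ℝ≥0∞ := fun x => ∫⁻ y, ‖K x y‖ₑ * ‖f' y‖ₑ ∂μ with hF
  have hFm : Measurable F := Measurable.lintegral_prod_right (f := fun x y => ‖K x y‖ₑ * ‖f' y‖ₑ)
      (h.menorm.mul (hfm.enorm.comp measurable_snd))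
  have hinteg : Integrable (Function.uncurry fun x y => conj (g' x) * (K x y * f' y)) (μ.prod μ) := by
    refine ⟨m1.aestronglyMeasurable, ?_⟩
    rw [HasFiniteIntegral, lintegral_prod _ m1.enorm.aemeasurable]
    have e3 : ∫⁻ x, ∫⁻ y, ‖Function.uncurry (fun x y => conj (g' x) * (K x y * f' y)) (x, y)‖ₑ ∂μ ∂μ
        = ∫⁻ x, F x * ‖g' x‖ₑ ∂μ := by
      refine lintegral_congr fun x => ?_
      simp only [Function.uncurry, enorm_mul, RCLike.enorm_conj]
      rw [lintegral_const_mul, mul_comm]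
      exact (h.meas.of_uncurry_left.enorm).mul hfm.enorm
    rw [e3]
    refine (ENNReal.lintegral_mul_le_Lp_mul_Lq μ hpq hFm.aemeasurable
      hgm.enorm.aemeasurable).trans_lt (ENNReal.mul_lt_top ?_ ?_)
    · refine ENNReal.rpow_lt_top_of_nonneg (by positivity) (ne_of_lt ?_)
      refine (h.lint_le hp hf2.1).trans_lt
        (ENNReal.mul_lt_top ?_ (ENNReal.mul_lt_top ENNReal.coe_lt_top ?_))
      · exact ENNReal.rpow_lt_top_of_nonneg (by linarith) ENNReal.coe_ne_top
      · rw [← eLpNorm_rpow hp0]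
        exact ENNReal.rpow_lt_top_of_nonneg hp0.le hf2.2.ne
    · refine ENNReal.rpow_lt_top_of_nonneg (by positivity) (ne_of_lt ?_)
      rw [← eLpNorm_rpow hq0]
      exact ENNReal.rpow_lt_top_of_nonneg hq0.le hg2.2.ne
  calc ∫ x, conj (g' x) * IntOp μ K f' x ∂μ = ∫ x, ∫ y, conj (g' x) * (K x y * f' y) ∂μ ∂μ := by
        simp_rw [IntOp, integral_const_mul]
    _ = ∫ y, ∫ x, conj (g' x) * (K x y * f' y) ∂μ ∂μ := integral_integral_swap hinteg
    _ = _ := by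
        refine integral_congr_ae (Eventually.of_forall fun y => ?_)
        simp only [IntOp, kadj]
        rw [← integral_conj, ← integral_mul_const]
        refine integral_congr_ae (Eventually.of_forall fun x => ?_)
        simp only [map_mul, Complex.conj_conj]
        ring

theorem SchurKer.star_clm (h : SchurKer μ K A B) : star h.clm = h.adj.clm := by
  rw [ContinuousLinearMap.star_eq_adjoint]
  symm
  rw [ContinuousLinearMap.eq_adjoint_iff]
  intro g f
  rw [L2.inner_def, L2.inner_def]
  simp only [RCLike.inner_apply]
  have hpq : (2 : ℝ).HolderConjugate 2 := Real.HolderConjugate.two_two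
  have h1 := h.pairing (p := 2) (q := 2) one_le_two hpq (f := f) (g := g)
    (by simpa using Lp.memLp f) (by simpa using Lp.memLp g)
  have e1 : ∫ a, f a * (starRingEnd ℂ) ((h.adj.clm g) a) ∂μ =
      ∫ y, conj (IntOp μ (kadj K) g y) * f y ∂μ :=
    integral_congr_ae ((h.adj.clm_apply g).mono fun x hx => by simp only [hx]; ring)
  have e2 : ∫ a, (h.clm f) a * (starRingEnd ℂ) (g a) ∂μ = ∫ x, conj (g x) * IntOp μ K f x ∂μ :=
    integral_congr_ae ((h.clm_apply f).mono fun x hx => by simp only [hx]; ring)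
  rw [e1, e2, h1]

end L2
end GR
end

section
open scoped ENNReal NNReal Topology ComplexConjugate
namespace GR
set_option linter.unusedSectionVars false

section AO
variable {X : Type*} [MeasurableSpace X] {μ : Measure X} [SFinite μ]

/-- Kernels living at scale `r`. -/
structure GoodKer (μ : Measure X) (ρ : X → X → ℝ≥0∞) (r : ℝ) (A : ℝ≥0) (K : X → X → ℂ) : Prop where
  rpos : 0 < r
  meas : Measurable (Function.uncurry K)
  size1 : ∀ x, ∫⁻ y, ‖K x y‖ₑ * (1 + ρ x y / ENNReal.ofReal r) ∂μ ≤ A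
  size2 : ∀ y, ∫⁻ x, ‖K x y‖ₑ * (1 + ρ y x / ENNReal.ofReal r) ∂μ ≤ A
  reg1 : ∀ y y0, ∫⁻ x, ‖K x y - K x y0‖ₑ ∂μ ≤ A * (ρ y y0 / ENNReal.ofReal r)
  reg2 : ∀ x x0, ∫⁻ y, ‖K x y - K x0 y‖ₑ ∂μ ≤ A * (ρ x x0 / ENNReal.ofReal r)
  canc1 : ∀ x, ∫ y, K x y ∂μ = 0
  canc2 : ∀ y, ∫ x, K x y ∂μ = 0

variable {ρ : X → X → ℝ≥0∞} {K L : X → X → ℂ} {r rL rK : ℝ} {A : ℝ≥0}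

theorem GoodKer.schur (h : GoodKer μ ρ r A K) : SchurKer μ K A A where
  meas := h.meas
  row x := le_trans (lintegral_mono fun y => by
    simpa using mul_le_mul_right (le_self_add (a := (1:ℝ≥0∞)) (b := ρ x y / ENNReal.ofReal r)) ‖K x y‖ₑ) (h.size1 x)
  col y := le_trans (lintegral_mono fun x => by
    simpa using mul_le_mul_right (le_self_add (a := (1:ℝ≥0∞)) (b := ρ y x / ENNReal.ofReal r)) ‖K x y‖ₑ) (h.size2 y)

theorem GoodKer.adj (h : GoodKer μ ρ r A K) : GoodKer μ ρ r A (kadj K) where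
  rpos := h.rpos
  meas := h.schur.adj.meas
  size1 x := by simpa [kadj] using h.size2 x
  size2 y := by simpa [kadj] using h.size1 y
  reg1 y y0 := by
    refine le_trans (le_of_eq (lintegral_congr fun x => ?_)) (h.reg2 y y0)
    simp [kadj, ← map_sub]
  reg2 y y0 := by
    refine le_trans (le_of_eq (lintegral_congr fun x => ?_)) (h.reg1 y y0)
    simp [kadj, ← map_sub]
  canc1 x := by
    have := h.canc2 x
    simp only [kadj]; rw [integral_conj, this, map_zero]
  canc2 x := by
    have := h.canc1 x
    simp only [kadj]; rw [integral_conj, this, map_zero]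

theorem kadj_kcomp (z y : X) : kcomp μ (kadj K) (kadj L) z y = kadj (kcomp μ L K) z y := by
  simp only [kcomp, kadj]
  rw [← integral_conj]
  exact integral_congr_ae (Eventually.of_forall fun x => by simp [mul_comm])

theorem kcomp_enorm_le (z y : X) :
    ‖kcomp μ L K z y‖ₑ ≤ ∫⁻ x, ‖L z x‖ₑ * ‖K x y‖ₑ ∂μ := by
  refine (enorm_integral_le_lintegral_enorm _).trans (le_of_eq ?_)
  simp_rw [enorm_mul]

theorem GoodKer.comp_row (hL : GoodKer μ ρ rL A L) (hK : GoodKer μ ρ rK A K) (z : X) :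
    ∫⁻ y, ‖kcomp μ L K z y‖ₑ ∂μ ≤ (A * A : ℝ≥0) := by
  have m : Measurable (Function.uncurry fun x y => ‖L z x‖ₑ * ‖K x y‖ₑ) :=
    (hL.meas.of_uncurry_left.enorm.comp measurable_fst).mul hK.meas.enorm
  calc ∫⁻ y, ‖kcomp μ L K z y‖ₑ ∂μ ≤ ∫⁻ y, ∫⁻ x, ‖L z x‖ₑ * ‖K x y‖ₑ ∂μ ∂μ :=
        lintegral_mono fun y => kcomp_enorm_le z y
    _ = ∫⁻ x, ∫⁻ y, ‖L z x‖ₑ * ‖K x y‖ₑ ∂μ ∂μ := (lintegral_lintegral_swap m.aemeasurable).symm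
    _ = ∫⁻ x, ‖L z x‖ₑ * ∫⁻ y, ‖K x y‖ₑ ∂μ ∂μ := by
        refine lintegral_congr fun x => ?_
        rw [lintegral_const_mul _ hK.meas.of_uncurry_left.enorm]
    _ ≤ ∫⁻ x, ‖L z x‖ₑ * A ∂μ := by
        gcongr with x
        exact hK.schur.row x
    _ = (∫⁻ x, ‖L z x‖ₑ ∂μ) * A := lintegral_mul_const _ hL.meas.of_uncurry_left.enorm
    _ ≤ _ := by
        push_cast
        gcongr
        exact hL.schur.row z

theorem GoodKer.comp_row_small (hρ : ∀ x y, ρ x y = ρ y x) (hL : GoodKer μ ρ rL A L) (hK : GoodKer μ ρ rK A K) (z : X) :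
    ∫⁻ y, ‖kcomp μ L K z y‖ₑ ∂μ ≤ (A * A * (rL / rK).toNNReal : ℝ≥0) := by
  have m : Measurable (Function.uncurry fun x y => ‖L z x‖ₑ * ‖K x y - K z y‖ₑ) := by
    refine (hL.meas.of_uncurry_left.enorm.comp measurable_fst).mul (Measurable.enorm ?_)
    exact hK.meas.sub (hK.meas.of_uncurry_left.comp measurable_snd)
  have key : ∀ y, ‖kcomp μ L K z y‖ₑ ≤ ∫⁻ x, ‖L z x‖ₑ * ‖K x y - K z y‖ₑ ∂μ := by
    intro y
    by_cases hi : Integrable (fun x => L z x * K x y) μ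
    · have hLi : Integrable (L z) μ :=
        ⟨hL.meas.of_uncurry_left.aestronglyMeasurable, (hL.schur.row z).trans_lt ENNReal.coe_lt_top⟩
      have : kcomp μ L K z y = ∫ x, L z x * (K x y - K z y) ∂μ := by
        simp_rw [mul_sub]
        rw [integral_sub hi (hLi.mul_const _), integral_mul_const, hL.canc1 z]
        simp [kcomp]
      rw [this]
      refine (enorm_integral_le_lintegral_enorm _).trans (le_of_eq ?_)
      simp_rw [enorm_mul]
    · simp [kcomp, integral_undef hi]
  have hrL : ENNReal.ofReal rL ≠ 0 := by simpa using hL.rpos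
  have hsc : ∀ a : ℝ≥0∞, a / ENNReal.ofReal rK = ((rL / rK).toNNReal : ℝ≥0∞) * (a / ENNReal.ofReal rL) := by
    intro a
    change _ = ENNReal.ofReal (rL / rK) * _
    rw [ENNReal.ofReal_div_of_pos hK.rpos, div_eq_mul_inv, div_eq_mul_inv, div_eq_mul_inv]
    calc a * (ENNReal.ofReal rK)⁻¹ = (ENNReal.ofReal rL * (ENNReal.ofReal rL)⁻¹) * (a * (ENNReal.ofReal rK)⁻¹) := by
          rw [ENNReal.mul_inv_cancel hrL ENNReal.ofReal_ne_top, one_mul]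
      _ = _ := by ring
  calc ∫⁻ y, ‖kcomp μ L K z y‖ₑ ∂μ ≤ ∫⁻ y, ∫⁻ x, ‖L z x‖ₑ * ‖K x y - K z y‖ₑ ∂μ ∂μ :=
        lintegral_mono key
    _ = ∫⁻ x, ∫⁻ y, ‖L z x‖ₑ * ‖K x y - K z y‖ₑ ∂μ ∂μ := (lintegral_lintegral_swap m.aemeasurable).symm
    _ = ∫⁻ x, ‖L z x‖ₑ * ∫⁻ y, ‖K x y - K z y‖ₑ ∂μ ∂μ := by
        refine lintegral_congr fun x => ?_
        rw [lintegral_const_mul]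
        exact (hK.meas.of_uncurry_left.sub hK.meas.of_uncurry_left).enorm
    _ ≤ ∫⁻ x, ‖L z x‖ₑ * (A * (ρ z x / ENNReal.ofReal rK)) ∂μ := by
        gcongr with x
        rw [hρ z x]
        exact hK.reg2 x z
    _ = ∫⁻ x, (A * ((rL / rK).toNNReal : ℝ≥0∞)) * (‖L z x‖ₑ * (ρ z x / ENNReal.ofReal rL)) ∂μ := by
        refine lintegral_congr fun x => ?_
        rw [hsc]
        ring
    _ = (A * ((rL / rK).toNNReal : ℝ≥0∞)) * ∫⁻ x, (‖L z x‖ₑ * (ρ z x / ENNReal.ofReal rL)) ∂μ := 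
        lintegral_const_mul' _ _ (ENNReal.mul_ne_top ENNReal.coe_ne_top ENNReal.coe_ne_top)
    _ ≤ (A * ((rL / rK).toNNReal : ℝ≥0∞)) * A := by
        gcongr
        refine le_trans (lintegral_mono fun x => ?_) (hL.size1 z)
        gcongr
        exact le_add_self
    _ = _ := by push_cast; ring

theorem GoodKer.comp_col (hL : GoodKer μ ρ rL A L) (hK : GoodKer μ ρ rK A K) (y : X) :
    ∫⁻ z, ‖kcomp μ L K z y‖ₑ ∂μ ≤ (A * A : ℝ≥0) := by
  have := hK.adj.comp_row hL.adj y
  simpa [kadj_kcomp, kadj] using this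

theorem GoodKer.comp_col_small (hρ : ∀ x y, ρ x y = ρ y x) (hL : GoodKer μ ρ rL A L) (hK : GoodKer μ ρ rK A K) (y : X) :
    ∫⁻ z, ‖kcomp μ L K z y‖ₑ ∂μ ≤ (A * A * (rK / rL).toNNReal : ℝ≥0) := by
  have := hK.adj.comp_row_small hρ hL.adj y
  simpa [kadj_kcomp, kadj] using this

theorem GoodKer.comp_norm_le (hρ : ∀ x y, ρ x y = ρ y x) (hL : GoodKer μ ρ rL A L)
    (hK : GoodKer μ ρ rK A K) :
    ‖hL.schur.clm * hK.schur.clm‖ ≤ A ^ 2 * √(min (rL / rK) (rK / rL)) := by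
  have hm := kcomp_meas (μ := μ) hL.meas hK.meas
  have p1 : 0 ≤ rL / rK := (div_pos hL.rpos hK.rpos).le
  have p2 : 0 ≤ rK / rL := (div_pos hK.rpos hL.rpos).le
  have hA : (0:ℝ) ≤ A := A.2
  rcases le_total (rL / rK) (rK / rL) with h | h
  · have hM : SchurKer μ (kcomp μ L K) _ _ := ⟨hm, hL.comp_row_small hρ hK, hL.comp_col hK⟩
    rw [hL.schur.comp_clm hK.schur hM, min_eq_left h]
    refine hM.norm_clm_le.trans (le_of_eq ?_)
    push_cast
    rw [Real.coe_toNNReal _ p1, show (A:ℝ) * A * (rL / rK) * (A * A) = ((A:ℝ) ^ 2) ^ 2 * (rL / rK) by ring,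
      Real.sqrt_mul (by positivity), Real.sqrt_sq (by positivity)]
  · have hM : SchurKer μ (kcomp μ L K) _ _ := ⟨hm, hL.comp_row hK, hL.comp_col_small hρ hK⟩
    rw [hL.schur.comp_clm hK.schur hM, min_eq_right h]
    refine hM.norm_clm_le.trans (le_of_eq ?_)
    push_cast
    rw [Real.coe_toNNReal _ p2, show (A:ℝ) * A * (A * A * (rK / rL)) = ((A:ℝ) ^ 2) ^ 2 * (rK / rL) by ring,
      Real.sqrt_mul (by positivity), Real.sqrt_sq (by positivity)]

theorem geom_two_sided {q : ℝ} (h0 : 0 < q) (h1 : q < 1) (J i : ℕ) :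
    ∑ j ∈ Finset.range J, q ^ (Nat.dist i j) ≤ 2 / (1 - q) := by
  have hg : ∀ N, ∑ j ∈ Finset.range N, q ^ j ≤ 1 / (1 - q) := by
    intro N
    rw [one_div, ← tsum_geometric_of_lt_one h0.le h1]
    exact (summable_geometric_of_lt_one h0.le h1).sum_le_tsum _ (fun _ _ => by positivity)
  have : ∑ j ∈ Finset.range J, q ^ (Nat.dist i j) ≤
      ∑ j ∈ Finset.range (i + 1 + J), q ^ (Nat.dist i j) :=
    Finset.sum_le_sum_of_subset_of_nonneg (by intro x; simp; omega) (fun _ _ _ => by positivity)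
  refine this.trans ?_
  rw [Finset.sum_range_add, ← Finset.sum_range_reflect]
  have e1 : ∑ j ∈ Finset.range (i + 1), q ^ Nat.dist i (i + 1 - 1 - j) = ∑ j ∈ Finset.range (i + 1), q ^ j := by
    refine Finset.sum_congr rfl fun j hj => ?_
    have : j < i + 1 := by simpa using hj
    congr 1
    simp only [Nat.dist]; omega
  have e2 : ∑ j ∈ Finset.range J, q ^ Nat.dist i (i + 1 + j) ≤ ∑ j ∈ Finset.range J, q ^ j := by
    refine Finset.sum_le_sum fun j _ => pow_le_pow_of_le_one h0.le h1.le ?_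
    simp only [Nat.dist]; omega
  rw [e1]
  have := hg (i + 1)
  have := hg J
  have : 2 / (1 - q) = 1 / (1 - q) + 1 / (1 - q) := by ring
  linarith

/-- an absolute constant -/
def cG : ℝ := 2 / (1 - (2:ℝ) ^ (-(1/4) : ℝ))

theorem cG_pos : 0 < cG := by
  have : (2:ℝ) ^ (-(1/4) : ℝ) < 1 := Real.rpow_lt_one_of_one_lt_of_neg (by norm_num) (by norm_num)
  unfold cG
  exact div_pos two_pos (by linarith)

theorem ao_L2 (hρ : ∀ x y, ρ x y = ρ y x) {R : ℝ} (hA : 0 < A) {J : ℕ} {Kf : ℕ → X → X → ℂ}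
    (h : ∀ j, GoodKer μ ρ (R * (1/2) ^ j) A (Kf j)) :
    ‖∑ j : Fin J, (h j).schur.clm‖ ≤ cG * A := by
  have hA' : (0:ℝ) < A := hA
  have hR : 0 < R := by simpa using (h 0).rpos
  set q : ℝ := (2:ℝ) ^ (-(1/4) : ℝ) with hq
  have hq0 : 0 < q := by positivity
  have hq1 : q < 1 := Real.rpow_lt_one_of_one_lt_of_neg (by norm_num) (by norm_num)
  have hq4 : q ^ 4 = 1 / 2 := by
    rw [hq, ← Real.rpow_natCast, ← Real.rpow_mul (by norm_num)]; norm_num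
  have hpow : ∀ a b : ℕ, a ≤ b → (1/2 : ℝ) ^ b / (1/2) ^ a = (1/2) ^ (b - a) := fun a b hab => by
    rw [div_eq_iff (by positivity), ← pow_add]; congr 1; omega
  have hmin : ∀ i j : ℕ, √(min ((R * (1/2) ^ i) / (R * (1/2) ^ j)) ((R * (1/2) ^ j) / (R * (1/2) ^ i)))
      ≤ (q ^ Nat.dist i j) ^ 2 := by
    intro i j
    apply Real.sqrt_le_iff.2
    refine ⟨by positivity, ?_⟩
    have e : ((q ^ Nat.dist i j) ^ 2) ^ 2 = (1/2 : ℝ) ^ Nat.dist i j := by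
      rw [← hq4]; ring
    rw [e]
    rcases le_total i j with hij | hij
    · refine (min_le_right _ _).trans (le_of_eq ?_)
      rw [mul_div_mul_left _ _ hR.ne', hpow _ _ hij, Nat.dist_eq_sub_of_le hij]
    · refine (min_le_left _ _).trans (le_of_eq ?_)
      rw [mul_div_mul_left _ _ hR.ne', hpow _ _ hij, Nat.dist_eq_sub_of_le_right hij]
  refine cotlar_stein (fun j : Fin J => (h j).schur.clm) (fun i j => A * q ^ (Nat.dist i j)) ?_ ?_ ?_ ?_ ?_
  · intros; positivity
  · exact mul_pos cG_pos hA
  · intro i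
    rw [← Finset.mul_sum, Fin.sum_univ_eq_sum_range (fun j => q ^ Nat.dist i j) J, mul_comm]
    gcongr
    exact geom_two_sided hq0 hq1 J i
  · intro i j
    rw [(h i).schur.star_clm]
    have := (h i).adj.comp_norm_le hρ (h j)
    refine this.trans ?_
    rw [mul_pow]
    gcongr
    exact hmin i j
  · intro i j
    rw [(h j).schur.star_clm]
    have := (h i).comp_norm_le hρ (h j).adj
    refine this.trans ?_
    rw [mul_pow]
    gcongr
    exact hmin i j

end AO
end GR
end

section
open scoped ENNReal NNReal Topology ComplexConjugate
namespace GR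
set_option linter.unusedSectionVars false

section CZ
variable {X : Type*} [MeasurableSpace X] {μ : Measure X} [SFinite μ]

/-- the cell of `x` at generation `j` -/
def cell {ι : Type*} (idx : ℤ → X → ι) (j : ℤ) (i : ι) : Set X := {y | idx j y = i}

/-- A system of dyadic cubes adapted to `ρ`. -/
structure Dyadic {ι : Type*} (μ : Measure X) (ρ : X → X → ℝ≥0∞) (D : ℝ≥0) (idx : ℤ → X → ι) : Prop where
  count : Countable ι
  hD : 1 ≤ D
  meas : ∀ j i, MeasurableSet (cell idx j i)
  mono : ∀ j x y, idx j x = idx j y → idx (j + 1) x = idx (j + 1) y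
  pos : ∀ j x, μ (cell idx j (idx j x)) ≠ 0
  fin : ∀ j x, μ (cell idx j (idx j x)) ≠ ⊤
  doub : ∀ j x, μ (cell idx (j + 1) (idx (j + 1) x)) ≤ D * μ (cell idx j (idx j x))
  tend : ∀ x, Tendsto (fun j => μ (cell idx j (idx j x))) atTop (𝓝 ⊤)
  star : ∀ j x, μ {z | ∃ y, idx j y = idx j x ∧ ρ y z < ENNReal.ofReal ((2:ℝ) ^ j)} ≤
    D * μ (cell idx j (idx j x))
  near : ∀ j x y, idx j x = idx j y → ρ x y ≤ D * ENNReal.ofReal ((2:ℝ) ^ j)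

/-- continuity with respect to `ρ` -/
def RC (ρ : X → X → ℝ≥0∞) (f : X → ℂ) : Prop :=
  ∀ x, ∀ ε > 0, ∃ δ : ℝ≥0∞, 0 < δ ∧ ∀ y, ρ x y < δ → ‖f y - f x‖ < ε

theorem RC.comp {ρ : X → X → ℝ≥0∞} {f : X → ℂ} (h : RC ρ f) {φ : ℂ → ℂ} (hφ : Continuous φ) :
    RC ρ (fun x => φ (f x)) := by
  intro x ε hε
  obtain ⟨η, hη, h1⟩ := Metric.continuous_iff.1 hφ (f x) ε hε
  obtain ⟨δ, hδ, h2⟩ := h x η hη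
  refine ⟨δ, hδ, fun y hy => ?_⟩
  have := h1 (f y) (by simpa [dist_eq_norm] using h2 y hy)
  simpa [dist_eq_norm] using this

/-- nice functions -/
structure Nice (μ : Measure X) (ρ : X → X → ℝ≥0∞) (f : X → ℂ) : Prop where
  meas : Measurable f
  rc : RC ρ f
  bdd : ∃ M : ℝ≥0, ∀ x, ‖f x‖ₑ ≤ M
  int : Integrable f μ

theorem Nice.comp {ρ : X → X → ℝ≥0∞} {f : X → ℂ} (h : Nice μ ρ f) {φ : ℂ → ℂ} (hφ : Continuous φ)
    {c : ℝ≥0} (hc : ∀ x, ‖φ (f x)‖ₑ ≤ c * ‖f x‖ₑ) : Nice μ ρ (fun x => φ (f x)) where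
  meas := hφ.measurable.comp h.meas
  rc := h.rc.comp hφ
  bdd := by
    obtain ⟨M, hM⟩ := h.bdd
    refine ⟨c * M, fun x => (hc x).trans ?_⟩
    push_cast
    gcongr
    exact hM x
  int := by
    refine ⟨(hφ.measurable.comp h.meas).aestronglyMeasurable, ?_⟩
    have h1 : ∫⁻ x, ‖f x‖ₑ ∂μ < ⊤ := h.int.2
    refine (lintegral_mono hc).trans_lt ?_
    rw [lintegral_const_mul _ h.meas.enorm]
    exact ENNReal.mul_lt_top ENNReal.coe_lt_top h1

variable {ι : Type*} {ρ : X → X → ℝ≥0∞} {D : ℝ≥0} {idx : ℤ → X → ι}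

theorem Dyadic.mono' (d : Dyadic μ ρ D idx) {j k : ℤ} (hjk : j ≤ k) {x y : X} (h : idx j x = idx j y) :
    idx k x = idx k y := by
  induction k, hjk using Int.leInduction with
  | base => exact h
  | succ k _ ih => exact d.mono k x y ih

/-- cube `c = (j,i)` is a selected cube for `F` at height `l` -/
def Halt (μ : Measure X) (idx : ℤ → X → ι) (F : X → ℝ≥0∞) (l : ℝ≥0∞) (c : ℤ × ι) : Prop :=
  ∃ x, idx c.1 x = c.2 ∧ l * μ (cell idx c.1 c.2) < ∫⁻ y in cell idx c.1 c.2, F y ∂μ ∧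
    ∀ k, c.1 < k → ∫⁻ y in cell idx k (idx k x), F y ∂μ ≤ l * μ (cell idx k (idx k x))

section Haltping
variable {F : X → ℝ≥0∞} {l : ℝ≥0∞}

theorem Dyadic.halt_disj (d : Dyadic μ ρ D idx) {c c' : ℤ × ι} (h : Halt μ idx F l c)
    (h' : Halt μ idx F l c') {z : X} (hz : z ∈ cell idx c.1 c.2) (hz' : z ∈ cell idx c'.1 c'.2) :
    c = c' := by
  obtain ⟨x, hx, h1, h2⟩ := h
  obtain ⟨x', hx', h1', h2'⟩ := h'
  have hz : idx c.1 z = c.2 := hz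
  have hz' : idx c'.1 z = c'.2 := hz'
  rcases lt_trichotomy c.1 c'.1 with hlt | heq | hgt
  · exfalso
    have e1 : idx c'.1 x = c'.2 := by
      rw [← hz']; exact d.mono' hlt.le (hx.trans hz.symm)
    have := h2 c'.1 hlt
    rw [e1] at this
    exact absurd h1' (not_lt.2 this)
  · refine Prod.ext heq ?_
    rw [← hz, ← hz', heq]
  · exfalso
    have e1 : idx c.1 x' = c.2 := by
      rw [← hz]; exact d.mono' hgt.le (hx'.trans hz'.symm)
    have := h2' c.1 hgt
    rw [e1] at this
    exact absurd h1 (not_lt.2 this)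

theorem Dyadic.halt_exists (d : Dyadic μ ρ D idx) (hl : l ≠ 0) (hF : ∫⁻ x, F x ∂μ ≠ ⊤) {x : X} {j : ℤ}
    (h : l * μ (cell idx j (idx j x)) < ∫⁻ y in cell idx j (idx j x), F y ∂μ) :
    ∃ c, Halt μ idx F l c ∧ x ∈ cell idx c.1 c.2 := by
  have h1 : ∀ᶠ k in atTop, (∫⁻ x, F x ∂μ) / l < μ (cell idx k (idx k x)) :=
    (d.tend x).eventually (lt_mem_nhds (ENNReal.div_lt_top hF hl))
  obtain ⟨b, hb⟩ := eventually_atTop.1 h1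
  obtain ⟨k, hk, hkm⟩ := Int.exists_greatest_of_bdd
    (P := fun j => l * μ (cell idx j (idx j x)) < ∫⁻ y in cell idx j (idx j x), F y ∂μ)
    ⟨b, fun z hz => by
      by_contra hcon
      have h2 := hb z (not_le.1 hcon).le
      have h3 : ∫⁻ x, F x ∂μ < l * μ (cell idx z (idx z x)) := by
        rw [ENNReal.div_lt_iff (Or.inl hl) (Or.inr hF)] at h2
        rwa [mul_comm]
      exact absurd (hz.trans_le (setLIntegral_le_lintegral _ _)) (not_lt.2 h3.le)⟩ ⟨j, h⟩
  refine ⟨(k, idx k x), ⟨x, rfl, hk, fun k' hk' => ?_⟩, rfl⟩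
  by_contra hcon
  exact absurd (hkm k' (not_le.1 hcon)) (not_le.2 hk')

theorem Dyadic.halt_upper (d : Dyadic μ ρ D idx) {c : ℤ × ι} (h : Halt μ idx F l c) :
    ∫⁻ y in cell idx c.1 c.2, F y ∂μ ≤ l * D * μ (cell idx c.1 c.2) := by
  obtain ⟨x, hx, h1, h2⟩ := h
  have h3 : cell idx c.1 c.2 ⊆ cell idx (c.1 + 1) (idx (c.1 + 1) x) := by
    intro z hz
    have hz : idx c.1 z = c.2 := hz
    exact d.mono _ _ _ (hz.trans hx.symm)
  calc _ ≤ ∫⁻ y in cell idx (c.1 + 1) (idx (c.1 + 1) x), F y ∂μ := lintegral_mono_set h3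
    _ ≤ l * μ (cell idx (c.1 + 1) (idx (c.1 + 1) x)) := h2 _ (by omega)
    _ ≤ l * (D * μ (cell idx c.1 (idx c.1 x))) := by gcongr; exact d.doub _ _
    _ = _ := by rw [hx, mul_assoc]

theorem Dyadic.halt_ne (d : Dyadic μ ρ D idx) {c : ℤ × ι} (h : Halt μ idx F l c) :
    μ (cell idx c.1 c.2) ≠ 0 ∧ μ (cell idx c.1 c.2) ≠ ⊤ := by
  obtain ⟨x, hx, -⟩ := h
  rw [← hx]
  exact ⟨d.pos _ _, d.fin _ _⟩

theorem Dyadic.halt_star (d : Dyadic μ ρ D idx) (hl : l ≠ 0) (hl' : l ≠ ⊤) {c : ℤ × ι} (h : Halt μ idx F l c) :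
    μ {z | ∃ y, idx c.1 y = c.2 ∧ ρ y z < ENNReal.ofReal ((2:ℝ) ^ c.1)} ≤
      D / l * ∫⁻ y in cell idx c.1 c.2, F y ∂μ := by
  obtain ⟨x, hx, h1, -⟩ := h
  have := d.star c.1 x
  rw [hx] at this
  refine this.trans ?_
  rw [div_eq_mul_inv, mul_assoc]
  gcongr
  rw [← ENNReal.mul_le_mul_iff_right hl hl', ← mul_assoc, ENNReal.mul_inv_cancel hl hl', one_mul]
  exact h1.le

end Haltping

end CZ
end GR
end

section
open scoped ENNReal NNReal Topology ComplexConjugate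
namespace GR
set_option linter.unusedSectionVars false

section CZ
variable {X : Type*} [MeasurableSpace X] {μ : Measure X} [SFinite μ]
variable {ι : Type*} {ρ : X → X → ℝ≥0∞} {D : ℝ≥0} {idx : ℤ → X → ι}

theorem Dyadic.off_halt (d : Dyadic μ ρ D idx) {f : X → ℂ} (hf : Nice μ ρ f) {l : ℝ≥0∞} (hl : l ≠ 0)
    {x : X} (hx : ∀ c, Halt μ idx (fun x => ‖f x‖ₑ) l c → x ∉ cell idx c.1 c.2) : ‖f x‖ₑ ≤ l := by
  by_contra hcon
  obtain ⟨l', h1, h2⟩ := ENNReal.lt_iff_exists_nnreal_btwn.1 (not_le.1 hcon)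
  have h2' : (l' : ℝ) < ‖f x‖ := by
    have : (l' : ℝ≥0∞) < (‖f x‖₊ : ℝ≥0∞) := h2
    exact_mod_cast this
  obtain ⟨δ, hδ, h3⟩ := hf.rc x (‖f x‖ - l') (by linarith)
  have h4 : Tendsto (fun j : ℕ => (D : ℝ≥0∞) * ENNReal.ofReal ((2:ℝ) ^ (-(j:ℤ)))) atTop (𝓝 0) := by
    have e : Tendsto (fun j : ℕ => ((2:ℝ) ^ (-(j:ℤ)))) atTop (𝓝 0) := by
      have := tendsto_pow_atTop_nhds_zero_of_lt_one (r := (1/2:ℝ)) (by norm_num) (by norm_num)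
      refine this.congr fun j => ?_
      simp
    have := ENNReal.Tendsto.const_mul (a := (D:ℝ≥0∞)) (ENNReal.tendsto_ofReal e) (Or.inr ENNReal.coe_ne_top)
    simpa using this
  obtain ⟨j, hj⟩ := (h4.eventually (gt_mem_nhds hδ)).exists
  have h5 : ∀ y ∈ cell idx (-(j:ℤ)) (idx (-(j:ℤ)) x), (l' : ℝ≥0∞) ≤ ‖f y‖ₑ := by
    intro y hy
    have hy : idx (-(j:ℤ)) y = idx (-(j:ℤ)) x := hy
    have h6 := h3 y ((d.near _ x y hy.symm).trans_lt hj)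
    have h7 := norm_sub_norm_le (f x) (f y)
    rw [norm_sub_rev] at h7
    have h8 : (l' : ℝ) ≤ ‖f y‖ := by linarith
    have : (l' : ℝ≥0∞) ≤ (‖f y‖₊ : ℝ≥0∞) := by exact_mod_cast h8
    exact this
  obtain ⟨c, hc, hxc⟩ := d.halt_exists (F := fun x => ‖f x‖ₑ) hl hf.int.2.ne (x := x) (j := -(j:ℤ)) (by
    calc _ < (l' : ℝ≥0∞) * μ (cell idx (-(j:ℤ)) (idx (-(j:ℤ)) x)) := 
            ENNReal.mul_lt_mul_left (d.pos _ _) (d.fin _ _) h1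
      _ = ∫⁻ y in cell idx (-(j:ℤ)) (idx (-(j:ℤ)) x), l' ∂μ := by simp
      _ ≤ _ := setLIntegral_mono' (d.meas _ _) h5)
  exact hx c hc hxc

/-- exceptional enlargement of a cube -/
def starS (ρ : X → X → ℝ≥0∞) (idx : ℤ → X → ι) (c : ℤ × ι) : Set X :=
  {z | ∃ y, idx c.1 y = c.2 ∧ ρ y z < ENNReal.ofReal ((2:ℝ) ^ c.1)}

theorem Dyadic.cz (d : Dyadic μ ρ D idx) {f : X → ℂ} (hf : Nice μ ρ f) {l : ℝ≥0∞} (hl : l ≠ 0) (hl' : l ≠ ⊤) :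
    ∃ g : X → ℂ, Measurable g ∧ (∀ x, ‖g x‖ₑ ≤ D * l) ∧ ∫⁻ x, ‖g x‖ₑ ∂μ ≤ ∫⁻ x, ‖f x‖ₑ ∂μ ∧
      ∃ S : Set (ℤ × ι), (S.PairwiseDisjoint fun c => cell idx c.1 c.2) ∧
        (∀ c ∈ S, ∃ x, idx c.1 x = c.2) ∧
        (∀ c ∈ S, ∫ y in cell idx c.1 c.2, (f y - g y) ∂μ = 0) ∧
        (∀ x, x ∉ (⋃ c ∈ S, cell idx c.1 c.2) → f x - g x = 0) ∧
        μ (⋃ c ∈ S, starS ρ idx c) ≤ D / l * ∫⁻ x, ‖f x‖ₑ ∂μ := by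
  classical
  have := d.count
  set S : Set (ℤ × ι) := {c | Halt μ idx (fun x => ‖f x‖ₑ) l c} with hS
  have hSc : S.Countable := Set.to_countable S
  have hdis : S.PairwiseDisjoint fun c => cell idx c.1 c.2 := by
    intro c hc c' hc' hne
    refine Set.disjoint_left.2 fun z hz hz' => hne (d.halt_disj hc hc' hz hz')
  let _ : MeasurableSpace (Option (ℤ × ι)) := ⊤
  let ci : X → Option (ℤ × ι) := fun x =>
    if h : ∃ c, c ∈ S ∧ x ∈ cell idx c.1 c.2 then some h.choose else none
  have hci : ∀ c ∈ S, ∀ x ∈ cell idx c.1 c.2, ci x = some c := by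
    intro c hc x hx
    have h : ∃ c, c ∈ S ∧ x ∈ cell idx c.1 c.2 := ⟨c, hc, hx⟩
    simp only [ci, dif_pos h]
    congr 1
    exact d.halt_disj h.choose_spec.1 hc h.choose_spec.2 hx
  have hcin : ∀ x, x ∉ (⋃ c ∈ S, cell idx c.1 c.2) → ci x = none := by
    intro x hx
    have h : ¬ ∃ c, c ∈ S ∧ x ∈ cell idx c.1 c.2 := by simpa using hx
    simp only [ci, dif_neg h]
  have hcis : ∀ x c, ci x = some c → c ∈ S ∧ x ∈ cell idx c.1 c.2 := by
    intro x c hx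
    by_cases h : ∃ c, c ∈ S ∧ x ∈ cell idx c.1 c.2
    · simp only [ci, dif_pos h] at hx
      have := h.choose_spec
      rw [Option.some.inj hx] at this
      exact this
    · simp only [ci, dif_neg h] at hx
      exact absurd hx (by simp)
  have hsome : ∀ c, MeasurableSet (ci ⁻¹' {some c}) := by
    intro c
    by_cases hc : c ∈ S
    · convert d.meas c.1 c.2 using 1
      ext x
      constructor
      · intro h; exact (hcis x c h).2
      · intro h; exact hci c hc x h
    · convert MeasurableSet.empty using 1
      ext x
      constructor
      · intro h; exact hc (hcis x c h).1
      · intro h; exact h.elim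
  have hcm : Measurable ci := by
    refine measurable_to_countable' fun o => ?_
    cases o with
    | some c => exact hsome c
    | none =>
      have : ci ⁻¹' {none} = (⋃ c, ci ⁻¹' {some c})ᶜ := by
        ext x
        simp only [mem_preimage, mem_singleton_iff, mem_compl_iff, mem_iUnion, not_exists]
        cases h : ci x with
        | none => simp
        | some c => simp
      rw [this]
      exact (MeasurableSet.iUnion hsome).compl
  let av : Option (ℤ × ι) → ℂ := fun o => match o with
    | none => 0
    | some c => ⨍ y in cell idx c.1 c.2, f y ∂μ
  have hfi := hf.int
  have havn : ∀ c ∈ S, ‖av (some c)‖ₑ * μ (cell idx c.1 c.2) ≤ ∫⁻ y in cell idx c.1 c.2, ‖f y‖ₑ ∂μ := by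
    intro c hc
    obtain ⟨n0, nt⟩ := d.halt_ne hc
    simp only [av, setAverage_eq]
    rw [enorm_smul]
    have h1 : ‖(μ.real (cell idx c.1 c.2))⁻¹‖ₑ = (μ (cell idx c.1 c.2))⁻¹ := by
      rw [Real.enorm_eq_ofReal (by positivity), Measure.real, ENNReal.ofReal_inv_of_pos (ENNReal.toReal_pos n0 nt)]
      simp [nt]
    rw [h1]
    calc _ = (μ (cell idx c.1 c.2))⁻¹ * μ (cell idx c.1 c.2) * ‖∫ y in cell idx c.1 c.2, f y ∂μ‖ₑ := by ring
      _ = ‖∫ y in cell idx c.1 c.2, f y ∂μ‖ₑ := by rw [ENNReal.inv_mul_cancel n0 nt, one_mul]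
      _ ≤ _ := enorm_integral_le_lintegral_enorm _
  let g : X → ℂ := fun x => if ci x = none then f x else av (ci x)
  have hg1 : ∀ c ∈ S, ∀ x ∈ cell idx c.1 c.2, g x = av (some c) := by
    intro c hc x hx
    simp [g, hci c hc x hx]
  have hg2 : ∀ x, x ∉ (⋃ c ∈ S, cell idx c.1 c.2) → g x = f x := by
    intro x hx
    simp [g, hcin x hx]
  have hgm : Measurable g := by
    refine Measurable.ite (hcm (MeasurableSpace.measurableSet_top (s := {none}))) hf.meas ?_
    exact (measurable_from_top (f := av)).comp hcm
  have hΩ : MeasurableSet (⋃ c ∈ S, cell idx c.1 c.2) := .biUnion hSc fun c _ => d.meas _ _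
  refine ⟨g, hgm, ?_, ?_, S, hdis, ?_, ?_, ?_, ?_⟩
  · intro x
    by_cases hx : x ∈ (⋃ c ∈ S, cell idx c.1 c.2)
    · obtain ⟨c, hc, hxc⟩ := mem_iUnion₂.1 hx
      rw [hg1 c hc x hxc]
      obtain ⟨n0, nt⟩ := d.halt_ne hc
      rw [← ENNReal.mul_le_mul_iff_left n0 nt]
      refine (havn c hc).trans ((d.halt_upper hc).trans (le_of_eq (by ring)))
    · rw [hg2 x hx]
      have h1 : ‖f x‖ₑ ≤ l := d.off_halt hf hl fun c hc hxc => hx (mem_iUnion₂.2 ⟨c, hc, hxc⟩)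
      refine h1.trans ?_
      calc l = 1 * l := (one_mul l).symm
        _ ≤ _ := by gcongr; exact_mod_cast d.hD
  · rw [← lintegral_add_compl (fun x => ‖g x‖ₑ) hΩ, ← lintegral_add_compl (fun x => ‖f x‖ₑ) hΩ]
    gcongr ?_ + ?_
    · rw [lintegral_biUnion hSc (fun c _ => d.meas _ _) hdis, lintegral_biUnion hSc (fun c _ => d.meas _ _) hdis]
      refine ENNReal.tsum_le_tsum fun c => ?_
      refine le_trans (le_of_eq ?_) (havn c c.2)
      rw [setLIntegral_congr_fun (d.meas _ _) (g := fun _ => ‖av (some c)‖ₑ) (fun x hx => by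
        rw [hg1 c c.2 x hx])]
      simp
    · refine le_of_eq (setLIntegral_congr_fun hΩ.compl fun x hx => ?_)
      simp only [hg2 x hx]
  · rintro c ⟨x, hx, -⟩
    exact ⟨x, hx⟩
  · intro c hc
    obtain ⟨n0, nt⟩ := d.halt_ne hc
    rw [setIntegral_congr_fun (d.meas _ _) (g := fun y => f y - av (some c)) (fun x hx => by
        simp only [hg1 c hc x hx])]
    have _ : IsFiniteMeasure (μ.restrict (cell idx c.1 c.2)) := ⟨by simpa using nt.lt_top⟩
    rw [integral_sub hfi.integrableOn (integrable_const _)]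
    simp only [integral_const, av, setAverage_eq]
    rw [← mul_smul]
    have : μ.real (cell idx c.1 c.2) ≠ 0 := (ENNReal.toReal_pos n0 nt).ne'
    simp [measureReal_restrict_apply_univ, mul_inv_cancel₀ this]
  · intro x hx
    rw [hg2 x hx, sub_self]
  · refine (measure_biUnion_le μ hSc _).trans ?_
    calc ∑' c : S, μ (starS ρ idx c) ≤ ∑' c : S, D / l * ∫⁻ y in cell idx c.1.1 c.1.2, ‖f y‖ₑ ∂μ :=
          ENNReal.tsum_le_tsum fun c => d.halt_star hl hl' c.2
      _ = D / l * ∑' c : S, ∫⁻ y in cell idx c.1.1 c.1.2, ‖f y‖ₑ ∂μ := ENNReal.tsum_mul_left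
      _ = D / l * ∫⁻ y in (⋃ c ∈ S, cell idx c.1 c.2), ‖f y‖ₑ ∂μ := by
          rw [lintegral_biUnion hSc (fun c _ => d.meas _ _) hdis]
      _ ≤ _ := by
          gcongr
          exact Measure.restrict_le_self

theorem weak_type (d : Dyadic μ ρ D idx) {K : X → X → ℂ} {A B : ℝ≥0} (hK : SchurKer μ K A B) {B2 H : ℝ≥0}
    (hL2 : ∀ f : X → ℂ, MemLp f 2 μ → ∫⁻ x, ‖IntOp μ K f x‖ₑ ^ 2 ∂μ ≤ B2 * ∫⁻ x, ‖f x‖ₑ ^ 2 ∂μ)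
    (hH : ∀ j y y0, idx j y = idx j y0 →
      ∫⁻ x in (starS ρ idx (j, idx j y0))ᶜ, ‖K x y - K x y0‖ₑ ∂μ ≤ H)
    {f : X → ℂ} (hf : Nice μ ρ f) {l : ℝ≥0∞} (hl : l ≠ 0) (hl' : l ≠ ⊤) :
    μ {x | 2 * l < ‖IntOp μ K f x‖ₑ} ≤ (B2 * D + D + 2 * H : ℝ≥0) / l * ∫⁻ x, ‖f x‖ₑ ∂μ := by
  obtain ⟨g, hgm, hgb, hg1, S, hdis, hne, hcan, hoff, hstar⟩ := d.cz hf hl hl'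
  have := d.count
  have hSc : S.Countable := Set.to_countable S
  have hfi : ∫⁻ x, ‖f x‖ₑ ∂μ < ⊤ := hf.int.2
  have hgi : Integrable g μ := ⟨hgm.aestronglyMeasurable, hg1.trans_lt hfi⟩
  obtain ⟨M, hM⟩ := hf.bdd
  have hDl : (D : ℝ≥0∞) * l ≠ ⊤ := ENNReal.mul_ne_top ENNReal.coe_ne_top hl'
  have hKi : ∀ x (h : X → ℂ), Measurable h → (∃ M : ℝ≥0∞, M ≠ ⊤ ∧ ∀ y, ‖h y‖ₑ ≤ M) →
      Integrable (fun y => K x y * h y) μ := by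
    rintro x h hm ⟨M, hM, hb⟩
    refine ⟨(hK.meas.of_uncurry_left.mul hm).aestronglyMeasurable, ?_⟩
    rw [HasFiniteIntegral]
    calc ∫⁻ y, ‖K x y * h y‖ₑ ∂μ ≤ ∫⁻ y, ‖K x y‖ₑ * M ∂μ := by
          refine lintegral_mono fun y => ?_
          rw [enorm_mul]
          gcongr
          exact hb y
      _ = (∫⁻ y, ‖K x y‖ₑ ∂μ) * M := lintegral_mul_const _ hK.meas.of_uncurry_left.enorm
      _ < ⊤ := ENNReal.mul_lt_top ((hK.row x).trans_lt ENNReal.coe_lt_top) hM.lt_top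
  set b : X → ℂ := fun y => f y - g y with hb
  have hbm : Measurable b := hf.meas.sub hgm
  have hbi : Integrable b μ := hf.int.sub hgi
  have hb1 : ∫⁻ x, ‖b x‖ₑ ∂μ ≤ 2 * ∫⁻ x, ‖f x‖ₑ ∂μ := by
    calc ∫⁻ x, ‖b x‖ₑ ∂μ ≤ ∫⁻ x, (‖f x‖ₑ + ‖g x‖ₑ) ∂μ := lintegral_mono fun x => enorm_sub_le
      _ = ∫⁻ x, ‖f x‖ₑ ∂μ + ∫⁻ x, ‖g x‖ₑ ∂μ := lintegral_add_left hf.meas.enorm _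
      _ ≤ _ := by rw [two_mul]; gcongr
  have hKg : ∀ x, Integrable (fun y => K x y * g y) μ := fun x => hKi x g hgm ⟨_, hDl, hgb⟩
  have hKf : ∀ x, Integrable (fun y => K x y * f y) μ := fun x => hKi x f hf.meas ⟨_, ENNReal.coe_ne_top, hM⟩
  have hKb : ∀ x, Integrable (fun y => K x y * b y) μ := fun x => by
    have := (hKf x).sub (hKg x)
    refine this.congr (Eventually.of_forall fun y => ?_)
    simp [hb, mul_sub]
  have hsplit : ∀ x, IntOp μ K f x = IntOp μ K g x + IntOp μ K b x := by
    intro x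
    simp only [IntOp]
    rw [← integral_add (hKg x) (hKb x)]
    refine integral_congr_ae (Eventually.of_forall fun y => ?_)
    simp only [hb]; ring
  -- the good part
  have hgood : μ {x | l < ‖IntOp μ K g x‖ₑ} ≤ (B2 * D : ℝ≥0) / l * ∫⁻ x, ‖f x‖ₑ ∂μ := by
    have hg2 : ∫⁻ x, ‖g x‖ₑ ^ 2 ∂μ ≤ D * l * ∫⁻ x, ‖f x‖ₑ ∂μ := by
      calc ∫⁻ x, ‖g x‖ₑ ^ 2 ∂μ ≤ ∫⁻ x, D * l * ‖g x‖ₑ ∂μ := by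
            refine lintegral_mono fun x => ?_
            rw [pow_two]
            gcongr
            exact hgb x
        _ = D * l * ∫⁻ x, ‖g x‖ₑ ∂μ := lintegral_const_mul _ hgm.enorm
        _ ≤ _ := by gcongr
    have hgL : MemLp g 2 μ := by
      refine ⟨hgm.aestronglyMeasurable, ?_⟩
      rw [eLpNorm_lt_top_iff_lintegral_rpow_enorm_lt_top (by norm_num) (by norm_num)]
      simp only [ENNReal.toReal_ofNat, ENNReal.rpow_ofNat]
      exact hg2.trans_lt (ENNReal.mul_lt_top hDl.lt_top hfi)
    have h1 := hL2 g hgL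
    have h2 : l ^ 2 * μ {x | l < ‖IntOp μ K g x‖ₑ} ≤ ∫⁻ x, ‖IntOp μ K g x‖ₑ ^ 2 ∂μ := by
      refine le_trans ?_ (mul_meas_ge_le_lintegral
        ((hK.stronglyMeasurable_IntOp hgm).measurable.enorm.pow_const 2) (l ^ 2))
      gcongr with x
      intro h
      exact pow_le_pow_left₀ (zero_le) h.le 2
    have hl2 : l ^ 2 ≠ 0 := pow_ne_zero 2 hl
    have hl2' : l ^ 2 ≠ ⊤ := ENNReal.pow_ne_top hl'
    rw [← ENNReal.mul_le_mul_iff_right hl2 hl2']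
    refine h2.trans (h1.trans ?_)
    calc (B2 : ℝ≥0∞) * ∫⁻ x, ‖g x‖ₑ ^ 2 ∂μ ≤ B2 * (D * l * ∫⁻ x, ‖f x‖ₑ ∂μ) := by gcongr
      _ = B2 * (D * l * ∫⁻ x, ‖f x‖ₑ ∂μ) * (l * l⁻¹) := by rw [ENNReal.mul_inv_cancel hl hl', mul_one]
      _ = _ := by push_cast; rw [div_eq_mul_inv]; ring
  -- the bad part
  set Os : Set X := ⋃ c ∈ S, starS ρ idx c with hOs
  have hbad1 : ∀ x, ‖IntOp μ K b x‖ₑ ≤ ∑' c : S, ∫⁻ y in cell idx c.1.1 c.1.2,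
      ‖K x y - K x (hne c.1 c.2).choose‖ₑ * ‖b y‖ₑ ∂μ := by
    intro x
    have e1 : IntOp μ K b x = ∫ y in (⋃ c ∈ S, cell idx c.1 c.2), K x y * b y ∂μ := by
      rw [setIntegral_eq_integral_of_forall_compl_eq_zero]
      · rfl
      · intro y hy
        simp only [hb, hoff y hy, mul_zero]
    rw [e1, Set.biUnion_eq_iUnion]
    have : Countable S := hSc.to_subtype
    rw [integral_iUnion (ι := S) (s := fun c : S => cell idx c.1.1 c.1.2) (fun c => d.meas _ _) (fun (c c' : S) hcc => hdis c.2 c'.2 (fun h => hcc (Subtype.ext h)))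
      (hKb x).integrableOn]
    refine (enorm_tsum_le_tsum_enorm).trans (ENNReal.tsum_le_tsum fun c => ?_)
    have e2 : ∫ y in cell idx c.1.1 c.1.2, K x y * b y ∂μ =
        ∫ y in cell idx c.1.1 c.1.2, (K x y - K x (hne c.1 c.2).choose) * b y ∂μ := by
      simp_rw [sub_mul]
      rw [integral_sub (hKb x).integrableOn (hbi.const_mul _).integrableOn, integral_const_mul, hcan c.1 c.2]
      simp
    rw [e2]
    refine (enorm_integral_le_lintegral_enorm _).trans (le_of_eq ?_)
    simp_rw [enorm_mul]
  have hbad2 : ∫⁻ x in Osᶜ, ‖IntOp μ K b x‖ₑ ∂μ ≤ H * (2 * ∫⁻ x, ‖f x‖ₑ ∂μ) := by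
    have mm : ∀ x0, Measurable (Function.uncurry fun x y => ‖K x y - K x x0‖ₑ * ‖b y‖ₑ) := by
      intro x0
      refine (Measurable.enorm ?_).mul (hbm.enorm.comp measurable_snd)
      exact hK.meas.sub ((hK.meas.of_uncurry_right (y := x0)).comp measurable_fst)
    calc ∫⁻ x in Osᶜ, ‖IntOp μ K b x‖ₑ ∂μ ≤ ∫⁻ x in Osᶜ, ∑' c : S, ∫⁻ y in cell idx c.1.1 c.1.2,
          ‖K x y - K x (hne c.1 c.2).choose‖ₑ * ‖b y‖ₑ ∂μ ∂μ := lintegral_mono hbad1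
      _ = ∑' c : S, ∫⁻ x in Osᶜ, ∫⁻ y in cell idx c.1.1 c.1.2,
          ‖K x y - K x (hne c.1 c.2).choose‖ₑ * ‖b y‖ₑ ∂μ ∂μ := by
          have : Countable S := hSc.to_subtype
          refine lintegral_tsum fun c => ?_
          exact (Measurable.lintegral_prod_right (mm _)).aemeasurable
      _ ≤ ∑' c : S, ∫⁻ y in cell idx c.1.1 c.1.2, H * ‖b y‖ₑ ∂μ := by
          refine ENNReal.tsum_le_tsum fun c => ?_
          rw [lintegral_lintegral_swap (mm _).aemeasurable]
          refine setLIntegral_mono' (d.meas _ _) fun y hy => ?_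
          rw [lintegral_mul_const]
          · gcongr
            have hx := (hne c.1 c.2).choose_spec
            have hy : idx c.1.1 y = c.1.2 := hy
            refine le_trans (lintegral_mono_set ?_) (hH c.1.1 y (hne c.1 c.2).choose (hy.trans hx.symm))
            refine compl_subset_compl.2 ?_
            rw [hx]
            exact Set.subset_biUnion_of_mem (u := fun c => starS ρ idx c) c.2
          · exact (hK.meas.of_uncurry_right.sub hK.meas.of_uncurry_right).enorm
      _ = ∫⁻ y in (⋃ c ∈ S, cell idx c.1 c.2), H * ‖b y‖ₑ ∂μ := by
          rw [lintegral_biUnion hSc (fun c _ => d.meas _ _) hdis]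
      _ ≤ ∫⁻ y, H * ‖b y‖ₑ ∂μ := setLIntegral_le_lintegral _ _
      _ = H * ∫⁻ y, ‖b y‖ₑ ∂μ := lintegral_const_mul _ hbm.enorm
      _ ≤ _ := by gcongr
  have hbad : μ ({x | l < ‖IntOp μ K b x‖ₑ} ∩ Osᶜ) ≤ (2 * H : ℝ≥0) / l * ∫⁻ x, ‖f x‖ₑ ∂μ := by
    have mb := (hK.stronglyMeasurable_IntOp hbm).measurable.enorm
    rw [← Measure.restrict_apply (measurableSet_lt measurable_const mb)]
    rw [← ENNReal.mul_le_mul_iff_right hl hl']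
    calc l * (μ.restrict Osᶜ) {x | l < ‖IntOp μ K b x‖ₑ} ≤ ∫⁻ x in Osᶜ, ‖IntOp μ K b x‖ₑ ∂μ := by
          refine le_trans ?_ (mul_meas_ge_le_lintegral mb l)
          gcongr with x
          intro h; exact h.le
      _ ≤ _ := hbad2
      _ = H * (2 * ∫⁻ x, ‖f x‖ₑ ∂μ) * (l * l⁻¹) := by rw [ENNReal.mul_inv_cancel hl hl', mul_one]
      _ = _ := by push_cast; rw [div_eq_mul_inv]; ring
  calc μ {x | 2 * l < ‖IntOp μ K f x‖ₑ}
      ≤ μ ({x | l < ‖IntOp μ K g x‖ₑ} ∪ (Os ∪ ({x | l < ‖IntOp μ K b x‖ₑ} ∩ Osᶜ))) := by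
        refine measure_mono fun x hx => ?_
        by_contra hcon
        simp only [mem_union, mem_setOf_eq, not_or, not_lt, mem_inter_iff, mem_compl_iff, not_and, not_not] at hcon
        obtain ⟨h1, h2, h3⟩ := hcon
        have h4 : ‖IntOp μ K b x‖ₑ ≤ l := by
          by_contra h; exact h2 (h3 (not_le.1 h))
        have hx : 2 * l < ‖IntOp μ K f x‖ₑ := hx
        rw [hsplit x] at hx
        have := (enorm_add_le (IntOp μ K g x) (IntOp μ K b x)).trans (add_le_add h1 h4)
        rw [← two_mul] at this
        exact absurd hx (not_lt.2 this)
    _ ≤ μ {x | l < ‖IntOp μ K g x‖ₑ} + (μ Os + μ ({x | l < ‖IntOp μ K b x‖ₑ} ∩ Osᶜ)) :=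
        (measure_union_le _ _).trans (by gcongr; exact measure_union_le _ _)
    _ ≤ (B2 * D : ℝ≥0) / l * ∫⁻ x, ‖f x‖ₑ ∂μ + (D / l * ∫⁻ x, ‖f x‖ₑ ∂μ + (2 * H : ℝ≥0) / l * ∫⁻ x, ‖f x‖ₑ ∂μ) := by
        gcongr
    _ = _ := by
        push_cast
        simp only [div_eq_mul_inv]
        ring

end CZ
end GR
end

section
open scoped ENNReal NNReal Topology ComplexConjugate
namespace GR
set_option linter.unusedSectionVars false

theorem lint_Ioc_rpow {s a : ℝ} (hs : 0 < s) (ha : -1 < a) :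
    ∫⁻ t in Ioc 0 s, ENNReal.ofReal (t ^ a) = ENNReal.ofReal (s ^ (a + 1) / (a + 1)) := by
  have h := intervalIntegral.intervalIntegrable_rpow' (a := 0) (b := s) ha
  rw [intervalIntegrable_iff_integrableOn_Ioc_of_le hs.le] at h
  rw [← ofReal_integral_eq_lintegral_ofReal h, ← intervalIntegral.integral_of_le hs.le,
    integral_rpow (Or.inl ha), Real.zero_rpow (by linarith), sub_zero]
  refine (ae_restrict_mem measurableSet_Ioc).mono fun t ht => ?_
  exact Real.rpow_nonneg ht.1.le _

theorem lint_Ioi_rpow {s a : ℝ} (hs : 0 < s) (ha : a < -1) :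
    ∫⁻ t in Ioi s, ENNReal.ofReal (t ^ a) = ENNReal.ofReal (s ^ (a + 1) / (-(a + 1))) := by
  have h := integrableOn_Ioi_rpow_of_lt ha hs
  rw [← ofReal_integral_eq_lintegral_ofReal h, integral_Ioi_rpow_of_lt ha hs]
  · congr 1; rw [div_neg, neg_div]
  refine (ae_restrict_mem measurableSet_Ioi).mono fun t ht => ?_
  exact Real.rpow_nonneg (hs.trans ht).le _

theorem marc_inner {p s : ℝ} (hp : 1 < p) (hp2 : p < 2) (hs : 0 ≤ s) (b w : ℝ≥0∞) :
    ∫⁻ t in Ioi 0, (b * ENNReal.ofReal (t ^ (p - 3)) * ENNReal.ofReal (min s t) ^ 2 +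
      w * ENNReal.ofReal (t ^ (p - 2)) * ENNReal.ofReal (s - t)) ≤
      (b * ENNReal.ofReal (1 / p + 1 / (2 - p)) + w * ENNReal.ofReal (1 / (p - 1))) *
        ENNReal.ofReal (s ^ p) := by
  rcases hs.eq_or_lt with rfl | hs
  · rw [setLIntegral_congr_fun (g := fun _ => 0) measurableSet_Ioi]
    · simp
    · intro t ht
      have ht : (0:ℝ) < t := ht
      simp [min_eq_left ht.le, ENNReal.ofReal_of_nonpos (neg_nonpos.2 ht.le)]
  · have hu : Ioi (0:ℝ) = Ioc 0 s ∪ Ioi s := (Ioc_union_Ioi_eq_Ioi hs.le).symm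
    rw [hu]
    refine (lintegral_union_le _ _ _).trans ?_
    have h1 : ∫⁻ t in Ioc 0 s, (b * ENNReal.ofReal (t ^ (p - 3)) * ENNReal.ofReal (min s t) ^ 2 +
      w * ENNReal.ofReal (t ^ (p - 2)) * ENNReal.ofReal (s - t)) ≤
      ∫⁻ t in Ioc 0 s, (b * ENNReal.ofReal (t ^ (p - 1)) + w * ENNReal.ofReal s * ENNReal.ofReal (t ^ (p - 2))) := by
      refine setLIntegral_mono' measurableSet_Ioc fun t ht => ?_
      gcongr ?_ + ?_
      · rw [mul_assoc, min_eq_right ht.2, ← ENNReal.ofReal_pow ht.1.le, ← ENNReal.ofReal_mul (Real.rpow_nonneg ht.1.le _),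
          ← Real.rpow_natCast, ← Real.rpow_add ht.1]
        norm_num
        ring_nf; rfl
      · rw [mul_right_comm]
        gcongr
        linarith [ht.1]
    have h2 : ∫⁻ t in Ioi s, (b * ENNReal.ofReal (t ^ (p - 3)) * ENNReal.ofReal (min s t) ^ 2 +
      w * ENNReal.ofReal (t ^ (p - 2)) * ENNReal.ofReal (s - t)) =
      ∫⁻ t in Ioi s, b * ENNReal.ofReal s ^ 2 * ENNReal.ofReal (t ^ (p - 3)) := by
      refine setLIntegral_congr_fun measurableSet_Ioi fun t ht => ?_
      have ht : s < t := ht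
      simp only [min_eq_left ht.le]
      rw [ENNReal.ofReal_of_nonpos (by linarith : s - t ≤ 0), mul_zero, add_zero]
      ring
    have m : ∀ a : ℝ, Measurable fun t : ℝ => ENNReal.ofReal (t ^ a) := fun a => by fun_prop
    rw [h2, lintegral_const_mul _ (m _), lint_Ioi_rpow hs (by linarith)]
    refine (add_le_add_left h1 _).trans (le_of_eq ?_)
    rw [lintegral_add_left ((m _).const_mul _), lintegral_const_mul _ (m _), lintegral_const_mul _ (m _),
      lint_Ioc_rpow hs (by linarith), lint_Ioc_rpow hs (by linarith)]
    have e1 : s ^ (p - 1 + 1) / (p - 1 + 1) = 1 / p * s ^ p := by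
      rw [sub_add_cancel]; ring
    have e2 : ENNReal.ofReal s * ENNReal.ofReal (s ^ (p - 2 + 1) / (p - 2 + 1)) =
        ENNReal.ofReal (1 / (p - 1)) * ENNReal.ofReal (s ^ p) := by
      rw [← ENNReal.ofReal_mul hs.le, ← ENNReal.ofReal_mul (by
        have : 0 < p - 1 := by linarith
        positivity)]
      congr 1
      have : s ^ p = s * s ^ (p - 1) := by
        rw [← Real.rpow_one_add' hs.le (by linarith)]; congr 1; ring
      rw [this, show p - 2 + 1 = p - 1 by ring]; ring
    have e3 : ENNReal.ofReal s ^ 2 * ENNReal.ofReal (s ^ (p - 3 + 1) / (-(p - 3 + 1))) =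
        ENNReal.ofReal (1 / (2 - p)) * ENNReal.ofReal (s ^ p) := by
      rw [← ENNReal.ofReal_pow hs.le, ← ENNReal.ofReal_mul (by positivity), ← ENNReal.ofReal_mul (by
        have : 0 < 2 - p := by linarith
        positivity)]
      congr 1
      have : s ^ p = s ^ 2 * s ^ (p - 2) := by
        rw [← Real.rpow_natCast, ← Real.rpow_add hs]; congr 1; push_cast; ring
      rw [this, show -(p - 3 + 1) = 2 - p by ring, show p - 3 + 1 = p - 2 by ring]; ring
    rw [e1, mul_assoc w, e2, mul_assoc b, e3, ENNReal.ofReal_mul (by positivity),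
      ENNReal.ofReal_add (by positivity) (by
        have : 0 < 2 - p := by linarith
        positivity)]
    ring

/-- soft truncation -/
def trunc (t : ℝ) (z : ℂ) : ℂ := ((t / max t ‖z‖ : ℝ) : ℂ) * z

theorem trunc_cont {t : ℝ} (ht : 0 < t) : Continuous (trunc t) := by
  unfold trunc
  refine Continuous.mul (Complex.continuous_ofReal.comp ?_) continuous_id
  refine continuous_const.div (continuous_const.max continuous_norm) fun z => ?_
  exact (lt_of_lt_of_le ht (le_max_left _ _)).ne'

theorem trunc_norm {t : ℝ} (ht : 0 < t) (z : ℂ) : ‖trunc t z‖ = min ‖z‖ t := by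
  have hz := norm_nonneg z
  unfold trunc
  rw [norm_mul, Complex.norm_real, Real.norm_of_nonneg (by positivity)]
  rcases le_total t ‖z‖ with h | h
  · rw [max_eq_right h, min_eq_right h, div_mul_cancel₀]
    exact (ht.trans_le h).ne'
  · rw [max_eq_left h, min_eq_left h, div_self ht.ne', one_mul]

theorem sub_trunc_norm {t : ℝ} (ht : 0 < t) (z : ℂ) : ‖z - trunc t z‖ₑ = ENNReal.ofReal (‖z‖ - t) := by
  have hz := norm_nonneg z
  rw [← ofReal_norm]
  unfold trunc
  rcases le_total t ‖z‖ with h | h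
  · have hz0 : 0 < ‖z‖ := ht.trans_le h
    have : z - ((t / max t ‖z‖ : ℝ) : ℂ) * z = ((1 - t / ‖z‖ : ℝ) : ℂ) * z := by
      rw [max_eq_right h]; push_cast; ring
    rw [this, norm_mul, Complex.norm_real, Real.norm_of_nonneg]
    · congr 1; field_simp
    · rw [sub_nonneg, div_le_one hz0]; exact h
  · rw [max_eq_left h, div_self ht.ne', Complex.ofReal_one, one_mul, sub_self, norm_zero,
      ENNReal.ofReal_of_nonpos (by linarith : ‖z‖ - t ≤ 0)]; simp

section CZ
variable {X : Type*} [MeasurableSpace X] {μ : Measure X} [SFinite μ] {ρ : X → X → ℝ≥0∞}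

theorem Nice.row_int {K : X → X → ℂ} {A B : ℝ≥0} (hK : SchurKer μ K A B) {f : X → ℂ} (hf : Nice μ ρ f) (x : X) :
    Integrable (fun y => K x y * f y) μ := by
  obtain ⟨M, hM⟩ := hf.bdd
  refine ⟨(hK.meas.of_uncurry_left.mul hf.meas).aestronglyMeasurable, ?_⟩
  rw [HasFiniteIntegral]
  calc ∫⁻ y, ‖K x y * f y‖ₑ ∂μ ≤ ∫⁻ y, ‖K x y‖ₑ * M ∂μ := by
        refine lintegral_mono fun y => ?_
        rw [enorm_mul]
        gcongr
        exact hM y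
    _ = (∫⁻ y, ‖K x y‖ₑ ∂μ) * M := lintegral_mul_const _ hK.meas.of_uncurry_left.enorm
    _ < ⊤ := ENNReal.mul_lt_top ((hK.row x).trans_lt ENNReal.coe_lt_top) ENNReal.coe_lt_top

theorem Nice.lint_lt_top {f : X → ℂ} (hf : Nice μ ρ f) {p : ℝ} (hp : 1 ≤ p) :
    ∫⁻ x, ‖f x‖ₑ ^ p ∂μ < ⊤ := by
  obtain ⟨M, hM⟩ := hf.bdd
  calc ∫⁻ x, ‖f x‖ₑ ^ p ∂μ ≤ ∫⁻ x, (M:ℝ≥0∞) ^ (p - 1) * ‖f x‖ₑ ∂μ := by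
        refine lintegral_mono fun x => ?_
        calc ‖f x‖ₑ ^ p = ‖f x‖ₑ ^ ((p - 1) + 1) := by congr 1; ring
          _ = ‖f x‖ₑ ^ (p - 1) * ‖f x‖ₑ := by
            rw [ENNReal.rpow_add_of_nonneg _ _ (by linarith) (by linarith), ENNReal.rpow_one]
          _ ≤ _ := by
            gcongr
            exact hM x
    _ = (M:ℝ≥0∞) ^ (p - 1) * ∫⁻ x, ‖f x‖ₑ ∂μ := lintegral_const_mul _ hf.meas.enorm
    _ < ⊤ := ENNReal.mul_lt_top (ENNReal.rpow_lt_top_of_nonneg (by linarith) ENNReal.coe_ne_top) hf.int.2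

theorem Nice.memLp {f : X → ℂ} (hf : Nice μ ρ f) {p : ℝ} (hp : 1 ≤ p) : MemLp f (ENNReal.ofReal p) μ := by
  refine ⟨hf.meas.aestronglyMeasurable, ?_⟩
  have h := hf.lint_lt_top hp
  have hp0 : 0 < p := by linarith
  rw [← eLpNorm_rpow hp0] at h
  exact (ENNReal.rpow_lt_top_iff_of_pos hp0).1 h

theorem marcinkiewicz {K : X → X → ℂ} {A B : ℝ≥0} (hK : SchurKer μ K A B) {B2 W : ℝ≥0}
    (hL2 : ∀ f : X → ℂ, MemLp f 2 μ → ∫⁻ x, ‖IntOp μ K f x‖ₑ ^ 2 ∂μ ≤ B2 * ∫⁻ x, ‖f x‖ₑ ^ 2 ∂μ)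
    (hW : ∀ f : X → ℂ, Nice μ ρ f → ∀ l : ℝ≥0∞, l ≠ 0 → l ≠ ⊤ →
      μ {x | 2 * l < ‖IntOp μ K f x‖ₑ} ≤ W / l * ∫⁻ x, ‖f x‖ₑ ∂μ)
    {p : ℝ} (hp : 1 < p) (hp2 : p < 2) {f : X → ℂ} (hf : Nice μ ρ f) :
    ∫⁻ x, ‖IntOp μ K f x‖ₑ ^ p ∂μ ≤ ENNReal.ofReal (4 ^ p * p) * (B2 * ENNReal.ofReal (1 / p + 1 / (2 - p)) +
      W * ENNReal.ofReal (1 / (p - 1))) * ∫⁻ x, ‖f x‖ₑ ^ p ∂μ := by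
  have hp0 : 0 < p := by linarith
  have mT := (hK.stronglyMeasurable_IntOp hf.meas).measurable
  have key : ∀ t : ℝ, 0 < t → μ {x | t < ‖IntOp μ K f x‖ / 4} ≤
      B2 * ENNReal.ofReal (t ^ (-2 : ℝ)) * ∫⁻ x, ENNReal.ofReal (min ‖f x‖ t) ^ 2 ∂μ +
      W * ENNReal.ofReal (t ^ (-1 : ℝ)) * ∫⁻ x, ENNReal.ofReal (‖f x‖ - t) ∂μ := by
    intro t ht
    set l := ENNReal.ofReal t with hl
    have hl0 : l ≠ 0 := by simpa [hl] using ht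
    have hlt : l ≠ ⊤ := ENNReal.ofReal_ne_top
    have hh : Nice μ ρ (fun x => trunc t (f x)) := hf.comp (trunc_cont ht) (c := 1) (fun x => by
      rw [ENNReal.coe_one, one_mul, ← ofReal_norm, ← ofReal_norm]
      apply ENNReal.ofReal_le_ofReal
      rw [trunc_norm ht]; exact min_le_left _ _)
    have he : Nice μ ρ (fun x => f x - trunc t (f x)) := 
      hf.comp (φ := fun z => z - trunc t z) (continuous_id.sub (trunc_cont ht)) (c := 1) (fun x => by
      rw [ENNReal.coe_one, one_mul, sub_trunc_norm ht, ← ofReal_norm]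
      apply ENNReal.ofReal_le_ofReal
      linarith)
    set h : X → ℂ := fun x => trunc t (f x) with hhd
    set e : X → ℂ := fun x => f x - trunc t (f x) with hed
    have hsplit : ∀ x, IntOp μ K f x = IntOp μ K h x + IntOp μ K e x := by
      intro x
      simp only [IntOp]
      rw [← integral_add (hh.row_int hK x) (he.row_int hK x)]
      refine integral_congr_ae (Eventually.of_forall fun y => ?_)
      simp only [hhd, hed]; ring
    have h1 : μ {x | 2 * l < ‖IntOp μ K h x‖ₑ} ≤ B2 * ENNReal.ofReal (t ^ (-2 : ℝ)) * ∫⁻ x, ENNReal.ofReal (min ‖f x‖ t) ^ 2 ∂μ := by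
      have hl2 : l ^ 2 ≠ 0 := pow_ne_zero 2 hl0
      have hl2' : l ^ 2 ≠ ⊤ := ENNReal.pow_ne_top hlt
      have h3 := hL2 h (by have := hh.memLp one_le_two; rwa [two_eq] at this)
      have h4 : l ^ 2 * μ {x | 2 * l < ‖IntOp μ K h x‖ₑ} ≤ ∫⁻ x, ‖IntOp μ K h x‖ₑ ^ 2 ∂μ := by
        refine le_trans ?_ (mul_meas_ge_le_lintegral
          ((hK.stronglyMeasurable_IntOp hh.meas).measurable.enorm.pow_const 2) (l ^ 2))
        gcongr with x
        intro hx
        refine pow_le_pow_left₀ (zero_le) (le_trans ?_ hx.le) 2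
        rw [two_mul]; exact le_self_add
      have h5 : ∀ x, ‖h x‖ₑ = ENNReal.ofReal (min ‖f x‖ t) := fun x => by
        rw [← ofReal_norm, hhd, trunc_norm ht]
      simp_rw [h5] at h3
      rw [← ENNReal.mul_le_mul_iff_right hl2 hl2']
      refine h4.trans (h3.trans (le_of_eq ?_))
      have h6 : l ^ 2 * ENNReal.ofReal (t ^ (-2:ℝ)) = 1 := by
        rw [hl, ← ENNReal.ofReal_pow ht.le, ← ENNReal.ofReal_mul (by positivity), Real.rpow_neg ht.le]
        norm_num
        rw [mul_inv_cancel₀ (by positivity)]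
      calc _ = (l ^ 2 * ENNReal.ofReal (t ^ (-2:ℝ))) * (B2 * ∫⁻ x, ENNReal.ofReal (min ‖f x‖ t) ^ 2 ∂μ) := by
            rw [h6, one_mul]
        _ = _ := by ring
    have h2 : μ {x | 2 * l < ‖IntOp μ K e x‖ₑ} ≤ W * ENNReal.ofReal (t ^ (-1 : ℝ)) * ∫⁻ x, ENNReal.ofReal (‖f x‖ - t) ∂μ := by
      refine (hW e he l hl0 hlt).trans (le_of_eq ?_)
      rw [Real.rpow_neg_one, ENNReal.ofReal_inv_of_pos ht, ← hl, div_eq_mul_inv]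
      congr 1
      exact lintegral_congr fun x => sub_trunc_norm ht (f x)
    refine le_trans (le_trans (measure_mono ?_) (measure_union_le _ _)) (add_le_add h1 h2)
    intro x hx
    have hx : t < ‖IntOp μ K f x‖ / 4 := hx
    by_contra hcon
    simp only [mem_union, mem_setOf_eq, not_or, not_lt] at hcon
    have h3 : ‖IntOp μ K f x‖ₑ ≤ ENNReal.ofReal (4 * t) := by
      rw [hsplit x]
      refine (enorm_add_le _ _).trans ((add_le_add hcon.1 hcon.2).trans (le_of_eq ?_))
      rw [ENNReal.ofReal_mul (by norm_num), ← hl, ← add_mul]; norm_num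
    rw [← ofReal_norm, ENNReal.ofReal_le_ofReal_iff (by positivity)] at h3
    linarith
  -- layer cake
  have lc := lintegral_rpow_eq_lintegral_meas_lt_mul μ (f := fun x => ‖IntOp μ K f x‖ / 4)
    (Eventually.of_forall fun x => by positivity) (mT.norm.div_const 4).aemeasurable hp0
  have e0 : ∫⁻ x, ‖IntOp μ K f x‖ₑ ^ p ∂μ = ENNReal.ofReal (4 ^ p) * ∫⁻ x, ENNReal.ofReal ((‖IntOp μ K f x‖ / 4) ^ p) ∂μ := by
    rw [← lintegral_const_mul' _ _ ENNReal.ofReal_ne_top]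
    refine lintegral_congr fun x => ?_
    rw [← ENNReal.ofReal_mul (by positivity), ← Real.mul_rpow (by norm_num) (by positivity),
      ← ofReal_norm, ENNReal.ofReal_rpow_of_nonneg (norm_nonneg _) hp0.le]
    congr 2; ring
  rw [e0, lc, ← mul_assoc, ← ENNReal.ofReal_mul (by positivity), mul_assoc (ENNReal.ofReal (4 ^ p * p))]
  gcongr
  have mf : Measurable (Function.uncurry fun (t : ℝ) (x : X) => 
      (B2 * ENNReal.ofReal (t ^ (p - 3)) * ENNReal.ofReal (min ‖f x‖ t) ^ 2 +
      W * ENNReal.ofReal (t ^ (p - 2)) * ENNReal.ofReal (‖f x‖ - t) : ℝ≥0∞)) := by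
    have m1 : Measurable fun q : ℝ × X => ‖f q.2‖ := hf.meas.norm.comp measurable_snd
    have m2 : ∀ a : ℝ, Measurable fun q : ℝ × X => ENNReal.ofReal (q.1 ^ a) := fun a => by fun_prop
    change Measurable fun q : ℝ × X => (B2 * ENNReal.ofReal (q.1 ^ (p - 3)) * ENNReal.ofReal (min ‖f q.2‖ q.1) ^ 2 +
      W * ENNReal.ofReal (q.1 ^ (p - 2)) * ENNReal.ofReal (‖f q.2‖ - q.1) : ℝ≥0∞)
    exact Measurable.add (((m2 _).const_mul _).mul ((m1.min measurable_fst).ennreal_ofReal.pow_const 2))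
      (((m2 _).const_mul _).mul (m1.sub measurable_fst).ennreal_ofReal)
  calc ∫⁻ t in Ioi 0, μ {x | t < ‖IntOp μ K f x‖ / 4} * ENNReal.ofReal (t ^ (p - 1))
      ≤ ∫⁻ t in Ioi (0:ℝ), ∫⁻ x, (B2 * ENNReal.ofReal (t ^ (p - 3)) * ENNReal.ofReal (min ‖f x‖ t) ^ 2 +
      W * ENNReal.ofReal (t ^ (p - 2)) * ENNReal.ofReal (‖f x‖ - t)) ∂μ := by
        refine setLIntegral_mono' measurableSet_Ioi fun t ht => ?_
        have ht : (0:ℝ) < t := ht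
        have m3 : Measurable fun x => ENNReal.ofReal (min ‖f x‖ t) ^ 2 :=
          (hf.meas.norm.min measurable_const).ennreal_ofReal.pow_const 2
        have m4 : Measurable fun x => ENNReal.ofReal (‖f x‖ - t) :=
          (hf.meas.norm.sub measurable_const).ennreal_ofReal
        rw [lintegral_add_left (m3.const_mul _), lintegral_const_mul _ m3, lintegral_const_mul _ m4]
        refine (mul_le_mul_left (key t ht) _).trans (le_of_eq ?_)
        have e3 : ENNReal.ofReal (t ^ (p - 3)) = ENNReal.ofReal (t ^ (-2:ℝ)) * ENNReal.ofReal (t ^ (p - 1)) := by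
          rw [← ENNReal.ofReal_mul (by positivity), ← Real.rpow_add ht]; congr 2; ring
        have e4 : ENNReal.ofReal (t ^ (p - 2)) = ENNReal.ofReal (t ^ (-1:ℝ)) * ENNReal.ofReal (t ^ (p - 1)) := by
          rw [← ENNReal.ofReal_mul (by positivity), ← Real.rpow_add ht]; congr 2; ring
        rw [e3, e4]
        ring
    _ = ∫⁻ x, ∫⁻ t in Ioi (0:ℝ), (B2 * ENNReal.ofReal (t ^ (p - 3)) * ENNReal.ofReal (min ‖f x‖ t) ^ 2 +
      W * ENNReal.ofReal (t ^ (p - 2)) * ENNReal.ofReal (‖f x‖ - t)) ∂volume ∂μ :=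
        lintegral_lintegral_swap mf.aemeasurable
    _ ≤ ∫⁻ x, (B2 * ENNReal.ofReal (1 / p + 1 / (2 - p)) + W * ENNReal.ofReal (1 / (p - 1))) * ‖f x‖ₑ ^ p ∂μ := by
        refine lintegral_mono fun x => ?_
        refine (marc_inner hp hp2 (norm_nonneg _) _ _).trans (le_of_eq ?_)
        rw [← ofReal_norm, ENNReal.ofReal_rpow_of_nonneg (norm_nonneg _) hp0.le]
    _ = _ := lintegral_const_mul _ (hf.meas.enorm.pow_const p)

end CZ
end GR
end

section
open scoped ENNReal NNReal Topology ComplexConjugate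
namespace GR
set_option linter.unusedSectionVars false

theorem sum_min_le (J : ℕ) : ∀ u : ℝ, 0 < u →
    ∑ i ∈ Finset.range J, min (2 ^ i * u) (2 ^ i * u)⁻¹ ≤ if u < 1 then 4 - u else 2 / u := by
  induction J with
  | zero =>
    intro u hu
    simp only [Finset.range_zero, Finset.sum_empty]
    split_ifs
    · linarith
    · positivity
  | succ J ih =>
    intro u hu
    rw [Finset.sum_range_succ']
    have e : ∑ k ∈ Finset.range J, min (2 ^ (k + 1) * u) (2 ^ (k + 1) * u)⁻¹ =
        ∑ k ∈ Finset.range J, min (2 ^ k * (2 * u)) (2 ^ k * (2 * u))⁻¹ :=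
      Finset.sum_congr rfl fun k _ => by rw [pow_succ, mul_assoc]
    rw [e]
    have h1 := ih (2 * u) (by linarith)
    split_ifs at h1 ⊢ with h2 h3 h3
    · have := min_le_left (2 ^ 0 * u) (2 ^ 0 * u)⁻¹
      simp only [pow_zero, one_mul] at this ⊢
      linarith
    · have := min_le_left (2 ^ 0 * u) (2 ^ 0 * u)⁻¹
      simp only [pow_zero, one_mul] at this ⊢
      have h4 : 2 / (2 * u) ≤ 2 := by
        rw [div_le_iff₀ (by linarith)]; linarith
      linarith
    · exact absurd h3 (by linarith)
    · have := min_le_right (2 ^ 0 * u) (2 ^ 0 * u)⁻¹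
      simp only [pow_zero, one_mul] at this ⊢
      have h4 : 2 / (2 * u) = u⁻¹ := by field_simp
      have h5 : 2 / u = u⁻¹ + u⁻¹ := by rw [div_eq_mul_inv]; ring
      linarith

theorem sum_min_le4 (J : ℕ) {u : ℝ} (hu : 0 < u) :
    ∑ i ∈ Finset.range J, min (2 ^ i * u) (2 ^ i * u)⁻¹ ≤ 4 := by
  refine (sum_min_le J u hu).trans ?_
  split_ifs with h
  · linarith
  · rw [div_le_iff₀ hu]; linarith

section CZ
variable {X : Type*} [MeasurableSpace X] {μ : Measure X} [SFinite μ] {ρ : X → X → ℝ≥0∞}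
variable {ι : Type*} {D : ℝ≥0} {idx : ℤ → X → ι} {A : ℝ≥0} {R : ℝ} {Kf : ℕ → X → X → ℂ}

/-- partial sums of kernels -/
def Ksum (Kf : ℕ → X → X → ℂ) (J : ℕ) (x y : X) : ℂ := ∑ j ∈ Finset.range J, Kf j x y

theorem kadj_Ksum (J : ℕ) : kadj (Ksum Kf J) = Ksum (fun j => kadj (Kf j)) J := by
  funext x y
  simp [kadj, Ksum]

theorem Ksum_schur (h : ∀ j, GoodKer μ ρ (R * (1/2) ^ j) A (Kf j)) (J : ℕ) :
    SchurKer μ (Ksum Kf J) (J * A) (J * A) where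
  meas := by
    have : Function.uncurry (Ksum Kf J) = fun q => ∑ j ∈ Finset.range J, Function.uncurry (Kf j) q := by
      funext q; rfl
    rw [this]
    exact Finset.measurable_sum _ fun j _ => (h j).meas
  row x := by
    calc ∫⁻ y, ‖Ksum Kf J x y‖ₑ ∂μ ≤ ∫⁻ y, ∑ j ∈ Finset.range J, ‖Kf j x y‖ₑ ∂μ :=
          lintegral_mono fun y => enorm_sum_le _ _
      _ = ∑ j ∈ Finset.range J, ∫⁻ y, ‖Kf j x y‖ₑ ∂μ :=
          lintegral_finsetSum _ fun j _ => (h j).meas.of_uncurry_left.enorm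
      _ ≤ ∑ j ∈ Finset.range J, (A : ℝ≥0∞) := Finset.sum_le_sum fun j _ => (h j).schur.row x
      _ = _ := by simp
  col y := by
    calc ∫⁻ x, ‖Ksum Kf J x y‖ₑ ∂μ ≤ ∫⁻ x, ∑ j ∈ Finset.range J, ‖Kf j x y‖ₑ ∂μ :=
          lintegral_mono fun y => enorm_sum_le _ _
      _ = ∑ j ∈ Finset.range J, ∫⁻ x, ‖Kf j x y‖ₑ ∂μ :=
          lintegral_finsetSum _ fun j _ => (h j).meas.of_uncurry_right.enorm
      _ ≤ ∑ j ∈ Finset.range J, (A : ℝ≥0∞) := Finset.sum_le_sum fun j _ => (h j).schur.col y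
      _ = _ := by simp

theorem Lp_coe_sum {κ : Type*} (s : Finset κ) (F : κ → Lp ℂ 2 μ) :
    ⇑(∑ i ∈ s, F i) =ᵐ[μ] fun x => ∑ i ∈ s, F i x := by
  classical
  induction s using Finset.induction_on with
  | empty =>
    simp only [Finset.sum_empty]
    exact Lp.coeFn_zero ℂ 2 μ
  | insert a s ha ih =>
    rw [Finset.sum_insert ha]
    filter_upwards [Lp.coeFn_add (F a) (∑ i ∈ s, F i), ih] with x h1 h2
    rw [h1, Finset.sum_insert ha, Pi.add_apply, h2]

theorem Ksum_L2 (hρ : ∀ x y, ρ x y = ρ y x) (hA : 0 < A)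
    (h : ∀ j, GoodKer μ ρ (R * (1/2) ^ j) A (Kf j)) (J : ℕ) (f : X → ℂ) (hf : MemLp f 2 μ) :
    ∫⁻ x, ‖IntOp μ (Ksum Kf J) f x‖ₑ ^ 2 ∂μ ≤ ((cG * A).toNNReal ^ 2 : ℝ≥0) * ∫⁻ x, ‖f x‖ₑ ^ 2 ∂μ := by
  set T := ∑ j : Fin J, (h j).schur.clm with hT
  have hN : ‖T‖ ≤ cG * A := ao_L2 hρ hA h
  have e1 : T (hf.toLp f) =ᵐ[μ] IntOp μ (Ksum Kf J) f := by
    have h1 : T (hf.toLp f) = ∑ j : Fin J, (h j).schur.clm (hf.toLp f) := by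
      simp [hT]
    rw [h1]
    refine (Lp_coe_sum _ _).trans ?_
    have h2 : ∀ j : Fin J, ((h j).schur.clm (hf.toLp f)) =ᵐ[μ] IntOp μ (Kf j) f := fun j =>
      ((h j).schur.clm_apply _).trans (Eventually.of_forall fun x => by rw [IntOp_congr hf.coeFn_toLp])
    have h3 : ∀ j : Fin J, ∀ᵐ x ∂μ, Integrable (fun y => Kf j x y * f y) μ := fun j =>
      (h j).schur.ae_integrable (p := 2) one_le_two (by rwa [two_eq])
    filter_upwards [ae_all_iff.2 h2, ae_all_iff.2 h3] with x hx hx3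
    simp only [hx]
    simp only [IntOp, Ksum, Finset.sum_mul]
    rw [integral_finsetSum]
    · exact Fin.sum_univ_eq_sum_range (fun j => ∫ y, Kf j x y * f y ∂μ) J
    · exact fun j hj => hx3 ⟨j, by simpa using hj⟩
  have h2 : ‖T (hf.toLp f)‖ₑ ≤ ENNReal.ofReal (cG * A) * ‖hf.toLp f‖ₑ := by
    rw [← ofReal_norm, ← ofReal_norm, ← ENNReal.ofReal_mul (by have := cG_pos; positivity)]
    exact ENNReal.ofReal_le_ofReal ((T.le_opNorm _).trans (by gcongr))
  have h3 : ∀ g : Lp ℂ 2 μ, ‖g‖ₑ ^ 2 = ∫⁻ x, ‖g x‖ₑ ^ 2 ∂μ := by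
    intro g
    have := eLpNorm_rpow (μ := μ) (p := 2) two_pos g
    rw [two_eq] at this
    simp only [ENNReal.rpow_ofNat] at this
    rw [Lp.enorm_def, this]
  have h4 := pow_le_pow_left₀ zero_le h2 2
  rw [mul_pow, h3, h3] at h4
  have i1 : ∫⁻ x, ‖T (hf.toLp f) x‖ₑ ^ 2 ∂μ = ∫⁻ x, ‖IntOp μ (Ksum Kf J) f x‖ₑ ^ 2 ∂μ :=
    lintegral_congr_ae (e1.mono fun x hx => by simp only [hx])
  have i2 : ∫⁻ x, ‖hf.toLp f x‖ₑ ^ 2 ∂μ = ∫⁻ x, ‖f x‖ₑ ^ 2 ∂μ :=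
    lintegral_congr_ae (hf.coeFn_toLp.mono fun x hx => by simp only [hx])
  rw [i1, i2] at h4
  refine h4.trans (le_of_eq ?_)
  simp [ENNReal.ofReal]

theorem Ksum_horm (d : Dyadic μ ρ D idx) (hρm : ∀ z, Measurable (ρ z))
    (h : ∀ j, GoodKer μ ρ (R * (1/2) ^ j) A (Kf j)) (J : ℕ) (j : ℤ) (y y0 : X) (hy : idx j y = idx j y0) :
    ∫⁻ x in (starS ρ idx (j, idx j y0))ᶜ, ‖Ksum Kf J x y - Ksum Kf J x y0‖ₑ ∂μ ≤
      (4 * A * (D + 2) : ℝ≥0) := by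
  have hR : 0 < R := by simpa using (h 0).rpos
  set s : ℝ := (2:ℝ) ^ j with hs
  have hs0 : 0 < s := by positivity
  set E := (starS ρ idx (j, idx j y0))ᶜ with hE
  have hfar : ∀ x ∈ E, ∀ z, idx j z = idx j y0 → ENNReal.ofReal s ≤ ρ z x := by
    intro x hx z hz
    by_contra hcon
    exact hx ⟨z, hz, not_le.1 hcon⟩
  have hr : ∀ i : ℕ, 0 < R * (1/2) ^ i := fun i => by positivity
  have hone : ∀ i, ∀ z, idx j z = idx j y0 → ∫⁻ x in E, ‖Kf i x z‖ₑ ∂μ ≤ 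
      A * ENNReal.ofReal ((2 ^ i * (s / R))⁻¹) := by
    intro i z hz
    set r := R * (1/2) ^ i with hrd
    have hr0 : 0 < r := hr i
    have e1 : ((2 ^ i * (s / R))⁻¹) = r / s := by
      rw [hrd, one_div, inv_pow]; field_simp
    have h1 : ENNReal.ofReal (s / r) * ∫⁻ x in E, ‖Kf i x z‖ₑ ∂μ ≤ A := by
      rw [← lintegral_const_mul _ (h i).meas.of_uncurry_right.enorm]
      refine le_trans ?_ ((setLIntegral_le_lintegral E _).trans ((h i).size2 z))
      refine setLIntegral_mono ?_ fun x hx => ?_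
      · exact (h i).meas.of_uncurry_right.enorm.mul (measurable_const.add ((hρm z).div_const _))
      · rw [mul_comm]
        gcongr
        rw [ENNReal.ofReal_div_of_pos hr0]
        exact (ENNReal.div_le_div_right (hfar x hx z hz) _).trans le_add_self
    rw [e1, mul_comm]
    have e2 : ENNReal.ofReal (r / s) * ENNReal.ofReal (s / r) = 1 := by
      rw [← ENNReal.ofReal_mul (by positivity)]
      rw [div_mul_div_cancel₀ hs0.ne', div_self hr0.ne', ENNReal.ofReal_one]
    calc ∫⁻ x in E, ‖Kf i x z‖ₑ ∂μ = ENNReal.ofReal (r / s) * (ENNReal.ofReal (s / r) * ∫⁻ x in E, ‖Kf i x z‖ₑ ∂μ) := by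
          rw [← mul_assoc, e2, one_mul]
      _ ≤ _ := by gcongr
  have hterm : ∀ i, ∫⁻ x in E, ‖Kf i x y - Kf i x y0‖ₑ ∂μ ≤
      (A * (D + 2) : ℝ≥0) * ENNReal.ofReal (min (2 ^ i * (s / R)) (2 ^ i * (s / R))⁻¹) := by
    intro i
    rcases min_choice (2 ^ i * (s / R)) (2 ^ i * (s / R))⁻¹ with hm | hm <;> rw [hm]
    · refine (setLIntegral_le_lintegral E _).trans (((h i).reg1 y y0).trans ?_)
      have h1 := d.near j y y0 hy
      have e1 : 2 ^ i * (s / R) = s / (R * (1/2) ^ i) := by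
        rw [one_div, inv_pow]; field_simp
      rw [e1, ENNReal.ofReal_div_of_pos (hr i)]
      push_cast
      rw [mul_assoc]
      gcongr
      calc ρ y y0 / ENNReal.ofReal (R * (1/2) ^ i) ≤ (D * ENNReal.ofReal s) / ENNReal.ofReal (R * (1/2) ^ i) := by gcongr
        _ = D * (ENNReal.ofReal s / ENNReal.ofReal (R * (1/2) ^ i)) := by rw [mul_div_assoc]
        _ ≤ _ := by gcongr; exact le_self_add
    · calc ∫⁻ x in E, ‖Kf i x y - Kf i x y0‖ₑ ∂μ ≤ ∫⁻ x in E, (‖Kf i x y‖ₑ + ‖Kf i x y0‖ₑ) ∂μ :=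
            lintegral_mono fun x => enorm_sub_le
        _ = ∫⁻ x in E, ‖Kf i x y‖ₑ ∂μ + ∫⁻ x in E, ‖Kf i x y0‖ₑ ∂μ :=
            lintegral_add_left (h i).meas.of_uncurry_right.enorm _
        _ ≤ A * ENNReal.ofReal ((2 ^ i * (s / R))⁻¹) + A * ENNReal.ofReal ((2 ^ i * (s / R))⁻¹) :=
            add_le_add (hone i y hy) (hone i y0 rfl)
        _ = A * 2 * ENNReal.ofReal ((2 ^ i * (s / R))⁻¹) := by ring
        _ ≤ _ := by
            push_cast
            gcongr
            exact le_add_self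
  calc ∫⁻ x in E, ‖Ksum Kf J x y - Ksum Kf J x y0‖ₑ ∂μ
      ≤ ∫⁻ x in E, ∑ i ∈ Finset.range J, ‖Kf i x y - Kf i x y0‖ₑ ∂μ := by
        refine lintegral_mono fun x => ?_
        simp only [Ksum, ← Finset.sum_sub_distrib]
        exact enorm_sum_le _ _
    _ = ∑ i ∈ Finset.range J, ∫⁻ x in E, ‖Kf i x y - Kf i x y0‖ₑ ∂μ :=
        lintegral_finsetSum _ fun i _ =>
          ((h i).meas.of_uncurry_right.sub (h i).meas.of_uncurry_right).enorm
    _ ≤ ∑ i ∈ Finset.range J, (A * (D + 2) : ℝ≥0) * ENNReal.ofReal (min (2 ^ i * (s / R)) (2 ^ i * (s / R))⁻¹) :=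
        Finset.sum_le_sum fun i _ => hterm i
    _ = (A * (D + 2) : ℝ≥0) * ENNReal.ofReal (∑ i ∈ Finset.range J, (min (2 ^ i * (s / R)) (2 ^ i * (s / R))⁻¹)) := by
        rw [ENNReal.ofReal_sum_of_nonneg fun i _ => by positivity, Finset.mul_sum]
    _ ≤ (A * (D + 2) : ℝ≥0) * ENNReal.ofReal 4 := by
        gcongr
        exact sum_min_le4 J (by positivity)
    _ = _ := by
        have : ENNReal.ofReal 4 = ((4 : ℝ≥0) : ℝ≥0∞) := by norm_num
        rw [this, ← ENNReal.coe_mul]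
        congr 1
        ring

theorem Nice.IntOp' (hρ : ∀ x y, ρ x y = ρ y x) {K : X → X → ℂ} {A B c : ℝ≥0} (hK : SchurKer μ K A B)
    (hr : ∀ x x0, ∫⁻ y, ‖K x y - K x0 y‖ₑ ∂μ ≤ c * ρ x x0) {f : X → ℂ} (hf : Nice μ ρ f) :
    Nice μ ρ (IntOp μ K f) := by
  obtain ⟨M, hM⟩ := hf.bdd
  refine ⟨(hK.stronglyMeasurable_IntOp hf.meas).measurable, ?_, ⟨A * M, fun x => ?_⟩, ?_⟩
  · intro x ε hε
    refine ⟨ENNReal.ofReal ε / (c * M + 1), ?_, fun y hy => ?_⟩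
    · exact ENNReal.div_pos (by simpa using hε) (by
        exact ENNReal.add_ne_top.2 ⟨ENNReal.mul_ne_top ENNReal.coe_ne_top ENNReal.coe_ne_top, ENNReal.one_ne_top⟩)
    · have e1 : ‖IntOp μ K f y - IntOp μ K f x‖ₑ ≤ c * M * ρ x y := by
        simp only [IntOp]
        rw [← integral_sub (hf.row_int hK y) (hf.row_int hK x)]
        refine (enorm_integral_le_lintegral_enorm _).trans ?_
        calc ∫⁻ z, ‖K y z * f z - K x z * f z‖ₑ ∂μ ≤ ∫⁻ z, ‖K y z - K x z‖ₑ * M ∂μ := by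
              refine lintegral_mono fun z => ?_
              rw [← sub_mul, enorm_mul]
              gcongr
              exact hM z
          _ = (∫⁻ z, ‖K y z - K x z‖ₑ ∂μ) * M :=
              lintegral_mul_const _ (hK.meas.of_uncurry_left.sub hK.meas.of_uncurry_left).enorm
          _ ≤ (c * ρ y x) * M := by gcongr; exact hr y x
          _ = _ := by rw [hρ y x]; ring
      have e2 : ‖IntOp μ K f y - IntOp μ K f x‖ₑ < ENNReal.ofReal ε := by
        rcases eq_or_ne (c * M) 0 with h0 | h0
        · have : (c : ℝ≥0∞) * M = 0 := by exact_mod_cast h0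
          rw [this, zero_mul] at e1
          exact e1.trans_lt (by simpa using hε)
        · have h2 : ρ x y * (c * M + 1) < ENNReal.ofReal ε := ENNReal.mul_lt_of_lt_div hy
          refine e1.trans_lt (lt_of_le_of_lt ?_ h2)
          rw [mul_comm]
          gcongr
          exact le_self_add
      rw [← ofReal_norm] at e2
      exact (ENNReal.ofReal_lt_ofReal_iff hε).1 e2
  · refine (IntOp_enorm_le f x).trans ?_
    calc ∫⁻ y, ‖K x y‖ₑ * ‖f y‖ₑ ∂μ ≤ ∫⁻ y, ‖K x y‖ₑ * M ∂μ := by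
          refine lintegral_mono fun z => ?_
          gcongr
          exact hM z
      _ = (∫⁻ z, ‖K x z‖ₑ ∂μ) * M := lintegral_mul_const _ hK.meas.of_uncurry_left.enorm
      _ ≤ _ := by push_cast; gcongr; exact hK.row x
  · have := hK.memLp (p := 1) le_rfl (f := f) (hf.memLp le_rfl)
    rw [ENNReal.ofReal_one] at this
    exact memLp_one_iff_integrable.1 this

theorem Ksum_reg (h : ∀ j, GoodKer μ ρ (R * (1/2) ^ j) A (Kf j)) (J : ℕ) :
    ∃ c : ℝ≥0, ∀ x x0, ∫⁻ y, ‖Ksum Kf J x y - Ksum Kf J x0 y‖ₑ ∂μ ≤ c * ρ x x0 := by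
  refine ⟨∑ j ∈ Finset.range J, A * (R * (1/2) ^ j).toNNReal⁻¹, fun x x0 => ?_⟩
  calc ∫⁻ y, ‖Ksum Kf J x y - Ksum Kf J x0 y‖ₑ ∂μ
      ≤ ∫⁻ y, ∑ i ∈ Finset.range J, ‖Kf i x y - Kf i x0 y‖ₑ ∂μ := by
        refine lintegral_mono fun y => ?_
        simp only [Ksum, ← Finset.sum_sub_distrib]
        exact enorm_sum_le _ _
    _ = ∑ i ∈ Finset.range J, ∫⁻ y, ‖Kf i x y - Kf i x0 y‖ₑ ∂μ :=
        lintegral_finsetSum _ fun i _ =>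
          ((h i).meas.of_uncurry_left.sub (h i).meas.of_uncurry_left).enorm
    _ ≤ ∑ i ∈ Finset.range J, A * (ρ x x0 / ENNReal.ofReal (R * (1/2) ^ i)) :=
        Finset.sum_le_sum fun i _ => (h i).reg2 x x0
    _ = _ := by
        push_cast
        rw [Finset.sum_mul]
        refine Finset.sum_congr rfl fun i _ => ?_
        rw [ENNReal.coe_inv (by have := (h i).rpos; simpa using this), div_eq_mul_inv, ENNReal.ofReal]
        ring

theorem dual_bound (hρ : ∀ x y, ρ x y = ρ y x) {K : X → X → ℂ} {A B c : ℝ≥0} (hK : SchurKer μ K A B)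
    (hr : ∀ x x0, ∫⁻ y, ‖K x y - K x0 y‖ₑ ∂μ ≤ c * ρ x x0) {p q : ℝ} (hp : 2 < p) (hpq : p.HolderConjugate q)
    {C : ℝ≥0}
    (hq : ∀ g, Nice μ ρ g → ∫⁻ x, ‖IntOp μ (kadj K) g x‖ₑ ^ q ∂μ ≤ C * ∫⁻ x, ‖g x‖ₑ ^ q ∂μ)
    {f : X → ℂ} (hf : Nice μ ρ f) :
    ∫⁻ x, ‖IntOp μ K f x‖ₑ ^ p ∂μ ≤ (C ^ (p - 1) : ℝ≥0) * ∫⁻ x, ‖f x‖ₑ ^ p ∂μ := by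
  have hp0 : 0 < p := by linarith
  have hq0 : 0 < q := hpq.symm.pos
  have hq1 : 1 < q := hpq.symm.lt
  set u := IntOp μ K f with hu
  have hun : Nice μ ρ u := hf.IntOp' hρ hK hr
  set φ : ℂ → ℂ := fun z => ((‖z‖ ^ (p - 2) : ℝ) : ℂ) * z with hφ
  have hφc : Continuous φ := by
    refine Continuous.mul (Complex.continuous_ofReal.comp ?_) continuous_id
    exact continuous_norm.rpow_const fun z => Or.inr (by linarith)
  obtain ⟨M, hM⟩ := hun.bdd
  have hMn : ∀ x, ‖u x‖ ≤ M := fun x => by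
    have := hM x
    rw [← ofReal_norm] at this
    exact ENNReal.ofReal_le_coe.1 this
  have hφe : ∀ z, ‖φ z‖ₑ = ‖z‖ₑ ^ (p - 1) := by
    intro z
    rw [← ofReal_norm, ← ofReal_norm, ENNReal.ofReal_rpow_of_nonneg (norm_nonneg _) (by linarith)]
    congr 1
    simp only [hφ, norm_mul, Complex.norm_real, Real.norm_eq_abs]
    rw [abs_of_nonneg (by positivity)]
    rcases eq_or_ne (‖z‖) 0 with h0 | h0
    · rw [h0, mul_zero, Real.zero_rpow (by linarith)]
    · have : 0 < ‖z‖ := lt_of_le_of_ne (norm_nonneg _) (Ne.symm h0)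
      rw [show p - 1 = (p - 2) + 1 by ring, Real.rpow_add_one h0]
  have hg : Nice μ ρ (fun x => φ (u x)) := by
    refine hun.comp hφc (c := M ^ (p - 2)) fun x => ?_
    rw [hφe, show p - 1 = (p - 2) + 1 by ring,
      ENNReal.rpow_add_of_nonneg _ _ (by linarith) (by linarith), ENNReal.rpow_one,
      ENNReal.coe_rpow_of_nonneg _ (by linarith)]
    gcongr
    exact hM x
  have hpair := hK.pairing hpq.lt.le hpq (hf.memLp hpq.lt.le) (hg.memLp hq1.le)
  set I := ∫⁻ x, ‖u x‖ₑ ^ p ∂μ with hI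
  set F := ∫⁻ x, ‖f x‖ₑ ^ p ∂μ with hF
  have hIt : I ≠ ⊤ := (hun.lint_lt_top hpq.lt.le).ne
  have hFt : F ≠ ⊤ := (hf.lint_lt_top hpq.lt.le).ne
  have hgi : ∫⁻ x, ‖φ (u x)‖ₑ ^ q ∂μ = I := by
    refine lintegral_congr fun x => ?_
    rw [hφe, ← ENNReal.rpow_mul, hpq.sub_one_mul_conj]
  have h1 : I = ENNReal.ofReal ‖∫ x, conj (φ (u x)) * u x ∂μ‖ := by
    have e0 : ∀ x, conj (φ (u x)) * u x = ((‖u x‖ ^ p : ℝ) : ℂ) := by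
      intro x
      simp only [hφ, map_mul, Complex.conj_ofReal]
      rw [mul_assoc, Complex.conj_mul', ← Complex.ofReal_pow, ← Complex.ofReal_mul]
      congr 1
      rcases eq_or_ne (‖u x‖) 0 with h0 | h0
      · rw [h0, Real.zero_rpow hp0.ne']; simp
      · have : 0 < ‖u x‖ := lt_of_le_of_ne (norm_nonneg _) (Ne.symm h0)
        rw [← Real.rpow_natCast, ← Real.rpow_add this]; norm_num
    simp_rw [e0]
    rw [integral_complex_ofReal, Complex.norm_real, Real.norm_eq_abs, abs_of_nonneg
      (integral_nonneg fun x => by positivity), integral_eq_lintegral_of_nonneg_ae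
      (Eventually.of_forall fun x => by positivity)
      (hun.meas.norm.pow_const _).aestronglyMeasurable]
    have e1 : ∫⁻ x, ENNReal.ofReal (‖u x‖ ^ p) ∂μ = I := by
      refine lintegral_congr fun x => ?_
      rw [← ofReal_norm, ENNReal.ofReal_rpow_of_nonneg (norm_nonneg _) hp0.le]
    rw [e1, ENNReal.ofReal_toReal hIt]
  have hw : Measurable (IntOp μ (kadj K) fun x => φ (u x)) :=
    (hK.adj.stronglyMeasurable_IntOp hg.meas).measurable
  have h2 : I ≤ (C * I) ^ (1 / q) * F ^ (1 / p) := by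
    refine (le_of_eq h1).trans ?_
    rw [ofReal_norm, hpair]
    refine (enorm_integral_le_lintegral_enorm _).trans ?_
    simp_rw [enorm_mul]
    refine (ENNReal.lintegral_mul_le_Lp_mul_Lq μ hpq.symm ((Complex.continuous_conj.measurable.comp hw).enorm.aemeasurable)
      hf.meas.enorm.aemeasurable).trans ?_
    gcongr
    refine le_trans (le_of_eq ?_) ((hq _ hg).trans (le_of_eq (by rw [hgi])))
    refine lintegral_congr fun x => ?_
    simp
  rcases eq_or_ne I 0 with h0 | h0
  · rw [h0]; exact zero_le
  have h3 : I ^ (1 / p) ≤ (C:ℝ≥0∞) ^ (1 / q) * F ^ (1 / p) := by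
    rw [ENNReal.mul_rpow_of_nonneg _ _ (by positivity)] at h2
    have e : I = I ^ (1 / q) * I ^ (1 / p) := by
      rw [← ENNReal.rpow_add _ _ h0 hIt]
      have := hpq.symm.inv_add_inv_eq_one
      rw [one_div, one_div, this, ENNReal.rpow_one]
    have h4 : I ^ (1 / q) * I ^ (1 / p) ≤ I ^ (1 / q) * ((C:ℝ≥0∞) ^ (1 / q) * F ^ (1 / p)) := by
      rw [← e]
      refine h2.trans (le_of_eq (by ring))
    refine (ENNReal.mul_le_mul_iff_right ?_ ?_).1 h4
    · exact (ENNReal.rpow_pos (pos_iff_ne_zero.2 h0) hIt).ne'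
    · exact ENNReal.rpow_ne_top_of_nonneg (by positivity) hIt
  have h5 := ENNReal.rpow_le_rpow h3 hp0.le
  rw [ENNReal.mul_rpow_of_nonneg _ _ hp0.le, ← ENNReal.rpow_mul, ← ENNReal.rpow_mul, ← ENNReal.rpow_mul,
    one_div_mul_cancel hp0.ne', ENNReal.rpow_one, ENNReal.rpow_one] at h5
  have e6 : 1 / q * p = p - 1 := by
    have := hpq.sub_one_mul_conj
    field_simp
    linarith
  rw [e6] at h5
  rwa [ENNReal.coe_rpow_of_nonneg _ (by linarith)]

/-- abstract Calderon-Zygmund theorem -/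
theorem cz_bounded (d : Dyadic μ ρ D idx) (hρm : ∀ z, Measurable (ρ z)) (hρ : ∀ x y, ρ x y = ρ y x)
    (hA : 0 < A) {p : ℝ} (hp : 1 < p) : ∃ C : ℝ≥0, ∀ (R : ℝ) (J : ℕ) (Kf : ℕ → X → X → ℂ),
      (∀ j, GoodKer μ ρ (R * (1/2) ^ j) A (Kf j)) → ∀ f, Nice μ ρ f →
      ∫⁻ x, ‖IntOp μ (Ksum Kf J) f x‖ₑ ^ p ∂μ ≤ C * ∫⁻ x, ‖f x‖ₑ ^ p ∂μ := by
  have main : ∀ {p : ℝ}, 1 < p → p < 2 → ∃ C : ℝ≥0, ∀ (R : ℝ) (J : ℕ) (Kf : ℕ → X → X → ℂ),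
      (∀ j, GoodKer μ ρ (R * (1/2) ^ j) A (Kf j)) → ∀ f, Nice μ ρ f →
      ∫⁻ x, ‖IntOp μ (Ksum Kf J) f x‖ₑ ^ p ∂μ ≤ C * ∫⁻ x, ‖f x‖ₑ ^ p ∂μ := by
    intro p hp hp2
    set B2 : ℝ≥0 := (cG * A).toNNReal ^ 2
    set W : ℝ≥0 := B2 * D + D + 2 * (4 * A * (D + 2))
    refine ⟨(4 ^ p * p).toNNReal * (B2 * (1 / p + 1 / (2 - p)).toNNReal + W * (1 / (p - 1)).toNNReal),
      fun R J Kf h f hf => ?_⟩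
    have := marcinkiewicz (ρ := ρ) (Ksum_schur h J) (B2 := B2) (W := W) (Ksum_L2 hρ hA h J)
      (fun f hf l hl hl' => weak_type d (Ksum_schur h J) (Ksum_L2 hρ hA h J)
        (fun j y y0 hy => Ksum_horm d hρm h J j y y0 hy) hf hl hl') hp hp2 hf
    refine this.trans (le_of_eq ?_)
    push_cast
    rfl
  rcases lt_trichotomy p 2 with h2 | h2 | h2
  · exact main hp h2
  · subst h2
    refine ⟨(cG * A).toNNReal ^ 2, fun R J Kf h f hf => ?_⟩
    have := Ksum_L2 hρ hA h J f (by simpa using hf.memLp (p := 2) one_le_two)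
    simpa using this
  · have hpq : p.HolderConjugate (p / (p - 1)) := Real.HolderConjugate.conjExponent hp
    obtain ⟨C, hC⟩ := main hpq.symm.lt (by rw [div_lt_iff₀ (by linarith)]; linarith)
    refine ⟨C ^ (p - 1), fun R J Kf h f hf => ?_⟩
    obtain ⟨c, hc⟩ := Ksum_reg h J
    refine dual_bound hρ (Ksum_schur h J) hc h2 hpq (fun g hg => ?_) hf
    rw [kadj_Ksum]
    exact hC R J _ (fun j => (h j).adj) g hg

end CZ
end GR
end

section
open scoped ENNReal NNReal Topology ComplexConjugate
namespace GR
set_option linter.unusedSectionVars false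

/-- `cosh √s` -/
def Cf (s : ℂ) : ℂ := ∑' n : ℕ, s ^ n / ((2 * n).factorial : ℂ)
/-- `sinh √s / √s` -/
def Sf (s : ℂ) : ℂ := ∑' n : ℕ, s ^ n / ((2 * n + 1).factorial : ℂ)

theorem Cf_sq (z : ℂ) : Cf (z ^ 2) = Complex.cosh z := by
  rw [Complex.cosh_eq_tsum, Cf]
  simp_rw [pow_mul]

theorem Sf_sq (z : ℂ) : z * Sf (z ^ 2) = Complex.sinh z := by
  rw [Complex.sinh_eq_tsum, Sf, ← tsum_mul_left]
  refine tsum_congr fun n => ?_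
  rw [← pow_mul, pow_succ]; ring

theorem Sf_zero : Sf 0 = 1 := by
  rw [Sf, tsum_eq_single 0]
  · simp
  · intro n hn; simp [hn]

theorem Cf_zero : Cf 0 = 1 := by
  have := Cf_sq 0
  simpa using this

theorem summable_aux (M : ℝ) : Summable fun n : ℕ => M ^ n / (n.factorial : ℝ) :=
  Real.summable_pow_div_factorial M

theorem Cf_diff : Differentiable ℂ Cf := by
  intro s
  have h : DifferentiableOn ℂ Cf (Metric.ball 0 (‖s‖ + 1)) := by
    refine Complex.differentiableOn_tsum_of_summable_norm (summable_aux (‖s‖ + 1)) (fun n => ?_) Metric.isOpen_ball ?_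
    · fun_prop
    · intro n w hw
      rw [norm_div, norm_pow]
      simp only [mem_ball_zero_iff] at hw
      rw [Complex.norm_natCast]
      gcongr
      omega
  exact h.differentiableAt (Metric.isOpen_ball.mem_nhds (by simp))

theorem Sf_diff : Differentiable ℂ Sf := by
  intro s
  have h : DifferentiableOn ℂ Sf (Metric.ball 0 (‖s‖ + 1)) := by
    refine Complex.differentiableOn_tsum_of_summable_norm (summable_aux (‖s‖ + 1)) (fun n => ?_) Metric.isOpen_ball ?_
    · fun_prop
    · intro n w hw
      rw [norm_div, norm_pow]
      simp only [mem_ball_zero_iff] at hw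
      rw [Complex.norm_natCast]
      gcongr
      omega
  exact h.differentiableAt (Metric.isOpen_ball.mem_nhds (by simp))

theorem r1 (x : ℝ) : x ^ 2 * cosh x ≤ (1 + |x|) * (x * sinh x) := by
  wlog h : 0 ≤ x generalizing x
  · have := this (-x) (by linarith)
    simpa [Real.sinh_neg, Real.cosh_neg] using this
  rw [abs_of_nonneg h, Real.cosh_eq, Real.sinh_eq]
  have h1 : 1 + 2 * x ≤ exp (2 * x) := by linarith [Real.add_one_le_exp (2 * x)]
  have h2 : exp (2 * x) * exp (-x) = exp x := by rw [← Real.exp_add]; ring_nf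
  have h3 : (1 + 2 * x) * exp (-x) ≤ exp x := by
    rw [← h2]; gcongr
  nlinarith

theorem sinh_le_mul_cosh' {x : ℝ} (h : 0 ≤ x) : sinh x ≤ x * cosh x := by
  refine hasSum_le (fun n => ?_) (Real.hasSum_sinh x) ((Real.hasSum_cosh x).mul_left x)
  rw [← mul_div_assoc, ← pow_succ']
  gcongr
  omega

theorem r2 (x : ℝ) : sinh x ^ 2 ≤ x * sinh x * cosh x := by
  wlog h : 0 ≤ x generalizing x
  · have := this (-x) (by linarith)
    simpa [Real.sinh_neg, Real.cosh_neg] using this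
  have := sinh_le_mul_cosh' h
  have h2 : 0 ≤ sinh x := Real.sinh_nonneg_iff.2 h
  nlinarith

theorem r3 (x : ℝ) : sinh x ^ 2 ≤ x ^ 2 * cosh x ^ 2 := by
  wlog h : 0 ≤ x generalizing x
  · have := this (-x) (by linarith)
    simpa [Real.sinh_neg, Real.cosh_neg] using this
  rw [← mul_pow]
  exact pow_le_pow_left₀ (Real.sinh_nonneg_iff.2 h) (sinh_le_mul_cosh' h) 2

theorem cos_half {y : ℝ} (hy : |y| ≤ 1) : 1 / 2 ≤ cos y := by
  have := Real.one_sub_sq_div_two_le_cos (x := y)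
  have h2 : y ^ 2 ≤ 1 := by rw [← sq_abs]; nlinarith [abs_nonneg y]
  linarith

theorem r4 {y : ℝ} (hy : |y| ≤ 1) : y ^ 2 * cos y ≤ y * sin y := by
  wlog h : 0 ≤ y generalizing y
  · have := this (y := -y) (by simpa using hy) (by linarith)
    simpa using this
  rw [abs_of_nonneg h] at hy
  have h1 := Real.le_tan h (by linarith [Real.pi_gt_three])
  have h2 : 1 / 2 ≤ cos y := cos_half (by rwa [abs_of_nonneg h])
  rw [Real.tan_eq_sin_div_cos, le_div_iff₀ (by linarith)] at h1
  nlinarith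

theorem r5 {y : ℝ} (hy : |y| ≤ 1) : sin y ^ 2 ≤ y * sin y := by
  wlog h : 0 ≤ y generalizing y
  · have := this (y := -y) (by simpa using hy) (by linarith)
    simpa using this
  rw [abs_of_nonneg h] at hy
  have h1 := Real.sin_le h
  have h2 := Real.sin_nonneg_of_nonneg_of_le_pi h (by linarith [Real.pi_gt_three])
  nlinarith

theorem r6 {y : ℝ} (hy : |y| ≤ 1) : y * sin y ≤ y ^ 2 := by
  wlog h : 0 ≤ y generalizing y
  · have := this (y := -y) (by simpa using hy) (by linarith)
    simpa using this
  have h1 := Real.sin_le h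
  nlinarith

theorem cosh_re' (z : ℂ) : (Complex.cosh z).re = cosh z.re * cos z.im := by
  conv_lhs => rw [← Complex.re_add_im z]
  rw [Complex.cosh_add, Complex.cosh_mul_I, Complex.sinh_mul_I]
  simp [← Complex.ofReal_cosh, ← Complex.ofReal_sinh, ← Complex.ofReal_cos, ← Complex.ofReal_sin]

theorem cosh_im' (z : ℂ) : (Complex.cosh z).im = sinh z.re * sin z.im := by
  conv_lhs => rw [← Complex.re_add_im z]
  rw [Complex.cosh_add, Complex.cosh_mul_I, Complex.sinh_mul_I]
  simp [← Complex.ofReal_cosh, ← Complex.ofReal_sinh, ← Complex.ofReal_cos, ← Complex.ofReal_sin]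

theorem sinh_re' (z : ℂ) : (Complex.sinh z).re = sinh z.re * cos z.im := by
  conv_lhs => rw [← Complex.re_add_im z]
  rw [Complex.sinh_add, Complex.cosh_mul_I, Complex.sinh_mul_I]
  simp [← Complex.ofReal_cosh, ← Complex.ofReal_sinh, ← Complex.ofReal_cos, ← Complex.ofReal_sin]

theorem sinh_im' (z : ℂ) : (Complex.sinh z).im = cosh z.re * sin z.im := by
  conv_lhs => rw [← Complex.re_add_im z]
  rw [Complex.sinh_add, Complex.cosh_mul_I, Complex.sinh_mul_I]
  simp [← Complex.ofReal_cosh, ← Complex.ofReal_sinh, ← Complex.ofReal_cos, ← Complex.ofReal_sin]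

theorem normSq_sinh (z : ℂ) : Complex.normSq (Complex.sinh z) = sinh z.re ^ 2 + sin z.im ^ 2 := by
  rw [Complex.normSq_apply, sinh_re', sinh_im']
  have h1 := Real.cosh_sq z.re
  have h2 := Real.sin_sq_add_cos_sq z.im
  have h3 : cos z.im ^ 2 = 1 - sin z.im ^ 2 := by linarith
  ring_nf; rw [h1, h3]; ring

theorem normSq_cosh (z : ℂ) : Complex.normSq (Complex.cosh z) = sinh z.re ^ 2 + cos z.im ^ 2 := by
  rw [Complex.normSq_apply, cosh_re', cosh_im']
  have h1 := Real.cosh_sq z.re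
  have h2 := Real.sin_sq_add_cos_sq z.im
  have h3 : cos z.im ^ 2 = 1 - sin z.im ^ 2 := by linarith
  ring_nf; rw [h1, h3]; ring

theorem Sf_eq_div {z : ℂ} (hz : z ≠ 0) : Sf (z ^ 2) = Complex.sinh z / z := by
  rw [← Sf_sq z]; field_simp

section
variable {z : ℂ}

theorem Sf_re_ge (hy : |z.im| ≤ 1) : cos z.im * cosh z.re ≤ (1 + |z.re|) * (Sf (z ^ 2)).re := by
  rcases eq_or_ne z 0 with rfl | hz
  · simp [Sf_zero]
  have hN : 0 < Complex.normSq z := Complex.normSq_pos.2 hz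
  have e : (Sf (z ^ 2)).re = (z.re * sinh z.re * cos z.im + z.im * sin z.im * cosh z.re) / Complex.normSq z := by
    rw [Sf_eq_div hz, Complex.div_re, sinh_re', sinh_im']; field_simp
  rw [e, ← mul_div_assoc, le_div_iff₀ hN, Complex.normSq_apply]
  have h1 := r1 z.re
  have h2 := r4 hy
  have h3 := cos_half hy
  have h4 := Real.cosh_pos z.re
  have h5 : 0 ≤ |z.re| := abs_nonneg _
  have a1 : z.re ^ 2 * cosh z.re * cos z.im ≤ (1 + |z.re|) * (z.re * sinh z.re) * cos z.im := by gcongr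
  have a2 : z.im ^ 2 * cos z.im * cosh z.re ≤ z.im * sin z.im * cosh z.re := by gcongr
  have a3 : 0 ≤ z.im ^ 2 * cos z.im * cosh z.re := by positivity
  nlinarith

theorem Sf_norm_le (hy : |z.im| ≤ 1) : ‖Sf (z ^ 2)‖ ≤ cosh z.re := by
  rcases eq_or_ne z 0 with rfl | hz
  · simp [Sf_zero]
  have hN : 0 < Complex.normSq z := Complex.normSq_pos.2 hz
  rw [Sf_eq_div hz, norm_div, div_le_iff₀ (by positivity)]
  refine abs_le_of_sq_le_sq' ?_ (by have := Real.cosh_pos z.re; positivity) |>.2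
  rw [mul_pow, ← Complex.normSq_eq_norm_sq, ← Complex.normSq_eq_norm_sq, normSq_sinh, Complex.normSq_apply]
  have h1 := r3 z.re
  have h2 := (r5 hy).trans (r6 hy)
  have h3 := Real.one_le_cosh z.re
  have h4 : 1 ≤ cosh z.re ^ 2 := one_le_pow₀ h3
  nlinarith [sq_nonneg z.im]

theorem Cf_norm_le : ‖Cf (z ^ 2)‖ ≤ cosh z.re := by
  rw [Cf_sq]
  refine abs_le_of_sq_le_sq' ?_ (Real.cosh_pos z.re).le |>.2
  rw [← Complex.normSq_eq_norm_sq, normSq_cosh, Real.cosh_sq]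
  nlinarith [Real.sin_sq_add_cos_sq z.im, sq_nonneg (sin z.im)]

theorem Cf_re : (Cf (z ^ 2)).re = cosh z.re * cos z.im := by rw [Cf_sq, cosh_re']

theorem Sf_re_pos (hy : |z.im| ≤ 1) : 0 < (Sf (z ^ 2)).re := by
  have h1 := Sf_re_ge hy
  have h3 := cos_half hy
  have h4 := Real.cosh_pos z.re
  have h5 : 0 ≤ |z.re| := abs_nonneg _
  have : 0 < (1 + |z.re|) * (Sf (z ^ 2)).re := lt_of_lt_of_le (by positivity) h1
  exact (mul_pos_iff_of_pos_left (by positivity)).1 this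

theorem Cf_re_pos (hy : |z.im| ≤ 1) : 0 < (Cf (z ^ 2)).re := by
  rw [Cf_re]
  have h3 := cos_half hy
  have h4 := Real.cosh_pos z.re
  positivity

theorem a_re_ge (hy : |z.im| ≤ 1) : cos z.im ≤ (Cf (z ^ 2) / Sf (z ^ 2)).re := by
  rcases eq_or_ne z 0 with rfl | hz
  · simp [Sf_zero, Cf_zero]
  have hs : Complex.sinh z ≠ 0 := by
    intro h0
    have := Sf_re_pos hy
    rw [Sf_eq_div hz, h0] at this
    simp at this
  have hN : 0 < Complex.normSq (Complex.sinh z) := Complex.normSq_pos.2 hs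
  have e : Cf (z ^ 2) / Sf (z ^ 2) = z * Complex.cosh z / Complex.sinh z := by
    rw [Sf_eq_div hz, Cf_sq]; field_simp
  have e2 : (Cf (z ^ 2) / Sf (z ^ 2)).re = (z.re * sinh z.re * cosh z.re + z.im * sin z.im * cos z.im) / Complex.normSq (Complex.sinh z) := by
    rw [e, Complex.div_re, Complex.mul_re, Complex.mul_im, sinh_re', sinh_im', cosh_re', cosh_im', ← add_div]
    congr 1
    have h1 := Real.cosh_sq z.re
    have h2 := Real.sin_sq_add_cos_sq z.im
    have h3 : cos z.im ^ 2 = 1 - sin z.im ^ 2 := by linarith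
    ring_nf; rw [h1, h3]; ring
  rw [e2, le_div_iff₀ hN, normSq_sinh]
  have h1 := r2 z.re
  have h2 := r5 hy
  have h3 := cos_half hy
  have h4 := Real.cos_le_one z.im
  nlinarith [sq_nonneg (sinh z.re), sq_nonneg (sin z.im)]

theorem sb_re_ge (hy : |z.im| ≤ 1) :
    z.re ^ 2 / (1 + |z.re|) - 2 * z.im ^ 2 ≤ (z ^ 2 * (Sf (z ^ 2) / Cf (z ^ 2))).re := by
  have hs : Complex.cosh z ≠ 0 := by
    intro h0
    have := Cf_re_pos hy
    rw [Cf_sq, h0] at this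
    simp at this
  have hN : 0 < Complex.normSq (Complex.cosh z) := Complex.normSq_pos.2 hs
  have e : z ^ 2 * (Sf (z ^ 2) / Cf (z ^ 2)) = z * Complex.sinh z / Complex.cosh z := by
    rw [← Sf_sq, Cf_sq]; ring
  have e2 : (z ^ 2 * (Sf (z ^ 2) / Cf (z ^ 2))).re = (z.re * sinh z.re * cosh z.re - z.im * sin z.im * cos z.im) / Complex.normSq (Complex.cosh z) := by
    rw [e, Complex.div_re, Complex.mul_re, Complex.mul_im, sinh_re', sinh_im', cosh_re', cosh_im', ← add_div]
    congr 1
    have h1 := Real.cosh_sq z.re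
    have h2 := Real.sin_sq_add_cos_sq z.im
    have h3 : cos z.im ^ 2 = 1 - sin z.im ^ 2 := by linarith
    ring_nf; rw [h1, h3]; ring
  rw [e2, le_div_iff₀ hN, normSq_cosh]
  have h1 := r1 z.re
  have h2 := r6 hy
  have h3 := cos_half hy
  have h4 := Real.cos_le_one z.im
  have h5 : 0 < 1 + |z.re| := by positivity
  have h6 : z.re ^ 2 / (1 + |z.re|) * cosh z.re ≤ z.re * sinh z.re := by
    rw [div_mul_eq_mul_div, div_le_iff₀ h5]; linarith
  have h7 := Real.cosh_sq z.re
  have h8 := Real.cosh_pos z.re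
  have h9 : 0 ≤ z.re ^ 2 / (1 + |z.re|) := by positivity
  set q := z.re ^ 2 / (1 + |z.re|)
  have b1 : q * cosh z.re * cosh z.re ≤ z.re * sinh z.re * cosh z.re := by gcongr
  have b2 : q * (sinh z.re ^ 2 + cos z.im ^ 2) ≤ q * (cosh z.re * cosh z.re) := by
    gcongr
    rw [← sq, h7]
    nlinarith
  have b3 : z.im * sin z.im * cos z.im ≤ z.im ^ 2 * cos z.im := by gcongr
  have b4 : z.im ^ 2 * cos z.im ≤ 2 * z.im ^ 2 * (sinh z.re ^ 2 + cos z.im ^ 2) := by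
    have : z.im ^ 2 * cos z.im ≤ z.im ^ 2 * (2 * cos z.im ^ 2) := by
      gcongr; nlinarith
    nlinarith [mul_nonneg (sq_nonneg z.im) (sq_nonneg (sinh z.re))]
  nlinarith

theorem b_norm_le (hy : |z.im| ≤ 1) : ‖Sf (z ^ 2) / Cf (z ^ 2)‖ ≤ 2 := by
  have h1 := Sf_norm_le hy
  have h2 := (Complex.re_le_norm (Cf (z ^ 2)))
  rw [Cf_re] at h2
  have h3 := cos_half hy
  have h4 := Real.cosh_pos z.re
  have h5 : 0 < ‖Cf (z ^ 2)‖ := lt_of_lt_of_le (by positivity) h2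
  rw [norm_div, div_le_iff₀ h5]
  nlinarith

theorem a_norm_le (hy : |z.im| ≤ 1) : ‖Cf (z ^ 2) / Sf (z ^ 2)‖ ≤ 2 * (1 + |z.re|) := by
  have h1 := Cf_norm_le (z := z)
  have h0 := Sf_re_ge hy
  have h2 := (Complex.re_le_norm (Sf (z ^ 2)))
  have h3 := cos_half hy
  have h4 := Real.cosh_pos z.re
  have h6 := Sf_re_pos hy
  have h5 : 0 < ‖Sf (z ^ 2)‖ := lt_of_lt_of_le h6 h2
  have h7 : 0 ≤ |z.re| := abs_nonneg _
  rw [norm_div, div_le_iff₀ h5]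
  nlinarith

theorem Sf_norm_ge (hy : |z.im| ≤ 1) : exp (|z.re| / 2) / 8 ≤ ‖Sf (z ^ 2)‖ := by
  have h0 := Sf_re_ge hy
  have h2 := (Complex.re_le_norm (Sf (z ^ 2)))
  have h3 := cos_half hy
  have h4 := Real.cosh_pos z.re
  have h5 : exp |z.re| / 2 ≤ cosh z.re := by
    rw [← Real.cosh_abs, Real.cosh_eq]; linarith [exp_pos (-|z.re|)]
  have h6 : 1 + |z.re| ≤ 2 * exp (|z.re| / 2) := by
    have := Real.add_one_le_exp (|z.re| / 2); linarith [abs_nonneg z.re]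
  have h7 : exp |z.re| = exp (|z.re| / 2) * exp (|z.re| / 2) := by rw [← Real.exp_add]; ring_nf
  have h8 : exp |z.re| / 4 ≤ (1 + |z.re|) * ‖Sf (z ^ 2)‖ := by
    have : (1 + |z.re|) * (Sf (z ^ 2)).re ≤ (1 + |z.re|) * ‖Sf (z ^ 2)‖ := by gcongr
    nlinarith
  have h9 : (1 + |z.re|) * ‖Sf (z ^ 2)‖ ≤ 2 * exp (|z.re| / 2) * ‖Sf (z ^ 2)‖ := by gcongr
  have h10 := exp_pos (|z.re| / 2)
  have : exp (|z.re| / 2) * (exp (|z.re| / 2) / 8) ≤ exp (|z.re| / 2) * ‖Sf (z ^ 2)‖ := by nlinarith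
  exact le_of_mul_le_mul_left this h10
end

end GR
end

section
open scoped ENNReal NNReal Topology ComplexConjugate
namespace GR
set_option linter.unusedSectionVars false

/-- Euclidean space. -/
abbrev Eu (n : ℕ) := EuclideanSpace ℝ (Fin n)

/-- complex shift in direction `k` -/
def shf {m : ℕ} (l : Eu m) (k : Fin m) (τ : ℂ) : Fin m → ℂ :=
  fun i => (l i : ℂ) + if i = k then τ else 0

/-- sum of squares -/
def ssq {m : ℕ} (ζ : Fin m → ℂ) : ℂ := ∑ i, ζ i ^ 2

theorem shf_add {m : ℕ} (l : Eu m) (k : Fin m) (τ : ℂ) (ξ : ℝ) :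
    shf l k (τ + ξ) = shf (l + ξ • EuclideanSpace.single k (1:ℝ)) k τ := by
  funext i
  by_cases h : i = k
  · subst h; simp [shf]; ring
  · simp [shf, h]

theorem norm_sq_eu {m : ℕ} (l : Eu m) : ‖l‖ ^ 2 = ∑ i, l i ^ 2 := by
  rw [EuclideanSpace.norm_sq_eq]; simp

theorem coord_le {m : ℕ} (l : Eu m) (k : Fin m) : |l k| ≤ ‖l‖ := by
  have := EuclideanSpace.norm_eq l
  have h2 : l k ^ 2 ≤ ‖l‖ ^ 2 := by
    rw [norm_sq_eu]
    exact Finset.single_le_sum (f := fun i => l i ^ 2) (fun i _ => sq_nonneg _) (Finset.mem_univ k)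
  exact abs_le_of_sq_le_sq h2 (norm_nonneg _)

theorem ssq_shf {m : ℕ} (l : Eu m) (k : Fin m) (τ : ℂ) :
    ssq (shf l k τ) = (‖l‖ ^ 2 : ℝ) + 2 * τ * l k + τ ^ 2 := by
  have : ∀ i, shf l k τ i ^ 2 = ((l i ^ 2 : ℝ) : ℂ) + if i = k then (2 * τ * l i + τ ^ 2) else 0 := by
    intro i
    by_cases h : i = k
    · simp [shf, h]; ring
    · simp [shf, h]
  unfold ssq
  simp_rw [this, Finset.sum_add_distrib]
  rw [norm_sq_eu]; push_cast; simp; ring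

theorem exists_root {m : ℕ} (l : Eu m) (k : Fin m) (η : ℝ) :
    ∃ z : ℂ, z ^ 2 = ssq (shf l k (Complex.I * η)) ∧ |z.im| ≤ |η| ∧
      ‖l‖ - |η| ≤ |z.re| ∧ |z.re| ≤ ‖l‖ := by
  obtain ⟨z, hz⟩ := IsAlgClosed.exists_pow_nat_eq (ssq (shf l k (Complex.I * η))) two_pos
  refine ⟨z, hz, ?_⟩
  rw [ssq_shf] at hz
  have hre := congrArg Complex.re hz
  have him := congrArg Complex.im hz
  simp [pow_two] at hre him
  have hk := coord_le l k
  have hl := norm_nonneg l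
  have hk2 : l k ^ 2 ≤ ‖l‖ ^ 2 := sq_le_sq' (by linarith [abs_le.mp hk]) (abs_le.mp hk).2
  have hxy : z.re * z.im = η * l k := by linarith
  have h1 : z.re ^ 2 * z.im ^ 2 ≤ η ^ 2 * ‖l‖ ^ 2 := by
    rw [← mul_pow, hxy, mul_pow]; gcongr
  have hre' : z.re ^ 2 - z.im ^ 2 = ‖l‖ ^ 2 - η ^ 2 := by nlinarith
  have hy : z.im ^ 2 ≤ η ^ 2 := by
    by_contra! h
    nlinarith [sq_nonneg z.im, sq_nonneg ‖l‖, sq_nonneg η]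
  refine ⟨sq_le_sq.mp hy, ?_, ?_⟩
  · by_contra! h
    have : |z.re| ^ 2 < (‖l‖ - |η|) ^ 2 := by
      apply pow_lt_pow_left₀ h (abs_nonneg _); norm_num
    have h3 : ‖l‖ - |η| ≥ 0 := le_trans (abs_nonneg _) h.le
    rw [sq_abs] at this
    nlinarith [sq_abs η, sq_nonneg z.im, abs_nonneg η]
  · have : |z.re| ^ 2 ≤ ‖l‖ ^ 2 := by rw [sq_abs]; nlinarith
    exact (pow_le_pow_iff_left₀ (abs_nonneg _) hl (by norm_num)).mp this

/-- `√s coth √s` -/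
def fa (s : ℂ) : ℂ := Cf s / Sf s
/-- `tanh √s / √s` -/
def fb (s : ℂ) : ℂ := Sf s / Cf s

/-- basic kernel symbol -/
def kf (n : ℕ) (s : ℂ) (U V : ℝ) : ℂ :=
  (4 * π * Sf (4 * s)) ^ (((-(n:ℝ)/2 : ℝ)) : ℂ) *
    Complex.exp (-(1/4) * (fa s * U + s * fb s * V))

/-- nonvanishing conditions -/
def Good (s : ℂ) : Prop := Sf s ≠ 0 ∧ Cf s ≠ 0 ∧ (4 * π * Sf (4 * s)) ∈ Complex.slitPlane

theorem good_of {z : ℂ} (h : |z.im| ≤ 1/2) : Good (z ^ 2) := by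
  have h1 : |z.im| ≤ 1 := by linarith
  refine ⟨?_, ?_, ?_⟩
  · intro h0; have := Sf_re_pos h1; rw [h0] at this; simp at this
  · intro h0; have := Cf_re_pos h1; rw [h0] at this; simp at this
  · left
    have h2 : |(2 * z).im| ≤ 1 := by
      simp [abs_mul]; linarith
    have := Sf_re_pos h2
    rw [show (2 * z)^2 = 4 * z ^ 2 by ring] at this
    rw [show (4 * π * Sf (4 * z^2) : ℂ) = ((4 * π : ℝ) : ℂ) * Sf (4 * z^2) by push_cast; ring,
      Complex.re_ofReal_mul]
    positivity

theorem good_shf {m : ℕ} (l : Eu m) (k : Fin m) (τ : ℂ) (h : |τ.im| ≤ 1/2) :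
    Good (ssq (shf l k τ)) := by
  have : τ = Complex.I * τ.im + τ.re := by
    rw [add_comm, mul_comm]; exact (Complex.re_add_im τ).symm
  rw [this, shf_add]
  obtain ⟨z, hz, h1, -, -⟩ := exists_root (l + τ.re • EuclideanSpace.single k (1:ℝ)) k τ.im
  rw [← hz]
  exact good_of (h1.trans h)

theorem cos_ge_quad (y : ℝ) : 1 - y ^ 2 / 2 ≤ cos y := Real.one_sub_sq_div_two_le_cos

theorem kf_bound {n : ℕ} (hn : 1 ≤ n) {m : ℕ} (l : Eu m) (k : Fin m) (η : ℝ) (u v : ℝ)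
    (hv : 0 ≤ v) {r : ℝ} (hr : r ≤ 1/2) (hη : |η| * (1 + v) ≤ r) :
    ‖kf n (ssq (shf l k (Complex.I * η))) (u ^ 2) (v ^ 2)‖ ≤
      exp 1 * exp (-((1 - r ^ 2) * u ^ 2 / 4)) * exp (-(‖l‖ * (1 + v) / 4)) := by
  obtain ⟨z, hz, h1, h2, h3⟩ := exists_root l k η
  rw [← hz]
  have hηr : |η| ≤ r := le_trans (le_mul_of_one_le_right (abs_nonneg _) (by linarith)) hη
  have hr0 : 0 ≤ r := (abs_nonneg _).trans hηr
  have him : |z.im| ≤ 1 := by linarith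
  have h2im : |(2 * z).im| ≤ 1 := by simp [abs_mul]; linarith
  have g := (good_of (show |z.im| ≤ 1/2 by linarith))
  rw [kf, norm_mul, Complex.norm_cpow_real, Complex.norm_exp]
  have hS := Sf_norm_ge h2im
  rw [show (2 * z)^2 = 4 * z ^ 2 by ring, show |(2*z).re| / 2 = |z.re| by simp [abs_mul]] at hS
  have hq : exp |z.re| ≤ ‖(4 * π * Sf (4 * z ^ 2) : ℂ)‖ := by
    rw [norm_mul, norm_mul]
    simp only [Complex.norm_real, Complex.norm_ofNat, Real.norm_eq_abs, abs_of_pos pi_pos]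
    nlinarith [pi_gt_three, exp_pos |z.re|]
  have hq2 : ‖(4 * π * Sf (4 * z ^ 2) : ℂ)‖ ^ (-(n:ℝ)/2) ≤ exp (-(|z.re| / 2)) := by
    calc _ ≤ (exp |z.re|) ^ (-(n:ℝ)/2) :=
          Real.rpow_le_rpow_of_nonpos (exp_pos _) hq (by have : (1:ℝ) ≤ n := by exact_mod_cast hn
                                                         linarith)
      _ = exp (|z.re| * (-(n:ℝ)/2)) := by rw [← Real.exp_mul]
      _ ≤ _ := by
          apply exp_le_exp.mpr
          have : (1:ℝ) ≤ n := by exact_mod_cast hn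
          nlinarith [abs_nonneg z.re]
  have ha := a_re_ge him
  have hb := sb_re_ge him
  have hcos := cos_ge_quad z.im
  have hy2 : z.im ^ 2 ≤ r ^ 2 := by rw [← sq_abs]; exact pow_le_pow_left₀ (abs_nonneg _) (h1.trans hηr) 2
  have hyv : z.im ^ 2 * v ^ 2 ≤ 1/4 := by
    have : |z.im| * v ≤ 1/2 := by
      calc |z.im| * v ≤ |η| * (1 + v) := by gcongr; linarith
        _ ≤ 1/2 := by linarith
    have h0 : 0 ≤ |z.im| * v := by positivity
    rw [← sq_abs z.im, ← mul_pow]; nlinarith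
  have hre : (-(1/4) * (fa (z^2) * ((u^2:ℝ):ℂ) + z^2 * fb (z^2) * ((v^2:ℝ):ℂ)) : ℂ).re =
      -(1/4) * ((Cf (z^2)/Sf (z^2)).re * u^2 + (z^2 * (Sf (z^2)/Cf (z^2))).re * v^2) := by
    rw [show (-(1/4) : ℂ) = ((-(1/4) : ℝ) : ℂ) by push_cast; ring, Complex.re_ofReal_mul,
      Complex.add_re, mul_comm (fa _), Complex.re_ofReal_mul, mul_comm _ ((v^2:ℝ):ℂ), Complex.re_ofReal_mul]
    simp only [fa, fb]; ring
  rw [hre]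
  set X := |z.re|
  have hX : 0 ≤ X := abs_nonneg _
  rw [← sq_abs z.re] at hb
  have hamgm : X * v / 2 - (1 + X) / 4 ≤ X ^ 2 / (1 + X) * v ^ 2 / 4 := by
    have : X ^ 2 / (1 + X) * v ^ 2 / 4 - (X * v / 2 - (1 + X) / 4) = (X * v - (1 + X))^2 / (4 * (1 + X)) := by
      field_simp; ring
    have h4 : 0 ≤ (X * v - (1 + X))^2 / (4 * (1 + X)) := by positivity
    linarith
  have hXR : ‖l‖ * (1 + v) - 1/2 ≤ X * (1 + v) := by nlinarith
  have e1 : (1 - r^2) * u^2 ≤ (Cf (z^2)/Sf (z^2)).re * u^2 := by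
    gcongr; nlinarith
  have e2 : X ^ 2 / (1 + X) * v ^ 2 - 1/2 ≤ (z^2 * (Sf (z^2)/Cf (z^2))).re * v^2 := by
    have := mul_le_mul_of_nonneg_right hb (sq_nonneg v)
    nlinarith
  calc _ ≤ exp (-(X / 2)) * exp (-(1/4) * ((Cf (z^2)/Sf (z^2)).re * u^2 + (z^2 * (Sf (z^2)/Cf (z^2))).re * v^2)) := by
        gcongr
    _ ≤ _ := by
        rw [← exp_add, ← exp_add, ← exp_add]
        apply exp_le_exp.mpr
        nlinarith

end GR
end

section
open scoped ENNReal NNReal Topology ComplexConjugate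
namespace GR
set_option linter.unusedSectionVars false

theorem pow_exp_le (N : ℕ) {c : ℝ} (hc : 0 < c) :
    ∃ C : ℝ, 0 < C ∧ ∀ w : ℝ, 0 ≤ w → (1 + w) ^ N ≤ C * exp (c * w) := by
  refine ⟨(N.factorial : ℝ) / c ^ N * exp c, by positivity, fun w hw => ?_⟩
  have := Real.pow_div_factorial_le_exp (c * (1 + w)) (by positivity) N
  rw [div_le_iff₀ (by positivity), mul_pow] at this
  rw [div_mul_eq_mul_div, div_mul_eq_mul_div, le_div_iff₀ (by positivity)]
  calc _ = c ^ N * (1 + w)^N := by ring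
    _ ≤ _ := this
    _ = _ := by rw [mul_add, exp_add, mul_one]; ring

theorem integrable_exp_norm (m : ℕ) {c : ℝ} (hc : 0 < c) :
    Integrable (fun l : Eu m => exp (-(c * ‖l‖))) := by
  have h2 := integrable_one_add_norm (E := Eu m) (μ := volume) (r := (m:ℝ) + 1) (by simp)
  obtain ⟨C, hC, h⟩ := pow_exp_le (m+1) hc
  refine (h2.const_mul C).mono' (by fun_prop) (ae_of_all _ fun l => ?_)
  rw [Real.norm_eq_abs, abs_of_pos (exp_pos _)]
  have := h ‖l‖ (norm_nonneg _)
  have hp : 0 < 1 + ‖l‖ := by positivity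
  rw [rpow_neg hp.le, show ((m:ℝ)+1) = ((m+1:ℕ):ℝ) by push_cast; ring, rpow_natCast,
    ← div_eq_mul_inv, le_div_iff₀ (by positivity), exp_neg, inv_mul_le_iff₀ (exp_pos _)]
  linarith

/-- Holomorphic contour shift. -/
theorem contour {m : ℕ} (k : Fin m) (G : Eu m → ℂ → ℂ) {b B c : ℝ} (hb : 0 < b) (hc : 0 < c)
    (hcont : ∀ τ : ℂ, |τ.im| < b → Continuous fun l => G l τ)
    (hdiff : ∀ l (τ : ℂ), |τ.im| < b → DifferentiableAt ℂ (G l) τ)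
    (hbd : ∀ l (η : ℝ), |η| < b → ‖G l (Complex.I * η)‖ ≤ B * exp (-(c * ‖l‖)))
    (htr : ∀ l τ (ξ : ℝ), G l (τ + ξ) = G (l + ξ • EuclideanSpace.single k (1:ℝ)) τ)
    {η : ℝ} (hη : |η| < b) : ∫ l, G l (Complex.I * η) = ∫ l, G l 0 := by
  set S : Set ℂ := {τ | |τ.im| < b} with hS
  have hSo : IsOpen S := isOpen_lt (by fun_prop) continuous_const
  have hconv : Convex ℝ S := by
    have : S = Complex.im ⁻¹' (Ioo (-b) b) := by ext τ; simp [hS, abs_lt]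
    rw [this]
    exact (convex_Ioo (-b) b).linear_preimage Complex.imLm
  have hB : 0 ≤ B := by
    have := (norm_nonneg _).trans (hbd 0 0 (by simpa using hb))
    simpa using this
  have hbd' : ∀ l (τ : ℂ), τ ∈ S → ‖G l τ‖ ≤ B * exp (c * |τ.re|) * exp (-(c * ‖l‖)) := by
    intro l τ hτ
    have h1 : τ = Complex.I * τ.im + τ.re := by
      rw [add_comm, mul_comm]; exact (Complex.re_add_im τ).symm
    rw [h1, htr]
    refine (hbd _ _ hτ).trans ?_
    rw [mul_assoc, ← exp_add]
    gcongr
    have : ‖l‖ ≤ ‖l + τ.re • EuclideanSpace.single k (1:ℝ)‖ + |τ.re| := by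
      have := norm_sub_le (l + τ.re • EuclideanSpace.single k (1:ℝ)) (τ.re • EuclideanSpace.single k (1:ℝ))
      simpa [norm_smul] using this
    simp
    nlinarith
  have hinteg : ∀ M : ℝ, Integrable (fun l : Eu m => M * exp (-(c * ‖l‖))) := fun M =>
    (integrable_exp_norm m hc).const_mul M
  have hGint : ∀ τ ∈ S, Integrable fun l => G l τ := fun τ hτ =>
    (hinteg _).mono' (hcont τ hτ).aestronglyMeasurable (ae_of_all _ fun l => hbd' l τ hτ)
  have hder : ∀ τ ∈ S, HasDerivAt (fun τ => ∫ l, G l τ) (∫ l, deriv (G l) τ) τ := by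
    intro τ hτ
    obtain ⟨ε, hε, hball⟩ := Metric.isOpen_iff.mp hSo τ hτ
    set δ := ε / 3
    have hδ : 0 < δ := by positivity
    refine (hasDerivAt_integral_of_dominated_loc_of_deriv_le (F := fun τ l => G l τ)
      (F' := fun τ l => deriv (G l) τ) (x₀ := τ) (s := Metric.ball τ δ)
      (bound := fun l => (B * exp (c * (|τ.re| + ε)) / δ) * exp (-(c * ‖l‖))) (Metric.ball_mem_nhds _ hδ) ?_ (hGint τ hτ) ?_ ?_ (hinteg _) ?_).2
    · filter_upwards [hSo.mem_nhds hτ] with σ hσ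
      exact (hcont σ hσ).aestronglyMeasurable
    · have hlim : ∀ l, Tendsto (fun j : ℕ => ((δ / (j + 1) : ℝ) : ℂ)⁻¹ * (G l (τ + ((δ / (j + 1) : ℝ) : ℂ)) - G l τ)) atTop (𝓝 (deriv (G l) τ)) := by
        intro l
        have h1 := (hasDerivAt_iff_tendsto_slope_zero.mp (hdiff l τ hτ).hasDerivAt)
        have h2 : Tendsto (fun j : ℕ => ((δ / (j + 1) : ℝ) : ℂ)) atTop (𝓝[≠] 0) := by
          refine tendsto_nhdsWithin_iff.mpr ⟨?_, ?_⟩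
          · have : Tendsto (fun j : ℕ => (δ / (j + 1) : ℝ)) atTop (𝓝 0) := by
              have := tendsto_one_div_add_atTop_nhds_zero_nat (𝕜 := ℝ)
              simpa [div_eq_mul_inv] using this.const_mul δ
            exact (Complex.continuous_ofReal.tendsto 0).comp this
          · refine Eventually.of_forall fun j => ?_
            simp only [mem_compl_iff, mem_singleton_iff, Complex.ofReal_eq_zero]
            positivity
        simpa only [smul_eq_mul, Function.comp_def] using h1.comp h2
      refine aestronglyMeasurable_of_tendsto_ae atTop (fun j => ?_) (ae_of_all _ hlim)
      refine Continuous.aestronglyMeasurable ?_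
      refine continuous_const.mul ((hcont _ ?_).sub (hcont _ hτ))
      have : (τ + ((δ / (j + 1) : ℝ) : ℂ)).im = τ.im := by rw [Complex.add_im, Complex.ofReal_im, add_zero]
      rw [this]; exact hτ
    · refine ae_of_all _ fun l σ hσ => ?_
      rw [Metric.mem_ball, dist_eq_norm] at hσ
      have hsub : ∀ w ∈ Metric.closedBall σ δ, w ∈ Metric.ball τ ε := by
        intro w hw
        rw [Metric.mem_closedBall, dist_eq_norm] at hw
        rw [Metric.mem_ball, dist_eq_norm]
        have : w - τ = (w - σ) + (σ - τ) := by ring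
        rw [this]
        refine (norm_add_le _ _).trans_lt ?_
        have : δ = ε / 3 := rfl
        linarith
      have := Complex.norm_deriv_le_of_forall_mem_sphere_norm_le (c := σ) (R := δ) (f := G l) (C := B * exp (c * (|τ.re| + ε)) * exp (-(c * ‖l‖))) hδ ?_ ?_
      · refine this.trans (le_of_eq ?_); ring
      · refine DifferentiableOn.diffContOnCl fun w hw => ?_
        rw [closure_ball _ hδ.ne'] at hw
        exact (hdiff l w (hball (hsub w hw))).differentiableWithinAt
      · intro w hw
        have hw' := hsub w (Metric.sphere_subset_closedBall hw)
        refine (hbd' l w (hball hw')).trans ?_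
        gcongr
        rw [Metric.mem_ball, dist_eq_norm] at hw'
        have h5 := Complex.abs_re_le_norm (w - τ)
        rw [Complex.sub_re] at h5
        have h6 := abs_sub_abs_le_abs_sub w.re τ.re
        linarith
    · refine ae_of_all _ fun l σ hσ => (hdiff l σ ?_).hasDerivAt
      exact hball (Metric.ball_subset_ball (by simp only [δ]; linarith) hσ)
  have hzero : ∀ τ ∈ S, deriv (fun τ => ∫ l, G l τ) τ = 0 := by
    intro τ hτ
    have h1 := hder τ hτ
    have h2 : HasDerivAt (fun ξ : ℝ => ∫ l, G l (τ + ξ)) (∫ l, deriv (G l) τ) 0 := by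
      have h3 : HasDerivAt (fun ξ : ℝ => τ + (ξ:ℂ)) 1 0 := by
        simpa using (Complex.ofRealCLM.hasDerivAt (x := (0:ℝ))).const_add τ
      have h1' : HasDerivAt (fun τ => ∫ l, G l τ) (∫ l, deriv (G l) τ) (τ + ((0:ℝ):ℂ)) := by simpa using h1
      have h7 := h1'.comp (0:ℝ) h3
      rw [mul_one] at h7
      exact h7
    have h4 : (fun ξ : ℝ => ∫ l, G l (τ + ξ)) = fun _ => ∫ l, G l τ := by
      funext ξ
      simp_rw [htr]
      exact integral_add_right_eq_self (fun l => G l τ) _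
    rw [h4] at h2
    rw [h1.deriv, h2.unique (hasDerivAt_const _ _)]
  refine hSo.is_const_of_deriv_eq_zero (f := fun τ => ∫ l, G l τ) (x := Complex.I * η) (y := 0) hconv.isPreconnected ?_ ?_ ?_ ?_
  · intro τ hτ; exact (hder τ hτ).differentiableAt.differentiableWithinAt
  · intro τ hτ; exact hzero τ hτ
  · simpa [hS] using hη
  · simpa [hS] using hb

end GR
end

section
open scoped ENNReal NNReal Topology ComplexConjugate
namespace GR
set_option linter.unusedSectionVars false

theorem kf_diffAt (n : ℕ) {s : ℂ} (hs : Good s) (U V : ℝ) :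
    DifferentiableAt ℂ (fun s => kf n s U V) s := by
  unfold kf fa fb
  obtain ⟨h1, h2, h3⟩ := hs
  have e1 := Sf_diff s
  have e2 := Cf_diff s
  have e3 : DifferentiableAt ℂ (fun s => (4 * π * Sf (4 * s) : ℂ)) s := by
    have := Sf_diff (4 * s)
    have : DifferentiableAt ℂ (fun s => Sf (4 * s)) s :=
      DifferentiableAt.comp s this (by fun_prop)
    fun_prop
  have e4 := e3.cpow (differentiableAt_const (((-(n:ℝ)/2 : ℝ)) : ℂ)) h3
  have e5 : DifferentiableAt ℂ (fun s => Cf s / Sf s) s := e2.div e1 h1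
  have e6 : DifferentiableAt ℂ (fun s => Sf s / Cf s) s := e1.div e2 h2
  refine e4.mul ?_
  fun_prop

theorem ssq_shf_diff {m : ℕ} (l : Eu m) (k : Fin m) : Differentiable ℂ fun τ => ssq (shf l k τ) := by
  simp_rw [ssq_shf]; fun_prop

theorem ssq_shf_cont {m : ℕ} (k : Fin m) (τ : ℂ) : Continuous fun l => ssq (shf l k τ) := by
  simp_rw [ssq_shf]; fun_prop

/-- real vector as complex vector -/
def cl {m : ℕ} (l : Eu m) : Fin m → ℂ := fun i => (l i : ℂ)

theorem shf_zero {m : ℕ} (l : Eu m) (k : Fin m) : shf l k 0 = cl l := by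
  funext i; simp [shf, cl]

theorem ssq_cl {m : ℕ} (l : Eu m) : ssq (cl l) = ((‖l‖ ^ 2 : ℝ) : ℂ) := by
  simp [ssq, cl, norm_sq_eu]

theorem good_cl {m : ℕ} (l : Eu m) : Good (ssq (cl l)) := by
  rw [ssq_cl, Complex.ofReal_pow]; exact good_of (by simp)

theorem exists_big {m : ℕ} (hm : 1 ≤ m) (z : Eu m) : ∃ k, ‖z‖ ≤ m * |z k| := by
  haveI : Nonempty (Fin m) := ⟨⟨0, hm⟩⟩
  obtain ⟨k, hk⟩ := Finite.exists_max fun i => |z i|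
  refine ⟨k, ?_⟩
  have h2 : ‖z‖ ^ 2 ≤ (m * |z k|) ^ 2 := by
    rw [norm_sq_eu]
    calc ∑ i, z i ^ 2 ≤ ∑ i : Fin m, |z k| ^ 2 := by
          refine Finset.sum_le_sum fun i _ => ?_
          rw [← sq_abs]; exact pow_le_pow_left₀ (abs_nonneg _) (hk i) 2
      _ = m * |z k| ^ 2 := by simp
      _ ≤ _ := by
          rw [mul_pow]
          have : (1:ℝ) ≤ m := by exact_mod_cast hm
          gcongr; nlinarith
  exact (pow_le_pow_iff_left₀ (norm_nonneg _) (by positivity) (by norm_num)).mp h2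

theorem int_scale (m : ℕ) {R : ℝ} (hR : 0 < R) (f : ℝ → ℝ) :
    ∫ l : Eu m, f (R * ‖l‖) = (R ^ m)⁻¹ * ∫ l : Eu m, f ‖l‖ := by
  have := Measure.integral_comp_smul (μ := (volume : Measure (Eu m))) (fun l => f ‖l‖) R
  simp only [norm_smul, Real.norm_eq_abs, abs_of_pos hR, finrank_euclideanSpace, Fintype.card_fin, smul_eq_mul] at this
  rw [this, abs_of_pos (by positivity)]

/-- phase -/
def ph {m : ℕ} (ζ : Fin m → ℂ) (z : Eu m) : ℂ := Complex.exp (-Complex.I * ∑ i, ζ i * z i)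

theorem ph_shf {m : ℕ} (l : Eu m) (k : Fin m) (τ : ℂ) (z : Eu m) :
    ph (shf l k τ) z = Complex.exp (-Complex.I * ((dotp l z : ℝ) : ℂ)) * Complex.exp (-Complex.I * (τ * z k)) := by
  rw [ph, ← Complex.exp_add, ← mul_add]
  congr 2
  simp [shf, add_mul, Finset.sum_add_distrib, dotp]

theorem ph_cl {m : ℕ} (l : Eu m) (z : Eu m) :
    ph (cl l) z = Complex.exp (-Complex.I * ((dotp l z : ℝ) : ℂ)) := by
  rw [ph]; congr 2; simp [cl, dotp]

theorem norm_ph_cl {m : ℕ} (l z : Eu m) : ‖ph (cl l) z‖ = 1 := by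
  rw [ph_cl, Complex.norm_exp]; simp

theorem norm_ph_shf {m : ℕ} (l : Eu m) (k : Fin m) (η : ℝ) (z : Eu m) :
    ‖ph (shf l k (Complex.I * η)) z‖ = exp (η * z k) := by
  rw [ph_shf, norm_mul, Complex.norm_exp, Complex.norm_exp]
  simp

theorem dotp_cont {m : ℕ} (z : Eu m) : Continuous fun l : Eu m => dotp l z := by
  unfold dotp; fun_prop

theorem osc_bound (n m : ℕ) (hn : 1 ≤ n) (hm : 1 ≤ m) (N : ℕ) {r : ℝ} (hr0 : 0 < r) (hr : r ≤ 1/2) :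
    ∃ C : ℝ, 0 < C ∧ ∀ (u v : ℝ), 0 ≤ v → ∀ (P : (Fin m → ℂ) → ℂ) (D : ℝ), 0 ≤ D →
      (∀ k (τ : ℂ), |τ.im| ≤ 1/2 → Continuous fun l => P (shf l k τ)) →
      (∀ k l (τ : ℂ), |τ.im| ≤ 1/2 → DifferentiableAt ℂ (fun τ => P (shf l k τ)) τ) →
      (∀ k l (η : ℝ), |η| * (1 + v) ≤ r → ‖P (shf l k (Complex.I * η))‖ ≤ D * (1 + ‖l‖ * (1 + v)) ^ N) →
      ∀ z : Eu m, ‖∫ l : Eu m, P (cl l) * kf n (ssq (cl l)) (u ^ 2) (v ^ 2) * ph (cl l) z‖ ≤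
        C * D * exp (-((1 - r ^ 2) * u ^ 2 / 4)) * ((1 + v) ^ m)⁻¹ * exp (-(r / (2 * m) * (‖z‖ / (1 + v)))) := by
  obtain ⟨C0, hC0, hC⟩ := pow_exp_le N (show (0:ℝ) < 1/8 by norm_num)
  have hI := integrable_exp_norm m (show (0:ℝ) < 1/8 by norm_num)
  set I0 := ∫ l : Eu m, exp (-(1/8 * ‖l‖)) with hI0
  have hI0' : 0 ≤ I0 := integral_nonneg fun l => (exp_pos _).le
  refine ⟨C0 * exp 1 * (I0 + 1), by positivity, ?_⟩
  intro u v hv P D hD hPc hPd hPb z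
  obtain ⟨k, hk⟩ := exists_big hm z
  set R := 1 + v with hR
  have hR1 : 1 ≤ R := by linarith
  have hR0 : 0 < R := by linarith
  set b := r / R with hb
  have hb0 : 0 < b := by positivity
  have hb2 : b ≤ 1/2 := by rw [hb, div_le_iff₀ hR0]; nlinarith
  set E := exp (-((1 - r ^ 2) * u ^ 2 / 4)) with hE
  set G : Eu m → ℂ → ℂ := fun l τ => P (shf l k τ) * kf n (ssq (shf l k τ)) (u^2) (v^2) * ph (shf l k τ) z with hG
  have hbG : ∀ l (η : ℝ), |η| < b → ‖G l (Complex.I * η)‖ ≤ D * C0 * exp 1 * E * exp (-(1/8 * (R * ‖l‖))) * exp (η * z k) := by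
    intro l η hη
    have hη' : |η| * (1 + v) ≤ r := by
      rw [← hR]; rw [hb, lt_div_iff₀ hR0] at hη; exact hη.le
    have h1 := hPb k l η hη'
    have h2 := kf_bound hn l k η u v hv hr hη'
    have h3 := hC (‖l‖ * R) (by positivity)
    simp only [hG]
    rw [norm_mul, norm_mul, norm_ph_shf]
    refine mul_le_mul_of_nonneg_right ?_ (exp_pos _).le
    calc _ ≤ (D * (C0 * exp (1/8 * (‖l‖ * R)))) * (exp 1 * E * exp (-(‖l‖ * (1 + v) / 4))) := by
          refine mul_le_mul (h1.trans (by gcongr)) h2 (norm_nonneg _) (by positivity)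
      _ = D * C0 * exp 1 * E * (exp (1/8 * (‖l‖ * R)) * exp (-(‖l‖ * (1 + v) / 4))) := by ring
      _ = _ := by rw [← exp_add, ← hR]; congr 2; ring
  have hshift : ∀ η : ℝ, |η| < b → ∫ l, G l (Complex.I * η) = ∫ l, G l 0 := by
    intro η hη
    refine contour k G (b := b) (B := D * C0 * exp 1 * E * exp (b * |z k|)) (c := R / 8) hb0 (by positivity) ?_ ?_ ?_ ?_ hη
    · intro τ hτ
      have hτ' : |τ.im| ≤ 1/2 := by linarith
      refine ((hPc k τ hτ').mul ?_).mul ?_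
      · refine continuous_iff_continuousAt.mpr fun l => ?_
        exact ContinuousAt.comp (g := fun s => kf n s (u^2) (v^2)) (kf_diffAt n (good_shf l k τ hτ') _ _).continuousAt (ssq_shf_cont k τ).continuousAt
      · simp_rw [ph_shf]
        have := dotp_cont z
        fun_prop
    · intro l τ hτ
      have hτ' : |τ.im| ≤ 1/2 := by linarith
      refine ((hPd k l τ hτ').mul ?_).mul ?_
      · exact DifferentiableAt.comp (g := fun s => kf n s (u^2) (v^2)) τ (kf_diffAt n (good_shf l k τ hτ') _ _) (ssq_shf_diff l k τ)
      · simp_rw [ph_shf]; fun_prop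
    · intro l η hη
      refine (hbG l η hη).trans ?_
      calc _ ≤ D * C0 * exp 1 * E * exp (-(1/8 * (R * ‖l‖))) * exp (b * |z k|) := by
            refine mul_le_mul_of_nonneg_left (exp_le_exp.mpr ?_) (by positivity)
            calc η * z k ≤ |η * z k| := le_abs_self _
              _ = |η| * |z k| := abs_mul _ _
              _ ≤ _ := by gcongr
        _ = _ := by rw [mul_right_comm]; congr 2; ring
    · intro l τ ξ
      simp only [hG, shf_add]
  set η : ℝ := if 0 ≤ z k then -(b / 2) else b / 2 with hη
  have hηb : |η| < b := by
    rw [hη]; split_ifs <;> rw [abs_lt] <;> constructor <;> linarith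
  have hηz : η * z k = -(b / 2 * |z k|) := by
    rw [hη]; split_ifs with h
    · rw [abs_of_nonneg h]; ring
    · rw [abs_of_neg (not_le.mp h)]; ring
  have hmain : ∫ l : Eu m, P (cl l) * kf n (ssq (cl l)) (u ^ 2) (v ^ 2) * ph (cl l) z = ∫ l, G l (Complex.I * η) := by
    rw [hshift η hηb]
    simp only [hG, shf_zero]
  rw [hmain]
  have hIR : Integrable fun l : Eu m => exp (-(1/8 * (R * ‖l‖))) := by
    have := integrable_exp_norm m (show (0:ℝ) < R/8 by positivity)
    refine this.congr (ae_of_all _ fun l => ?_)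
    simp only; congr 1; ring
  calc _ ≤ ∫ l, D * C0 * exp 1 * E * exp (-(1/8 * (R * ‖l‖))) * exp (η * z k) :=
        norm_integral_le_of_norm_le ((hIR.const_mul _).mul_const _) (ae_of_all _ fun l => hbG l η hηb)
    _ = D * C0 * exp 1 * E * ((R ^ m)⁻¹ * I0) * exp (η * z k) := by
        rw [integral_mul_const, integral_const_mul, int_scale m hR0 (fun w => exp (-(1/8 * w)))]
    _ ≤ D * C0 * exp 1 * E * ((R ^ m)⁻¹ * (I0 + 1)) * exp (-(r / (2 * m) * (‖z‖ / R))) := by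
        gcongr
        · linarith
        · rw [hηz]
          have hm0 : (0:ℝ) < m := by exact_mod_cast hm
          rw [neg_le_neg_iff, hb]
          calc r / (2 * m) * (‖z‖ / R) ≤ r / (2 * m) * ((m * |z k|) / R) := by gcongr
            _ = _ := by field_simp
    _ = _ := by ring

end GR
end

section
open scoped ENNReal NNReal Topology ComplexConjugate
namespace GR
set_option linter.unusedSectionVars false

/-- Polynomial symbols. -/
inductive Sym (n m : ℕ) : Type
  | const (c : ℂ) : Sym n m
  | dr (j : Fin n) : Sym n m
  | u (j : Fin n) : Sym n m
  | lam (k : Fin m) : Sym n m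
  | lv (j : Fin n) (k : Fin m) : Sym n m
  | ca : Sym n m
  | cb : Sym n m
  | add (e f : Sym n m) : Sym n m
  | mul (e f : Sym n m) : Sym n m

variable {n m : ℕ}

/-- evaluation of symbols -/
def ev (A u v : Eu n) (ζ : Fin m → ℂ) : Sym n m → ℂ
  | .const c => c
  | .dr j => (A j : ℂ)
  | .u j => (u j : ℂ)
  | .lam k => ζ k
  | .lv j k => ζ k * (v j : ℂ)
  | .ca => fa (ssq ζ)
  | .cb => fb (ssq ζ)
  | .add e f => ev A u v ζ e + ev A u v ζ f
  | .mul e f => ev A u v ζ e * ev A u v ζ f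

/-- symbol sums -/
def lsum : List (Sym n m) → Sym n m
  | [] => .const 0
  | e :: L => .add e (lsum L)

theorem ev_lsum (A u v : Eu n) (ζ : Fin m → ℂ) (L : List (Sym n m)) :
    ev A u v ζ (lsum L) = (L.map (ev A u v ζ)).sum := by
  induction L with
  | nil => simp [lsum, ev]
  | cons e L ih => simp [lsum, ev, ih]

/-- derivative of a symbol in the direction `(u,v) = (sg,1) e_j` -/
def dS (sg : ℝ) (j : Fin n) : Sym n m → Sym n m
  | .const _ => .const 0
  | .dr _ => .const 0
  | .u i => .const (if i = j then sg else 0)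
  | .lam _ => .const 0
  | .lv i k => if i = j then .lam k else .const 0
  | .ca => .const 0
  | .cb => .const 0
  | .add e f => .add (dS sg j e) (dS sg j f)
  | .mul e f => .add (.mul (dS sg j e) f) (.mul e (dS sg j f))

/-- logarithmic derivative of the exponential -/
def Ls (sg : ℝ) (j : Fin n) : Sym n m :=
  .mul (.const (-(1/2))) (.add (.mul (.const sg) (.mul .ca (.u j)))
    (.mul .cb (lsum ((List.finRange m).map fun k => .mul (.lam k) (.lv j k)))))

theorem ev_Ls (sg : ℝ) (j : Fin n) (A u v : Eu n) (ζ : Fin m → ℂ) :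
    ev A u v ζ (Ls sg j) = -(1/2) * (sg * (fa (ssq ζ) * u j) + fb (ssq ζ) * (ssq ζ * v j)) := by
  simp only [Ls, ev, ev_lsum, List.map_map, Function.comp_def]
  rw [← Fin.sum_univ_def, ssq, Finset.sum_mul]
  have : ∑ i, ζ i * (ζ i * (v j : ℂ)) = ∑ i, ζ i ^ 2 * (v j : ℂ) :=
    Finset.sum_congr rfl fun k _ => by ring
  rw [this]

theorem ev_hasDerivAt (sg : ℝ) (A u v w : Eu n) (ζ : Fin m → ℂ) (e : Sym n m) :
    HasDerivAt (fun s : ℝ => ev A (u + (s * sg) • w) (v + s • w) ζ e)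
      (∑ j, (w j : ℂ) * ev A u v ζ (dS sg j e)) 0 := by
  induction e with
  | const c => simpa [ev, dS] using hasDerivAt_const (0:ℝ) c
  | dr i => simpa [ev, dS] using hasDerivAt_const (0:ℝ) _
  | lam i => simpa [ev, dS] using hasDerivAt_const (0:ℝ) _
  | ca => simpa [ev, dS] using hasDerivAt_const (0:ℝ) _
  | cb => simpa [ev, dS] using hasDerivAt_const (0:ℝ) _
  | u i =>
    simp only [ev, dS]
    have : HasDerivAt (fun s : ℝ => (((u i + s * sg * w i : ℝ)) : ℂ)) ((sg * w i : ℝ) : ℂ) 0 := by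
      apply HasDerivAt.ofReal_comp
      have h := (((hasDerivAt_id (0:ℝ)).mul_const sg).mul_const (w i)).const_add (u i)
      simpa using h
    refine this.congr_deriv ?_
    rw [Finset.sum_eq_single i]
    · simp [mul_comm]
    · intro b _ hb; simp [Ne.symm hb]
    · simp
  | lv i k =>
    simp only [ev, dS]
    have : HasDerivAt (fun s : ℝ => ζ k * (((v i + s * w i : ℝ)) : ℂ)) (ζ k * (w i : ℝ)) 0 := by
      apply HasDerivAt.const_mul
      apply HasDerivAt.ofReal_comp
      have h := ((hasDerivAt_id (0:ℝ)).mul_const (w i)).const_add (v i)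
      simpa using h
    refine this.congr_deriv ?_
    rw [Finset.sum_eq_single i]
    · simp [ev, mul_comm]
    · intro b _ hb; simp [ev, Ne.symm hb]
    · simp
  | add e f he hf =>
    simp only [ev, dS]
    refine (he.fun_add hf).congr_deriv ?_
    rw [← Finset.sum_add_distrib]
    exact Finset.sum_congr rfl fun j _ => by ring
  | mul e f he hf =>
    simp only [ev, dS]
    refine (he.fun_mul hf).congr_deriv ?_
    simp only [zero_mul, zero_smul, add_zero, Finset.sum_mul, Finset.mul_sum]
    rw [← Finset.sum_add_distrib]
    exact Finset.sum_congr rfl fun j _ => by ring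

theorem hasDerivAt_normsq (u w : Eu n) (sg : ℝ) :
    HasDerivAt (fun s : ℝ => ‖u + (s * sg) • w‖ ^ 2) (2 * sg * dotp u w) 0 := by
  have : ∀ s : ℝ, ‖u + (s * sg) • w‖ ^ 2 = ‖u‖^2 + 2 * sg * dotp u w * s + s ^ 2 * (sg ^ 2 * ‖w‖^2) := by
    intro s
    rw [norm_sq_eu, norm_sq_eu, norm_sq_eu, dotp, Finset.mul_sum, Finset.sum_mul, Finset.mul_sum, Finset.mul_sum,
      ← Finset.sum_add_distrib, ← Finset.sum_add_distrib]
    refine Finset.sum_congr rfl fun i _ => ?_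
    simp; ring
  simp_rw [this]
  have h := (((hasDerivAt_id (0:ℝ)).const_mul (2 * sg * dotp u w)).const_add (‖u‖^2)).fun_add
    (((hasDerivAt_id (0:ℝ)).pow 2).mul_const (sg ^ 2 * ‖w‖^2))
  refine h.congr_deriv ?_
  simp

/-- the full symbol -/
def Ph (A : Eu n) (e : Sym n m) (u v : Eu n) (ζ : Fin m → ℂ) : ℂ :=
  ev A u v ζ e * kf n (ssq ζ) (‖u‖ ^ 2) (‖v‖ ^ 2)

/-- derivative symbol -/
def D1 (sg : ℝ) (j : Fin n) (e : Sym n m) : Sym n m := .add (dS sg j e) (.mul (Ls sg j) e)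

theorem Ph_hasDerivAt (sg : ℝ) (A u v w : Eu n) (ζ : Fin m → ℂ) (e : Sym n m) :
    HasDerivAt (fun s : ℝ => Ph A e (u + (s * sg) • w) (v + s • w) ζ)
      (∑ j, (w j : ℂ) * Ph A (D1 sg j e) u v ζ) 0 := by
  have h1 := ev_hasDerivAt sg A u v w ζ e
  have h2 : HasDerivAt (fun s : ℝ => kf n (ssq ζ) (‖u + (s * sg) • w‖ ^ 2) (‖v + s • w‖ ^ 2))
      (kf n (ssq ζ) (‖u‖ ^ 2) (‖v‖ ^ 2) *
        (-(1/4) * (fa (ssq ζ) * (2 * sg * dotp u w : ℝ) + ssq ζ * fb (ssq ζ) * (2 * dotp v w : ℝ)))) 0 := by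
    have a1 := (hasDerivAt_normsq u w sg).ofReal_comp
    have a2 := (hasDerivAt_normsq v w 1).ofReal_comp
    simp only [mul_one] at a2
    unfold kf
    have a3 := (((a1.const_mul (fa (ssq ζ))).fun_add (a2.const_mul (ssq ζ * fb (ssq ζ)))).const_mul (-(1/4):ℂ)).cexp
    have a4 := a3.const_mul ((4 * π * Sf (4 * ssq ζ)) ^ (((-(n:ℝ)/2 : ℝ)) : ℂ))
    refine a4.congr_deriv ?_
    simp [mul_assoc]
  unfold Ph
  refine (h1.fun_mul h2).congr_deriv ?_
  simp only [zero_mul, zero_smul, add_zero, D1, ev, ev_Ls, dotp, Finset.mul_sum, Finset.sum_mul]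
  push_cast
  simp only [Finset.mul_sum, ← Finset.sum_add_distrib]
  exact Finset.sum_congr rfl fun j _ => by ring

theorem fa_diffAt {s : ℂ} (h : Good s) : DifferentiableAt ℂ fa s := (Cf_diff s).div (Sf_diff s) h.1
theorem fb_diffAt {s : ℂ} (h : Good s) : DifferentiableAt ℂ fb s := (Sf_diff s).div (Cf_diff s) h.2.1

theorem ev_cont {Ω : Type*} [TopologicalSpace Ω] {A u v : Ω → Eu n} {ζ : Ω → Fin m → ℂ}
    (hA : Continuous A) (hu : Continuous u) (hv : Continuous v) (hζ : Continuous ζ)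
    (hg : ∀ ω, Good (ssq (ζ ω))) (e : Sym n m) : Continuous fun ω => ev (A ω) (u ω) (v ω) (ζ ω) e := by
  have hs : Continuous fun ω => ssq (ζ ω) := by unfold ssq; fun_prop
  induction e with
  | const c => exact continuous_const
  | dr i => simp only [ev]; fun_prop
  | lam i => simp only [ev]; fun_prop
  | ca => exact continuous_iff_continuousAt.mpr fun ω => (fa_diffAt (hg ω)).continuousAt.comp (f := fun ω => ssq (ζ ω)) hs.continuousAt
  | cb => exact continuous_iff_continuousAt.mpr fun ω => (fb_diffAt (hg ω)).continuousAt.comp (f := fun ω => ssq (ζ ω)) hs.continuousAt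
  | u i => simp only [ev]; fun_prop
  | lv i k => simp only [ev]; fun_prop
  | add e f he hf => exact he.add hf
  | mul e f he hf => exact he.mul hf

theorem ev_diff {A u v : Eu n} {ζ : ℂ → Fin m → ℂ} {τ : ℂ}
    (hζ : ∀ i, DifferentiableAt ℂ (fun τ => ζ τ i) τ)
    (hg : Good (ssq (ζ τ))) (e : Sym n m) : DifferentiableAt ℂ (fun τ => ev A u v (ζ τ) e) τ := by
  have hs : DifferentiableAt ℂ (fun τ => ssq (ζ τ)) τ := by
    unfold ssq
    refine DifferentiableAt.fun_sum fun i _ => (hζ i).pow 2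
  induction e with
  | const c => exact differentiableAt_const _
  | dr i => exact differentiableAt_const _
  | lam i => exact hζ i
  | ca => exact (fa_diffAt hg).comp (f := fun τ => ssq (ζ τ)) τ hs
  | cb => exact (fb_diffAt hg).comp (f := fun τ => ssq (ζ τ)) τ hs
  | u i => exact differentiableAt_const _
  | lv i k => exact (hζ k).mul (differentiableAt_const _)
  | add e f he hf => exact he.add hf
  | mul e f he hf => exact he.mul hf

theorem kf_cont {Ω : Type*} [TopologicalSpace Ω] {U V : Ω → ℝ} {s : Ω → ℂ} (hU : Continuous U)
    (hV : Continuous V) (hs : Continuous s) (hg : ∀ ω, Good (s ω)) :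
    Continuous fun ω => kf n (s ω) (U ω) (V ω) := by
  unfold kf
  have hfa : Continuous fun ω => fa (s ω) := continuous_iff_continuousAt.mpr fun ω => (fa_diffAt (hg ω)).continuousAt.comp (f := s) hs.continuousAt
  have hfb : Continuous fun ω => fb (s ω) := continuous_iff_continuousAt.mpr fun ω => (fb_diffAt (hg ω)).continuousAt.comp (f := s) hs.continuousAt
  have hS : Continuous fun ω => Sf (4 * s ω) := Sf_diff.continuous.comp (by fun_prop)
  refine Continuous.mul ?_ (by fun_prop)
  refine Continuous.cpow (by fun_prop) continuous_const fun ω => (hg ω).2.2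

theorem norm_shf_le (l : Eu m) (k i : Fin m) (η : ℝ) : ‖shf l k (Complex.I * η) i‖ ≤ ‖l‖ + |η| := by
  refine (norm_add_le _ _).trans ?_
  gcongr
  · rw [Complex.norm_real]; exact coord_le l i
  · split_ifs <;> simp

/-- weight -/
def Wt (A u v : Eu n) (l : Eu m) : ℝ := (1 + ‖A‖) * ((1 + ‖u‖) * (1 + ‖l‖ * (1 + ‖v‖)))

theorem Wt_ge (A u v : Eu n) (l : Eu m) : 1 ≤ Wt A u v l ∧ 1 + ‖A‖ ≤ Wt A u v l ∧ 1 + ‖u‖ ≤ Wt A u v l ∧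
    1 + ‖l‖ * (1 + ‖v‖) ≤ Wt A u v l := by
  have h1 : 1 ≤ 1 + ‖A‖ := by simp
  have h2 : 1 ≤ 1 + ‖u‖ := by simp
  have h3 : 1 ≤ 1 + ‖l‖ * (1 + ‖v‖) := by
    have : 0 ≤ ‖l‖ * (1 + ‖v‖) := by positivity
    linarith
  unfold Wt
  generalize 1 + ‖A‖ = a at *
  generalize 1 + ‖u‖ = b at *
  generalize 1 + ‖l‖ * (1 + ‖v‖) = c at *
  have hbc : 1 ≤ b * c := one_le_mul_of_one_le_of_one_le h2 h3
  refine ⟨one_le_mul_of_one_le_of_one_le h1 hbc, le_mul_of_one_le_right (by linarith) hbc, ?_, ?_⟩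
  · exact (le_mul_of_one_le_right (by linarith) h3).trans (le_mul_of_one_le_left (by linarith) h1)
  · exact (le_mul_of_one_le_left (by linarith) h2).trans (le_mul_of_one_le_left (by linarith) h1)

theorem ev_bound (e : Sym n m) : ∃ (C : ℝ) (N : ℕ), 0 ≤ C ∧ ∀ (A u v : Eu n) (l : Eu m) (k : Fin m) (η : ℝ),
    |η| * (1 + ‖v‖) ≤ 1/2 → ‖ev A u v (shf l k (Complex.I * η)) e‖ ≤ C * Wt A u v l ^ N ∧
     ‖ev A u v (shf l k (Complex.I * η)) e - ev 0 u v (shf l k (Complex.I * η)) e‖ ≤ ‖A‖ * (C * Wt A u v l ^ N) := by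
  have key : ∀ (v : Eu n) (η : ℝ), |η| * (1 + ‖v‖) ≤ 1/2 → |η| ≤ 1/2 := fun v η h =>
    (le_mul_of_one_le_right (abs_nonneg _) (by simp)).trans h
  induction e with
  | const c =>
    refine ⟨‖c‖, 0, norm_nonneg _, fun A u v l k η h => ?_⟩
    simp [ev]; positivity
  | dr i =>
    refine ⟨1, 1, zero_le_one, fun A u v l k η h => ?_⟩
    obtain ⟨w1, w2, w3, w4⟩ := Wt_ge A u v l
    have := coord_le A i
    simp only [ev, pow_one, one_mul, Complex.norm_real, Real.norm_eq_abs, PiLp.zero_apply, Complex.ofReal_zero, sub_zero]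
    exact ⟨by linarith, this.trans (le_mul_of_one_le_right (norm_nonneg _) w1)⟩
  | u i =>
    refine ⟨1, 1, zero_le_one, fun A u v l k η h => ?_⟩
    obtain ⟨w1, w2, w3, w4⟩ := Wt_ge A u v l
    have := coord_le u i
    simp only [ev, pow_one, one_mul, Complex.norm_real, Real.norm_eq_abs, sub_self, norm_zero]
    exact ⟨by linarith, by positivity⟩
  | lam i =>
    refine ⟨1, 1, zero_le_one, fun A u v l k η h => ?_⟩
    obtain ⟨w1, w2, w3, w4⟩ := Wt_ge A u v l
    have h1 := norm_shf_le l k i η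
    have h2 := key v η h
    simp only [ev, pow_one, one_mul, sub_self, norm_zero]
    refine ⟨?_, by positivity⟩
    nlinarith [norm_nonneg l, norm_nonneg v, mul_nonneg (norm_nonneg l) (norm_nonneg v)]
  | lv i j =>
    refine ⟨1, 1, zero_le_one, fun A u v l k η h => ?_⟩
    obtain ⟨w1, w2, w3, w4⟩ := Wt_ge A u v l
    have h1 := norm_shf_le l k j η
    have h3 := coord_le v i
    simp only [ev, pow_one, one_mul, sub_self, norm_zero, norm_mul, Complex.norm_real, Real.norm_eq_abs]
    refine ⟨?_, by positivity⟩
    calc _ ≤ (‖l‖ + |η|) * ‖v‖ := mul_le_mul h1 h3 (abs_nonneg _) (by positivity)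
      _ ≤ _ := by nlinarith [norm_nonneg l, abs_nonneg η]
  | ca =>
    refine ⟨2, 1, zero_le_two, fun A u v l k η h => ?_⟩
    obtain ⟨w1, w2, w3, w4⟩ := Wt_ge A u v l
    have h2 := key v η h
    simp only [ev, pow_one, sub_self, norm_zero]
    refine ⟨?_, by positivity⟩
    obtain ⟨z, hz, g1, g2, g3⟩ := exists_root l k η
    rw [← hz]
    refine (a_norm_le (show |z.im| ≤ 1 by linarith)).trans ?_
    nlinarith [norm_nonneg l, norm_nonneg v, mul_nonneg (norm_nonneg l) (norm_nonneg v)]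
  | cb =>
    refine ⟨2, 0, zero_le_two, fun A u v l k η h => ?_⟩
    have h2 := key v η h
    simp only [ev, pow_zero, sub_self, norm_zero]
    refine ⟨?_, by positivity⟩
    obtain ⟨z, hz, g1, g2, g3⟩ := exists_root l k η
    rw [← hz, mul_one]
    exact b_norm_le (show |z.im| ≤ 1 by linarith)
  | add e f he hf =>
    obtain ⟨C1, N1, hC1, h1⟩ := he
    obtain ⟨C2, N2, hC2, h2⟩ := hf
    refine ⟨C1 + C2, N1 + N2, by positivity, fun A u v l k η h => ?_⟩
    obtain ⟨a1, a2⟩ := h1 A u v l k η h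
    obtain ⟨b1, b2⟩ := h2 A u v l k η h
    have w := (Wt_ge A u v l).1
    have p1 : C1 * Wt A u v l ^ N1 ≤ C1 * Wt A u v l ^ (N1 + N2) := by
      gcongr
      omega
    have p2 : C2 * Wt A u v l ^ N2 ≤ C2 * Wt A u v l ^ (N1 + N2) := by
      gcongr
      omega
    simp only [ev]
    constructor
    · refine (norm_add_le _ _).trans ?_
      rw [add_mul]; linarith
    · rw [add_sub_add_comm]
      refine (norm_add_le _ _).trans ?_
      rw [add_mul, mul_add]
      exact add_le_add (a2.trans (by gcongr)) (b2.trans (by gcongr))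
  | mul e f he hf =>
    obtain ⟨C1, N1, hC1, h1⟩ := he
    obtain ⟨C2, N2, hC2, h2⟩ := hf
    refine ⟨2 * (C1 * C2), N1 + N2, by positivity, fun A u v l k η h => ?_⟩
    obtain ⟨a1, a2⟩ := h1 A u v l k η h
    obtain ⟨b1, b2⟩ := h2 A u v l k η h
    obtain ⟨b0, -⟩ := h2 0 u v l k η h
    have w := (Wt_ge A u v l).1
    have w0 := (Wt_ge (0 : Eu n) u v l).1
    have b0' : ‖ev 0 u v (shf l k (Complex.I * η)) f‖ ≤ C2 * Wt A u v l ^ N2 := by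
      refine b0.trans ?_
      gcongr
      unfold Wt
      gcongr
      simp
    simp only [ev]
    have hpos : 0 ≤ C1 * Wt A u v l ^ N1 * (C2 * Wt A u v l ^ N2) := by positivity
    constructor
    · rw [norm_mul]
      calc _ ≤ C1 * Wt A u v l ^ N1 * (C2 * Wt A u v l ^ N2) := mul_le_mul a1 b1 (norm_nonneg _) (by positivity)
        _ ≤ 2 * (C1 * Wt A u v l ^ N1 * (C2 * Wt A u v l ^ N2)) := by linarith
        _ = _ := by rw [pow_add]; ring
    · rw [show ∀ p q p' q' : ℂ, p * q - p' * q' = p * (q - q') + (p - p') * q' by intros; ring]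
      refine (norm_add_le _ _).trans ?_
      rw [norm_mul, norm_mul]
      calc _ ≤ (C1 * Wt A u v l ^ N1) * (‖A‖ * (C2 * Wt A u v l ^ N2)) + (‖A‖ * (C1 * Wt A u v l ^ N1)) * (C2 * Wt A u v l ^ N2) :=
            add_le_add (mul_le_mul a1 b2 (norm_nonneg _) (by positivity)) (mul_le_mul a2 b0' (norm_nonneg _) (by positivity))
        _ = _ := by rw [pow_add]; ring

end GR
end

section
open scoped ENNReal NNReal Topology ComplexConjugate
namespace GR
set_option linter.unusedSectionVars false
variable {n m : ℕ}

/-- normalizing constant -/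
def cst (m : ℕ) : ℂ := ((((2 * π) ^ m)⁻¹ : ℝ) : ℂ)

/-- kernels in `(u,v,z)` coordinates -/
def J (A : Eu n) (e : Sym n m) (u v : Eu n) (z : Eu m) : ℂ :=
  cst m * ∫ l : Eu m, Ph A e u v (cl l) * ph (cl l) z

theorem pow_exp_sq_le (N : ℕ) {c : ℝ} (hc : 0 < c) :
    ∃ C : ℝ, 0 < C ∧ ∀ w : ℝ, 0 ≤ w → (1 + w) ^ N ≤ C * exp (c * w ^ 2) := by
  obtain ⟨C, hC, h⟩ := pow_exp_le N hc
  refine ⟨C * exp c, by positivity, fun w hw => (h w hw).trans ?_⟩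
  rw [mul_assoc, ← exp_add]
  gcongr
  nlinarith [sq_nonneg (w - 1)]

theorem cl_eq (k : Fin m) (l : Eu m) : cl l = shf l k (Complex.I * ((0:ℝ):ℂ)) := by
  simp [shf_zero]

theorem Ph_bound (hn : 1 ≤ n) (hm : 1 ≤ m) (e : Sym n m) : ∃ (C : ℝ) (N : ℕ), 0 ≤ C ∧ ∀ (A u v : Eu n) (l : Eu m),
    ‖Ph A e u v (cl l)‖ ≤ C * (1 + ‖A‖) ^ N * exp (-(‖u‖ ^ 2 / 8)) * exp (-(‖l‖ * (1 + ‖v‖) / 8)) := by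
  obtain ⟨C, N, hC, h⟩ := ev_bound e
  obtain ⟨C1, hC1, h1⟩ := pow_exp_sq_le N (show (0:ℝ) < 1/8 by norm_num)
  obtain ⟨C2, hC2, h2⟩ := pow_exp_le N (show (0:ℝ) < 1/8 by norm_num)
  refine ⟨C * C1 * C2 * exp 1, N, by positivity, fun A u v l => ?_⟩
  have a1 := (h A u v l ⟨0, hm⟩ 0 (by simp)).1
  have a2 := kf_bound (n := n) hn l ⟨0, hm⟩ 0 ‖u‖ ‖v‖ (norm_nonneg _) (r := 0) (by norm_num) (by simp)
  rw [← cl_eq] at a1 a2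
  have b1 := h1 ‖u‖ (norm_nonneg _)
  have b2 := h2 (‖l‖ * (1 + ‖v‖)) (by positivity)
  rw [Ph, norm_mul]
  calc _ ≤ (C * ((1 + ‖A‖) ^ N * ((C1 * exp (1/8 * ‖u‖^2)) * (C2 * exp (1/8 * (‖l‖ * (1 + ‖v‖))))))) *
        (exp 1 * exp (-((1 - 0 ^ 2) * ‖u‖ ^ 2 / 4)) * exp (-(‖l‖ * (1 + ‖v‖) / 4))) := by
        refine mul_le_mul (a1.trans ?_) a2 (norm_nonneg _) (by positivity)
        rw [Wt, mul_pow, mul_pow]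
        gcongr
    _ = C * C1 * C2 * exp 1 * (1 + ‖A‖) ^ N * (exp (1/8 * ‖u‖^2) * exp (-((1 - 0 ^ 2) * ‖u‖ ^ 2 / 4))) *
        (exp (1/8 * (‖l‖ * (1 + ‖v‖))) * exp (-(‖l‖ * (1 + ‖v‖) / 4))) := by ring
    _ = _ := by
        rw [← exp_add, ← exp_add]
        congr 3
        · congr 1; ring
        · ring

theorem Ph_bound' (hn : 1 ≤ n) (hm : 1 ≤ m) (e : Sym n m) : ∃ (C : ℝ) (N : ℕ), 0 ≤ C ∧ ∀ (A u v : Eu n) (l z : Eu m),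
    ‖Ph A e u v (cl l) * ph (cl l) z‖ ≤ C * (1 + ‖A‖) ^ N * exp (-(1/8 * ‖l‖)) := by
  obtain ⟨C, N, hC, h⟩ := Ph_bound hn hm e
  refine ⟨C, N, hC, fun A u v l z => ?_⟩
  rw [norm_mul, norm_ph_cl, mul_one]
  refine (h A u v l).trans ?_
  have e1 : exp (-(‖u‖ ^ 2 / 8)) ≤ 1 := exp_le_one_iff.mpr (by have := sq_nonneg ‖u‖; linarith)
  have e2 : exp (-(‖l‖ * (1 + ‖v‖) / 8)) ≤ exp (-(1/8 * ‖l‖)) := by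
    apply exp_le_exp.mpr
    nlinarith [norm_nonneg l, norm_nonneg v, mul_nonneg (norm_nonneg l) (norm_nonneg v)]
  calc _ ≤ C * (1 + ‖A‖) ^ N * 1 * exp (-(1/8 * ‖l‖)) := by gcongr
    _ = _ := by ring

theorem cl_cont : Continuous (cl : Eu m → _) := by unfold cl; fun_prop

theorem Phph_cont (e : Sym n m) {Ω : Type*} [TopologicalSpace Ω] {A u v : Ω → Eu n} {l z : Ω → Eu m}
    (hA : Continuous A) (hu : Continuous u) (hv : Continuous v) (hl : Continuous l) (hz : Continuous z) :
    Continuous fun ω => Ph (A ω) e (u ω) (v ω) (cl (l ω)) * ph (cl (l ω)) (z ω) := by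
  have hcl : Continuous fun ω => cl (l ω) := cl_cont.comp hl
  have hs : Continuous fun ω => ssq (cl (l ω)) := by unfold ssq; fun_prop
  refine Continuous.mul (Continuous.mul ?_ ?_) ?_
  · exact ev_cont hA hu hv hcl (fun ω => good_cl _) e
  · exact kf_cont (by fun_prop) (by fun_prop) hs fun ω => good_cl _
  · unfold ph; fun_prop

theorem Phph_int (hn : 1 ≤ n) (hm : 1 ≤ m) (A u v : Eu n) (e : Sym n m) (z : Eu m) :
    Integrable fun l : Eu m => Ph A e u v (cl l) * ph (cl l) z := by
  obtain ⟨C, N, hC, h⟩ := Ph_bound' hn hm e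
  exact ((integrable_exp_norm m (show (0:ℝ) < 1/8 by norm_num)).const_mul (C * (1 + ‖A‖) ^ N)).mono'
    (Phph_cont e continuous_const continuous_const continuous_const continuous_id continuous_const).aestronglyMeasurable
    (ae_of_all _ fun l => h A u v l z)

theorem J_cont (hn : 1 ≤ n) (hm : 1 ≤ m) (e : Sym n m) :
    Continuous fun q : Eu n × Eu n × Eu n × Eu m => J q.1 e q.2.1 q.2.2.1 q.2.2.2 := by
  obtain ⟨C, N, hC, h⟩ := Ph_bound' hn hm e
  refine continuous_const.mul (continuous_iff_continuousAt.mpr fun q0 => ?_)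
  refine continuousAt_of_dominated (bound := fun l => C * (1 + (‖q0.1‖ + 1)) ^ N * exp (-(1/8 * ‖l‖))) ?_ ?_ ?_ ?_
  · exact Eventually.of_forall fun q => (Phph_int hn hm _ _ _ _ _).aestronglyMeasurable
  · have : ∀ᶠ q in 𝓝 q0, ‖q.1‖ < ‖q0.1‖ + 1 := by
      have hc : Continuous fun q : Eu n × Eu n × Eu n × Eu m => ‖q.1‖ := by fun_prop
      exact hc.continuousAt.eventually_lt continuousAt_const (by simp)
    filter_upwards [this] with q hq
    refine ae_of_all _ fun l => (h _ _ _ _ _).trans ?_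
    gcongr
  · exact (integrable_exp_norm m (show (0:ℝ) < 1/8 by norm_num)).const_mul _
  · refine ae_of_all _ fun l => Continuous.continuousAt ?_
    exact Phph_cont e (by fun_prop) (by fun_prop) (by fun_prop) continuous_const (by fun_prop)

/-- derivative symbol in `z_k` -/
def D2 (k : Fin m) (e : Sym n m) : Sym n m := .mul (.mul (.const (-Complex.I)) (.lam k)) e

theorem ph_hasDerivAt (l z w : Eu m) :
    HasDerivAt (fun s : ℝ => ph (cl l) (z + s • w)) (∑ k, (w k : ℂ) * (-Complex.I * cl l k) * ph (cl l) z) 0 := by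
  unfold ph
  have h1 : HasDerivAt (fun s : ℝ => ∑ i, cl l i * (((z i + s * w i : ℝ)) : ℂ)) (∑ i, cl l i * (w i : ℝ)) 0 := by
    refine HasDerivAt.fun_sum fun i _ => ?_
    apply HasDerivAt.const_mul
    apply HasDerivAt.ofReal_comp
    have h := ((hasDerivAt_id (0:ℝ)).mul_const (w i)).const_add (z i)
    simpa using h
  refine ((h1.const_mul (-Complex.I)).cexp).congr_deriv ?_
  simp only [zero_mul, add_zero, Finset.mul_sum]
  exact Finset.sum_congr rfl fun i _ => by ring

theorem shift_deriv {f : ℝ → ℂ} {d : ℂ} {s : ℝ} (h : HasDerivAt (fun t => f (s + t)) d 0) : HasDerivAt f d s := by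
  have : HasDerivAt (fun t => (fun t => f (s + t)) (t - s)) d s := by
    refine HasDerivAt.comp_sub_const (f := fun t => f (s + t)) s s ?_
    simpa using h
  simpa using this

theorem Phph_hasDerivAt (sg : ℝ) (A u v w : Eu n) (l z w2 : Eu m) (e : Sym n m) (s0 : ℝ) :
    HasDerivAt (fun s : ℝ => Ph A e (u + (s * sg) • w) (v + s • w) (cl l) * ph (cl l) (z + s • w2))
      (∑ j, (w j : ℂ) * (Ph A (D1 sg j e) (u + (s0 * sg) • w) (v + s0 • w) (cl l) * ph (cl l) (z + s0 • w2)) +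
       ∑ k, (w2 k : ℂ) * (Ph A (D2 k e) (u + (s0 * sg) • w) (v + s0 • w) (cl l) * ph (cl l) (z + s0 • w2))) s0 := by
  apply shift_deriv
  have h1 := Ph_hasDerivAt sg A (u + (s0 * sg) • w) (v + s0 • w) w (cl l) e
  have h2 := ph_hasDerivAt l (z + s0 • w2) w2
  have h3 := h1.fun_mul h2
  have e1 : ∀ t : ℝ, u + ((s0 + t) * sg) • w = u + (s0 * sg) • w + (t * sg) • w := fun t => by module
  have e2 : ∀ t : ℝ, v + (s0 + t) • w = v + s0 • w + t • w := fun t => by module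
  have e3 : ∀ t : ℝ, z + (s0 + t) • w2 = z + s0 • w2 + t • w2 := fun t => by module
  simp_rw [e1, e2, e3]
  refine h3.congr_deriv ?_
  simp only [zero_mul, zero_smul, add_zero, Finset.sum_mul, Finset.mul_sum, D2]
  congr 1
  · exact Finset.sum_congr rfl fun i _ => by ring
  · exact Finset.sum_congr rfl fun i _ => by simp only [Ph, ev]; ring

theorem J_hasDerivAt (hn : 1 ≤ n) (hm : 1 ≤ m) (sg : ℝ) (A u v w : Eu n) (z w2 : Eu m) (e : Sym n m) (s0 : ℝ) :
    HasDerivAt (fun s : ℝ => J A e (u + (s * sg) • w) (v + s • w) (z + s • w2))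
      (∑ j, (w j : ℂ) * J A (D1 sg j e) (u + (s0 * sg) • w) (v + s0 • w) (z + s0 • w2) +
       ∑ k, (w2 k : ℂ) * J A (D2 k e) (u + (s0 * sg) • w) (v + s0 • w) (z + s0 • w2)) s0 := by
  choose C1 N1 hC1 h1 using fun j => Ph_bound' hn hm (D1 sg j e)
  choose C2 N2 hC2 h2 using fun k => Ph_bound' hn hm (D2 k e)
  have key := (hasDerivAt_integral_of_dominated_loc_of_deriv_le
    (F := fun s (l : Eu m) => Ph A e (u + (s * sg) • w) (v + s • w) (cl l) * ph (cl l) (z + s • w2))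
    (F' := fun s (l : Eu m) => (∑ j, (w j : ℂ) * (Ph A (D1 sg j e) (u + (s * sg) • w) (v + s • w) (cl l) * ph (cl l) (z + s • w2)) +
       ∑ k, (w2 k : ℂ) * (Ph A (D2 k e) (u + (s * sg) • w) (v + s • w) (cl l) * ph (cl l) (z + s • w2))))
    (x₀ := s0) (s := univ) (μ := volume)
    (bound := fun l => (∑ j, |w j| * (C1 j * (1 + ‖A‖) ^ N1 j) + ∑ k, |w2 k| * (C2 k * (1 + ‖A‖) ^ N2 k)) * exp (-(1/8 * ‖l‖)))
    univ_mem ?_ ?_ ?_ ?_ ?_ ?_).2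
  · have k2 := key.const_mul (cst m)
    unfold J
    refine k2.congr_deriv ?_
    rw [integral_add, integral_finsetSum, integral_finsetSum]
    · simp only [integral_const_mul, mul_add, Finset.mul_sum]
      congr 1
      · exact Finset.sum_congr rfl fun i _ => by ring
      · exact Finset.sum_congr rfl fun i _ => by ring
    · intro i _; exact (Phph_int hn hm _ _ _ _ _).const_mul _
    · intro i _; exact (Phph_int hn hm _ _ _ _ _).const_mul _
    · exact integrable_finsetSum _ fun i _ => (Phph_int hn hm _ _ _ _ _).const_mul _
    · exact integrable_finsetSum _ fun i _ => (Phph_int hn hm _ _ _ _ _).const_mul _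
  · exact Eventually.of_forall fun s => (Phph_int hn hm _ _ _ _ _).aestronglyMeasurable
  · exact Phph_int hn hm _ _ _ _ _
  · refine AEStronglyMeasurable.add ?_ ?_
    · exact (integrable_finsetSum _ fun i _ => (Phph_int hn hm _ _ _ _ _).const_mul _).aestronglyMeasurable
    · exact (integrable_finsetSum _ fun i _ => (Phph_int hn hm _ _ _ _ _).const_mul _).aestronglyMeasurable
  · refine ae_of_all _ fun l s _ => ?_
    refine (norm_add_le _ _).trans ?_
    rw [add_mul, Finset.sum_mul, Finset.sum_mul]
    refine add_le_add ((norm_sum_le _ _).trans (Finset.sum_le_sum fun j _ => ?_)) ((norm_sum_le _ _).trans (Finset.sum_le_sum fun j _ => ?_))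
    · rw [norm_mul, Complex.norm_real, Real.norm_eq_abs, mul_assoc]
      exact mul_le_mul_of_nonneg_left (h1 j _ _ _ _ _) (abs_nonneg _)
    · rw [norm_mul, Complex.norm_real, Real.norm_eq_abs, mul_assoc]
      exact mul_le_mul_of_nonneg_left (h2 j _ _ _ _ _) (abs_nonneg _)
  · exact (integrable_exp_norm m (show (0:ℝ) < 1/8 by norm_num)).const_mul _
  · exact ae_of_all _ fun l s _ => Phph_hasDerivAt sg A u v w l z w2 e s

/-- pointwise majorant -/
def Mj (κ c : ℝ) (u v : Eu n) (z : Eu m) : ℝ :=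
  exp (-(κ * ‖u‖ ^ 2)) * ((1 + ‖v‖) ^ m)⁻¹ * exp (-(c * (‖z‖ / (1 + ‖v‖))))

theorem J_bound (hn : 1 ≤ n) (hm : 1 ≤ m) {κ : ℝ} (hκ0 : 0 ≤ κ) (hκ : κ < 1/4) :
    ∃ c : ℝ, 0 < c ∧ ∀ e : Sym n m, ∃ (C : ℝ) (N : ℕ), 0 ≤ C ∧ ∀ (A u v : Eu n) (z : Eu m),
      ‖J A e u v z‖ ≤ C * (1 + ‖A‖) ^ N * Mj κ c u v z ∧
      ‖J A e u v z - J 0 e u v z‖ ≤ ‖A‖ * (C * (1 + ‖A‖) ^ N * Mj κ c u v z) := by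
  set r := (1 - 4 * κ) / 2 with hr
  have hr0 : 0 < r := by rw [hr]; linarith
  have hr1 : r ≤ 1/2 := by rw [hr]; linarith
  refine ⟨r / (2 * m), by positivity, fun e => ?_⟩
  obtain ⟨C, N, hC, h⟩ := ev_bound e
  obtain ⟨C2, hC2, h2⟩ := osc_bound n m hn hm N hr0 hr1
  set δ := (1 - r ^ 2) / 4 - κ with hδ
  have hδ0 : 0 < δ := by rw [hδ]; nlinarith
  obtain ⟨C1, hC1, h1⟩ := pow_exp_sq_le N hδ0
  have hcst : ‖cst m‖ ≤ 1 := by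
    rw [cst, Complex.norm_real, Real.norm_eq_abs, abs_of_pos (by positivity)]
    apply inv_le_one_of_one_le₀
    apply one_le_pow₀
    linarith [pi_gt_three]
  refine ⟨C2 * C * C1, N, by positivity, fun A u v z => ?_⟩
  have hgen : ∀ (P : (Fin m → ℂ) → ℂ) (D0 : ℝ), 0 ≤ D0 →
      (∀ k (τ : ℂ), |τ.im| ≤ 1/2 → Continuous fun l => P (shf l k τ)) →
      (∀ k l (τ : ℂ), |τ.im| ≤ 1/2 → DifferentiableAt ℂ (fun τ => P (shf l k τ)) τ) →
      (∀ k l (η : ℝ), |η| * (1 + ‖v‖) ≤ r → ‖P (shf l k (Complex.I * η))‖ ≤ D0 * (C * Wt A u v l ^ N)) →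
      ‖cst m * ∫ l : Eu m, P (cl l) * kf n (ssq (cl l)) (‖u‖ ^ 2) (‖v‖ ^ 2) * ph (cl l) z‖ ≤
        D0 * (C2 * C * C1 * (1 + ‖A‖) ^ N * Mj κ (r / (2 * m)) u v z) := by
    intro P D0 hD0 p1 p2 p3
    have := h2 ‖u‖ ‖v‖ (norm_nonneg _) P (D0 * C * ((1 + ‖A‖) ^ N * (1 + ‖u‖) ^ N)) (by positivity) p1 p2 (by
      intro k l η hη
      refine (p3 k l η hη).trans (le_of_eq ?_)
      rw [Wt, mul_pow, mul_pow]; ring) z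
    rw [norm_mul]
    calc _ ≤ 1 * _ := mul_le_mul hcst this (norm_nonneg _) zero_le_one
      _ ≤ 1 * (C2 * (D0 * C * ((1 + ‖A‖) ^ N * (C1 * exp (δ * ‖u‖ ^ 2)))) * exp (-((1 - r ^ 2) * ‖u‖ ^ 2 / 4)) * ((1 + ‖v‖) ^ m)⁻¹ *
          exp (-(r / (2 * m) * (‖z‖ / (1 + ‖v‖))))) := by
          gcongr
          exact h1 _ (norm_nonneg _)
      _ = D0 * (C2 * C * C1 * (1 + ‖A‖) ^ N * ((exp (δ * ‖u‖ ^ 2) * exp (-((1 - r ^ 2) * ‖u‖ ^ 2 / 4))) * ((1 + ‖v‖) ^ m)⁻¹ *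
          exp (-(r / (2 * m) * (‖z‖ / (1 + ‖v‖)))))) := by ring
      _ = _ := by
          rw [← exp_add, Mj, hδ]
          congr 5; ring_nf
  have hζ : ∀ l k (τ : ℂ) (i : Fin m), DifferentiableAt ℂ (fun τ => shf l k τ i) τ := by
    intro l k τ i
    unfold shf
    by_cases hik : i = k <;> simp only [hik, if_true, if_false] <;> fun_prop
  have hζc : ∀ k (τ : ℂ), Continuous fun l : Eu m => shf l k τ := by
    intro k τ; unfold shf; fun_prop
  constructor
  · have := hgen (fun ζ => ev A u v ζ e) 1 zero_le_one
      (fun k τ hτ => ev_cont continuous_const continuous_const continuous_const (hζc k τ) (fun l => good_shf l k τ hτ) e)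
      (fun k l τ hτ => ev_diff (hζ l k τ) (good_shf l k τ hτ) e)
      (fun k l η hη => by rw [one_mul]; exact (h A u v l k η (hη.trans hr1)).1)
    rw [one_mul] at this
    exact this
  · have := hgen (fun ζ => ev A u v ζ e - ev 0 u v ζ e) ‖A‖ (norm_nonneg _)
      (fun k τ hτ => (ev_cont continuous_const continuous_const continuous_const (hζc k τ) (fun l => good_shf l k τ hτ) e).sub
        (ev_cont continuous_const continuous_const continuous_const (hζc k τ) (fun l => good_shf l k τ hτ) e))
      (fun k l τ hτ => (ev_diff (hζ l k τ) (good_shf l k τ hτ) e).sub (ev_diff (hζ l k τ) (good_shf l k τ hτ) e))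
      (fun k l η hη => (h A u v l k η (hη.trans hr1)).2)
    refine le_trans (le_of_eq ?_) this
    congr 1
    rw [J, J, ← mul_sub, ← integral_sub (Phph_int hn hm _ _ _ _ _) (Phph_int hn hm _ _ _ _ _)]
    congr 2
    funext l
    simp only [Ph]; ring

end GR
end

section
open scoped ENNReal NNReal Topology ComplexConjugate
namespace GR
set_option linter.unusedSectionVars false
variable {n m : ℕ}

/-- quasi-distance -/
def rhoR (x y : Ep n m) : ℝ := ‖x.1 - y.1‖ + ‖x.2 - y.2‖ / (‖x.1‖ + ‖y.1‖ + √‖x.2 - y.2‖)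
/-- quasi-distance, extended -/
def rho (x y : Ep n m) : ℝ≥0∞ := ENNReal.ofReal (rhoR x y)

theorem rhoR_nonneg (x y : Ep n m) : 0 ≤ rhoR x y := by unfold rhoR; positivity

theorem rhoR_symm (x y : Ep n m) : rhoR x y = rhoR y x := by
  unfold rhoR; rw [norm_sub_rev x.1, norm_sub_rev x.2, add_comm ‖x.1‖]

theorem rho_symm (x y : Ep n m) : rho x y = rho y x := by rw [rho, rhoR_symm, rho]

theorem rhoR_meas : Measurable (Function.uncurry (rhoR : Ep n m → Ep n m → ℝ)) := by
  unfold rhoR Function.uncurry; fun_prop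

theorem rho_meas : Measurable (Function.uncurry (rho : Ep n m → Ep n m → ℝ≥0∞)) :=
  rhoR_meas.ennreal_ofReal

/-- majorant kernel -/
def Mk (κ c : ℝ) (x y : Ep n m) : ℝ := Mj κ c (y.1 - x.1) (y.1 + x.1) (y.2 - x.2)

theorem Mj_cont {Ω : Type*} [TopologicalSpace Ω] (κ c : ℝ) {u v : Ω → Eu n} {z : Ω → Eu m}
    (hu : Continuous u) (hv : Continuous v) (hz : Continuous z) :
    Continuous fun ω => Mj κ c (u ω) (v ω) (z ω) := by
  unfold Mj
  have h1 : ∀ ω, 1 + ‖v ω‖ ≠ 0 := fun q => by positivity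
  have h2 : ∀ ω, (1 + ‖v ω‖) ^ m ≠ 0 := fun q => by positivity
  fun_prop (disch := assumption)

theorem Mk_cont {Ω : Type*} [TopologicalSpace Ω] (κ c : ℝ) {x y : Ω → Ep n m}
    (hx : Continuous x) (hy : Continuous y) : Continuous fun ω => Mk κ c (x ω) (y ω) := by
  unfold Mk
  exact Mj_cont κ c (by fun_prop) (by fun_prop) (by fun_prop)

theorem J_cont' {Ω : Type*} [TopologicalSpace Ω] (hn : 1 ≤ n) (hm : 1 ≤ m) (e : Sym n m)
    {A u v : Ω → Eu n} {z : Ω → Eu m} (hA : Continuous A)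
    (hu : Continuous u) (hv : Continuous v) (hz : Continuous z) :
    Continuous fun ω => J (A ω) e (u ω) (v ω) (z ω) := by
  have h2 : Continuous fun ω => (A ω, u ω, v ω, z ω) := hA.prodMk (hu.prodMk (hv.prodMk hz))
  have h1 := J_cont hn hm e
  have := Continuous.comp h1 h2
  exact this

theorem Mj_nonneg (κ c : ℝ) (u v : Eu n) (z : Eu m) : 0 ≤ Mj κ c u v z := by unfold Mj; positivity
theorem Mk_nonneg (κ c : ℝ) (x y : Ep n m) : 0 ≤ Mk κ c x y := Mj_nonneg _ _ _ _ _

theorem Mk_symm (κ c : ℝ) (x y : Ep n m) : Mk κ c x y = Mk κ c y x := by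
  unfold Mk Mj; rw [norm_sub_rev, norm_sub_rev y.2, add_comm y.1]

theorem Mj_sign (κ c : ℝ) {σ : ℝ} (hσ : |σ| = 1) (u v : Eu n) (z : Eu m) : Mj κ c (σ • u) v (σ • z) = Mj κ c u v z := by
  unfold Mj; simp [norm_smul, hσ]

theorem gauss_int (n : ℕ) {κ : ℝ} (hκ : 0 < κ) : Integrable fun u : Eu n => exp (-(κ * ‖u‖ ^ 2)) := by
  have := integrable_exp_norm n hκ
  refine (this.const_mul (exp κ)).mono' (by fun_prop) (ae_of_all _ fun u => ?_)
  rw [Real.norm_eq_abs, abs_of_pos (exp_pos _), ← exp_add]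
  apply exp_le_exp.mpr
  nlinarith [sq_nonneg (‖u‖ - 1)]

theorem Mk_int (n m : ℕ) {κ c : ℝ} (hκ : 0 < κ) (hc : 0 < c) :
    ∃ B : ℝ≥0, ∀ y : Ep n m, ∫⁻ x, ENNReal.ofReal (Mk κ c x y) ≤ B := by
  set I1 := ∫ u : Eu n, exp (-(κ * ‖u‖ ^ 2)) with hI1
  set I2 := ∫ z : Eu m, exp (-(c * ‖z‖)) with hI2
  have hI2' : 0 ≤ I2 := integral_nonneg fun _ => (exp_pos _).le
  refine ⟨(I2 * I1).toNNReal, fun y => ?_⟩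
  rw [Measure.volume_eq_prod, lintegral_prod _ (by
    refine (Continuous.measurable ?_).ennreal_ofReal.aemeasurable
    exact Mk_cont κ c continuous_id continuous_const)]
  have inner : ∀ x1 : Eu n, ∫⁻ x2 : Eu m, ENNReal.ofReal (Mk κ c (x1, x2) y) =
      ENNReal.ofReal (exp (-(κ * ‖y.1 - x1‖ ^ 2)) * I2) := by
    intro x1
    set R := 1 + ‖y.1 + x1‖ with hR
    have hR0 : 0 < R := by positivity
    have e1 : ∫ x2 : Eu m, Mk κ c (x1, x2) y = exp (-(κ * ‖y.1 - x1‖ ^ 2)) * I2 := by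
      unfold Mk Mj
      simp only
      rw [integral_const_mul, integral_sub_left_eq_self (fun z : Eu m => exp (-(c * (‖z‖ / (1 + ‖y.1 + x1‖))))) volume y.2, ← hR]
      have := int_scale m (inv_pos.mpr hR0) (fun w => exp (-(c * w)))
      simp only [inv_mul_eq_div] at this
      rw [this, inv_pow, ← hI2]
      field_simp
    rw [← e1, ofReal_integral_eq_lintegral_ofReal]
    · unfold Mk Mj
      simp only
      refine Integrable.const_mul ?_ _
      have := (integrable_exp_norm m (show 0 < c / R by positivity)).comp_sub_left y.2
      refine this.congr (ae_of_all _ fun z => ?_)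
      simp only [← hR]; congr 1; ring
    · exact ae_of_all _ fun _ => Mk_nonneg _ _ _ _
  simp_rw [inner]
  rw [← ofReal_integral_eq_lintegral_ofReal, integral_mul_const,
    integral_sub_left_eq_self (fun u : Eu n => exp (-(κ * ‖u‖ ^ 2))) volume y.1, ← hI1, mul_comm]
  · rfl
  · exact ((gauss_int n hκ).comp_sub_left y.1).mul_const _
  · exact ae_of_all _ fun _ => by positivity

theorem rhoR_le (x y : Ep n m) : rhoR x y ≤ 1 + ‖y.1 - x.1‖ + ‖y.2 - x.2‖ / (1 + ‖y.1 + x.1‖) := by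
  unfold rhoR
  rw [norm_sub_rev x.1, norm_sub_rev x.2]
  set h := ‖y.2 - x.2‖ with hh
  have hh0 : 0 ≤ h := norm_nonneg _
  have hv : ‖y.1 + x.1‖ ≤ ‖x.1‖ + ‖y.1‖ := by rw [add_comm ‖x.1‖]; exact norm_add_le _ _
  by_cases h1 : √h ≤ 1
  · have : h / (‖x.1‖ + ‖y.1‖ + √h) ≤ 1 := by
      apply div_le_one_of_le₀ _ (by positivity)
      calc h = √h * √h := (Real.mul_self_sqrt hh0).symm
        _ ≤ 1 * √h := by gcongr
        _ ≤ _ := by rw [one_mul]; linarith [norm_nonneg x.1, norm_nonneg y.1]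
    have : 0 ≤ h / (1 + ‖y.1 + x.1‖) := by positivity
    linarith
  · push Not at h1
    have : h / (‖x.1‖ + ‖y.1‖ + √h) ≤ h / (1 + ‖y.1 + x.1‖) := by
      exact div_le_div_of_nonneg_left hh0 (by positivity) (by linarith)
    linarith

theorem Mk_weight (n m : ℕ) {κ c : ℝ} (hκ : 0 < κ) (hc : 0 < c) : ∃ B : ℝ, 0 < B ∧ ∀ x y : Ep n m,
    Mk κ c x y * (1 + rhoR x y) ≤ B * Mk (κ/2) (c/2) x y := by
  obtain ⟨C1, hC1, h1⟩ := pow_exp_sq_le 1 (show 0 < κ / 2 by positivity)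
  obtain ⟨C2, hC2, h2⟩ := pow_exp_le 1 (show 0 < c / 2 by positivity)
  refine ⟨2 * (C1 * C2), by positivity, fun x y => ?_⟩
  have a := rhoR_le x y
  unfold Mk Mj
  set U := ‖y.1 - x.1‖
  set V := ‖y.1 + x.1‖
  set H := ‖y.2 - x.2‖ / (1 + V) with hH
  have hU : 0 ≤ U := norm_nonneg _
  have hH0 : 0 ≤ H := by positivity
  have b1 := h1 U hU
  have b2 := h2 H hH0
  rw [pow_one] at b1 b2
  have : 1 + rhoR x y ≤ 2 * ((C1 * exp (κ/2 * U ^ 2)) * (C2 * exp (c/2 * H))) := by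
    calc 1 + rhoR x y ≤ 2 * ((1 + U) * (1 + H)) := by nlinarith [mul_nonneg hU hH0]
      _ ≤ _ := by gcongr
  calc _ ≤ exp (-(κ * U ^ 2)) * ((1 + V) ^ m)⁻¹ * exp (-(c * H)) * (2 * ((C1 * exp (κ/2 * U ^ 2)) * (C2 * exp (c/2 * H)))) := by gcongr
    _ = 2 * (C1 * C2) * ((exp (-(κ * U ^ 2)) * exp (κ/2 * U ^ 2)) * ((1 + V) ^ m)⁻¹ * (exp (-(c * H)) * exp (c/2 * H))) := by ring
    _ = _ := by
      rw [← exp_add, ← exp_add]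
      congr 3
      · congr 2; ring
      · congr 1; ring

/-- signed kernels -/
def Kg (σ : ℝ) (e : Sym n m) (x y : Ep n m) : ℂ := J 0 e (σ • (y.1 - x.1)) (y.1 + x.1) (σ • (y.2 - x.2))

theorem Kg_cont {Ω : Type*} [TopologicalSpace Ω] (hn : 1 ≤ n) (hm : 1 ≤ m) (σ : ℝ) (e : Sym n m)
    {x y : Ω → Ep n m} (hx : Continuous x) (hy : Continuous y) :
    Continuous fun ω => Kg σ e (x ω) (y ω) := by
  unfold Kg
  exact J_cont' hn hm e continuous_const (by fun_prop) (by fun_prop) (by fun_prop)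

/-- symbol for `v_i * D2 k e` -/
def D3 (i : Fin n) (k : Fin m) (e : Sym n m) : Sym n m := .mul (.mul (.const (-Complex.I)) (.lv i k)) e

theorem J_D3 (A u v : Eu n) (z : Eu m) (i : Fin n) (k : Fin m) (e : Sym n m) :
    J A (D3 i k e) u v z = (v i : ℂ) * J A (D2 k e) u v z := by
  have : ∫ l, Ph A (D3 i k e) u v (cl l) * ph (cl l) z = (v i : ℂ) * ∫ l, Ph A (D2 k e) u v (cl l) * ph (cl l) z := by
    rw [← integral_const_mul]; congr 1; funext l; simp only [Ph, D3, D2, ev]; ring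
  rw [J, J, this]; ring

theorem norm_le_sum (v : Eu n) : ‖v‖ ≤ ∑ i, |v i| := by
  have h1 : v = ∑ i, v i • EuclideanSpace.single i (1:ℝ) := by
    ext k
    simp [Finset.sum_apply, Pi.single_apply]
  calc ‖v‖ = ‖∑ i, v i • EuclideanSpace.single i (1:ℝ)‖ := by rw [← h1]
    _ ≤ _ := (norm_sum_le _ _).trans (le_of_eq (by simp [norm_smul]))

end GR
end

section
open scoped ENNReal NNReal Topology ComplexConjugate
namespace GR
set_option linter.unusedSectionVars false
variable {n m : ℕ}

theorem Kg_bound (hn : 1 ≤ n) (hm : 1 ≤ m) : ∃ c : ℝ, 0 < c ∧ ∀ e : Sym n m, ∃ C : ℝ, 0 ≤ C ∧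
    ∀ (σ : ℝ), |σ| = 1 → ∀ x y : Ep n m, ‖Kg σ e x y‖ ≤ C * Mk (3/16) c x y := by
  obtain ⟨c, hc, h⟩ := J_bound hn hm (show (0:ℝ) ≤ 3/16 by norm_num) (by norm_num)
  refine ⟨c, hc, fun e => ?_⟩
  obtain ⟨C, N, hC, h⟩ := h e
  refine ⟨C, hC, fun σ hσ x y => ?_⟩
  have := (h 0 (σ • (y.1 - x.1)) (y.1 + x.1) (σ • (y.2 - x.2))).1
  rw [Mj_sign _ _ hσ] at this
  simpa [Kg, Mk] using this

theorem Mk_mono {κ κ' c : ℝ} (h : κ' ≤ κ) (x y : Ep n m) : Mk κ c x y ≤ Mk κ' c x y := by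
  unfold Mk Mj; gcongr

theorem Mk_u (c : ℝ) : ∃ B : ℝ, 0 < B ∧ ∀ x y : Ep n m,
    (1 + ‖y.1 - x.1‖) * Mk (3/16) c x y ≤ B * Mk (1/8) c x y := by
  obtain ⟨C1, hC1, h1⟩ := pow_exp_sq_le 1 (show (0:ℝ) < 1/16 by positivity)
  refine ⟨C1, hC1, fun x y => ?_⟩
  have b1 := h1 ‖y.1 - x.1‖ (norm_nonneg _)
  rw [pow_one] at b1
  unfold Mk Mj
  set U := ‖y.1 - x.1‖
  calc _ ≤ (C1 * exp (1/16 * U ^ 2)) * (exp (-(3/16 * U ^ 2)) * ((1 + ‖y.1 + x.1‖) ^ m)⁻¹ *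
        exp (-(c * (‖y.2 - x.2‖ / (1 + ‖y.1 + x.1‖))))) := by gcongr
    _ = C1 * ((exp (1/16 * U ^ 2) * exp (-(3/16 * U ^ 2))) * ((1 + ‖y.1 + x.1‖) ^ m)⁻¹ *
        exp (-(c * (‖y.2 - x.2‖ / (1 + ‖y.1 + x.1‖))))) := by ring
    _ = _ := by rw [← exp_add]; congr 4; ring

theorem Kg_D3 (σ : ℝ) (i : Fin n) (k : Fin m) (e : Sym n m) (x y : Ep n m) :
    Kg σ (D3 i k e) x y = ((y.1 + x.1) i : ℂ) * Kg σ (D2 k e) x y := J_D3 _ _ _ _ _ _ _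

theorem Kg_all (hn : 1 ≤ n) (hm : 1 ≤ m) : ∃ c : ℝ, 0 < c ∧ ∀ e : Sym n m, ∃ C : ℝ, 0 ≤ C ∧
    ∀ (σ : ℝ), |σ| = 1 → ∀ x y : Ep n m, ‖Kg σ e x y‖ ≤ C * Mk (1/8) c x y ∧
      ∀ k, (1 + ‖y.1‖) * ‖Kg σ (D2 k e) x y‖ ≤ C * Mk (1/8) c x y := by
  obtain ⟨c, hc, h⟩ := Kg_bound hn hm
  obtain ⟨B, hB, hu⟩ := Mk_u (n := n) (m := m) c
  refine ⟨c, hc, fun e => ?_⟩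
  obtain ⟨C0, hC0, h0⟩ := h e
  choose C2 hC2 h2 using fun k => h (D2 k e)
  choose C3 hC3 h3 using fun (i : Fin n) k => h (D3 i k e)
  refine ⟨C0 + ∑ k, (C2 k * B + ∑ i, C3 i k), ?_, fun σ hσ x y => ⟨?_, fun k => ?_⟩⟩
  · exact add_nonneg hC0 (Finset.sum_nonneg fun k _ => add_nonneg (mul_nonneg (hC2 k) hB.le) (Finset.sum_nonneg fun i _ => hC3 i k))
  · refine (h0 σ hσ x y).trans (mul_le_mul ?_ (Mk_mono (by norm_num) _ _) (Mk_nonneg _ _ _ _) ?_)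
    · exact le_add_of_nonneg_right (Finset.sum_nonneg fun k _ => add_nonneg (mul_nonneg (hC2 k) hB.le) (Finset.sum_nonneg fun i _ => hC3 i k))
    · exact add_nonneg hC0 (Finset.sum_nonneg fun k _ => add_nonneg (mul_nonneg (hC2 k) hB.le) (Finset.sum_nonneg fun i _ => hC3 i k))
  · have hy : 1 + ‖y.1‖ ≤ (1 + ‖y.1 - x.1‖) + ∑ i, |(y.1 + x.1) i| := by
      have e1 : (2:ℝ) • y.1 = (y.1 + x.1) + (y.1 - x.1) := by rw [two_smul]; abel
      have e2 : 2 * ‖y.1‖ ≤ ‖y.1 + x.1‖ + ‖y.1 - x.1‖ := by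
        have := norm_add_le (y.1 + x.1) (y.1 - x.1)
        rw [← e1, norm_smul] at this; simpa using this
      have e3 := norm_le_sum (y.1 + x.1)
      linarith [norm_nonneg y.1]
    calc (1 + ‖y.1‖) * ‖Kg σ (D2 k e) x y‖ ≤ ((1 + ‖y.1 - x.1‖) + ∑ i, |(y.1 + x.1) i|) * ‖Kg σ (D2 k e) x y‖ :=
          mul_le_mul_of_nonneg_right hy (norm_nonneg _)
      _ = (1 + ‖y.1 - x.1‖) * ‖Kg σ (D2 k e) x y‖ + ∑ i, ‖Kg σ (D3 i k e) x y‖ := by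
          rw [add_mul, Finset.sum_mul]; congr 1
          refine Finset.sum_congr rfl fun i _ => ?_
          rw [Kg_D3, norm_mul, Complex.norm_real, Real.norm_eq_abs]
      _ ≤ (1 + ‖y.1 - x.1‖) * (C2 k * Mk (3/16) c x y) + ∑ i, C3 i k * Mk (1/8) c x y := by
          refine add_le_add (mul_le_mul_of_nonneg_left (h2 k σ hσ x y) (by positivity)) (Finset.sum_le_sum fun i _ => ?_)
          exact (h3 i k σ hσ x y).trans (mul_le_mul_of_nonneg_left (Mk_mono (by norm_num) _ _) (hC3 i k))
      _ = C2 k * ((1 + ‖y.1 - x.1‖) * Mk (3/16) c x y) + (∑ i, C3 i k) * Mk (1/8) c x y := by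
          rw [Finset.sum_mul]; ring
      _ ≤ C2 k * (B * Mk (1/8) c x y) + (∑ i, C3 i k) * Mk (1/8) c x y :=
          add_le_add (mul_le_mul_of_nonneg_left (hu x y) (hC2 k)) le_rfl
      _ = (C2 k * B + ∑ i, C3 i k) * Mk (1/8) c x y := by ring
      _ ≤ _ := by
          refine mul_le_mul_of_nonneg_right ?_ (Mk_nonneg _ _ _ _)
          have := Finset.single_le_sum (f := fun k => C2 k * B + ∑ i, C3 i k)
            (fun k _ => add_nonneg (mul_nonneg (hC2 k) hB.le) (Finset.sum_nonneg fun i _ => hC3 i k)) (Finset.mem_univ k)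
          linarith

/-- segment -/
def seg (y y0 : Ep n m) (s : ℝ) : Ep n m := (y0.1 + s • (y.1 - y0.1), y0.2 + s • (y.2 - y0.2))

/-- derivative along segment -/
def Gd (σ : ℝ) (e : Sym n m) (y y0 x : Ep n m) (s : ℝ) : ℂ :=
  ∑ j, ((y.1 - y0.1) j : ℂ) * Kg σ (D1 σ j e) x (seg y y0 s) +
    ∑ k, ((σ • (y.2 - y0.2)) k : ℂ) * Kg σ (D2 k e) x (seg y y0 s)

theorem Kg_deriv (hn : 1 ≤ n) (hm : 1 ≤ m) {σ : ℝ} (e : Sym n m) (y y0 x : Ep n m) (s : ℝ) :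
    HasDerivAt (fun s => Kg σ e x (seg y y0 s)) (Gd σ e y y0 x s) s := by
  have h := J_hasDerivAt hn hm σ 0 (σ • (y0.1 - x.1)) (y0.1 + x.1) (y.1 - y0.1) (σ • (y0.2 - x.2)) (σ • (y.2 - y0.2)) e s
  have e1 : ∀ s : ℝ, σ • (y0.1 - x.1) + (s * σ) • (y.1 - y0.1) = σ • ((seg y y0 s).1 - x.1) := by
    intro s; simp only [seg]; module
  have e2 : ∀ s : ℝ, y0.1 + x.1 + s • (y.1 - y0.1) = (seg y y0 s).1 + x.1 := by
    intro s; simp only [seg]; module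
  have e3 : ∀ s : ℝ, σ • (y0.2 - x.2) + s • σ • (y.2 - y0.2) = σ • ((seg y y0 s).2 - x.2) := by
    intro s; simp only [seg]; module
  simp only [e1, e2, e3] at h
  exact h

theorem seg_cont (y y0 : Ep n m) : Continuous (seg y y0) := by unfold seg; fun_prop

theorem Gd_cont {Ω : Type*} [TopologicalSpace Ω] (hn : 1 ≤ n) (hm : 1 ≤ m) (σ : ℝ) (e : Sym n m) (y y0 : Ep n m)
   {x : Ω → Ep n m} {s : Ω → ℝ} (hx : Continuous x) (hs : Continuous s) :
    Continuous fun ω => Gd σ e y y0 (x ω) (s ω) := by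
  unfold Gd
  refine Continuous.add ?_ ?_
  · exact continuous_finsetSum _ fun j _ => continuous_const.mul (Kg_cont hn hm _ _ hx ((seg_cont y y0).comp hs))
  · exact continuous_finsetSum _ fun j _ => continuous_const.mul (Kg_cont hn hm _ _ hx ((seg_cont y y0).comp hs))

theorem h_le (y y0 : Ep n m) (hρ : rhoR y y0 ≤ 1) {s : ℝ} (hs : s ∈ Icc (0:ℝ) 1) :
    ‖y.2 - y0.2‖ ≤ 5 * rhoR y y0 * (1 + ‖(seg y y0 s).1‖) := by
  have hd0 := norm_nonneg (y.1 - y0.1)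
  set h := ‖y.2 - y0.2‖ with hh
  set d := ‖y.1 - y0.1‖ with hd
  set T := ‖y.1‖ + ‖y0.1‖ with hT
  set S := ‖(seg y y0 s).1‖ with hS
  have hh0 : 0 ≤ h := norm_nonneg _
  have hS0 : 0 ≤ S := norm_nonneg _
  have hT0 : 0 ≤ T := by positivity
  set q := h / (T + √h) with hq
  have hρe : rhoR y y0 = d + q := rfl
  have hq0 : 0 ≤ q := by positivity
  have hhq : h = q * (T + √h) := by
    rcases eq_or_lt_of_le hh0 with h0 | h0
    · rw [hq, ← h0]; simp
    · rw [hq, div_mul_cancel₀]; positivity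
  have hsq : √h * √h = h := Real.mul_self_sqrt hh0
  have h1 : h ≤ q * (2 * T + 1) := by nlinarith [sq_nonneg (√h - q), mul_nonneg hq0 hd0]
  have t1 : ‖y.1‖ ≤ S + (1 - s) * d := by
    have : y.1 = (seg y y0 s).1 + (1 - s) • (y.1 - y0.1) := by simp only [seg]; module
    calc ‖y.1‖ = ‖(seg y y0 s).1 + (1 - s) • (y.1 - y0.1)‖ := by rw [← this]
      _ ≤ _ := (norm_add_le _ _).trans (by rw [norm_smul, Real.norm_eq_abs, abs_of_nonneg (by linarith [hs.2])])
  have t2 : ‖y0.1‖ ≤ S + s * d := by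
    have : y0.1 = (seg y y0 s).1 - s • (y.1 - y0.1) := by simp only [seg]; module
    calc ‖y0.1‖ = ‖(seg y y0 s).1 - s • (y.1 - y0.1)‖ := by rw [← this]
      _ ≤ _ := (norm_sub_le _ _).trans (by rw [norm_smul, Real.norm_eq_abs, abs_of_nonneg (by linarith [hs.1])])
  have hTS : T ≤ 2 * S + 1 := by rw [hT]; nlinarith
  calc h ≤ q * (2 * T + 1) := h1
    _ ≤ q * (5 * (1 + S)) := by gcongr; linarith
    _ ≤ (d + q) * (5 * (1 + S)) := by gcongr; linarith
    _ = _ := by rw [hρe]; ring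

theorem Gd_bound (hn : 1 ≤ n) (hm : 1 ≤ m) : ∃ c : ℝ, 0 < c ∧ ∀ (e : Sym n m) (σ : ℝ), |σ| = 1 → ∃ C : ℝ, 0 ≤ C ∧
    (∀ x y, ‖Kg σ e x y‖ ≤ C * Mk (1/8) c x y) ∧
    ∀ x y y0 : Ep n m, rhoR y y0 ≤ 1 → ∀ s ∈ Icc (0:ℝ) 1,
     ‖Gd σ e y y0 x s‖ ≤ C * rhoR y y0 * Mk (1/8) c x (seg y y0 s) := by
  obtain ⟨c, hc, H⟩ := Kg_all hn hm
  refine ⟨c, hc, fun e σ hσ => ?_⟩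
  obtain ⟨C, hC, h0⟩ := H e
  choose C1 hC1 h1 using fun j => H (D1 σ j e)
  refine ⟨C + ∑ j, C1 j + ∑ _k : Fin m, 5 * C, ?_, fun x y => ?_, fun x y y0 hρ s hs => ?_⟩
  · exact add_nonneg (add_nonneg hC (Finset.sum_nonneg fun j _ => hC1 j)) (Finset.sum_nonneg fun j _ => by positivity)
  · refine (h0 σ hσ x y).1.trans (mul_le_mul_of_nonneg_right ?_ (Mk_nonneg _ _ _ _))
    have : 0 ≤ ∑ j, C1 j := (Finset.sum_nonneg fun j _ => hC1 j)
    have : 0 ≤ ∑ _k : Fin m, 5 * C := (Finset.sum_nonneg fun j _ => by positivity)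
    linarith
  · set Y := seg y y0 s
    set M := Mk (1/8) c x Y with hM
    have hM0 : 0 ≤ M := Mk_nonneg _ _ _ _
    have hr0 := rhoR_nonneg y y0
    have hd : ‖y.1 - y0.1‖ ≤ rhoR y y0 := by unfold rhoR; exact le_add_of_nonneg_right (by positivity)
    have a1 : ‖∑ j, ((y.1 - y0.1) j : ℂ) * Kg σ (D1 σ j e) x Y‖ ≤ ∑ j, rhoR y y0 * (C1 j * M) := by
      refine (norm_sum_le _ _).trans (Finset.sum_le_sum fun j _ => ?_)
      rw [norm_mul, Complex.norm_real, Real.norm_eq_abs]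
      exact mul_le_mul ((coord_le _ _).trans hd) (h1 j σ hσ x Y).1 (norm_nonneg _) hr0
    have a2 : ‖∑ k, ((σ • (y.2 - y0.2)) k : ℂ) * Kg σ (D2 k e) x Y‖ ≤ ∑ _k : Fin m, 5 * rhoR y y0 * (C * M) := by
      refine (norm_sum_le _ _).trans (Finset.sum_le_sum fun k _ => ?_)
      rw [norm_mul, Complex.norm_real, Real.norm_eq_abs]
      have : |(σ • (y.2 - y0.2)) k| ≤ 5 * rhoR y y0 * (1 + ‖Y.1‖) := by
        refine (coord_le _ _).trans ?_
        rw [norm_smul, Real.norm_eq_abs, hσ, one_mul]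
        exact h_le y y0 hρ hs
      calc _ ≤ 5 * rhoR y y0 * (1 + ‖Y.1‖) * ‖Kg σ (D2 k e) x Y‖ := mul_le_mul_of_nonneg_right this (norm_nonneg _)
        _ = 5 * rhoR y y0 * ((1 + ‖Y.1‖) * ‖Kg σ (D2 k e) x Y‖) := by ring
        _ ≤ _ := mul_le_mul_of_nonneg_left ((h0 σ hσ x Y).2 k) (by positivity)
    calc _ ≤ ∑ j, rhoR y y0 * (C1 j * M) + ∑ _k : Fin m, 5 * rhoR y y0 * (C * M) := (norm_add_le _ _).trans (add_le_add a1 a2)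
      _ = (∑ j, C1 j + ∑ _k : Fin m, 5 * C) * rhoR y y0 * M := by
        simp only [Finset.sum_mul, add_mul]
        congr 1 <;> refine Finset.sum_congr rfl fun _ _ => by ring
      _ ≤ _ := by
        gcongr
        linarith

theorem ereal_aux {C r M : ℝ} (hC : 0 ≤ C) (hr : 0 ≤ r) : ENNReal.ofReal (C * r * M) =
    ENNReal.ofReal C * ENNReal.ofReal r * ENNReal.ofReal M := by
  rw [ENNReal.ofReal_mul (by positivity), ENNReal.ofReal_mul hC]

theorem Kg_reg (hn : 1 ≤ n) (hm : 1 ≤ m) (e : Sym n m) {σ : ℝ} (hσ : |σ| = 1) : ∃ A : ℝ≥0,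
    ∀ y y0 : Ep n m, ∫⁻ x, ‖Kg σ e x y - Kg σ e x y0‖ₑ ≤ A * rho y y0 := by
  obtain ⟨c, hc, H⟩ := Gd_bound hn hm
  obtain ⟨C, hC, h0, h1⟩ := H e σ hσ
  obtain ⟨B, hB⟩ := Mk_int n m (show (0:ℝ) < 1/8 by norm_num) hc
  have size : ∀ y : Ep n m, ∫⁻ x, ‖Kg σ e x y‖ₑ ≤ ENNReal.ofReal C * B := by
    intro y
    calc ∫⁻ x, ‖Kg σ e x y‖ₑ ≤ ∫⁻ x, ENNReal.ofReal C * ENNReal.ofReal (Mk (1/8) c x y) := by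
          refine lintegral_mono fun x => ?_
          rw [← ofReal_norm, ← ENNReal.ofReal_mul hC]
          exact ENNReal.ofReal_le_ofReal (h0 x y)
      _ = ENNReal.ofReal C * ∫⁻ x, ENNReal.ofReal (Mk (1/8) c x y) := lintegral_const_mul' _ _ ENNReal.ofReal_ne_top
      _ ≤ _ := by gcongr; exact hB y
  refine ⟨2 * (C.toNNReal * B), fun y y0 => ?_⟩
  have hcast : ((2 * (C.toNNReal * B) : ℝ≥0) : ℝ≥0∞) = 2 * (ENNReal.ofReal C * B) := by
    push_cast; rfl
  rw [hcast]
  by_cases hρ : rhoR y y0 ≤ 1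
  · have hr0 := rhoR_nonneg y y0
    have pt : ∀ x, ‖Kg σ e x y - Kg σ e x y0‖ₑ ≤
        ∫⁻ s in Icc (0:ℝ) 1, ENNReal.ofReal (C * rhoR y y0 * Mk (1/8) c x (seg y y0 s)) := by
      intro x
      have hf := intervalIntegral.integral_eq_sub_of_hasDerivAt (a := 0) (b := 1) (fun s _ => Kg_deriv hn hm (σ := σ) e y y0 x s)
        ((Gd_cont hn hm σ e y y0 continuous_const continuous_id).intervalIntegrable _ _)
      have s1 : seg y y0 1 = y := by simp [seg]
      have s0 : seg y y0 0 = y0 := by simp [seg]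
      rw [s1, s0] at hf
      rw [← hf, intervalIntegral.integral_of_le zero_le_one, ← integral_Icc_eq_integral_Ioc]
      refine (enorm_integral_le_lintegral_enorm _).trans ?_
      refine setLIntegral_mono' measurableSet_Icc fun s hs => ?_
      rw [← ofReal_norm]
      exact ENNReal.ofReal_le_ofReal (h1 x y y0 hρ s hs)
    calc _ ≤ ∫⁻ x, ∫⁻ s in Icc (0:ℝ) 1, ENNReal.ofReal (C * rhoR y y0 * Mk (1/8) c x (seg y y0 s)) := lintegral_mono pt
      _ = ∫⁻ s in Icc (0:ℝ) 1, ∫⁻ x, ENNReal.ofReal (C * rhoR y y0 * Mk (1/8) c x (seg y y0 s)) := by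
        refine lintegral_lintegral_swap ?_
        refine (Continuous.measurable ?_).ennreal_ofReal.aemeasurable
        exact continuous_const.mul (Mk_cont _ _ continuous_fst ((seg_cont y y0).comp continuous_snd))
      _ ≤ ∫⁻ s in Icc (0:ℝ) 1, ENNReal.ofReal C * ENNReal.ofReal (rhoR y y0) * B := by
        refine lintegral_mono fun s => ?_
        simp only [ereal_aux hC hr0]
        rw [lintegral_const_mul' _ _ (by finiteness)]
        gcongr; exact hB _
      _ = 1 * (ENNReal.ofReal C * B) * rho y y0 := by
        simp [rho]; ring
      _ ≤ _ := by gcongr; norm_num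
  · push Not at hρ
    calc _ ≤ ∫⁻ x, (‖Kg σ e x y‖ₑ + ‖Kg σ e x y0‖ₑ) := lintegral_mono fun x => enorm_sub_le
      _ = (∫⁻ x, ‖Kg σ e x y‖ₑ) + ∫⁻ x, ‖Kg σ e x y0‖ₑ := by
        refine lintegral_add_left ?_ _
        exact (Kg_cont hn hm σ e continuous_id continuous_const).measurable.enorm
      _ ≤ ENNReal.ofReal C * B + ENNReal.ofReal C * B := add_le_add (size y) (size y0)
      _ = 2 * (ENNReal.ofReal C * B) * 1 := by ring
      _ ≤ _ := by
        gcongr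
        rw [rho, ← ENNReal.ofReal_one]
        exact ENNReal.ofReal_le_ofReal hρ.le

theorem Kg_size (hn : 1 ≤ n) (hm : 1 ≤ m) (e : Sym n m) {σ : ℝ} (hσ : |σ| = 1) : ∃ A : ℝ≥0,
    ∀ y : Ep n m, ∫⁻ x, ‖Kg σ e x y‖ₑ * (1 + rho y x) ≤ A := by
  obtain ⟨c, hc, H⟩ := Gd_bound hn hm
  obtain ⟨C, hC, h0, h1⟩ := H e σ hσ
  obtain ⟨W, hW, hw⟩ := Mk_weight n m (show (0:ℝ) < 1/8 by norm_num) hc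
  obtain ⟨B, hB⟩ := Mk_int n m (show (0:ℝ) < 1/8/2 by norm_num) (show 0 < c/2 by positivity)
  refine ⟨(C * W).toNNReal * B, fun y => ?_⟩
  calc _ ≤ ∫⁻ x, ENNReal.ofReal (C * W) * ENNReal.ofReal (Mk (1/8/2) (c/2) x y) := by
        refine lintegral_mono fun x => ?_
        have hr := rhoR_nonneg x y
        rw [rho_symm, ← ofReal_norm, rho, ← ENNReal.ofReal_one, ← ENNReal.ofReal_add zero_le_one hr, ← ENNReal.ofReal_mul (norm_nonneg _), ← ENNReal.ofReal_mul (by positivity)]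
        refine ENNReal.ofReal_le_ofReal ?_
        calc _ ≤ (C * Mk (1/8) c x y) * (1 + rhoR x y) := mul_le_mul_of_nonneg_right (h0 x y) (by positivity)
          _ = C * (Mk (1/8) c x y * (1 + rhoR x y)) := by ring
          _ ≤ C * (W * Mk (1/8/2) (c/2) x y) := mul_le_mul_of_nonneg_left (hw x y) hC
          _ = _ := by ring
    _ = ENNReal.ofReal (C * W) * ∫⁻ x, ENNReal.ofReal (Mk (1/8/2) (c/2) x y) := lintegral_const_mul' _ _ ENNReal.ofReal_ne_top
    _ ≤ _ := by push_cast; gcongr; exacts [le_rfl, hB y]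

end GR
end

section
open scoped ENNReal NNReal Topology ComplexConjugate FourierTransform
namespace GR
set_option linter.unusedSectionVars false
variable {n m : ℕ}

/-- the vector fields acting on symbols -/
def opS : (Fin n ⊕ Fin n × Fin m) → Sym n m → Sym n m
  | .inl j, e => .add (dS 1 j e) (.mul (.add (Ls 1 j) (.mul (.const (-1)) (.dr j))) e)
  | .inr jk, e => .mul (.mul (.const (-Complex.I / 2)) (.add (.mul (.lam jk.2) (.u jk.1)) (.lv jk.1 jk.2))) e

theorem ph_zero_left (z : Eu m) : ph (cl (0 : Eu m)) z = 1 := by simp [ph, cl]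

theorem ph_zero_right (ζ : Fin m → ℂ) : ph ζ (0 : Eu m) = 1 := by simp [ph]

theorem dotp_inner {m : ℕ} (l z : Eu m) : dotp l z = inner ℝ l z := by
  simp [dotp, PiLp.inner_apply, mul_comm]

theorem J_int_z (hn : 1 ≤ n) (hm : 1 ≤ m) (e : Sym n m) (A u v : Eu n) : Integrable fun z : Eu m => J A e u v z := by
  obtain ⟨c, hc, h⟩ := J_bound hn hm (le_refl (0:ℝ)) (by norm_num)
  obtain ⟨C, N, hC, h⟩ := h e
  have := (integrable_exp_norm m (show 0 < c / (1 + ‖v‖) by positivity)).const_mul (C * (1 + ‖A‖) ^ N * ((1 + ‖v‖) ^ m)⁻¹)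
  refine this.mono' (J_cont' hn hm e continuous_const continuous_const continuous_const continuous_id).aestronglyMeasurable
    (ae_of_all _ fun z => (h A u v z).1.trans (le_of_eq ?_))
  unfold Mj
  rw [zero_mul, neg_zero, exp_zero, one_mul, show c * (‖z‖ / (1 + ‖v‖)) = c / (1 + ‖v‖) * ‖z‖ by ring]
  ring

theorem J_int_eq (hn : 1 ≤ n) (hm : 1 ≤ m) (e : Sym n m) (A u v : Eu n) :
    ∫ z : Eu m, J A e u v z = Ph A e u v (cl (0 : Eu m)) := by
  set φ : Eu m → ℂ := fun l => Ph A e u v (cl l) with hφ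
  have hcont : Continuous φ := by
    have := Phph_cont (n := n) (m := m) e (continuous_const (y := A)) (continuous_const (y := u)) (continuous_const (y := v)) continuous_id (continuous_const (y := (0 : Eu m)))
    simpa [ph_zero_right] using this
  have hinteg : Integrable φ := by
    have := Phph_int hn hm A u v e 0
    simpa [ph_zero_right] using this
  have hF : ∀ w : Eu m, 𝓕 φ w = (2 * π : ℂ) ^ m * J A e u v ((2 * π : ℝ) • w) := by
    intro w
    rw [Real.fourier_eq', J, ← mul_assoc]
    have : (2 * π : ℂ) ^ m * cst m = 1 := by
      unfold cst; push_cast; exact mul_inv_cancel₀ (by simp [Real.pi_ne_zero])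
    rw [this, one_mul]
    congr 1; funext l
    rw [smul_eq_mul, mul_comm, ph_cl, dotp_inner, inner_smul_right]
    congr 2; push_cast; ring
  have hπ : (2 * π : ℝ) ≠ 0 := by positivity
  have hFint : Integrable (𝓕 φ) := by
    have : 𝓕 φ = fun w => (2 * π : ℂ) ^ m * J A e u v ((2 * π : ℝ) • w) := funext hF
    rw [this]
    exact ((J_int_z hn hm e A u v).comp_smul hπ).const_mul _
  have h0 := congrFun (hcont.fourierInv_fourier_eq hinteg hFint) 0
  rw [Real.fourierInv_eq'] at h0
  simp only [inner_zero_right, mul_zero, Complex.ofReal_zero, zero_mul, Complex.exp_zero, one_smul] at h0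
  rw [← hφ] at *
  simp only [hF] at h0
  rw [integral_const_mul, Measure.integral_comp_smul] at h0
  rw [show Ph A e u v (cl 0) = φ 0 from rfl, ← h0]
  simp only [finrank_euclideanSpace, Fintype.card_fin, Complex.real_smul]
  rw [abs_of_pos (by positivity), ← mul_assoc]
  push_cast
  rw [mul_inv_cancel₀ (by simp [Real.pi_ne_zero]), one_mul]

theorem ssq_cl0 : ssq (cl (0 : Eu m)) = 0 := by simp [ssq_cl]

theorem ev_cl0 (A u v : Eu n) (e : Sym n m) : ev A u v (cl (0 : Eu m)) e = ev A u 0 (cl (0 : Eu m)) e := by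
  induction e with
  | add e f h1 h2 => simp only [ev, h1, h2]
  | mul e f h1 h2 => simp only [ev, h1, h2]
  | lv j k => simp [ev, cl]
  | _ => simp [ev]

theorem Ph_cl0 (A u v : Eu n) (e : Sym n m) : Ph A e u v (cl (0 : Eu m)) = Ph A e u 0 (cl (0 : Eu m)) := by
  unfold Ph
  rw [ev_cl0, ssq_cl0]
  congr 1
  simp [kf]

theorem Ph0_cont (e : Sym n m) : Continuous fun u : Eu n => Ph 0 e u 0 (cl (0 : Eu m)) := by
  have := Phph_cont (n := n) (m := m) e (continuous_const (y := 0)) (continuous_id) (continuous_const (y := 0)) (continuous_const (y := 0)) (continuous_const (y := (0 : Eu m)))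
  simpa [ph_zero_right] using this

theorem Ph0_int (hn : 1 ≤ n) (hm : 1 ≤ m) (e : Sym n m) : Integrable fun u : Eu n => Ph 0 e u 0 (cl (0 : Eu m)) := by
  obtain ⟨C, N, hC, h⟩ := Ph_bound hn hm e
  refine ((gauss_int n (show (0:ℝ) < 1/8 by norm_num)).const_mul C).mono' (Ph0_cont e).aestronglyMeasurable
    (ae_of_all _ fun u => (h 0 u 0 0).trans (le_of_eq ?_))
  simp; left; ring

theorem Ph0_zero (hn : 1 ≤ n) (hm : 1 ≤ m) (i : Fin n ⊕ Fin n × Fin m) (e : Sym n m) :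
    ∫ u : Eu n, Ph 0 (opS i e) u 0 (cl (0 : Eu m)) = 0 := by
  rcases i with j | ⟨j, k⟩
  · have e1 : ∀ u : Eu n, Ph 0 (opS (.inl j) e) u 0 (cl (0 : Eu m)) = Ph 0 (D1 1 j e) u 0 (cl (0 : Eu m)) := by
      intro u; simp [Ph, opS, D1, ev]
    simp only [e1]
    have hl : ∀ u : Eu n, HasLineDerivAt ℝ (fun u : Eu n => Ph 0 e u 0 (cl (0 : Eu m))) (Ph 0 (D1 1 j e) u 0 (cl (0 : Eu m))) u (EuclideanSpace.single j 1) := by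
      intro u
      have := Ph_hasDerivAt 1 0 u 0 (EuclideanSpace.single j 1) (cl (0 : Eu m)) e
      simp only [mul_one] at this
      simp only [Ph_cl0 0 _ (0 + _)] at this
      unfold HasLineDerivAt
      refine this.congr_deriv ?_
      rw [Finset.sum_eq_single j]
      · simp
      · intro b _ hb; simp [hb]
      · simp
    have key := integral_bilinear_hasLineDerivAt_right_eq_neg_left_of_integrable (μ := (volume : Measure (Eu n)))
      (B := ContinuousLinearMap.mul ℝ ℂ)
      (f := fun _ => (1:ℂ)) (f' := fun _ => 0) (g := fun u : Eu n => Ph 0 e u 0 (cl (0 : Eu m)))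
      (g' := fun u => Ph 0 (D1 1 j e) u 0 (cl (0 : Eu m))) (v := EuclideanSpace.single j 1)
      (by simp) (by simpa using Ph0_int hn hm _) (by simpa using Ph0_int hn hm _)
      (fun x _ => by unfold HasLineDerivAt; exact hasDerivAt_const _ _) (fun x _ => hl x)
    simpa using key
  · have e1 : ∀ u : Eu n, Ph 0 (opS (.inr (j, k)) e) u 0 (cl (0 : Eu m)) = 0 := by
      intro u; simp [Ph, opS, ev, cl]
    simp [e1]

theorem Kg_int (hn : 1 ≤ n) (hm : 1 ≤ m) (e : Sym n m) {σ : ℝ} (hσ : |σ| = 1) (y : Ep n m) :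
    Integrable fun x => Kg σ e x y := by
  obtain ⟨A, hA⟩ := Kg_size hn hm e hσ
  refine ⟨(Kg_cont hn hm σ e continuous_id continuous_const).aestronglyMeasurable, ?_⟩
  refine lt_of_le_of_lt ?_ (ENNReal.coe_lt_top (r := A))
  refine le_trans (lintegral_mono fun x => ?_) (hA y)
  exact le_mul_of_one_le_right' (le_add_of_nonneg_right (zero_le))

theorem Kg_canc (hn : 1 ≤ n) (hm : 1 ≤ m) (i : Fin n ⊕ Fin n × Fin m) (e : Sym n m) {σ : ℝ} (hσ : σ = 1 ∨ σ = -1) (y : Ep n m) :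
    ∫ x, Kg σ (opS i e) x y = 0 := by
  have hσ' : |σ| = 1 := by rcases hσ with rfl | rfl <;> simp
  have h1 := Kg_int hn hm (opS i e) hσ' y
  rw [Measure.volume_eq_prod] at h1 ⊢
  rw [integral_prod _ h1]
  have inner : ∀ x1 : Eu n, ∫ x2 : Eu m, Kg σ (opS i e) (x1, x2) y = Ph 0 (opS i e) (σ • (y.1 - x1)) 0 (cl (0 : Eu m)) := by
    intro x1
    unfold Kg
    simp only
    rw [integral_sub_left_eq_self (fun z : Eu m => J 0 (opS i e) (σ • (y.1 - x1)) (y.1 + x1) (σ • z)) volume y.2,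
      Measure.integral_comp_smul]
    rw [J_int_eq hn hm, Ph_cl0]
    simp [abs_inv, abs_pow, hσ']
  simp only [inner]
  rw [integral_sub_left_eq_self (fun u : Eu n => Ph 0 (opS i e) (σ • u) 0 (cl (0:Eu m))) volume y.1,
      Measure.integral_comp_smul (μ := (volume : Measure (Eu n))) (fun u : Eu n => Ph 0 (opS i e) u 0 (cl (0:Eu m))) σ, Ph0_zero hn hm, smul_zero]

end GR
end

section
open scoped ENNReal NNReal Topology ComplexConjugate
namespace GR
set_option linter.unusedSectionVars false
variable {n m : ℕ}

/-- anisotropic dilation -/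
def dl (s : ℝ) (x : Ep n m) : Ep n m := (s⁻¹ • x.1, (s ^ 2)⁻¹ • x.2)

theorem dl_meas : Measurable (fun q : ℝ × Ep n m => dl q.1 q.2) := by unfold dl; fun_prop

theorem dl_cont (s : ℝ) : Continuous (dl s : Ep n m → Ep n m) := by unfold dl; fun_prop

theorem rhoR_dl {s : ℝ} (hs : 0 < s) (x y : Ep n m) : rhoR (dl s x) (dl s y) = s⁻¹ * rhoR x y := by
  unfold rhoR dl
  simp only [← smul_sub, norm_smul, norm_inv, Real.norm_eq_abs, abs_of_pos hs, abs_of_pos (pow_pos hs 2)]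
  rw [Real.sqrt_mul (by positivity), Real.sqrt_inv, Real.sqrt_sq hs.le, mul_add]
  congr 1
  rw [show s⁻¹ * ‖x.1‖ + s⁻¹ * ‖y.1‖ + s⁻¹ * √‖x.2 - y.2‖ = s⁻¹ * (‖x.1‖ + ‖y.1‖ + √‖x.2 - y.2‖) by ring]
  rw [show (s ^ 2)⁻¹ = s⁻¹ * s⁻¹ by rw [sq, mul_inv], mul_assoc, mul_div_mul_left _ _ (by positivity), mul_div_assoc]

theorem rho_dl {s : ℝ} (hs : 0 < s) (x y : Ep n m) : rho (dl s x) (dl s y) = rho x y / ENNReal.ofReal s := by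
  unfold rho
  rw [rhoR_dl hs, inv_mul_eq_div, ENNReal.ofReal_div_of_pos hs]

theorem dl_map {s : ℝ} (hs : 0 < s) : Measure.map (dl s) (volume : Measure (Ep n m)) =
    ENNReal.ofReal (s ^ (n + 2 * m)) • volume := by
  have : (dl s : Ep n m → Ep n m) = Prod.map (s⁻¹ • ·) ((s^2)⁻¹ • ·) := rfl
  rw [this, Measure.volume_eq_prod, ← Measure.map_prod_map _ _ (by fun_prop) (by fun_prop),
    Measure.map_addHaar_smul _ (by positivity), Measure.map_addHaar_smul _ (by positivity),
    Measure.prod_smul_left, Measure.prod_smul_right, smul_smul, ← ENNReal.ofReal_mul (by positivity)]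
  congr 2
  simp only [finrank_euclideanSpace, Fintype.card_fin, inv_pow, inv_inv]
  rw [abs_of_pos (by positivity), abs_of_pos (by positivity), ← pow_mul, ← pow_add]

theorem dl_lint {s : ℝ} (hs : 0 < s) {F : Ep n m → ℝ≥0∞} (hF : Measurable F) :
    ∫⁻ x, F (dl s x) = ENNReal.ofReal (s ^ (n + 2 * m)) * ∫⁻ x, F x := by
  have := lintegral_map (μ := volume) hF (dl_cont s).measurable
  rw [← this, dl_map hs, lintegral_smul_measure, smul_eq_mul]

theorem dl_integral {s : ℝ} (hs : 0 < s) {F : Ep n m → ℂ} (hF : Measurable F) :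
    ∫ x, F (dl s x) = (s ^ (n + 2 * m) : ℝ) * ∫ x, F x := by
  have := integral_map (μ := volume) (dl_cont (n := n) (m := m) s).measurable.aemeasurable hF.aestronglyMeasurable
  rw [← this, dl_map hs, integral_smul_measure, ENNReal.toReal_ofReal (by positivity), Complex.real_smul]

/-- weight -/
def wq (n m : ℕ) (t : ℝ) : ℝ := (√t ^ (n + 2 * m))⁻¹ * t⁻¹

theorem wq_pos {t : ℝ} (ht : 0 < t) : 0 < wq n m t := by
  have := Real.sqrt_pos.mpr ht
  unfold wq; positivity

theorem wq_meas : Measurable (wq n m) := by unfold wq; fun_prop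

/-- scale averages -/
def avg (r : ℝ) (K : Ep n m → Ep n m → ℂ) (x y : Ep n m) : ℂ :=
  ∫ t in Ioc (r ^ 2 / 4) (r ^ 2), (wq n m t : ℂ) * K (dl √t x) (dl √t y)

theorem avg_core {r : ℝ} (hr : 0 < r) {F : Ep n m → ℝ≥0∞} (hF : Measurable F) {B : ℝ≥0∞} (hB : ∫⁻ x, F x ≤ B) {t : ℝ} (ht : t ∈ Ioc (r^2/4) (r^2)) :
    ∫⁻ x, ENNReal.ofReal (wq n m t) * F (dl √t x) ≤ ENNReal.ofReal (4 / r ^ 2) * B := by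
  have ht0 : 0 < t := lt_trans (by positivity) ht.1
  have hs := Real.sqrt_pos.mpr ht0
  rw [lintegral_const_mul' _ _ ENNReal.ofReal_ne_top, dl_lint hs hF, ← mul_assoc, ← ENNReal.ofReal_mul (wq_pos ht0).le]
  gcongr
  unfold wq
  rw [mul_right_comm, inv_mul_cancel₀ (by positivity), one_mul, ← inv_div]
  gcongr
  exact ht.1.le

theorem ioc_const {r : ℝ} (hr : 0 < r) (B : ℝ≥0∞) : ∫⁻ _ in Ioc (r ^ 2 / 4) (r ^ 2), ENNReal.ofReal (4 / r ^ 2) * B = 3 * B := by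
  rw [setLIntegral_const, Real.volume_Ioc, mul_right_comm, ← ENNReal.ofReal_mul (by positivity)]
  congr 1
  rw [show 4 / r ^ 2 * (r ^ 2 - r ^ 2 / 4) = 3 by field_simp; ring]; simp

theorem avg_enorm {r : ℝ} (hr : 0 < r) (K : Ep n m → Ep n m → ℂ) (x y : Ep n m) : ‖avg r K x y‖ₑ ≤
    ∫⁻ t in Ioc (r ^ 2 / 4) (r ^ 2), ENNReal.ofReal (wq n m t) * ‖K (dl √t x) (dl √t y)‖ₑ := by
  unfold avg
  refine (enorm_integral_le_lintegral_enorm _).trans (le_of_eq ?_)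
  refine setLIntegral_congr_fun measurableSet_Ioc fun t ht => ?_
  have ht0 : 0 < t := lt_trans (by positivity) ht.1
  simp only [enorm_mul]
  rw [← ofReal_norm (wq n m t : ℂ), Complex.norm_real, Real.norm_eq_abs, abs_of_pos (wq_pos ht0)]

theorem meas_K {K : Ep n m → Ep n m → ℂ} (hK : Continuous (Function.uncurry K)) {Ω : Type*} [MeasurableSpace Ω]
   {t : Ω → ℝ} {x y : Ω → Ep n m} (ht : Measurable t) (hx : Measurable x) (hy : Measurable y) :
   Measurable fun ω => K (dl √(t ω) (x ω)) (dl √(t ω) (y ω)) := by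
  have h1 : Measurable fun ω => dl √(t ω) (x ω) := dl_meas.comp (ht.sqrt.prodMk hx)
  have h2 : Measurable fun ω => dl √(t ω) (y ω) := dl_meas.comp (ht.sqrt.prodMk hy)
  exact hK.measurable.comp (h1.prodMk h2)

theorem rho_meas' {Ω : Type*} [MeasurableSpace Ω] {x y : Ω → Ep n m} (hx : Measurable x) (hy : Measurable y) :
    Measurable fun ω => rho (x ω) (y ω) := by unfold rho rhoR; fun_prop

theorem avg_size {r : ℝ} (hr : 0 < r) {K : Ep n m → Ep n m → ℂ} (hK : Continuous (Function.uncurry K)) {A : ℝ≥0}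
    (h : ∀ y, ∫⁻ x, ‖K x y‖ₑ * (1 + rho y x) ≤ A) (y : Ep n m) :
    ∫⁻ x, ‖avg r K x y‖ₑ * (1 + rho y x / ENNReal.ofReal r) ≤ 3 * A := by
  have hrm : ∀ y : Ep n m, Measurable (rho y) := fun y => by
    change Measurable fun x => rho y x
    unfold rho rhoR; fun_prop
  calc _ ≤ ∫⁻ x, ∫⁻ t in Ioc (r ^ 2 / 4) (r ^ 2), ENNReal.ofReal (wq n m t) * (‖K (dl √t x) (dl √t y)‖ₑ * (1 + rho (dl √t y) (dl √t x))) := by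
        refine lintegral_mono fun x => ?_
        refine (mul_le_mul_left (avg_enorm hr K x y) _).trans ?_
        rw [← lintegral_mul_const]
        · refine setLIntegral_mono' measurableSet_Ioc fun t ht => ?_
          have ht0 : 0 < t := lt_trans (by positivity) ht.1
          have hs := Real.sqrt_pos.mpr ht0
          rw [rho_dl hs, mul_assoc]
          gcongr
          rw [Real.sqrt_le_left hr.le]; exact ht.2
        · exact (wq_meas.ennreal_ofReal).mul (meas_K hK measurable_id measurable_const measurable_const).enorm
    _ = ∫⁻ t in Ioc (r ^ 2 / 4) (r ^ 2), ∫⁻ x, ENNReal.ofReal (wq n m t) * (‖K (dl √t x) (dl √t y)‖ₑ * (1 + rho (dl √t y) (dl √t x))) := by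
        refine lintegral_lintegral_swap ?_
        have hmr : Measurable fun q : Ep n m × ℝ => (1:ℝ≥0∞) + rho (dl √q.2 y) (dl √q.2 q.1) := by
          have h1 : Measurable fun q : Ep n m × ℝ => dl √q.2 y := dl_meas.comp (measurable_snd.sqrt.prodMk measurable_const)
          have h2 : Measurable fun q : Ep n m × ℝ => dl √q.2 q.1 := dl_meas.comp (measurable_snd.sqrt.prodMk measurable_fst)
          have h3 : Measurable fun q : Ep n m × ℝ => rho (dl √q.2 y) (dl √q.2 q.1) := rho_meas' h1 h2
          exact h3.const_add 1
        have hK' := (meas_K hK (measurable_snd (α := Ep n m) (β := ℝ)) measurable_fst (measurable_const (a := y))).enorm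
        have hw : Measurable fun q : Ep n m × ℝ => ENNReal.ofReal (wq n m q.2) := (wq_meas.comp measurable_snd).ennreal_ofReal
        exact (hw.mul (hK'.mul hmr)).aemeasurable
    _ ≤ ∫⁻ t in Ioc (r ^ 2 / 4) (r ^ 2), ENNReal.ofReal (4 / r ^ 2) * A := by
        refine setLIntegral_mono' measurableSet_Ioc fun t ht => ?_
        refine avg_core hr (F := fun x => ‖K x (dl √t y)‖ₑ * (1 + rho (dl √t y) x)) ?_ (h _) ht
        refine Measurable.mul (hK.measurable.comp measurable_prodMk_right).enorm (measurable_const.add (hrm _))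
    _ = _ := ioc_const hr _

theorem avg_intOn {r : ℝ} (hr : 0 < r) {K : Ep n m → Ep n m → ℂ} (hK : Continuous (Function.uncurry K)) (x y : Ep n m) :
    IntegrableOn (fun t => (wq n m t : ℂ) * K (dl √t x) (dl √t y)) (Ioc (r ^ 2 / 4) (r ^ 2)) := by
  refine IntegrableOn.mono_set ?_ Ioc_subset_Icc_self
  refine ContinuousOn.integrableOn_Icc ?_
  have hpos : ∀ t ∈ Icc (r ^ 2 / 4) (r ^ 2), 0 < t := fun t ht => lt_of_lt_of_le (by positivity) ht.1
  have d : ∀ x : Ep n m, ContinuousOn (fun t => dl √t x) (Icc (r ^ 2 / 4) (r ^ 2)) := by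
    intro x
    unfold dl
    have c1 : ContinuousOn (fun t : ℝ => (√t)⁻¹) (Icc (r ^ 2 / 4) (r ^ 2)) :=
      ContinuousOn.inv₀ (Real.continuous_sqrt.continuousOn) fun t ht => (Real.sqrt_pos.mpr (hpos t ht)).ne'
    have c2 : ContinuousOn (fun t : ℝ => (√t ^ 2)⁻¹) (Icc (r ^ 2 / 4) (r ^ 2)) :=
      ContinuousOn.inv₀ (Real.continuous_sqrt.pow 2).continuousOn fun t ht => by
        have := Real.sqrt_pos.mpr (hpos t ht); positivity
    exact (c1.smul continuousOn_const).prodMk (c2.smul continuousOn_const)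
  refine ContinuousOn.mul (Complex.continuous_ofReal.comp_continuousOn ?_) (hK.comp_continuousOn ((d x).prodMk (d y)))
  unfold wq
  refine ContinuousOn.mul (ContinuousOn.inv₀ (by fun_prop) fun t ht => ?_) (ContinuousOn.inv₀ (by fun_prop) fun t ht => ?_)
  · have := Real.sqrt_pos.mpr (hpos t ht); positivity
  · have := hpos t ht; positivity

theorem avg_reg {r : ℝ} (hr : 0 < r) {K : Ep n m → Ep n m → ℂ} (hK : Continuous (Function.uncurry K)) {A : ℝ≥0}
    (h : ∀ y y0, ∫⁻ x, ‖K x y - K x y0‖ₑ ≤ A * rho y y0) (y y0 : Ep n m) :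
    ∫⁻ x, ‖avg r K x y - avg r K x y0‖ₑ ≤ 6 * A * (rho y y0 / ENNReal.ofReal r) := by
  calc _ ≤ ∫⁻ x, ∫⁻ t in Ioc (r ^ 2 / 4) (r ^ 2), ENNReal.ofReal (wq n m t) * ‖K (dl √t x) (dl √t y) - K (dl √t x) (dl √t y0)‖ₑ := by
        refine lintegral_mono fun x => ?_
        unfold avg
        rw [← integral_sub (avg_intOn hr hK x y) (avg_intOn hr hK x y0)]
        refine (enorm_integral_le_lintegral_enorm _).trans (le_of_eq ?_)
        refine setLIntegral_congr_fun measurableSet_Ioc fun t ht => ?_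
        have ht0 : 0 < t := lt_trans (by positivity) ht.1
        simp only [← mul_sub, enorm_mul]
        rw [← ofReal_norm (wq n m t : ℂ), Complex.norm_real, Real.norm_eq_abs, abs_of_pos (wq_pos ht0)]
    _ = ∫⁻ t in Ioc (r ^ 2 / 4) (r ^ 2), ∫⁻ x, ENNReal.ofReal (wq n m t) * ‖K (dl √t x) (dl √t y) - K (dl √t x) (dl √t y0)‖ₑ := by
        refine lintegral_lintegral_swap ?_
        exact (Measurable.mul (wq_meas.comp measurable_snd).ennreal_ofReal (Measurable.sub (meas_K hK measurable_snd measurable_fst measurable_const) (meas_K hK measurable_snd measurable_fst measurable_const)).enorm).aemeasurable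
    _ ≤ ∫⁻ t in Ioc (r ^ 2 / 4) (r ^ 2), ENNReal.ofReal (4 / r ^ 2) * (A * (2 * (rho y y0 / ENNReal.ofReal r))) := by
        refine setLIntegral_mono' measurableSet_Ioc fun t ht => ?_
        have ht0 : 0 < t := lt_trans (by positivity) ht.1
        have hs := Real.sqrt_pos.mpr ht0
        refine avg_core hr (F := fun x => ‖K x (dl √t y) - K x (dl √t y0)‖ₑ) ?_ ((h _ _).trans ?_) ht
        · exact ((hK.measurable.comp measurable_prodMk_right).sub (hK.measurable.comp measurable_prodMk_right)).enorm
        · gcongr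
          rw [rho_dl hs]
          have h2 : r / 2 ≤ √t := by
            apply Real.le_sqrt_of_sq_le; nlinarith [ht.1]
          calc rho y y0 / ENNReal.ofReal √t ≤ rho y y0 / ENNReal.ofReal (r / 2) := by gcongr
            _ = _ := by
              rw [ENNReal.ofReal_div_of_pos two_pos, div_eq_mul_inv, ENNReal.inv_div (by simp) (by simp), ENNReal.ofReal_ofNat,
                div_eq_mul_inv, div_eq_mul_inv]; ring
    _ = _ := by rw [ioc_const hr]; ring

theorem avg_canc {r : ℝ} (hr : 0 < r) {K : Ep n m → Ep n m → ℂ} (hK : Continuous (Function.uncurry K)) {A : ℝ≥0}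
    (h : ∀ y, ∫⁻ x, ‖K x y‖ₑ * (1 + rho y x) ≤ A) (h0 : ∀ y, ∫ x, K x y = 0) (y : Ep n m) :
    ∫ x, avg r K x y = 0 := by
  unfold avg
  have hm : Measurable (Function.uncurry fun (x : Ep n m) (t : ℝ) => (wq n m t : ℂ) * K (dl √t x) (dl √t y)) :=
    (Complex.measurable_ofReal.comp (wq_meas.comp measurable_snd)).mul (meas_K hK measurable_snd measurable_fst measurable_const)
  rw [integral_integral_swap]
  · refine (setIntegral_congr_fun (g := fun _ => 0) measurableSet_Ioc fun t ht => ?_).trans (by simp)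
    have ht0 : 0 < t := lt_trans (by positivity) ht.1
    simp only
    rw [integral_const_mul, dl_integral (Real.sqrt_pos.mpr ht0) (F := fun x => K x (dl √t y)) (hK.measurable.comp measurable_prodMk_right), h0]
    simp
  · refine ⟨hm.aestronglyMeasurable, ?_⟩
    rw [HasFiniteIntegral, lintegral_prod _ hm.enorm.aemeasurable, lintegral_lintegral_swap (f := fun x t => ‖Function.uncurry (fun (x : Ep n m) (t : ℝ) => (wq n m t : ℂ) * K (dl √t x) (dl √t y)) (x, t)‖ₑ) hm.enorm.aemeasurable]
    refine lt_of_le_of_lt (b := ∫⁻ t in Ioc (r ^ 2 / 4) (r ^ 2), ENNReal.ofReal (4 / r ^ 2) * A) ?_ ?_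
    · refine setLIntegral_mono' measurableSet_Ioc fun t ht => ?_
      have ht0 : 0 < t := lt_trans (by positivity) ht.1
      refine le_trans (le_of_eq ?_) (avg_core hr (F := fun x => ‖K x (dl √t y)‖ₑ) (hK.measurable.comp measurable_prodMk_right).enorm
        ((lintegral_mono fun x => ?_).trans (h (dl √t y))) ht)
      · refine lintegral_congr fun x => ?_
        simp only [Function.uncurry, enorm_mul]
        rw [← ofReal_norm (wq n m t : ℂ), Complex.norm_real, Real.norm_eq_abs, abs_of_pos (wq_pos ht0)]
      · exact le_mul_of_one_le_right' (le_add_of_nonneg_right (zero_le))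
    · rw [ioc_const hr]; finiteness

theorem avg_meas {K : Ep n m → Ep n m → ℂ} (hK : Continuous (Function.uncurry K)) (r : ℝ) :
    Measurable (Function.uncurry (avg r K)) := by
  unfold avg Function.uncurry
  refine StronglyMeasurable.measurable ?_
  refine StronglyMeasurable.integral_prod_right (f := fun (q : Ep n m × Ep n m) t => (wq n m t : ℂ) * K (dl √t q.1) (dl √t q.2)) ?_
  refine Measurable.stronglyMeasurable ?_
  exact (Complex.measurable_ofReal.comp (wq_meas.comp measurable_snd)).mul (meas_K hK measurable_snd (measurable_fst.comp measurable_fst) (measurable_snd.comp measurable_fst))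

/-- main kernel -/
def Ker (e : Sym n m) (x y : Ep n m) : ℂ := Kg (-1) e x y

theorem Ker_swap (e : Sym n m) (x y : Ep n m) : Ker e x y = Kg 1 e y x := by
  unfold Ker Kg
  congr 1
  · rw [neg_smul, one_smul, one_smul, neg_sub]
  · rw [add_comm]
  · rw [neg_smul, one_smul, one_smul, neg_sub]

theorem Ker_good (hn : 1 ≤ n) (hm : 1 ≤ m) (i : Fin n ⊕ Fin n × Fin m) (e : Sym n m) : ∃ A : ℝ≥0, 0 < A ∧
    ∀ r > 0, GoodKer volume rho r A (avg r (Ker (opS i e))) := by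
  obtain ⟨A1, h1⟩ := Kg_size hn hm (opS i e) (show |(-1:ℝ)| = 1 by simp)
  obtain ⟨A2, h2⟩ := Kg_size hn hm (opS i e) (show |(1:ℝ)| = 1 by simp)
  obtain ⟨A3, h3⟩ := Kg_reg hn hm (opS i e) (show |(-1:ℝ)| = 1 by simp)
  obtain ⟨A4, h4⟩ := Kg_reg hn hm (opS i e) (show |(1:ℝ)| = 1 by simp)
  have hc1 : Continuous (Function.uncurry (Kg (-1) (opS i e))) := Kg_cont hn hm (-1) (opS i e) continuous_fst continuous_snd
  have hc2 : Continuous (Function.uncurry (Kg 1 (opS i e))) := Kg_cont hn hm 1 (opS i e) continuous_fst continuous_snd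
  have sw : ∀ r x y, avg r (Ker (opS i e)) x y = avg r (Kg 1 (opS i e)) y x := by
    intro r x y; unfold avg; simp only [Ker_swap]
  refine ⟨6 * (A1 + A2 + A3 + A4) + 1, by positivity, fun r hr => ⟨hr, avg_meas hc1 r, fun x => ?_, fun y => ?_, fun y y0 => ?_, fun x x0 => ?_, fun x => ?_, fun y => ?_⟩⟩
  · simp only [sw]
    refine (avg_size hr hc2 h2 x).trans ?_
    norm_cast
    have : (0:ℝ≥0) ≤ A1 + A3 + A4 := zero_le
    calc 3 * A2 ≤ 3 * A2 + (3 * A2 + 6 * (A1 + A3 + A4) + 1) := le_self_add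
      _ = _ := by ring
  · refine (avg_size hr hc1 h1 y).trans ?_
    norm_cast
    calc 3 * A1 ≤ 3 * A1 + (3 * A1 + 6 * (A2 + A3 + A4) + 1) := le_self_add
      _ = _ := by ring
  · refine (avg_reg hr hc1 h3 y y0).trans (mul_le_mul_left ?_ _)
    norm_cast
    calc 6 * A3 ≤ 6 * A3 + (6 * (A1 + A2 + A4) + 1) := le_self_add
      _ = _ := by ring
  · simp only [sw]
    refine (avg_reg hr hc2 h4 x x0).trans (mul_le_mul_left ?_ _)
    norm_cast
    calc 6 * A4 ≤ 6 * A4 + (6 * (A1 + A2 + A3) + 1) := le_self_add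
      _ = _ := by ring
  · simp only [sw]
    exact avg_canc hr hc2 h2 (fun y => Kg_canc hn hm i e (Or.inl rfl) y) x
  · exact avg_canc hr hc1 h1 (fun y => Kg_canc hn hm i e (Or.inr rfl) y) y

end GR
end

section
open scoped ENNReal NNReal Topology ComplexConjugate
namespace GR
set_option linter.unusedSectionVars false
variable {n m : ℕ}

/-- dyadic index of a real number -/
def fl (e : ℤ) (x : ℝ) : ℤ := ⌊x / (2:ℝ) ^ e⌋

theorem fl_mono {e e' : ℤ} (h : e ≤ e') (x : ℝ) : fl e' x = fl e x / ((2 ^ (e' - e).toNat : ℕ) : ℤ) := by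
  unfold fl
  have h2 : x / 2 ^ e = x / 2 ^ e' * ((2 ^ (e' - e).toNat : ℕ) : ℝ) := by
    push_cast
    rw [← zpow_natCast, Int.toNat_of_nonneg (by omega), zpow_sub₀ (by norm_num)]
    field_simp
  rw [h2, Int.mul_natCast_floor_div_cancel (by positivity)]

theorem fl_iff (e : ℤ) (x : ℝ) (k : ℤ) : fl e x = k ↔ x ∈ Ico (k * (2:ℝ) ^ e) ((k + 1) * 2 ^ e) := by
  unfold fl
  have : (0:ℝ) < 2 ^ e := by positivity
  rw [Int.floor_eq_iff, le_div_iff₀ this, div_lt_iff₀ this, mem_Ico]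

/-- size of integer vector -/
def Nk (k : Fin n → ℤ) : ℕ := 1 + Finset.univ.sup fun i => (k i).natAbs

theorem le_Nk (k : Fin n → ℤ) (i : Fin n) : (k i).natAbs + 1 ≤ Nk k := by
  unfold Nk; rw [add_comm]
  exact Nat.add_le_add_left (Finset.le_sup (f := fun i => (k i).natAbs) (Finset.mem_univ i)) 1

theorem Nk_le (k : Fin n → ℤ) (N : ℕ) (h1 : 1 ≤ N) (h : ∀ i, (k i).natAbs + 1 ≤ N) : Nk k ≤ N := by
  unfold Nk
  have : Finset.univ.sup (fun i => (k i).natAbs) ≤ N - 1 := Finset.sup_le fun i _ => by have := h i; omega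
  omega

/-- vertical exponent -/
def ex (j : ℤ) (k : Fin n → ℤ) : ℤ := 2 * j + Nat.log 2 (Nk k)

/-- horizontal index -/
def hk (j : ℤ) (x : Eu n) : Fin n → ℤ := fun i => fl j (x i)

/-- dyadic index -/
def idx (j : ℤ) (x : Ep n m) : (Fin n → ℤ) × (Fin m → ℤ) :=
  (hk j x.1, fun i => fl (ex j (hk j x.1)) (x.2 i))

theorem hk_succ (j : ℤ) (x : Eu n) (i : Fin n) : hk (j + 1) x i = hk j x i / 2 := by
  have := fl_mono (show j ≤ j + 1 by omega) (x i)
  simpa [hk] using this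

theorem Nk_pos (k : Fin n → ℤ) : 1 ≤ Nk k := by unfold Nk; omega

theorem Nk_succ1 (j : ℤ) (x : Eu n) : Nk (hk (j + 1) x) ≤ Nk (hk j x) := by
  refine Nk_le _ _ (Nk_pos _) fun i => ?_
  have := le_Nk (hk j x) i
  rw [hk_succ]; omega

theorem Nk_succ2 (j : ℤ) (x : Eu n) : Nk (hk j x) ≤ 2 * Nk (hk (j + 1) x) := by
  have := Nk_pos (hk (j + 1) x)
  refine Nk_le _ _ (by omega) fun i => ?_
  have := le_Nk (hk (j + 1) x) i
  rw [hk_succ] at this; omega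

theorem ex_succ1 (j : ℤ) (x : Eu n) : ex (j + 1) (hk (j + 1) x) ≤ ex j (hk j x) + 2 := by
  unfold ex
  have := Nat.log_mono_right (b := 2) (Nk_succ1 j x)
  omega

theorem ex_succ2 (j : ℤ) (x : Eu n) : ex j (hk j x) ≤ ex (j + 1) (hk (j + 1) x) := by
  unfold ex
  have h1 := Nat.log_mono_right (b := 2) (Nk_succ2 j x)
  have := Nk_pos (hk (j + 1) x)
  rw [mul_comm, Nat.log_mul_base (by norm_num) (by omega)] at h1
  omega

theorem two_ex (j : ℤ) (k : Fin n → ℤ) : (2:ℝ) ^ (ex j k) ≤ 2 ^ (2 * j) * Nk k ∧ 2 ^ (2 * j) * (Nk k : ℝ) ≤ 2 * 2 ^ (ex j k) := by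
  unfold ex
  rw [zpow_add₀ (by norm_num), zpow_natCast]
  have h0 : (0:ℝ) < 2 ^ (2 * j) := by positivity
  have h1 : ((2 ^ Nat.log 2 (Nk k) : ℕ) : ℝ) ≤ Nk k := by exact_mod_cast Nat.pow_log_le_self 2 (by have := Nk_pos k; omega)
  have h2 : (Nk k : ℝ) ≤ ((2 ^ (Nat.log 2 (Nk k) + 1) : ℕ) : ℝ) := by exact_mod_cast (Nat.lt_pow_succ_log_self (by norm_num) _).le
  push_cast at h1 h2
  constructor
  · gcongr
  · calc _ ≤ (2:ℝ) ^ (2 * j) * 2 ^ (Nat.log 2 (Nk k) + 1) := by gcongr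
      _ = _ := by rw [pow_succ]; ring

theorem vol_ico (a b : Fin n → ℝ) : volume {y : Eu n | ∀ i, y i ∈ Ico (a i) (b i)} = ∏ i, ENNReal.ofReal (b i - a i) := by
  have h := (PiLp.volume_preserving_ofLp (Fin n)).measure_preimage
    (s := Set.pi univ fun i => Ico (a i) (b i)) (MeasurableSet.univ_pi fun i => measurableSet_Ico).nullMeasurableSet
  rw [Real.volume_pi_Ico] at h
  rw [← h]; congr 1; ext y; simp

theorem vol_icc (a b : Fin n → ℝ) : volume {y : Eu n | ∀ i, y i ∈ Icc (a i) (b i)} = ∏ i, ENNReal.ofReal (b i - a i) := by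
  have h := (PiLp.volume_preserving_ofLp (Fin n)).measure_preimage
    (s := Icc a b) measurableSet_Icc.nullMeasurableSet
  rw [Real.volume_Icc_pi] at h
  rw [← h]; congr 1; ext y; simp [Pi.le_def, forall_and]

theorem cell_eq (j : ℤ) (i : (Fin n → ℤ) × (Fin m → ℤ)) :
    cell (X := Ep n m) idx j i = {y : Eu n | ∀ l, y l ∈ Ico (i.1 l * (2:ℝ) ^ j) ((i.1 l + 1) * 2 ^ j)} ×ˢ
      {y : Eu m | ∀ l, y l ∈ Ico (i.2 l * (2:ℝ) ^ (ex j i.1)) ((i.2 l + 1) * 2 ^ (ex j i.1))} := by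
  ext y
  simp only [cell, idx, mem_setOf_eq, mem_prod, Prod.ext_iff, ← fl_iff]
  constructor
  · rintro ⟨h1, h2⟩
    refine ⟨fun l => congrFun h1 l, fun l => ?_⟩
    rw [← h1]; exact congrFun h2 l
  · rintro ⟨h1, h2⟩
    have h1 : hk j y.1 = i.1 := funext h1
    exact ⟨h1, funext fun l => by rw [h1]; exact h2 l⟩

theorem vol_cell (j : ℤ) (i : (Fin n → ℤ) × (Fin m → ℤ)) :
    volume (cell (X := Ep n m) idx j i) = ENNReal.ofReal (2 ^ j) ^ n * ENNReal.ofReal (2 ^ (ex j i.1)) ^ m := by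
  rw [cell_eq, Measure.volume_eq_prod, Measure.prod_prod, vol_ico, vol_ico]
  congr 1
  · simp [add_mul]
  · simp [add_mul]

theorem hk_abs (j : ℤ) (x : Eu n) : ‖x‖ ≤ n * 2 ^ j * Nk (hk j x) := by
  refine (norm_le_sum x).trans ?_
  have h0 : (0:ℝ) < 2 ^ j := by positivity
  calc ∑ i, |x i| ≤ ∑ _i : Fin n, 2 ^ j * (Nk (hk j x) : ℝ) := by
        refine Finset.sum_le_sum fun i _ => ?_
        have h := (fl_iff j (x i) (hk j x i)).1 rfl
        have h2 : ((hk j x i).natAbs : ℝ) + 1 ≤ Nk (hk j x) := by exact_mod_cast le_Nk (hk j x) i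
        rw [Nat.cast_natAbs, Int.cast_abs] at h2
        set k := (hk j x i : ℝ)
        have a1 := neg_abs_le k
        have a2 := le_abs_self k
        rw [abs_le]
        constructor
        · nlinarith [h.1]
        · nlinarith [h.2]
    _ = _ := by simp; ring

theorem Nk_norm (j : ℤ) (x : Eu n) : 2 ^ j * (Nk (hk j x) : ℝ) ≤ 2 * 2 ^ j + ‖x‖ := by
  have h0 : (0:ℝ) < 2 ^ j := by positivity
  unfold Nk
  rcases Nat.eq_zero_or_pos n with rfl | hn
  · simp; nlinarith [norm_nonneg x]
  haveI : Nonempty (Fin n) := ⟨⟨0, hn⟩⟩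
  obtain ⟨i, _, hi⟩ := Finset.exists_mem_eq_sup (Finset.univ : Finset (Fin n)) Finset.univ_nonempty fun i => (hk j x i).natAbs
  rw [hi]
  have h := (fl_iff j (x i) (hk j x i)).1 rfl
  push_cast
  rw [Nat.cast_natAbs, Int.cast_abs]
  have hc := coord_le x i
  set k := (hk j x i : ℝ)
  rcases abs_cases k with ⟨e, _⟩ | ⟨e, _⟩
  · rw [e]; nlinarith [h.1, le_abs_self (x i)]
  · rw [e]; nlinarith [h.2, neg_abs_le (x i)]

theorem box_diff (e : ℤ) (x y : Eu n) (h : ∀ i, fl e (x i) = fl e (y i)) : ‖x - y‖ ≤ n * 2 ^ e := by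
  refine (norm_le_sum _).trans ?_
  calc _ ≤ ∑ _i : Fin n, (2:ℝ) ^ e := by
        refine Finset.sum_le_sum fun i _ => ?_
        have h1 := (fl_iff e (x i) (fl e (x i))).1 rfl
        have h2 := (fl_iff e (y i) (fl e (x i))).1 (h i).symm
        simp only [PiLp.sub_apply]
        rw [abs_le]
        constructor <;> nlinarith [h1.1, h1.2, h2.1, h2.2]
    _ = _ := by simp

theorem near_aux (j : ℤ) (x y : Ep n m) (h : idx j x = idx j y) : rhoR x y ≤ (n + 2 * m + 1) * 2 ^ j := by
  have h1 : hk j x.1 = hk j y.1 := congrArg Prod.fst h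
  have h2 := congrArg Prod.snd h
  simp only [idx] at h2
  have d1 := box_diff j x.1 y.1 (fun i => congrFun h1 i)
  have d2 := box_diff (ex j (hk j x.1)) x.2 y.2 (fun i => by
    have := congrFun h2 i; rw [← h1] at this; exact this)
  have e1 := (two_ex j (hk j x.1)).1
  have e2 := Nk_norm j x.1
  unfold rhoR
  set s : ℝ := 2 ^ j with hs
  have hs0 : 0 < s := by positivity
  have hs2 : (2:ℝ) ^ (2 * j) = s * s := by rw [two_mul, zpow_add₀ (by norm_num)]
  set H := ‖x.2 - y.2‖ with hH
  have hH0 : 0 ≤ H := norm_nonneg _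
  set T := ‖x.1‖ + ‖y.1‖ with hT
  have hT1 : ‖x.1‖ ≤ T := le_add_of_nonneg_right (norm_nonneg _)
  have hT0 : 0 ≤ T := by positivity
  have hHle : H ≤ m * (s * (2 * s + T)) := by
    refine d2.trans ?_
    gcongr
    refine e1.trans ?_
    rw [hs2, mul_assoc]
    gcongr
    linarith
  have : H / (T + √H) ≤ (2 * m + 1) * s := by
    by_cases hc : √H ≤ s
    · have : H / (T + √H) ≤ √H := by
        apply div_le_of_le_mul₀ (by positivity) (by positivity)
        nlinarith [Real.mul_self_sqrt hH0, mul_nonneg hT0 (Real.sqrt_nonneg H)]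
      have hm0 : (0:ℝ) ≤ m := by positivity
      nlinarith [mul_nonneg hm0 hs0.le]
    · push Not at hc
      apply div_le_of_le_mul₀ (by positivity) (by positivity)
      have hm0 : (0:ℝ) ≤ m := by positivity
      calc H ≤ m * (s * (2 * s + T)) := hHle
        _ ≤ m * (s * (2 * (T + √H))) := by gcongr; linarith
        _ ≤ _ := by nlinarith [mul_nonneg hs0.le hT0, mul_nonneg hs0.le (Real.sqrt_nonneg H)]
  have hn0 : (0:ℝ) ≤ n := by positivity
  linarith

theorem star_aux (j : ℤ) (x : Ep n m) (z y : Ep n m) (hy : idx j y = idx j x) (hr : rhoR y z < 2 ^ j) :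
    (∀ l, z.1 l ∈ Icc ((hk j x.1 l - 1 : ℝ) * (2:ℝ) ^ j) ((hk j x.1 l + 2) * 2 ^ j)) ∧
    (∀ l, z.2 l ∈ Icc (((idx j x).2 l - (8 * n + 6) : ℝ) * (2:ℝ) ^ (ex j (hk j x.1))) (((idx j x).2 l + 1 + (8 * n + 6)) * 2 ^ (ex j (hk j x.1)))) := by
  have h1 : hk j y.1 = hk j x.1 := congrArg Prod.fst hy
  have h2 := congrArg Prod.snd hy
  unfold rhoR at hr
  have hN := hk_abs j y.1
  rw [h1] at hN
  have hN2 := (two_ex j (hk j x.1)).2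
  have hN1 : (1:ℝ) ≤ Nk (hk j x.1) := by exact_mod_cast Nk_pos _
  set N := (Nk (hk j x.1) : ℝ)
  set s : ℝ := 2 ^ j with hs
  have hs0 : 0 < s := by positivity
  have hs2 : (2:ℝ) ^ (2 * j) = s * s := by rw [two_mul, zpow_add₀ (by norm_num)]
  set H := ‖y.2 - z.2‖ with hH
  have hH0 : 0 ≤ H := norm_nonneg _
  set T := ‖y.1‖ + ‖z.1‖ with hT
  have hT0 : 0 ≤ T := by positivity
  set q := H / (T + √H) with hq
  have hq0 : 0 ≤ q := by positivity
  have hd : ‖y.1 - z.1‖ < s := by linarith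
  have hqs : q < s := by linarith [norm_nonneg (y.1 - z.1)]
  have hHq : H = q * (T + √H) := by
    rcases eq_or_lt_of_le hH0 with h0 | h0
    · rw [hq, ← h0]; simp
    · rw [hq, div_mul_cancel₀]; positivity
  have hsq : √H * √H = H := Real.mul_self_sqrt hH0
  have hH1 : H ≤ s * (2 * T + s) := by
    have : H ≤ q * (2 * T + q) := by nlinarith [sq_nonneg (√H - q)]
    refine this.trans ?_
    gcongr
  have hz : ‖z.1‖ ≤ ‖y.1‖ + s := by
    have := norm_sub_norm_le z.1 y.1
    rw [norm_sub_rev] at this; linarith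
  have hTl : T ≤ 2 * (n * s * N) + s := by linarith
  have hn0 : (0:ℝ) ≤ n := by positivity
  have hHf : H ≤ (8 * n + 6) * 2 ^ (ex j (hk j x.1)) := by
    rw [hs2] at hN2
    calc H ≤ s * (2 * (2 * (n * s * N) + s) + s) := hH1.trans (by gcongr)
      _ = (s * s) * (4 * n * N + 3) := by ring
      _ ≤ (s * s) * (4 * n * N + 3 * N) := by gcongr; linarith
      _ = (4 * n + 3) * ((s * s) * N) := by ring
      _ ≤ (4 * n + 3) * (2 * 2 ^ (ex j (hk j x.1))) := by gcongr
      _ = _ := by ring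
  constructor
  · intro l
    have c := (fl_iff j (y.1 l) (hk j x.1 l)).1 (congrFun h1 l)
    rw [← hs] at c
    have c2 := (coord_le (y.1 - z.1) l).trans hd.le
    simp only [PiLp.sub_apply] at c2
    rw [abs_le] at c2
    constructor <;> nlinarith [c.1, c.2, c2.1, c2.2]
  · intro l
    have c := (fl_iff (ex j (hk j x.1)) (y.2 l) ((idx j x).2 l)).1 (by rw [← h2]; simp only [idx]; rw [h1])
    have c2 := (coord_le (y.2 - z.2) l).trans hHf
    simp only [PiLp.sub_apply] at c2
    rw [abs_le] at c2
    constructor <;> nlinarith [c.1, c.2, c2.1, c2.2]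

theorem dyadic_system (hn : 1 ≤ n) : ∃ D : ℝ≥0, Dyadic (volume : Measure (Ep n m)) rho D idx := by
  have hz : ∀ e : ℤ, ENNReal.ofReal ((2:ℝ) ^ e) ≠ 0 := fun e => by
    rw [Ne, ENNReal.ofReal_eq_zero, not_le]; positivity
  set D1 : ℝ≥0 := 2 ^ n * 4 ^ m
  set D2 : ℝ≥0 := (n + 2 * m + 1)
  set D3 : ℝ≥0 := 3 ^ n * (16 * n + 13) ^ m
  refine ⟨D1 + D2 + D3 + 1, ⟨inferInstance, le_add_self, ?_, ?_, ?_, ?_, ?_, ?_, ?_, ?_⟩⟩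
  · intro j i
    rw [cell_eq]
    refine MeasurableSet.prod ?_ ?_
    · simp only [setOf_forall]
      refine MeasurableSet.iInter fun l => measurableSet_Ico.preimage (by fun_prop)
    · simp only [setOf_forall]
      refine MeasurableSet.iInter fun l => measurableSet_Ico.preimage (by fun_prop)
  · intro j x y h
    have h1 : hk j x.1 = hk j y.1 := congrArg Prod.fst h
    have h2 := congrArg Prod.snd h
    have h3 : hk (j+1) x.1 = hk (j+1) y.1 := funext fun i => by rw [hk_succ, hk_succ, h1]
    unfold idx
    rw [← h3]
    congr 1
    funext i
    have := congrFun h2 i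
    simp only [idx] at this
    rw [fl_mono (ex_succ2 j x.1), fl_mono (ex_succ2 j x.1), this, ← h1]
  · intro j x
    rw [vol_cell]
    exact mul_ne_zero (pow_ne_zero _ (hz _)) (pow_ne_zero _ (hz _))
  · intro j x
    rw [vol_cell]; finiteness
  · intro j x
    rw [vol_cell, vol_cell]
    have a1 : ENNReal.ofReal ((2:ℝ) ^ (j + 1)) = 2 * ENNReal.ofReal (2 ^ j) := by
      rw [zpow_add₀ (by norm_num), mul_comm, ENNReal.ofReal_mul (by norm_num)]; simp
    have a2 : ENNReal.ofReal ((2:ℝ) ^ (ex (j + 1) (idx (j + 1) x).1)) ≤ 4 * ENNReal.ofReal (2 ^ (ex j (idx j x).1)) := by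
      calc _ ≤ ENNReal.ofReal ((2:ℝ) ^ (ex j (idx j x).1 + 2)) :=
            ENNReal.ofReal_le_ofReal (zpow_le_zpow_right₀ (by norm_num) (ex_succ1 j x.1))
        _ = _ := by
            rw [zpow_add₀ (by norm_num), mul_comm, ENNReal.ofReal_mul (by norm_num)]; norm_num
    calc _ ≤ (2 * ENNReal.ofReal (2 ^ j)) ^ n * (4 * ENNReal.ofReal (2 ^ (ex j (idx j x).1))) ^ m := by
          rw [a1]; gcongr
      _ = (D1 : ℝ≥0∞) * (ENNReal.ofReal (2 ^ j) ^ n * ENNReal.ofReal (2 ^ (ex j (idx j x).1)) ^ m) := by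
          simp only [D1]; push_cast; ring
      _ ≤ _ := by
          gcongr
          calc D1 ≤ D1 + (D2 + D3 + 1) := le_self_add
            _ = _ := by ring
  · intro x
    refine tendsto_nhds_top_mono (f := fun j : ℤ => ENNReal.ofReal ((2:ℝ) ^ j)) ?_ ?_
    · rw [ENNReal.tendsto_ofReal_nhds_top]
      refine tendsto_atTop_mono' _ ?_ (tendsto_intCast_atTop_atTop (R := ℝ))
      filter_upwards [eventually_ge_atTop 0] with j hj
      lift j to ℕ using hj
      rw [zpow_natCast]
      exact_mod_cast (Nat.lt_two_pow_self (n := j)).le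
    · filter_upwards [eventually_ge_atTop 0] with j hj
      rw [vol_cell]
      have b1 : (1:ℝ≥0∞) ≤ ENNReal.ofReal ((2:ℝ) ^ j) := by
        rw [← ENNReal.ofReal_one]; exact ENNReal.ofReal_le_ofReal (one_le_zpow₀ (by norm_num) hj)
      have b2 : (1:ℝ≥0∞) ≤ ENNReal.ofReal ((2:ℝ) ^ (ex j (idx j x).1)) := by
        rw [← ENNReal.ofReal_one]; refine ENNReal.ofReal_le_ofReal (one_le_zpow₀ (by norm_num) ?_)
        unfold ex; positivity
      calc _ ≤ ENNReal.ofReal ((2:ℝ) ^ j) ^ n := le_self_pow₀ b1 (by omega)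
        _ ≤ _ := le_mul_of_one_le_right' (one_le_pow₀ b2)
  · intro j x
    rw [vol_cell]
    have sub : {z : Ep n m | ∃ y, idx j y = idx j x ∧ rho y z < ENNReal.ofReal ((2:ℝ) ^ j)} ⊆
      {z : Eu n | ∀ l, z l ∈ Icc ((hk j x.1 l - 1 : ℝ) * (2:ℝ) ^ j) ((hk j x.1 l + 2) * 2 ^ j)} ×ˢ
      {z : Eu m | ∀ l, z l ∈ Icc (((idx j x).2 l - (8 * n + 6) : ℝ) * (2:ℝ) ^ (ex j (hk j x.1))) (((idx j x).2 l + 1 + (8 * n + 6)) * 2 ^ (ex j (hk j x.1)))} := by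
      rintro z ⟨y, hy, hr⟩
      rw [rho, ENNReal.ofReal_lt_ofReal_iff (by positivity)] at hr
      exact star_aux j x z y hy hr
    refine (measure_mono sub).trans ?_
    rw [Measure.volume_eq_prod, Measure.prod_prod, vol_icc, vol_icc]
    have v1 : ∀ l : Fin n, ENNReal.ofReal ((hk j x.1 l + 2) * 2 ^ j - (hk j x.1 l - 1 : ℝ) * (2:ℝ) ^ j) = 3 * ENNReal.ofReal (2 ^ j) := by
      intro l
      rw [← sub_mul, ENNReal.ofReal_mul' (by positivity)]
      congr 1
      rw [show ((hk j x.1 l : ℝ) + 2 - (hk j x.1 l - 1)) = 3 by ring]; simp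
    have v2 : ∀ l : Fin m, ENNReal.ofReal (((idx j x).2 l + 1 + (8 * n + 6)) * 2 ^ (ex j (hk j x.1)) - ((idx j x).2 l - (8 * n + 6) : ℝ) * (2:ℝ) ^ (ex j (hk j x.1)))
        = (16 * n + 13 : ℝ≥0) * ENNReal.ofReal (2 ^ (ex j (hk j x.1))) := by
      intro l
      rw [← sub_mul, ENNReal.ofReal_mul' (by positivity)]
      congr 1
      rw [show ((((idx j x).2 l : ℝ) + 1 + (8 * n + 6) - ((idx j x).2 l - (8 * n + 6)))) = ((16 * n + 13 : ℝ≥0) : ℝ) by push_cast; ring]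
      rw [ENNReal.ofReal_coe_nnreal]
    simp only [v1, v2, Finset.prod_const, Finset.card_univ, Fintype.card_fin]
    calc _ = (D3 : ℝ≥0∞) * (ENNReal.ofReal (2 ^ j) ^ n * ENNReal.ofReal (2 ^ (ex j (idx j x).1)) ^ m) := by
          simp only [D3, mul_pow, idx]; push_cast; ring
      _ ≤ _ := by
          gcongr
          calc D3 ≤ D3 + (D1 + D2 + 1) := le_self_add
            _ = _ := by ring
  · intro j x y h
    have := near_aux j x y h
    calc rho x y ≤ ENNReal.ofReal ((n + 2 * m + 1) * 2 ^ j) := ENNReal.ofReal_le_ofReal this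
      _ = (D2 : ℝ≥0∞) * ENNReal.ofReal (2 ^ j) := by
          rw [ENNReal.ofReal_mul (by positivity)]
          congr 1
          rw [show ((n:ℝ) + 2 * m + 1) = (D2 : ℝ) by simp [D2], ENNReal.ofReal_coe_nnreal]
      _ ≤ _ := by
          gcongr
          calc D2 ≤ D2 + (D1 + D3 + 1) := le_self_add
            _ = _ := by ring

end GR
end

section
open scoped ENNReal NNReal Topology ComplexConjugate
namespace GR
set_option linter.unusedSectionVars false
variable {n m : ℕ}

theorem kf_real (n : ℕ) {r : ℝ} (hr : 0 < r) (U V : ℝ) :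
    kf n (((r ^ 2 : ℝ)) : ℂ) U V = (((r / (2 * π * sinh (2 * r))) ^ ((n:ℝ) / 2) *
      exp (-(r / 4) * (cosh r / sinh r * U + sinh r / cosh r * V)) : ℝ) : ℂ) := by
  have hrc : (r : ℂ) ≠ 0 := by exact_mod_cast hr.ne'
  have s1 : Sf ((r ^ 2 : ℝ) : ℂ) = ((sinh r / r : ℝ) : ℂ) := by
    push_cast
    rw [← Sf_sq]; field_simp
  have s4 : Sf (4 * ((r ^ 2 : ℝ) : ℂ)) = ((sinh (2 * r) / (2 * r) : ℝ) : ℂ) := by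
    push_cast
    rw [← Sf_sq, mul_div_cancel_left₀ _ (by simp [hrc])]
    congr 1; ring
  have c1 : Cf ((r ^ 2 : ℝ) : ℂ) = ((cosh r : ℝ) : ℂ) := by
    push_cast; rw [← Cf_sq]
  have hs : 0 < sinh r := Real.sinh_pos_iff.mpr hr
  have hs2 : 0 < sinh (2 * r) := Real.sinh_pos_iff.mpr (by linarith)
  have hc : 0 < cosh r := Real.cosh_pos r
  unfold kf fa fb
  rw [s1, s4, c1]
  have e1 : (4 * (π:ℂ) * ((sinh (2 * r) / (2 * r) : ℝ) : ℂ)) = (((r / (2 * π * sinh (2 * r)))⁻¹ : ℝ) : ℂ) := by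
    rw [show (r / (2 * π * sinh (2 * r)))⁻¹ = 4 * π * (sinh (2 * r) / (2 * r)) by field_simp; ring]
    push_cast; ring
  rw [e1, ← Complex.ofReal_cpow (by positivity), Complex.ofReal_mul, Complex.ofReal_exp]
  congr 1
  · congr 1
    rw [Real.inv_rpow (by positivity), ← Real.rpow_neg (by positivity)]
    congr 1; ring
  · congr 1
    have h1 : (sinh r : ℂ) ≠ 0 := by exact_mod_cast hs.ne'
    have h2 : (cosh r : ℂ) ≠ 0 := by exact_mod_cast hc.ne'
    push_cast at h1 h2 ⊢
    field_simp

theorem norm_add_dotp (x y : Eu n) : ‖x + y‖ ^ 2 = ‖x - y‖ ^ 2 + 4 * dotp x y := by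
  rw [dotp_inner, norm_add_sq_real, norm_sub_sq_real]; ring

theorem hermite_eq {t : ℝ} (ht : 0 < t) {l : Eu m} (hl : l ≠ 0) (x y : Eu n) :
    ((hermiteK n t l x y : ℝ) : ℂ) = (((√t ^ n)⁻¹ : ℝ) : ℂ) *
      kf n (ssq (cl (t • l))) (‖(√t)⁻¹ • x - (√t)⁻¹ • y‖ ^ 2) (‖(√t)⁻¹ • x + (√t)⁻¹ • y‖ ^ 2) := by
  have hl0 : 0 < ‖l‖ := norm_pos_iff.mpr hl
  set r := t * ‖l‖ with hr
  have hr0 : 0 < r := by positivity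
  have hs := Real.sqrt_pos.mpr ht
  rw [ssq_cl, norm_smul, Real.norm_eq_abs, abs_of_pos ht, ← hr, kf_real n hr0, ← Complex.ofReal_mul]
  congr 1
  rw [← smul_sub, ← smul_add, norm_smul, norm_smul, norm_inv, Real.norm_eq_abs, abs_of_pos hs, mul_pow, mul_pow, inv_pow,
    Real.sq_sqrt ht.le, norm_add_dotp]
  unfold hermiteK
  rw [show 2 * ‖l‖ * t = 2 * r by rw [hr]; ring, show ‖l‖ * t = r by rw [hr]; ring, ← mul_assoc ((√t ^ n)⁻¹)]
  have hs1 : 0 < sinh r := Real.sinh_pos_iff.mpr hr0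
  have hs2 : 0 < sinh (2 * r) := Real.sinh_pos_iff.mpr (by linarith)
  have hc : 0 < cosh r := Real.cosh_pos r
  have hlr : ‖l‖ = r / t := by rw [hr]; field_simp
  congr 1
  · have : ‖l‖ / (2 * π * sinh (2 * r)) = t⁻¹ * (r / (2 * π * sinh (2 * r))) := by rw [hlr]; field_simp
    rw [this, Real.mul_rpow (by positivity) (by positivity)]
    congr 1
    rw [Real.inv_rpow ht.le, Real.sqrt_eq_rpow, ← Real.rpow_natCast, ← Real.rpow_mul ht.le]
    congr 2; ring
  · congr 1
    rw [hlr, Real.tanh_eq_sinh_div_cosh, Real.sinh_two_mul, Real.cosh_two_mul]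
    field_simp
    ring

/-- kernels with drift parameter -/
def KA (A : Eu n) (e : Sym n m) (x y : Ep n m) : ℂ := J A e (x.1 - y.1) (x.1 + y.1) (x.2 - y.2)

theorem KA_zero (e : Sym n m) (x y : Ep n m) : KA 0 e x y = Ker e x y := by
  unfold KA Ker Kg
  rw [neg_smul, one_smul, neg_smul, one_smul, neg_sub, neg_sub, add_comm]

theorem grushin_eq (hm : 1 ≤ m) {t : ℝ} (ht : 0 < t) (x y : Ep n m) (A : Eu n) :
    grushinH t x y = (((√t ^ (n + 2 * m))⁻¹ : ℝ) : ℂ) * KA A (.const 1) (dl √t x) (dl √t y) := by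
  haveI : Nonempty (Fin m) := ⟨⟨0, hm⟩⟩
  haveI : Nontrivial (Eu m) := inferInstance
  have hs := Real.sqrt_pos.mpr ht
  unfold grushinH KA J dl
  set F : Eu m → ℂ := fun l => Ph A (.const 1) ((√t)⁻¹ • x.1 - (√t)⁻¹ • y.1) ((√t)⁻¹ • x.1 + (√t)⁻¹ • y.1) (cl l) *
    ph (cl l) ((√t ^ 2)⁻¹ • x.2 - (√t ^ 2)⁻¹ • y.2) with hF
  have key : ∫ l : Eu m, ((hermiteK n t l x.1 y.1 : ℝ) : ℂ) * Complex.exp (-Complex.I * ((dotp l (x.2 - y.2) : ℝ) : ℂ))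
     = ∫ l : Eu m, (((√t ^ n)⁻¹ : ℝ) : ℂ) * F (t • l) := by
    refine integral_congr_ae ?_
    have h0 : ∀ᵐ l : Eu m, l ≠ 0 := by
      rw [ae_iff]; simp
    filter_upwards [h0] with l hl
    rw [hermite_eq ht hl, hF]
    simp only [Ph, ev, one_mul]
    rw [mul_assoc]
    congr 2
    rw [ph_cl]
    congr 3
    rw [← smul_sub, Real.sq_sqrt ht.le, dotp_inner, dotp_inner, inner_smul_left, inner_smul_right]
    simp; field_simp
  rw [key, integral_const_mul, Measure.integral_comp_smul, cst]
  simp only [finrank_euclideanSpace, Fintype.card_fin]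
  rw [abs_of_pos (by positivity), Complex.real_smul]
  have : (√t ^ (n + 2 * m))⁻¹ = (√t ^ n)⁻¹ * (t ^ m)⁻¹ := by
    rw [pow_add, mul_inv, pow_mul, Real.sq_sqrt ht.le]
  rw [this]
  push_cast
  ring

end GR
end

section
open scoped ENNReal NNReal Topology ComplexConjugate
namespace GR
set_option linter.unusedSectionVars false
variable {n m : ℕ}

theorem deriv_int_cpt {Φ Φ' : ℝ → Ep n m → ℂ} (hΦ : Continuous (Function.uncurry Φ)) (hΦ' : Continuous (Function.uncurry Φ'))
    (hd : ∀ y τ, HasDerivAt (fun τ => Φ τ y) (Φ' τ y) τ) {h : Ep n m → ℂ} (hh : Continuous h) (hc : HasCompactSupport h) :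
    HasDerivAt (fun τ => ∫ y, Φ τ y * h y) (∫ y, Φ' 0 y * h y) 0 := by
  obtain ⟨M, hM⟩ := ((isCompact_Icc (a := (-1:ℝ)) (b := 1)).prod hc.isCompact).exists_bound_of_continuousOn hΦ'.continuousOn
  have c1 : ∀ τ, Continuous (Φ τ) := fun τ => hΦ.comp (continuous_const.prodMk continuous_id)
  have c2 : ∀ τ, Continuous (Φ' τ) := fun τ => hΦ'.comp (continuous_const.prodMk continuous_id)
  refine (hasDerivAt_integral_of_dominated_loc_of_deriv_le (F := fun τ y => Φ τ y * h y) (F' := fun τ y => Φ' τ y * h y)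
    (x₀ := (0:ℝ)) (s := Metric.ball 0 1) (bound := fun y => M * ‖h y‖) (Metric.ball_mem_nhds _ one_pos) ?_ ?_ ?_ ?_ ?_ ?_).2
  · exact Eventually.of_forall fun τ => ((c1 τ).mul hh).aestronglyMeasurable
  · exact ((c1 0).mul hh).integrable_of_hasCompactSupport hc.mul_left
  · exact ((c2 0).mul hh).aestronglyMeasurable
  · refine ae_of_all _ fun y τ hτ => ?_
    rw [norm_mul]
    by_cases hy : y ∈ tsupport h
    · refine mul_le_mul_of_nonneg_right (hM (τ, y) ⟨?_, hy⟩) (norm_nonneg _)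
      rw [mem_ball_zero_iff, Real.norm_eq_abs, abs_lt] at hτ
      exact ⟨hτ.1.le, hτ.2.le⟩
    · rw [image_eq_zero_of_notMem_tsupport hy]; simp
  · exact (hh.norm.integrable_of_hasCompactSupport hc.norm).const_mul M
  · exact ae_of_all _ fun y τ _ => (hd y τ).mul_const (h y)

/-- drifted kernel -/
def GA (A : Eu n) (e : Sym n m) (x y : Ep n m) : ℂ := ((exp (-dotp A (x.1 + y.1)) : ℝ) : ℂ) * KA A e x y

theorem KA_cont {Ω : Type*} [TopologicalSpace Ω] (hn : 1 ≤ n) (hm : 1 ≤ m) (e : Sym n m) {A : Ω → Eu n}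
    {x y : Ω → Ep n m} (hA : Continuous A) (hx : Continuous x) (hy : Continuous y) :
    Continuous fun ω => KA (A ω) e (x ω) (y ω) := by
  unfold KA
  exact J_cont' hn hm e hA (by fun_prop) (by fun_prop) (by fun_prop)

theorem dotp_cont2 {Ω : Type*} [TopologicalSpace Ω] {A u : Ω → Eu n} (hA : Continuous A) (hu : Continuous u) :
    Continuous fun ω => dotp (A ω) (u ω) := by
  simp_rw [dotp_inner]; exact hA.inner hu

theorem GA_cont {Ω : Type*} [TopologicalSpace Ω] (hn : 1 ≤ n) (hm : 1 ≤ m) (e : Sym n m) {A : Ω → Eu n}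
    {x y : Ω → Ep n m} (hA : Continuous A) (hx : Continuous x) (hy : Continuous y) :
    Continuous fun ω => GA (A ω) e (x ω) (y ω) := by
  unfold GA
  refine Continuous.mul ?_ (KA_cont hn hm e hA hx hy)
  exact Complex.continuous_ofReal.comp (continuous_exp.comp (dotp_cont2 hA (hx.fst.add hy.fst)).neg)

theorem J_opS1 (hn : 1 ≤ n) (hm : 1 ≤ m) (A u v : Eu n) (z : Eu m) (j : Fin n) (e : Sym n m) :
    J A (opS (.inl j) e) u v z = J A (D1 1 j e) u v z - (A j : ℂ) * J A e u v z := by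
  unfold J
  rw [← mul_assoc, mul_comm (A j : ℂ), mul_assoc, ← mul_sub, ← integral_const_mul (A j : ℂ), ← integral_sub (Phph_int hn hm _ _ _ _ _)
    ((Phph_int hn hm _ _ _ _ _).const_mul _)]
  congr 2; funext l
  simp only [Ph, opS, D1, ev]; ring

theorem J_opS2 (A u v : Eu n) (z : Eu m) (jk : Fin n × Fin m) (e : Sym n m) :
    J A (opS (.inr jk) e) u v z = (((u jk.1 + v jk.1) / 2 : ℝ) : ℂ) * J A (D2 jk.2 e) u v z := by
  unfold J
  rw [← mul_assoc, mul_comm (((u jk.1 + v jk.1) / 2 : ℝ) : ℂ), mul_assoc, ← integral_const_mul (((u jk.1 + v jk.1) / 2 : ℝ) : ℂ)]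
  congr 2; funext l
  simp only [Ph, opS, D2, ev]; push_cast; ring

theorem GA_d1 (hn : 1 ≤ n) (hm : 1 ≤ m) (A : Eu n) (e : Sym n m) (x y : Ep n m) (j : Fin n) (q τ0 : ℝ) :
    HasDerivAt (fun τ : ℝ => GA A e (x.1 + τ • (q • EuclideanSpace.single j (1:ℝ)), x.2) y)
      ((q:ℂ) * GA A (opS (.inl j) e) (x.1 + τ0 • (q • EuclideanSpace.single j (1:ℝ)), x.2) y) τ0 := by
  set w : Eu n := q • EuclideanSpace.single j (1:ℝ) with hw
  have hJ := J_hasDerivAt hn hm 1 A (x.1 - y.1) (x.1 + y.1) w (x.2 - y.2) 0 e τ0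
  simp only [smul_zero, add_zero, PiLp.zero_apply, Complex.ofReal_zero, zero_mul, Finset.sum_const_zero, mul_one] at hJ
  have hsum : ∑ i, (w i : ℂ) * J A (D1 1 i e) (x.1 - y.1 + τ0 • w) (x.1 + y.1 + τ0 • w) (x.2 - y.2) =
      q * J A (D1 1 j e) (x.1 - y.1 + τ0 • w) (x.1 + y.1 + τ0 • w) (x.2 - y.2) := by
    rw [Finset.sum_eq_single j]
    · simp [hw]
    · intro b _ hb; simp [hw, hb]
    · simp
  rw [hsum] at hJ
  have hE : HasDerivAt (fun τ : ℝ => ((exp (-dotp A (x.1 + τ • w + y.1)) : ℝ) : ℂ))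
      (((exp (-dotp A (x.1 + τ0 • w + y.1)) * (-(q * A j)) : ℝ)) : ℂ) τ0 := by
    apply HasDerivAt.ofReal_comp
    apply HasDerivAt.exp
    apply HasDerivAt.neg
    have : ∀ τ, dotp A (x.1 + τ • w + y.1) = dotp A (x.1 + y.1) + τ * (q * A j) := by
      intro τ
      rw [dotp_inner, dotp_inner, hw, show x.1 + τ • q • EuclideanSpace.single j (1:ℝ) + y.1 = (x.1 + y.1) + τ • q • EuclideanSpace.single j (1:ℝ) by abel,
        inner_add_right, inner_smul_right, inner_smul_right, EuclideanSpace.inner_single_right]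
      simp
    simp_rw [this]
    simpa using ((hasDerivAt_id τ0).mul_const (q * A j)).const_add (dotp A (x.1 + y.1))
  have r1 : ∀ τ : ℝ, x.1 - y.1 + τ • w = x.1 + τ • w - y.1 := fun τ => by abel
  have r2 : ∀ τ : ℝ, x.1 + y.1 + τ • w = x.1 + τ • w + y.1 := fun τ => by abel
  simp only [r1, r2] at hJ
  unfold GA KA
  refine (hE.fun_mul hJ).congr_deriv ?_
  rw [J_opS1 hn hm]
  push_cast
  ring

theorem GA_d2 (hn : 1 ≤ n) (hm : 1 ≤ m) (A : Eu n) (e : Sym n m) (x y : Ep n m) (k : Fin m) (q τ0 : ℝ) :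
    HasDerivAt (fun τ : ℝ => GA A e (x.1, x.2 + τ • (q • EuclideanSpace.single k (1:ℝ))) y)
      ((q:ℂ) * GA A (D2 k e) (x.1, x.2 + τ0 • (q • EuclideanSpace.single k (1:ℝ))) y) τ0 := by
  set w : Eu m := q • EuclideanSpace.single k (1:ℝ) with hw
  have hJ := J_hasDerivAt hn hm 1 A (x.1 - y.1) (x.1 + y.1) 0 (x.2 - y.2) w e τ0
  simp only [smul_zero, add_zero, PiLp.zero_apply, Complex.ofReal_zero, zero_mul, Finset.sum_const_zero, mul_one, zero_add] at hJ
  have hsum : ∑ i, (w i : ℂ) * J A (D2 i e) (x.1 - y.1) (x.1 + y.1) (x.2 - y.2 + τ0 • w) =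
      q * J A (D2 k e) (x.1 - y.1) (x.1 + y.1) (x.2 - y.2 + τ0 • w) := by
    rw [Finset.sum_eq_single k]
    · simp [hw]
    · intro b _ hb; simp [hw, hb]
    · simp
  rw [hsum] at hJ
  have r1 : ∀ τ : ℝ, x.2 - y.2 + τ • w = x.2 + τ • w - y.2 := fun τ => by abel
  simp only [r1] at hJ
  unfold GA KA
  refine (hJ.const_mul (((exp (-dotp A (x.1 + y.1)) : ℝ) : ℂ))).congr_deriv ?_
  ring

theorem GA_opS2 (A : Eu n) (e : Sym n m) (x y : Ep n m) (jk : Fin n × Fin m) :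
    GA A (opS (.inr jk) e) x y = (x.1 jk.1 : ℂ) * GA A (D2 jk.2 e) x y := by
  unfold GA KA
  rw [J_opS2]
  simp only [PiLp.sub_apply, PiLp.add_apply]
  push_cast; ring

/-- model heat integral -/
def HH (s : ℝ) (A : Eu n) (h : Ep n m → ℂ) (e : Sym n m) (x : Ep n m) : ℂ := ∫ y, GA A e (dl s x) (dl s y) * h y

theorem vf_HH (hn : 1 ≤ n) (hm : 1 ≤ m) (i : Fin n ⊕ Fin n × Fin m) (s : ℝ) (A : Eu n) {h : Ep n m → ℂ}
    (hh : Continuous h) (hc : HasCompactSupport h) (e : Sym n m) (c : ℂ) :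
    vf i (fun x => c * HH s A h e x) = fun x => (c * (s⁻¹ : ℝ)) * HH s A h (opS i e) x := by
  funext x
  have hdl := dl_cont (n := n) (m := m) s
  cases i with
  | inl j =>
    unfold vf HH
    dsimp only
    rw [deriv_const_mul_field]
    have key := deriv_int_cpt (h := h)
      (Φ := fun τ y => GA A e ((dl s x).1 + τ • (s⁻¹ • EuclideanSpace.single j (1:ℝ)), (dl s x).2) (dl s y))
      (Φ' := fun τ y => ((s⁻¹:ℝ):ℂ) * GA A (opS (.inl j) e) ((dl s x).1 + τ • (s⁻¹ • EuclideanSpace.single j (1:ℝ)), (dl s x).2) (dl s y))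
      (GA_cont hn hm e continuous_const (by fun_prop) (hdl.comp continuous_snd))
      (continuous_const.mul (GA_cont hn hm _ continuous_const (by fun_prop) (hdl.comp continuous_snd)))
      (fun y τ => GA_d1 hn hm A e (dl s x) (dl s y) j s⁻¹ τ) hh hc
    have e1 : ∀ τ : ℝ, dl s (x.1 + τ • EuclideanSpace.single j (1:ℝ), x.2) =
      ((dl s x).1 + τ • (s⁻¹ • EuclideanSpace.single j (1:ℝ)), (dl s x).2) := by
      intro τ; simp only [dl]; rw [smul_add, smul_comm]
    simp only [e1]
    rw [key.deriv, mul_assoc, ← integral_const_mul (((s⁻¹ : ℝ) : ℂ))]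
    congr 2; funext y
    simp only [zero_smul, add_zero]
    ring
  | inr jk =>
    unfold vf HH
    dsimp only
    rw [deriv_const_mul_field]
    have key := deriv_int_cpt (h := h)
      (Φ := fun τ y => GA A e ((dl s x).1, (dl s x).2 + τ • ((s^2)⁻¹ • EuclideanSpace.single jk.2 (1:ℝ))) (dl s y))
      (Φ' := fun τ y => (((s^2)⁻¹:ℝ):ℂ) * GA A (D2 jk.2 e) ((dl s x).1, (dl s x).2 + τ • ((s^2)⁻¹ • EuclideanSpace.single jk.2 (1:ℝ))) (dl s y))
      (GA_cont hn hm e continuous_const (by fun_prop) (hdl.comp continuous_snd))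
      (continuous_const.mul (GA_cont hn hm _ continuous_const (by fun_prop) (hdl.comp continuous_snd)))
      (fun y τ => GA_d2 hn hm A e (dl s x) (dl s y) jk.2 (s^2)⁻¹ τ) hh hc
    have e1 : ∀ τ : ℝ, dl s (x.1, x.2 + τ • EuclideanSpace.single jk.2 (1:ℝ)) =
      ((dl s x).1, (dl s x).2 + τ • ((s^2)⁻¹ • EuclideanSpace.single jk.2 (1:ℝ))) := by
      intro τ; simp only [dl]; rw [smul_add, smul_comm]
    simp only [e1]
    rw [key.deriv, mul_left_comm, mul_assoc, ← integral_const_mul (((x.1 jk.1 : ℝ)) : ℂ), ← integral_const_mul (((s⁻¹ : ℝ) : ℂ))]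
    congr 2; funext y
    rw [GA_opS2]
    simp only [zero_smul, add_zero]
    rw [show (dl s x).1 jk.1 = s⁻¹ * x.1 jk.1 by simp [dl]]
    push_cast
    rw [show (((s:ℂ)^2)⁻¹) = (s:ℂ)⁻¹ * (s:ℂ)⁻¹ by rw [sq, mul_inv]]
    ring

theorem vf_HH_iter (hn : 1 ≤ n) (hm : 1 ≤ m) (i : Fin n ⊕ Fin n × Fin m) (s : ℝ) (A : Eu n) {h : Ep n m → ℂ}
    (hh : Continuous h) (hc : HasCompactSupport h) (e : Sym n m) (c : ℂ) (N : ℕ) :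
    (vf i)^[N] (fun x => c * HH s A h e x) = fun x => (c * (((s ^ N)⁻¹ : ℝ) : ℂ)) * HH s A h ((opS i)^[N] e) x := by
  induction N generalizing e c with
  | zero => simp
  | succ N ih =>
    rw [Function.iterate_succ_apply, vf_HH hn hm i s A hh hc, ih, Function.iterate_succ_apply]
    funext x
    congr 1
    rw [pow_succ, mul_inv]; push_cast; ring

/-- symbol obtained from a word -/
def opW (α : Fin n ⊕ Fin n × Fin m → ℕ) (L : List (Fin n ⊕ Fin n × Fin m)) (e : Sym n m) : Sym n m :=
  L.foldr (fun i e => (opS i)^[α i] e) e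

theorem foldr_HH (hn : 1 ≤ n) (hm : 1 ≤ m) (α : Fin n ⊕ Fin n × Fin m → ℕ) (s : ℝ) (A : Eu n) {h : Ep n m → ℂ}
    (hh : Continuous h) (hc : HasCompactSupport h) (e : Sym n m) (c : ℂ) (L : List (Fin n ⊕ Fin n × Fin m)) :
    L.foldr (fun i F => (vf i)^[α i] ∘ F) id (fun x => c * HH s A h e x) =
      fun x => (c * (((s ^ (L.map α).sum)⁻¹ : ℝ) : ℂ)) * HH s A h (opW α L e) x := by
  induction L with
  | nil => simp [opW]
  | cons i L ih =>
    rw [List.foldr_cons, Function.comp_apply, ih, vf_HH_iter hn hm i s A hh hc]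
    funext x
    rw [List.map_cons, List.sum_cons, pow_add, mul_inv]
    simp only [opW, List.foldr_cons]
    push_cast; ring

theorem opW_form (α : Fin n ⊕ Fin n × Fin m → ℕ) (e : Sym n m) (L : List (Fin n ⊕ Fin n × Fin m)) (hL : 1 ≤ (L.map α).sum) :
    ∃ i e', opW α L e = opS i e' := by
  induction L with
  | nil => simp at hL
  | cons i L ih =>
    simp only [opW, List.foldr_cons]
    rcases Nat.eq_zero_or_pos (α i) with h0 | h0
    · rw [h0]
      simp only [List.map_cons, List.sum_cons, h0, zero_add] at hL
      exact ih hL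
    · obtain ⟨N, hN⟩ := Nat.exists_eq_succ_of_ne_zero h0.ne'
      rw [hN, Function.iterate_succ_apply']
      exact ⟨_, _, rfl⟩

theorem Xalpha_heat (hn : 1 ≤ n) (hm : 1 ≤ m) (α : Fin n ⊕ Fin n × Fin m → ℕ) (a : Eu n) {f : Ep n m → ℂ}
    (hf : Continuous f) (hc : HasCompactSupport f) {t : ℝ} (ht : 0 < t) (x : Ep n m) :
    ((t ^ ((((∑ i, α i : ℕ) : ℝ) / 2) - 1) : ℝ) : ℂ) * Xalpha α (heatOp a t f) x =
      ((wq n m t * exp (-‖√t • a‖ ^ 2) : ℝ) : ℂ) *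
        ∫ y, GA (√t • a) (opW α Finset.univ.toList (.const 1)) (dl √t x) (dl √t y) * (f y * ((exp (2 * dotp a y.1) : ℝ) : ℂ)) := by
  have hs := Real.sqrt_pos.mpr ht
  set h : Ep n m → ℂ := fun y => f y * ((exp (2 * dotp a y.1) : ℝ) : ℂ) with hh
  have hhc : Continuous h := hf.mul (Complex.continuous_ofReal.comp (continuous_exp.comp (continuous_const.mul (dotp_cont2 continuous_const continuous_fst))))
  have hhs : HasCompactSupport h := hc.mul_right
  have hnorm : ‖√t • a‖ ^ 2 = ‖a‖ ^ 2 * t := by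
    rw [norm_smul, Real.norm_eq_abs, abs_of_pos hs, mul_pow, Real.sq_sqrt ht.le]; ring
  have e0 : heatOp a t f = fun x => ((exp (-‖√t • a‖ ^ 2) * (√t ^ (n + 2 * m))⁻¹ : ℝ) : ℂ) * HH √t (√t • a) h (.const 1) x := by
    funext x
    unfold heatOp HH
    rw [← integral_const_mul]
    congr 1; funext y
    unfold driftH
    rw [grushin_eq hm ht x y (√t • a), GA, hh, hnorm]
    have : dotp (√t • a) ((dl √t x).1 + (dl √t y).1) = dotp a (x.1 + y.1) := by
      simp only [dl]
      rw [← smul_add, dotp_inner, dotp_inner, inner_smul_left, inner_smul_right, ← mul_assoc]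
      simp [hs.ne']
    rw [this, neg_mul]
    push_cast; ring
  unfold Xalpha
  rw [e0, foldr_HH hn hm α _ _ hhc hhs]
  have hsum : (Finset.univ.toList.map α).sum = ∑ i, α i := Finset.sum_map_toList _ _
  rw [hsum]
  set k := ∑ i, α i with hk
  have : t ^ (((k:ℝ) / 2) - 1) = √t ^ k * t⁻¹ := by
    rw [Real.rpow_sub ht, Real.rpow_one, Real.sqrt_eq_rpow, ← Real.rpow_natCast, ← Real.rpow_mul ht.le, div_eq_mul_inv]
    congr 2; ring
  rw [this, ← mul_assoc]
  unfold HH wq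
  congr 1
  have h3 : (((√t : ℝ) : ℂ)) ≠ 0 := by exact_mod_cast hs.ne'
  push_cast
  field_simp

end GR
end

section
open scoped ENNReal NNReal Topology ComplexConjugate
namespace GR
set_option linter.unusedSectionVars false
variable {n m : ℕ}

/-- conjugated kernel -/
def MA (θ : ℝ) (A : Eu n) (e : Sym n m) (x y : Ep n m) : ℂ :=
  ((exp (-‖A‖ ^ 2 + θ * dotp A (x.1 - y.1)) : ℝ) : ℂ) * KA A e x y

theorem MA_cont {Ω : Type*} [TopologicalSpace Ω] (hn : 1 ≤ n) (hm : 1 ≤ m) (θ : ℝ) (e : Sym n m) {A : Ω → Eu n}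
    {x y : Ω → Ep n m} (hA : Continuous A) (hx : Continuous x) (hy : Continuous y) :
    Continuous fun ω => MA θ (A ω) e (x ω) (y ω) := by
  unfold MA
  refine Continuous.mul ?_ (KA_cont hn hm e hA hx hy)
  exact Complex.continuous_ofReal.comp (continuous_exp.comp (((hA.norm.pow 2).neg).add (continuous_const.mul (dotp_cont2 hA (hx.fst.sub hy.fst)))))

theorem exp_sub_one_le {w B : ℝ} (hB : 0 ≤ B) (hw : w ≤ B) : |exp w - 1| ≤ |w| * exp B := by
  rcases le_total 0 w with h | h
  · rw [abs_of_nonneg (by linarith [add_one_le_exp w]), abs_of_nonneg h]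
    have h1 := add_one_le_exp (-w)
    have h2 : exp w * exp (-w) = 1 := by rw [← exp_add]; simp
    have h3 : exp w ≤ exp B := exp_le_exp.mpr hw
    nlinarith [exp_pos w]
  · rw [abs_of_nonpos (by have := exp_le_one_iff.mpr h; linarith), abs_of_nonpos h]
    have h1 := add_one_le_exp w
    have h2 := one_le_exp hB
    nlinarith

theorem Mj_exp (κ q c : ℝ) (u v : Eu n) (z : Eu m) : exp (q * ‖u‖ ^ 2) * Mj κ c u v z = Mj (κ - q) c u v z := by
  unfold Mj
  rw [← mul_assoc, ← mul_assoc, ← exp_add]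
  congr 3; ring

theorem Mj_mono {κ κ' : ℝ} (h : κ' ≤ κ) (c : ℝ) (u v : Eu n) (z : Eu m) : Mj κ c u v z ≤ Mj κ' c u v z := by
  unfold Mj
  gcongr

theorem MA_bound (hn : 1 ≤ n) (hm : 1 ≤ m) {θ : ℝ} (hθ : |θ| < 1) (e : Sym n m) :
    ∃ κ c C : ℝ, 0 < κ ∧ 0 < c ∧ 0 ≤ C ∧ ∀ (A : Eu n) (x y : Ep n m),
      ‖MA θ A e x y - (if ‖A‖ ≤ 1 then Ker e x y else 0)‖ ≤ C * (‖A‖ * exp (-‖A‖)) * Mk κ c x y := by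
  set ε := 1 - |θ| with hε
  have hε0 : 0 < ε := by rw [hε]; linarith
  have hθ0 := abs_nonneg θ
  obtain ⟨c, hc, hJ⟩ := J_bound (n := n) (m := m) hn hm (κ := (1 + |θ|) / 8) (by positivity) (by linarith)
  obtain ⟨C, N, hC, hJ⟩ := hJ e
  obtain ⟨C1, hC1, h1⟩ := pow_exp_sq_le N (show 0 < ε / 2 by positivity)
  obtain ⟨C3, hC3, h3⟩ := pow_exp_sq_le 1 (show 0 < ε / 16 by positivity)
  set Ca := exp 1 * (exp 1 * C * 2 ^ N * C3 + C * 2 ^ N) with hCa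
  set Cb := C * C1 * exp (1 / (2 * ε)) with hCb
  have hCa0 : 0 ≤ Ca := by positivity
  have hCb0 : 0 ≤ Cb := by positivity
  refine ⟨ε / 16, c, Ca + Cb, by positivity, hc, by positivity, fun A x y => ?_⟩
  rw [Mk_symm]
  obtain ⟨b1, b2⟩ := hJ A (x.1 - y.1) (x.1 + y.1) (x.2 - y.2)
  unfold MA Mk KA
  rw [← KA_zero]; unfold KA
  set u := x.1 - y.1 with hu
  set v := x.1 + y.1 with hv
  set z := x.2 - y.2 with hz
  set s := ‖A‖ with hs
  have hs0 : 0 ≤ s := norm_nonneg _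
  have hu0 : 0 ≤ ‖u‖ := norm_nonneg _
  set M := Mj (ε / 16) c u v z with hM
  have hM0 : 0 ≤ M := Mj_nonneg _ _ _ _ _
  have hd : |θ * dotp A u| ≤ |θ| * (s * ‖u‖) := by
    rw [abs_mul, dotp_inner]
    exact mul_le_mul_of_nonneg_left (abs_real_inner_le_norm _ _) hθ0
  have hd2 : s * ‖u‖ ≤ s ^ 2 + ‖u‖ ^ 2 / 4 := by nlinarith [sq_nonneg (s - ‖u‖ / 2)]
  have hw : -s ^ 2 + θ * dotp A u ≤ -(ε * s ^ 2) + |θ| / 4 * ‖u‖ ^ 2 := by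
    have := (abs_le.mp hd).2
    have h2 := mul_le_mul_of_nonneg_left hd2 hθ0
    rw [hε]; nlinarith
  have hMq : exp (|θ| / 4 * ‖u‖ ^ 2) * Mj ((1 + |θ|) / 8) c u v z = Mj (ε / 8) c u v z := by
    rw [Mj_exp]; congr 1; rw [hε]; ring
  have hM8 : Mj (ε / 8) c u v z ≤ M := Mj_mono (by linarith) _ _ _ _
  have hM1 : Mj ((1 + |θ|) / 8) c u v z ≤ M := Mj_mono (by rw [hε]; linarith) _ _ _ _
  have hMu : (1 + ‖u‖) * Mj (ε / 8) c u v z ≤ C3 * M := by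
    have := h3 ‖u‖ hu0
    rw [pow_one] at this
    calc _ ≤ (C3 * exp (ε / 16 * ‖u‖ ^ 2)) * Mj (ε / 8) c u v z := mul_le_mul_of_nonneg_right this (Mj_nonneg _ _ _ _ _)
      _ = C3 * M := by rw [mul_assoc, Mj_exp, hM]; congr 2; ring
  by_cases h : s ≤ 1
  · rw [if_pos h]
    have e1 : ((exp (-s ^ 2 + θ * dotp A u) : ℝ) : ℂ) * J A e u v z - J 0 e u v z =
      ((exp (-s ^ 2 + θ * dotp A u) - 1 : ℝ) : ℂ) * J A e u v z + (J A e u v z - J 0 e u v z) := by push_cast; ring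
    rw [e1]
    refine (norm_add_le _ _).trans ?_
    rw [norm_mul, Complex.norm_real, Real.norm_eq_abs]
    have hpw : (1 + s) ^ N ≤ 2 ^ N := pow_le_pow_left₀ (by positivity) (by linarith) N
    have f1 : |exp (-s ^ 2 + θ * dotp A u) - 1| ≤ (s * (1 + ‖u‖)) * exp (|θ| / 4 * ‖u‖ ^ 2) := by
      have := exp_sub_one_le (w := -s ^ 2 + θ * dotp A u) (B := |θ| / 4 * ‖u‖ ^ 2) (by positivity) (hw.trans (by nlinarith [sq_nonneg s]))
      refine this.trans (mul_le_mul_of_nonneg_right ?_ (exp_pos _).le)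
      refine (abs_add_le _ _).trans ?_
      rw [abs_neg, abs_of_nonneg (sq_nonneg s)]
      have : |θ| * (s * ‖u‖) ≤ 1 * (s * ‖u‖) := mul_le_mul_of_nonneg_right hθ.le (by positivity)
      nlinarith
    have f2 : ‖J A e u v z‖ ≤ C * 2 ^ N * Mj ((1 + |θ|) / 8) c u v z :=
      b1.trans (mul_le_mul_of_nonneg_right (mul_le_mul_of_nonneg_left hpw hC) (Mj_nonneg _ _ _ _ _))
    have f3 : ‖J A e u v z - J 0 e u v z‖ ≤ s * (C * 2 ^ N * M) := by
      refine b2.trans (mul_le_mul_of_nonneg_left ?_ hs0)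
      exact mul_le_mul (mul_le_mul_of_nonneg_left hpw hC) hM1 (Mj_nonneg _ _ _ _ _) (by positivity)
    have f4 : |exp (-s ^ 2 + θ * dotp A u) - 1| * ‖J A e u v z‖ ≤ s * (C * 2 ^ N * C3 * M) := by
      calc _ ≤ ((s * (1 + ‖u‖)) * exp (|θ| / 4 * ‖u‖ ^ 2)) * (C * 2 ^ N * Mj ((1 + |θ|) / 8) c u v z) :=
            mul_le_mul f1 f2 (norm_nonneg _) (by positivity)
        _ = s * (C * 2 ^ N) * ((1 + ‖u‖) * (exp (|θ| / 4 * ‖u‖ ^ 2) * Mj ((1 + |θ|) / 8) c u v z)) := by ring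
        _ ≤ s * (C * 2 ^ N) * (C3 * M) := by
            rw [hMq]; exact mul_le_mul_of_nonneg_left hMu (by positivity)
        _ = _ := by ring
    have f5 : 1 ≤ exp 1 * exp (-s) := by rw [← exp_add]; exact one_le_exp (by linarith)
    have f6 : (1:ℝ) ≤ exp 1 := one_le_exp (by norm_num)
    calc _ ≤ s * (C * 2 ^ N * C3 * M) + s * (C * 2 ^ N * M) := add_le_add f4 f3
      _ ≤ s * (exp 1 * (C * 2 ^ N * C3 * M)) + s * (C * 2 ^ N * M) := by
          have : C * 2 ^ N * C3 * M ≤ exp 1 * (C * 2 ^ N * C3 * M) := le_mul_of_one_le_left (by positivity) f6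
          gcongr
      _ = 1 * (s * (exp 1 * C * 2 ^ N * C3 + C * 2 ^ N) * M) := by ring
      _ ≤ (exp 1 * exp (-s)) * (s * (exp 1 * C * 2 ^ N * C3 + C * 2 ^ N) * M) := mul_le_mul_of_nonneg_right f5 (by positivity)
      _ = Ca * (s * exp (-s)) * M := by rw [hCa]; ring
      _ ≤ _ := by
          have : Ca * (s * exp (-s)) ≤ (Ca + Cb) * (s * exp (-s)) := by
            apply mul_le_mul_of_nonneg_right _ (by positivity); linarith
          exact mul_le_mul_of_nonneg_right this hM0
  · rw [if_neg h, sub_zero, norm_mul, Complex.norm_real, Real.norm_eq_abs, abs_of_pos (exp_pos _)]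
    push Not at h
    have g1 : exp (-s ^ 2 + θ * dotp A u) ≤ exp (-(ε * s ^ 2)) * exp (|θ| / 4 * ‖u‖ ^ 2) := by
      rw [← exp_add]; exact exp_le_exp.mpr hw
    have g2 : (1 + s) ^ N * exp (-(ε * s ^ 2)) ≤ C1 * (exp (1 / (2 * ε)) * exp (-s)) := by
      calc _ ≤ (C1 * exp (ε / 2 * s ^ 2)) * exp (-(ε * s ^ 2)) := mul_le_mul_of_nonneg_right (h1 s hs0) (exp_pos _).le
        _ ≤ _ := by
          rw [mul_assoc, ← exp_add, ← exp_add]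
          refine mul_le_mul_of_nonneg_left (exp_le_exp.mpr ?_) hC1.le
          have : 0 ≤ (ε / 2) * (s - 1 / ε) ^ 2 := by positivity
          have e2 : (ε / 2) * (s - 1 / ε) ^ 2 = ε / 2 * s ^ 2 - s + 1 / (2 * ε) := by field_simp; ring
          linarith
    calc _ ≤ (exp (-(ε * s ^ 2)) * exp (|θ| / 4 * ‖u‖ ^ 2)) * (C * (1 + s) ^ N * Mj ((1 + |θ|) / 8) c u v z) :=
          mul_le_mul g1 b1 (norm_nonneg _) (by positivity)
      _ = C * ((1 + s) ^ N * exp (-(ε * s ^ 2))) * (exp (|θ| / 4 * ‖u‖ ^ 2) * Mj ((1 + |θ|) / 8) c u v z) := by ring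
      _ ≤ C * (C1 * (exp (1 / (2 * ε)) * exp (-s))) * M := by
          rw [hMq]
          exact mul_le_mul (mul_le_mul_of_nonneg_left g2 hC) hM8 (Mj_nonneg _ _ _ _ _) (by positivity)
      _ = Cb * (1 * exp (-s)) * M := by rw [hCb]; ring
      _ ≤ (Ca + Cb) * (s * exp (-s)) * M := by
          refine mul_le_mul_of_nonneg_right ?_ hM0
          refine mul_le_mul (by linarith) (mul_le_mul_of_nonneg_right h.le (exp_pos _).le) (by positivity) (by positivity)

theorem tint {b : ℝ} (hb : 0 < b) : ∫⁻ t in Ioi (0:ℝ), ENNReal.ofReal (t⁻¹ * (√t * b * exp (-(√t * b)))) ≤ 2 := by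
  have hcont : ContinuousWithinAt (fun t => -2 * exp (-(√t * b))) (Ici 0) 0 := by
    apply Continuous.continuousWithinAt; fun_prop
  have hder : ∀ t ∈ Ioi (0:ℝ), HasDerivAt (fun t => -2 * exp (-(√t * b))) (t⁻¹ * (√t * b * exp (-(√t * b)))) t := by
    intro t ht
    have ht : 0 < t := ht
    have hs := Real.sqrt_pos.mpr ht
    have h1 := ((((Real.hasDerivAt_sqrt ht.ne').mul_const b).fun_neg).exp).const_mul (-2)
    refine h1.congr_deriv ?_
    have : t = √t * √t := (Real.mul_self_sqrt ht.le).symm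
    rw [show t⁻¹ = (√t)⁻¹ * (√t)⁻¹ by rw [← mul_inv, ← this]]
    field_simp
  have hpos : ∀ t ∈ Ioi (0:ℝ), 0 ≤ t⁻¹ * (√t * b * exp (-(√t * b))) := by
    intro t ht
    have ht : 0 < t := ht
    positivity
  have hlim : Tendsto (fun t => -2 * exp (-(√t * b))) atTop (𝓝 (-2 * 0)) := by
    refine Tendsto.const_mul _ ?_
    refine tendsto_exp_neg_atTop_nhds_zero.comp ?_
    exact Real.tendsto_sqrt_atTop.atTop_mul_const hb
  have hinteg := integrableOn_Ioi_deriv_of_nonneg hcont hder hpos hlim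
  have hval := integral_Ioi_of_hasDerivAt_of_nonneg hcont hder hpos hlim
  rw [← ofReal_integral_eq_lintegral_ofReal hinteg ((ae_restrict_iff' measurableSet_Ioi).mpr (ae_of_all _ hpos)), hval]
  simp

end GR
end

section
open scoped ENNReal NNReal Topology ComplexConjugate
namespace GR
set_option linter.unusedSectionVars false
variable {n m : ℕ}

/-- integrand of the error kernel -/
def KSi (b κ c : ℝ) (t : ℝ) (x y : Ep n m) : ℝ :=
  wq n m t * (√t * b * exp (-(√t * b))) * Mk κ c (dl √t x) (dl √t y)

/-- error kernel -/
def KS (b κ c : ℝ) (x y : Ep n m) : ℝ≥0∞ := ∫⁻ t in Ioi (0:ℝ), ENNReal.ofReal (KSi b κ c t x y)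

theorem Mk_meas (κ c : ℝ) {Ω : Type*} [MeasurableSpace Ω] {x y : Ω → Ep n m}
    (hx : Measurable x) (hy : Measurable y) : Measurable fun ω => Mk κ c (x ω) (y ω) := by
  unfold Mk Mj
  fun_prop

theorem KSi_meas (b κ c : ℝ) {Ω : Type*} [MeasurableSpace Ω] {t : Ω → ℝ} {x y : Ω → Ep n m}
    (ht : Measurable t) (hx : Measurable x) (hy : Measurable y) : Measurable fun ω => KSi b κ c (t ω) (x ω) (y ω) := by
  unfold KSi
  refine Measurable.mul (Measurable.mul (wq_meas.comp ht) (by fun_prop)) ?_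
  have h1 : Measurable fun ω => dl √(t ω) (x ω) := dl_meas.comp (ht.sqrt.prodMk hx)
  have h2 : Measurable fun ω => dl √(t ω) (y ω) := dl_meas.comp (ht.sqrt.prodMk hy)
  exact Mk_meas κ c h1 h2

theorem KSi_symm (b κ c t : ℝ) (x y : Ep n m) : KSi b κ c t x y = KSi b κ c t y x := by
  unfold KSi; rw [Mk_symm]

theorem KS_symm (b κ c : ℝ) (x y : Ep n m) : KS b κ c x y = KS b κ c y x := by
  unfold KS; simp_rw [KSi_symm b κ c _ x y]

theorem KS_meas (b κ c : ℝ) : Measurable (Function.uncurry (KS b κ c : Ep n m → Ep n m → ℝ≥0∞)) := by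
  unfold KS Function.uncurry
  refine Measurable.lintegral_prod_right' (f := fun q : (Ep n m × Ep n m) × ℝ => ENNReal.ofReal (KSi b κ c q.2 q.1.1 q.1.2)) ?_
  exact (KSi_meas b κ c measurable_snd (measurable_fst.comp measurable_fst) (measurable_snd.comp measurable_fst)).ennreal_ofReal

theorem KS_schur (n m : ℕ) {κ c : ℝ} (hκ : 0 < κ) (hc : 0 < c) : ∃ B : ℝ≥0, ∀ b : ℝ, 0 < b → ∀ y : Ep n m,
    ∫⁻ x, KS b κ c x y ≤ B := by
  obtain ⟨B, hB⟩ := Mk_int n m hκ hc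
  refine ⟨2 * B, fun b hb y => ?_⟩
  unfold KS
  rw [lintegral_lintegral_swap (KSi_meas b κ c measurable_snd measurable_fst measurable_const).ennreal_ofReal.aemeasurable]
  calc _ ≤ ∫⁻ t in Ioi (0:ℝ), ENNReal.ofReal (t⁻¹ * (√t * b * exp (-(√t * b)))) * B := by
        refine setLIntegral_mono' measurableSet_Ioi fun t ht => ?_
        have ht : 0 < t := ht
        have hs := Real.sqrt_pos.mpr ht
        unfold KSi
        have hw := wq_pos (n := n) (m := m) ht
        have hnn : 0 ≤ wq n m t * (√t * b * exp (-(√t * b))) := by positivity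
        simp_rw [ENNReal.ofReal_mul hnn]
        rw [lintegral_const_mul' _ _ ENNReal.ofReal_ne_top,
          dl_lint hs (F := fun x => ENNReal.ofReal (Mk κ c x (dl √t y))) (Mk_cont κ c continuous_id continuous_const).measurable.ennreal_ofReal,
          ← mul_assoc, ← ENNReal.ofReal_mul hnn]
        refine mul_le_mul' (le_of_eq ?_) (hB _)
        congr 1
        unfold wq
        field_simp
    _ ≤ 2 * B := by
        rw [lintegral_mul_const' _ _ ENNReal.coe_ne_top]
        exact mul_le_mul_left (tint hb) _
    _ = _ := by push_cast; rfl

theorem Ker_bdd (hn : 1 ≤ n) (hm : 1 ≤ m) (e : Sym n m) : ∃ C : ℝ, 0 ≤ C ∧ ∀ x y, ‖Ker e x y‖ ≤ C := by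
  obtain ⟨c, hc, hJ⟩ := J_bound (n := n) (m := m) hn hm (κ := 0) le_rfl (by norm_num)
  obtain ⟨C, N, hC, hJ⟩ := hJ e
  refine ⟨C, hC, fun x y => ?_⟩
  rw [← KA_zero, KA]
  refine (hJ _ _ _ _).1.trans ?_
  rw [norm_zero, add_zero, one_pow, mul_one]
  refine mul_le_of_le_one_right hC ?_
  unfold Mj
  have h1 : (1:ℝ) ≤ (1 + ‖x.1 + y.1‖) ^ m := one_le_pow₀ (by linarith [norm_nonneg (x.1 + y.1)])
  have h2 : exp (-(c * (‖x.2 - y.2‖ / (1 + ‖x.1 + y.1‖)))) ≤ 1 := exp_le_one_iff.mpr (by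
    have : 0 ≤ c * (‖x.2 - y.2‖ / (1 + ‖x.1 + y.1‖)) := by positivity
    linarith)
  rw [zero_mul, neg_zero, exp_zero, one_mul]
  exact mul_le_one₀ (inv_le_one_of_one_le₀ h1) (exp_pos _).le h2

theorem Ker_cont (hn : 1 ≤ n) (hm : 1 ≤ m) (e : Sym n m) : Continuous (Function.uncurry (Ker e)) := by
  unfold Ker Function.uncurry
  exact Kg_cont hn hm (-1) e continuous_fst continuous_snd

theorem wq_anti {t r : ℝ} (hr : 0 < r) (h : r ≤ t) : wq n m t ≤ wq n m r := by
  unfold wq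
  have := Real.sqrt_pos.mpr hr
  have ht : 0 < t := hr.trans_le h
  have h2 := Real.sqrt_le_sqrt h
  gcongr

/-- main part of the integrand -/
def Mn (e : Sym n m) (g : Ep n m → ℂ) (x : Ep n m) (t : ℝ) : ℂ := (wq n m t : ℂ) * ∫ y, Ker e (dl √t x) (dl √t y) * g y

theorem Mn_step (hn : 1 ≤ n) (hm : 1 ≤ m) (e : Sym n m) {g : Ep n m → ℂ} (hg : Continuous g) (hgc : HasCompactSupport g)
    (x : Ep n m) {r : ℝ} (hr : 0 < r) :
    IntegrableOn (Mn e g x) (Ioc (r ^ 2 / 4) (r ^ 2)) ∧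
      ∫ t in Ioc (r ^ 2 / 4) (r ^ 2), Mn e g x t = IntOp volume (avg r (Ker e)) g x := by
  obtain ⟨C, hC, hb⟩ := Ker_bdd hn hm e
  have hgi : Integrable g := hg.integrable_of_hasCompactSupport hgc
  set ν := (volume : Measure ℝ).restrict (Ioc (r ^ 2 / 4) (r ^ 2)) with hν
  haveI : IsFiniteMeasure ν := by rw [hν]; infer_instance
  set F : ℝ → Ep n m → ℂ := fun t y => (wq n m t : ℂ) * (Ker e (dl √t x) (dl √t y) * g y) with hF
  have hmeas : Measurable (Function.uncurry F) :=
    (Complex.measurable_ofReal.comp (wq_meas.comp measurable_fst)).mul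
      ((meas_K (Ker_cont hn hm e) measurable_fst measurable_const measurable_snd).mul (hg.measurable.comp measurable_snd))
  have hFi : Integrable (Function.uncurry F) (ν.prod volume) := by
    have hbd : Integrable (fun q : ℝ × Ep n m => wq n m (r ^ 2 / 4) * (C * ‖g q.2‖)) (ν.prod volume) :=
      ((hgi.norm.comp_snd ν).const_mul C).const_mul _
    refine hbd.mono' hmeas.aestronglyMeasurable ?_
    have hae : ∀ᵐ q ∂(ν.prod (volume : Measure (Ep n m))), q.1 ∈ Ioc (r ^ 2 / 4) (r ^ 2) := by
      have : ∀ᵐ t ∂ν, t ∈ Ioc (r ^ 2 / 4) (r ^ 2) := ae_restrict_mem measurableSet_Ioc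
      exact Measure.quasiMeasurePreserving_fst.ae this
    filter_upwards [hae] with q hq
    have hq0 : 0 < q.1 := lt_trans (by positivity) hq.1
    simp only [Function.uncurry, hF]
    rw [norm_mul, norm_mul, Complex.norm_real, Real.norm_eq_abs, abs_of_pos (wq_pos hq0)]
    refine mul_le_mul (wq_anti (by positivity) hq.1.le) (mul_le_mul_of_nonneg_right (hb _ _) (norm_nonneg _)) (by positivity) (wq_pos (by positivity)).le
  have hMn : ∀ t, Mn e g x t = ∫ y, F t y := fun t => by
    simp only [Mn, hF]; rw [integral_const_mul]
  refine ⟨?_, ?_⟩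
  · have := hFi.integral_prod_left
    refine this.congr (ae_of_all _ fun t => ?_)
    exact (hMn t).symm
  · simp_rw [hMn]
    rw [integral_integral_swap hFi]
    unfold IntOp avg
    congr 1; funext y
    rw [← integral_mul_const]
    congr 1; funext t
    simp only [hF]; ring

theorem Mn_sum (hn : 1 ≤ n) (hm : 1 ≤ m) (e : Sym n m) {g : Ep n m → ℂ} (hg : Continuous g) (hgc : HasCompactSupport g)
    (hgi : ∀ r > 0, ∀ x, Integrable fun y => avg r (Ker e) x y * g y)
    (x : Ep n m) {R : ℝ} (hR : 0 < R) (J : ℕ) :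
    IntegrableOn (Mn e g x) (Ioc ((R * (1/2) ^ J) ^ 2) (R ^ 2)) ∧
      ∫ t in Ioc ((R * (1/2) ^ J) ^ 2) (R ^ 2), Mn e g x t = IntOp volume (Ksum (fun j => avg (R * (1/2) ^ j) (Ker e)) J) g x := by
  induction J with
  | zero => simp [IntOp, Ksum]
  | succ J ih =>
    have hr : 0 < R * (1/2) ^ J := by positivity
    obtain ⟨s1, s2⟩ := Mn_step hn hm e hg hgc x hr
    have e1 : (R * (1/2) ^ (J + 1)) ^ 2 = (R * (1/2) ^ J) ^ 2 / 4 := by rw [pow_succ]; ring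
    have hle : (R * (1/2) ^ J) ^ 2 ≤ R ^ 2 := by
      have : (1/2 : ℝ) ^ J ≤ 1 := pow_le_one₀ (by norm_num) (by norm_num)
      exact pow_le_pow_left₀ hr.le (mul_le_of_le_one_right hR.le this) 2
    have hle2 : (R * (1/2) ^ J) ^ 2 / 4 ≤ (R * (1/2) ^ J) ^ 2 := by
      have := sq_nonneg (R * (1/2) ^ J); linarith
    rw [e1, ← Ioc_union_Ioc_eq_Ioc hle2 hle]
    refine ⟨s1.union ih.1, ?_⟩
    rw [setIntegral_union (Ioc_disjoint_Ioc_of_le le_rfl) measurableSet_Ioc s1 ih.1, s2, ih.2]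
    unfold IntOp Ksum
    simp_rw [Finset.sum_range_succ, add_mul]
    rw [integral_add _ (hgi _ hr x), add_comm]
    simp_rw [Finset.sum_mul]
    exact integrable_finsetSum _ fun j _ => hgi _ (by positivity) x

end GR
end

section
open scoped ENNReal NNReal Topology ComplexConjugate
namespace GR
set_option linter.unusedSectionVars false
variable {n m : ℕ}

theorem rc_of_cont {g : Ep n m → ℂ} (hg : Continuous g) : RC rho g := by
  intro x ε hε
  obtain ⟨δ0, hδ0, h⟩ := Metric.continuous_iff.mp hg x ε hε
  set N := ‖x.1‖ with hN
  have hN0 : 0 ≤ N := norm_nonneg _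
  set δ := min (1/2) (δ0 / (4 * N + 5)) with hδ
  have hδpos : 0 < δ := lt_min (by norm_num) (by positivity)
  have hδ1 : δ ≤ 1/2 := min_le_left _ _
  have hδ2 : δ * (4 * N + 5) ≤ δ0 := by
    rw [← le_div_iff₀ (by positivity)]; exact min_le_right _ _
  refine ⟨ENNReal.ofReal δ, ENNReal.ofReal_pos.mpr hδpos, fun y hy => ?_⟩
  have hy : rhoR x y < δ := (ENNReal.ofReal_lt_ofReal_iff hδpos).mp hy
  unfold rhoR at hy
  set s := ‖x.2 - y.2‖ with hs
  have hs0 : 0 ≤ s := norm_nonneg _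
  have hq0 : 0 ≤ s / (N + ‖y.1‖ + √s) := by positivity
  have h1 : ‖x.1 - y.1‖ < δ := by linarith
  have h1' : ‖x.1 - y.1‖ < δ0 := by nlinarith
  have h2 : s / (N + ‖y.1‖ + √s) ≤ δ := by linarith [norm_nonneg (x.1 - y.1)]
  have hyN : ‖y.1‖ ≤ N + 1 := by
    have : y.1 = x.1 - (x.1 - y.1) := by abel
    rw [this]; refine (norm_sub_le _ _).trans ?_; linarith
  have hsq : √s ≤ 1 + s := by nlinarith [Real.sq_sqrt hs0, Real.sqrt_nonneg s, sq_nonneg (√s - 1)]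
  have h3 : s ≤ δ * (N + ‖y.1‖ + √s) := by
    rcases eq_or_lt_of_le (show 0 ≤ N + ‖y.1‖ + √s by positivity) with h0 | h0
    · have : √s = 0 := by linarith [norm_nonneg y.1, Real.sqrt_nonneg s]
      rw [Real.sqrt_eq_zero hs0] at this
      rw [← h0, this, mul_zero]
    · rwa [div_le_iff₀ h0] at h2
  have h4 : s < δ0 := by nlinarith
  rw [← dist_eq_norm]
  refine h y ?_
  rw [dist_comm, Prod.dist_eq, dist_eq_norm, dist_eq_norm]
  exact max_lt h1' h4

theorem nice_of_cont {g : Ep n m → ℂ} (hg : Continuous g) (hc : HasCompactSupport g) : Nice volume rho g where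
  meas := hg.measurable
  rc := rc_of_cont hg
  bdd := by
    obtain ⟨C, hC⟩ := hg.bounded_above_of_compact_support hc
    refine ⟨C.toNNReal, fun x => ?_⟩
    rw [← ofReal_norm]
    exact ENNReal.ofReal_le_ofReal (hC x)
  int := hg.integrable_of_hasCompactSupport hc

/-- full integrand -/
def Ps (θ : ℝ) (a : Eu n) (e : Sym n m) (g : Ep n m → ℂ) (x : Ep n m) (t : ℝ) : ℂ :=
  (wq n m t : ℂ) * ∫ y, MA θ (√t • a) e (dl √t x) (dl √t y) * g y

theorem dotp_dl (a : Eu n) {s : ℝ} (hs : 0 < s) (u : Eu n) : dotp (s • a) (s⁻¹ • u) = dotp a u := by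
  rw [dotp_inner, dotp_inner, real_inner_smul_left, real_inner_smul_right, ← mul_assoc, mul_inv_cancel₀ hs.ne', one_mul]

theorem dotp_add' (a u v : Eu n) : dotp a (u + v) = dotp a u + dotp a v := by
  simp only [dotp_inner, inner_add_right]

theorem dotp_sub' (a u v : Eu n) : dotp a (u - v) = dotp a u - dotp a v := by
  simp only [dotp_inner, inner_sub_right]

theorem Ps_eq (hn : 1 ≤ n) (hm : 1 ≤ m) (α : Fin n ⊕ Fin n × Fin m → ℕ) (a : Eu n) {f : Ep n m → ℂ}
    (hf : Continuous f) (hc : HasCompactSupport f) {t : ℝ} (ht : 0 < t) (x : Ep n m) (q : ℝ) :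
    ((exp (q * dotp a x.1) : ℝ) : ℂ) * (((t ^ ((((∑ i, α i : ℕ) : ℝ) / 2) - 1) : ℝ) : ℂ) * Xalpha α (heatOp a t f) x) =
      Ps (q - 1) a (opW α Finset.univ.toList (.const 1)) (fun y => ((exp (q * dotp a y.1) : ℝ) : ℂ) * f y) x t := by
  have hs := Real.sqrt_pos.mpr ht
  rw [Xalpha_heat hn hm α a hf hc ht x]
  unfold Ps
  rw [← mul_assoc, ← integral_const_mul, ← integral_const_mul]
  congr 1; funext y
  unfold GA MA
  set Q := KA (√t • a) (opW α Finset.univ.toList (.const 1)) (dl √t x) (dl √t y)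
  have e1 : ∀ z : Ep n m, dotp (√t • a) (dl √t z).1 = dotp a z.1 := fun z => dotp_dl a hs z.1
  rw [dotp_add', dotp_sub', e1, e1]
  have : exp (q * dotp a x.1) * (wq n m t * exp (-‖√t • a‖ ^ 2)) * (exp (-(dotp a x.1 + dotp a y.1)) * exp (2 * dotp a y.1)) =
      wq n m t * (exp (-‖√t • a‖ ^ 2 + (q - 1) * (dotp a x.1 - dotp a y.1)) * exp (q * dotp a y.1)) := by
    rw [← exp_add, ← exp_add, mul_left_comm, ← exp_add, mul_assoc, ← exp_add]
    congr 2; ring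
  have h2 := congrArg (fun r : ℝ => (r : ℂ) * (Q * f y)) this
  simp only [Complex.ofReal_mul] at h2 ⊢
  linear_combination h2

theorem Ps_diff (hn : 1 ≤ n) (hm : 1 ≤ m) {θ : ℝ} {e : Sym n m} {κ c C : ℝ} (hC : 0 ≤ C)
    (hb : ∀ (A : Eu n) (x y : Ep n m),
      ‖MA θ A e x y - (if ‖A‖ ≤ 1 then Ker e x y else 0)‖ ≤ C * (‖A‖ * exp (-‖A‖)) * Mk κ c x y)
    (a : Eu n) {g : Ep n m → ℂ} (hg : Continuous g) (hgc : HasCompactSupport g) (x : Ep n m) {t : ℝ} (ht : 0 < t) :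
    ‖Ps θ a e g x t - (if ‖√t • a‖ ≤ 1 then Mn e g x t else 0)‖ₑ ≤
      ∫⁻ y, ENNReal.ofReal C * ENNReal.ofReal (KSi ‖a‖ κ c t x y) * ‖g y‖ₑ := by
  have hs := Real.sqrt_pos.mpr ht
  have hw := wq_pos (n := n) (m := m) ht
  have hna : ‖√t • a‖ = √t * ‖a‖ := by rw [norm_smul, Real.norm_eq_abs, abs_of_pos hs]
  have i1 : Integrable fun y => MA θ (√t • a) e (dl √t x) (dl √t y) * g y :=
    ((MA_cont hn hm θ e continuous_const continuous_const (dl_cont _)).mul hg).integrable_of_hasCompactSupport hgc.mul_left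
  have i2 : Integrable fun y => Ker e (dl √t x) (dl √t y) * g y := by
    have h1 : Continuous fun y => Ker e (dl √t x) (dl √t y) := by
      unfold Ker
      exact Kg_cont hn hm (-1) e continuous_const (dl_cont _)
    exact (h1.mul hg).integrable_of_hasCompactSupport hgc.mul_left
  have key : Ps θ a e g x t - (if ‖√t • a‖ ≤ 1 then Mn e g x t else 0) =
      ∫ y, (wq n m t : ℂ) * ((MA θ (√t • a) e (dl √t x) (dl √t y) - (if ‖√t • a‖ ≤ 1 then Ker e (dl √t x) (dl √t y) else 0)) * g y) := by
    unfold Ps Mn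
    split_ifs with h
    · rw [← mul_sub, ← integral_sub i1 i2, integral_const_mul]
      simp_rw [sub_mul]
    · simp_rw [sub_zero]
      rw [integral_const_mul]
  rw [key]
  refine (enorm_integral_le_lintegral_enorm _).trans (lintegral_mono fun y => ?_)
  rw [enorm_mul, enorm_mul, ← mul_assoc, ← ENNReal.ofReal_mul hC]
  refine mul_le_mul_left ?_ _
  rw [← ofReal_norm, ← ofReal_norm, ← ENNReal.ofReal_mul (norm_nonneg _)]
  refine ENNReal.ofReal_le_ofReal ?_
  rw [Complex.norm_real, Real.norm_eq_abs, abs_of_pos hw]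
  refine (mul_le_mul_of_nonneg_left (hb _ _ _) hw.le).trans (le_of_eq ?_)
  unfold KSi
  rw [hna]; ring

/-- Pointwise truncated bound. -/
theorem Ps_trunc (hn : 1 ≤ n) (hm : 1 ≤ m) {θ : ℝ} {e : Sym n m} {κ c C : ℝ} (hC : 0 ≤ C)
    (hb : ∀ (A : Eu n) (x y : Ep n m),
      ‖MA θ A e x y - (if ‖A‖ ≤ 1 then Ker e x y else 0)‖ ≤ C * (‖A‖ * exp (-‖A‖)) * Mk κ c x y)
    {a : Eu n} (ha : a ≠ 0) {g : Ep n m → ℂ} (hg : Continuous g) (hgc : HasCompactSupport g)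
    (hgi : ∀ r > 0, ∀ x, Integrable fun y => avg r (Ker e) x y * g y) (x : Ep n m)
    (hi : IntegrableOn (Ps θ a e g x) (Ioi 0)) (J : ℕ) :
    ‖∫ t in Ioi ((‖a‖⁻¹ * (1/2) ^ J) ^ 2), Ps θ a e g x t‖ₑ ≤
      ‖IntOp volume (Ksum (fun j => avg (‖a‖⁻¹ * (1/2) ^ j) (Ker e)) J) g x‖ₑ +
        ∫⁻ y, ENNReal.ofReal C * KS ‖a‖ κ c x y * ‖g y‖ₑ := by
  have hna : 0 < ‖a‖ := norm_pos_iff.mpr ha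
  set R := ‖a‖⁻¹ with hR
  have hR0 : 0 < R := inv_pos.mpr hna
  set ε := (R * (1/2) ^ J) ^ 2 with hε
  have hε0 : 0 < ε := by positivity
  obtain ⟨m1, m2⟩ := Mn_sum hn hm e hg hgc hgi x hR0 J
  have hset : Ioi ε ∩ Iic (R ^ 2) = Ioc ε (R ^ 2) := Ioi_inter_Iic
  have hii : IntegrableOn ((Iic (R ^ 2)).indicator (Mn e g x)) (Ioi ε) := by
    rw [IntegrableOn, integrable_indicator_iff measurableSet_Iic, IntegrableOn, Measure.restrict_restrict measurableSet_Iic,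
      inter_comm, hset]
    exact m1
  have hie : IntegrableOn (Ps θ a e g x) (Ioi ε) := hi.mono_set (Ioi_subset_Ioi hε0.le)
  have hinteg : ∫ t in Ioi ε, (Iic (R ^ 2)).indicator (Mn e g x) t =
      IntOp volume (Ksum (fun j => avg (R * (1/2) ^ j) (Ker e)) J) g x := by
    rw [setIntegral_indicator measurableSet_Iic, hset, m2]
  have hsplit : ∫ t in Ioi ε, Ps θ a e g x t = (∫ t in Ioi ε, (Iic (R ^ 2)).indicator (Mn e g x) t) +
      ∫ t in Ioi ε, (Ps θ a e g x t - (Iic (R ^ 2)).indicator (Mn e g x) t) := by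
    rw [integral_sub hie hii]; ring
  rw [hsplit, hinteg]
  refine (enorm_add_le _ _).trans (add_le_add le_rfl ?_)
  refine (enorm_integral_le_lintegral_enorm _).trans ?_
  have hcond : ∀ t : ℝ, 0 < t → (‖√t • a‖ ≤ 1 ↔ t ≤ R ^ 2) := by
    intro t ht
    have hs := Real.sqrt_pos.mpr ht
    rw [norm_smul, Real.norm_eq_abs, abs_of_pos hs, ← le_div_iff₀ hna, one_div, ← hR, Real.sqrt_le_left hR0.le]
  calc ∫⁻ t in Ioi ε, ‖Ps θ a e g x t - (Iic (R ^ 2)).indicator (Mn e g x) t‖ₑ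
      ≤ ∫⁻ t in Ioi ε, ∫⁻ y, ENNReal.ofReal C * ENNReal.ofReal (KSi ‖a‖ κ c t x y) * ‖g y‖ₑ := by
        refine setLIntegral_mono' measurableSet_Ioi fun t ht => ?_
        have ht0 : 0 < t := hε0.trans ht
        have := Ps_diff hn hm hC hb a hg hgc x ht0
        simp only [hcond t ht0] at this
        simpa only [indicator, mem_Iic] using this
    _ ≤ ∫⁻ t in Ioi (0:ℝ), ∫⁻ y, ENNReal.ofReal C * ENNReal.ofReal (KSi ‖a‖ κ c t x y) * ‖g y‖ₑ :=
        lintegral_mono_set (Ioi_subset_Ioi hε0.le)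
    _ = ∫⁻ y, ∫⁻ t in Ioi (0:ℝ), ENNReal.ofReal C * ENNReal.ofReal (KSi ‖a‖ κ c t x y) * ‖g y‖ₑ := by
        refine lintegral_lintegral_swap ?_
        have h1 := (KSi_meas ‖a‖ κ c (measurable_fst (α := ℝ) (β := Ep n m)) (measurable_const (a := x)) measurable_snd).ennreal_ofReal
        have h2 : Measurable fun q : ℝ × Ep n m => ‖g q.2‖ₑ := (hg.measurable.comp measurable_snd).enorm
        exact ((h1.const_mul _).mul h2).aemeasurable
    _ = _ := by
        congr 1; funext y
        have h1 : Measurable fun t => ENNReal.ofReal (KSi ‖a‖ κ c t x y) :=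
          (KSi_meas ‖a‖ κ c measurable_id measurable_const measurable_const).ennreal_ofReal
        rw [lintegral_mul_const _ (h1.const_mul _), lintegral_const_mul _ h1]
        rfl

theorem Ps_point (hn : 1 ≤ n) (hm : 1 ≤ m) {θ : ℝ} {e : Sym n m} {κ c C : ℝ} (hC : 0 ≤ C)
    (hb : ∀ (A : Eu n) (x y : Ep n m),
      ‖MA θ A e x y - (if ‖A‖ ≤ 1 then Ker e x y else 0)‖ ≤ C * (‖A‖ * exp (-‖A‖)) * Mk κ c x y)
    {a : Eu n} (ha : a ≠ 0) {g : Ep n m → ℂ} (hg : Continuous g) (hgc : HasCompactSupport g)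
    (hgi : ∀ r > 0, ∀ x, Integrable fun y => avg r (Ker e) x y * g y) (x : Ep n m) {p : ℝ} (hp : 1 < p) :
    ‖∫ t in Ioi (0:ℝ), Ps θ a e g x t‖ₑ ^ p ≤ liminf (fun J : ℕ =>
      2 ^ (p - 1) * (‖IntOp volume (Ksum (fun j => avg (‖a‖⁻¹ * (1/2) ^ j) (Ker e)) J) g x‖ₑ ^ p +
        (∫⁻ y, ENNReal.ofReal C * KS ‖a‖ κ c x y * ‖g y‖ₑ) ^ p)) atTop := by
  have hna : 0 < ‖a‖ := norm_pos_iff.mpr ha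
  have hp0 : 0 < p := by linarith
  by_cases hi : IntegrableOn (Ps θ a e g x) (Ioi 0)
  swap
  · rw [integral_undef hi, enorm_zero, ENNReal.zero_rpow_of_pos hp0]
    exact bot_le
  have hU : ⋃ J : ℕ, Ioi ((‖a‖⁻¹ * (1/2) ^ J) ^ 2) = Ioi (0:ℝ) := by
    have ht0 : Tendsto (fun J : ℕ => (‖a‖⁻¹ * (1/2 : ℝ) ^ J) ^ 2) atTop (𝓝 0) := by
      have := ((tendsto_pow_atTop_nhds_zero_of_lt_one (r := (1/2:ℝ)) (by norm_num) (by norm_num)).const_mul ‖a‖⁻¹).pow 2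
      simpa using this
    ext t
    simp only [mem_iUnion, mem_Ioi]
    constructor
    · rintro ⟨J, hJ⟩; exact lt_of_le_of_lt (by positivity) hJ
    · intro ht; exact (ht0.eventually_lt_const ht).exists
  have hmono : Monotone fun J : ℕ => Ioi ((‖a‖⁻¹ * (1/2 : ℝ) ^ J) ^ 2) := by
    intro i j hij
    refine Ioi_subset_Ioi (pow_le_pow_left₀ (by positivity) (mul_le_mul_of_nonneg_left ?_ (by positivity)) 2)
    exact pow_le_pow_of_le_one (by norm_num) (by norm_num) hij
  have hlim := tendsto_setIntegral_of_monotone (f := Ps θ a e g x) (μ := volume) (fun J : ℕ => measurableSet_Ioi) hmono (by rw [hU]; exact hi)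
  rw [hU] at hlim
  have hlim2 := ((ENNReal.continuous_rpow_const (y := p)).tendsto _).comp ((continuous_enorm.tendsto _).comp hlim)
  rw [← hlim2.liminf_eq]
  refine liminf_le_liminf (Eventually.of_forall fun J => ?_)
  simp only [Function.comp]
  refine (ENNReal.rpow_le_rpow (Ps_trunc hn hm hC hb ha hg hgc hgi x hi J) hp0.le).trans ?_
  exact ENNReal.rpow_add_le_mul_rpow_add_rpow _ _ hp.le

theorem core (hn : 1 ≤ n) (hm : 1 ≤ m) {θ : ℝ} (hθ : |θ| < 1) (i : Fin n ⊕ Fin n × Fin m) (e : Sym n m) {p : ℝ} (hp : 1 < p) :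
    ∃ C : ℝ≥0, ∀ a : Eu n, a ≠ 0 → ∀ g : Ep n m → ℂ, Continuous g → HasCompactSupport g →
      ∫⁻ x, ‖∫ t in Ioi (0:ℝ), Ps θ a (opS i e) g x t‖ₑ ^ p ≤ C * ∫⁻ x, ‖g x‖ₑ ^ p := by
  have hp0 : 0 < p := by linarith
  obtain ⟨κ, c, C0, hκ, hc, hC0, hb⟩ := MA_bound hn hm hθ (opS i e)
  obtain ⟨B, hB⟩ := KS_schur n m hκ hc
  obtain ⟨A, hA, hgood⟩ := Ker_good hn hm i e
  obtain ⟨D, d⟩ := dyadic_system (n := n) (m := m) hn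
  obtain ⟨C1, hC1⟩ := cz_bounded d (fun z => rho_meas' measurable_const measurable_id) rho_symm hA hp
  set B' : ℝ≥0 := C0.toNNReal * B with hB'
  refine ⟨2 ^ (p - 1) * (C1 + B' ^ (p - 1) * B'), fun a ha g hg hgc => ?_⟩
  have hna : 0 < ‖a‖ := norm_pos_iff.mpr ha
  have hR : ∀ j : ℕ, 0 < ‖a‖⁻¹ * (1/2 : ℝ) ^ j := fun j => by positivity
  have hgi : ∀ r > 0, ∀ x, Integrable fun y => avg r (Ker (opS i e)) x y * g y := by
    intro r hr x
    have hS := (hgood r hr).schur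
    obtain ⟨M, hM⟩ := hg.bounded_above_of_compact_support hgc
    have h1 : Integrable fun y => avg r (Ker (opS i e)) x y :=
      ⟨(hS.meas.comp measurable_prodMk_left).aestronglyMeasurable, lt_of_le_of_lt (hS.row x) ENNReal.coe_lt_top⟩
    exact h1.mul_bdd (c := M) hg.aestronglyMeasurable (ae_of_all _ hM)
  have hKm : Measurable (Function.uncurry fun x y : Ep n m => ENNReal.ofReal C0 * KS ‖a‖ κ c x y) :=
    (KS_meas ‖a‖ κ c).const_mul (ENNReal.ofReal C0)
  have hgm : Measurable fun y => ‖g y‖ₑ := hg.measurable.enorm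
  have hSm : Measurable fun x => ∫⁻ y, ENNReal.ofReal C0 * KS ‖a‖ κ c x y * ‖g y‖ₑ := by
    have : Measurable (Function.uncurry fun x y : Ep n m => ENNReal.ofReal C0 * KS ‖a‖ κ c x y * ‖g y‖ₑ) :=
      hKm.mul (hgm.comp measurable_snd)
    exact this.lintegral_prod_right'
  have hIm : ∀ J, Measurable fun x => ‖IntOp volume (Ksum (fun j => avg (‖a‖⁻¹ * (1/2) ^ j) (Ker (opS i e))) J) g x‖ₑ := by
    intro J
    have h1 : Measurable (Function.uncurry (Ksum (fun j => avg (‖a‖⁻¹ * (1/2) ^ j) (Ker (opS i e))) J)) := by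
      have h0 := Finset.measurable_sum (Finset.range J) fun j (_ : j ∈ Finset.range J) => (hgood _ (hR j)).meas
      exact h0
    have h2 : Measurable (Function.uncurry fun x y => Ksum (fun j => avg (‖a‖⁻¹ * (1/2) ^ j) (Ker (opS i e))) J x y * g y) :=
      h1.mul (hg.measurable.comp measurable_snd)
    exact (h2.stronglyMeasurable.integral_prod_right).measurable.enorm
  have hSb : ∫⁻ x, (∫⁻ y, ENNReal.ofReal C0 * KS ‖a‖ κ c x y * ‖g y‖ₑ) ^ p ≤
      (B' : ℝ≥0∞) ^ (p - 1) * (B' * ∫⁻ y, ‖g y‖ₑ ^ p) := by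
    have hcol : ∀ y : Ep n m, ∫⁻ x, ENNReal.ofReal C0 * KS ‖a‖ κ c x y ≤ B' := by
      intro y
      rw [lintegral_const_mul' _ _ ENNReal.ofReal_ne_top, hB', ENNReal.coe_mul]
      exact mul_le_mul' le_rfl (hB _ hna y)
    refine schur_lintegral (K := fun x y => ENNReal.ofReal C0 * KS ‖a‖ κ c x y) hKm (fun x => ?_) hcol hp.le hgm
    simp_rw [KS_symm ‖a‖ κ c x]
    exact hcol x
  calc _ ≤ ∫⁻ x, liminf (fun J : ℕ =>
      2 ^ (p - 1) * (‖IntOp volume (Ksum (fun j => avg (‖a‖⁻¹ * (1/2) ^ j) (Ker (opS i e))) J) g x‖ₑ ^ p +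
        (∫⁻ y, ENNReal.ofReal C0 * KS ‖a‖ κ c x y * ‖g y‖ₑ) ^ p)) atTop :=
        lintegral_mono fun x => Ps_point hn hm hC0 hb ha hg hgc hgi x hp
    _ ≤ liminf (fun J : ℕ => ∫⁻ x,
      2 ^ (p - 1) * (‖IntOp volume (Ksum (fun j => avg (‖a‖⁻¹ * (1/2) ^ j) (Ker (opS i e))) J) g x‖ₑ ^ p +
        (∫⁻ y, ENNReal.ofReal C0 * KS ‖a‖ κ c x y * ‖g y‖ₑ) ^ p)) atTop :=
        lintegral_liminf_le fun J => (((hIm J).pow_const p).add (hSm.pow_const p)).const_mul _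
    _ ≤ liminf (fun _ : ℕ => (2:ℝ≥0∞) ^ (p - 1) * (C1 * (∫⁻ x, ‖g x‖ₑ ^ p) + (B' : ℝ≥0∞) ^ (p - 1) * (B' * ∫⁻ y, ‖g y‖ₑ ^ p))) atTop := by
        refine liminf_le_liminf (Eventually.of_forall fun J => ?_)
        rw [lintegral_const_mul' _ _ (ENNReal.rpow_ne_top_of_nonneg (by linarith) (by simp)), lintegral_add_left ((hIm J).pow_const p)]
        exact mul_le_mul' le_rfl (add_le_add (hC1 ‖a‖⁻¹ J _ (fun j => hgood _ (hR j)) g (nice_of_cont hg hgc)) hSb)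
    _ = _ := by
        rw [liminf_const]
        push_cast [ENNReal.coe_rpow_of_nonneg _ (show 0 ≤ p - 1 by linarith)]
        ring

theorem main_bound (n m : ℕ) (hn : 1 ≤ n) (hm : 1 ≤ m)
    (p : ℝ) (hp : 1 < p)
    (α : Fin n ⊕ Fin n × Fin m → ℕ) (k : ℕ) (hk : 1 ≤ k) (hαk : ∑ i, α i = k) :
    ∃ C : ℝ, 0 < C ∧
      ∀ a : EuclideanSpace ℝ (Fin n), a ≠ 0 →
        ∀ f : Ep n m → ℂ, ContDiff ℝ (⊤ : ℕ∞) f → HasCompactSupport f →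
          eLpNorm (grushinRiesz a α f) (ENNReal.ofReal p) (muG a) ≤
            ENNReal.ofReal C * eLpNorm f (ENNReal.ofReal p) (muG a) := by
  have hp0 : 0 < p := by linarith
  have hθ : |2 / p - 1| < 1 := by
    rw [abs_lt]
    have h1 : 0 < 2 / p := by positivity
    have h2 : 2 / p < 2 := by rw [div_lt_iff₀ hp0]; linarith
    constructor <;> linarith
  obtain ⟨i, e', he⟩ := opW_form α (.const 1 : Sym n m) Finset.univ.toList (by rw [Finset.sum_map_toList, hαk]; exact hk)
  obtain ⟨C, hC⟩ := core hn hm hθ i e' hp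
  rw [← he] at hC
  set G : ℂ := (((Real.Gamma (((∑ i, α i : ℕ) : ℝ) / 2))⁻¹ : ℝ) : ℂ) with hG
  set K : ℝ≥0 := ‖G‖₊ ^ p * C with hK
  refine ⟨(K ^ p⁻¹ : ℝ≥0) + 1, by positivity, fun a ha f hf hfc => ?_⟩
  have hfc' : Continuous f := hf.continuous
  set g : Ep n m → ℂ := fun y => ((exp (2 / p * dotp a y.1) : ℝ) : ℂ) * f y with hg
  have hexpc : Continuous fun y : Ep n m => ((exp (2 / p * dotp a y.1) : ℝ) : ℂ) :=
    Complex.continuous_ofReal.comp (continuous_exp.comp (continuous_const.mul (dotp_cont2 continuous_const continuous_fst)))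
  have hgc : Continuous g := hexpc.mul hfc'
  have hgs : HasCompactSupport g := hfc.mul_left
  have hdm : Measurable fun x : Ep n m => ENNReal.ofReal (exp (2 * dotp a x.1)) :=
    (continuous_exp.comp (continuous_const.mul (dotp_cont2 continuous_const continuous_fst))).measurable.ennreal_ofReal
  have hexp : ∀ x : Ep n m, ENNReal.ofReal (exp (2 * dotp a x.1)) = ‖((exp (2 / p * dotp a x.1) : ℝ) : ℂ)‖ₑ ^ p := by
    intro x
    rw [← ofReal_norm, Complex.norm_real, Real.norm_eq_abs, abs_of_pos (exp_pos _), ENNReal.ofReal_rpow_of_pos (exp_pos _),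
      ← Real.exp_mul]
    congr 2
    field_simp
  have hpt : ∀ x, ((exp (2 / p * dotp a x.1) : ℝ) : ℂ) * grushinRiesz a α f x =
      G * ∫ t in Ioi (0:ℝ), Ps (2 / p - 1) a (opW α Finset.univ.toList (.const 1)) g x t := by
    intro x
    unfold grushinRiesz
    rw [mul_left_comm, ← integral_const_mul]
    congr 1
    exact setIntegral_congr_fun measurableSet_Ioi fun t ht => Ps_eq hn hm α a hfc' hfc ht x (2 / p)
  have hsf : SFinite (muG (m := m) a) := by unfold muG; infer_instance
  have hL : eLpNorm (grushinRiesz a α f) (ENNReal.ofReal p) (muG a) ^ p ≤ K * eLpNorm f (ENNReal.ofReal p) (muG a) ^ p := by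
    rw [eLpNorm_rpow hp0, eLpNorm_rpow hp0]
    unfold muG
    refine (lintegral_withDensity_le_lintegral_mul _ hdm _).trans ?_
    rw [lintegral_withDensity_eq_lintegral_mul _ hdm (hfc'.measurable.enorm.pow_const p)]
    simp only [Pi.mul_apply]
    simp_rw [hexp, ← ENNReal.mul_rpow_of_nonneg _ _ hp0.le, ← enorm_mul, hpt]
    simp_rw [enorm_mul G, ENNReal.mul_rpow_of_nonneg _ _ hp0.le]
    rw [lintegral_const_mul' _ _ (ENNReal.rpow_ne_top_of_nonneg hp0.le enorm_ne_top)]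
    refine (mul_le_mul' le_rfl (hC a ha g hgc hgs)).trans (le_of_eq ?_)
    rw [← mul_assoc, hK, ENNReal.coe_mul, ENNReal.coe_rpow_of_nonneg _ hp0.le]
    rfl
  have h3 := ENNReal.rpow_le_rpow hL (inv_nonneg.mpr hp0.le)
  rw [ENNReal.mul_rpow_of_nonneg _ _ (inv_nonneg.mpr hp0.le), ← ENNReal.rpow_mul, ← ENNReal.rpow_mul, mul_inv_cancel₀ hp0.ne',
    ENNReal.rpow_one, ENNReal.rpow_one] at h3
  refine h3.trans (mul_le_mul' ?_ le_rfl)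
  rw [← ENNReal.coe_rpow_of_nonneg _ (inv_nonneg.mpr hp0.le), ← ENNReal.ofReal_coe_nnreal]
  exact ENNReal.ofReal_le_ofReal (by linarith)

end GR
end

/-- **Theorem (strong type (p,p))**: for `1 < p < ∞` and `|α| = k ≥ 1`, the Riesz transform
`R_{α,a}` is bounded on `L^p(ℝ^{n+m}, dμ_a)`, uniformly in the nonzero drift `a`. -/
theorem grushinRiesz_Lp_bounded (n m : ℕ) (hn : 1 ≤ n) (hm : 1 ≤ m)
    (p : ℝ) (hp : 1 < p)
    (α : Fin n ⊕ Fin n × Fin m → ℕ) (k : ℕ) (hk : 1 ≤ k) (hαk : ∑ i, α i = k) :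
    ∃ C : ℝ, 0 < C ∧
      ∀ a : EuclideanSpace ℝ (Fin n), a ≠ 0 →
        ∀ f : Ep n m → ℂ, ContDiff ℝ (⊤ : ℕ∞) f → HasCompactSupport f →
          eLpNorm (grushinRiesz a α f) (ENNReal.ofReal p) (muG a) ≤
            ENNReal.ofReal C * eLpNorm f (ENNReal.ofReal p) (muG a) := by
  exact GR.main_bound n m hn hm p hp α k hk hαk
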